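/- Let Ω ⊂ ℂ^N be a bounded strongly pseudoconvex domain with C^{2,α}-smooth boundary, α ∈ (0,1], and let φ : Δ → Ω be a complex geodesic, which then extends C^{1,α}-smoothly to the closed unit disc. Then, with constants depending only on Ω: (i) for all ζ ∈ Δ, ‖(φ'(ζ))_{φ(ζ)}‖/‖φ'(ζ)‖ + δ_Ω(φ(ζ))^{1/2} ∼ d_e(φ(Δ)); and (ii) for all ζ ∈ ∂Δ, ‖(φ'(ζ))_{φ(ζ)}‖/‖φ'(ζ)‖ ∼ d_e(φ(Δ)), where for ζ ∈ ∂Δ the normal component is taken with respect to the boundary point φ(ζ) ∈ ∂Ω. -/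

import Mathlib

open Metric Set Filter Topology MeasureTheory

noncomputable section

namespace InvDist

/-- Complex Euclidean `N`-space. -/
abbrev E (N : ℕ) := EuclideanSpace ℂ (Fin N)

variable {N : ℕ}

/-- The paper's Hermitian product `⟨a,b⟩ = ∑ a_j * conj (b_j)`. -/
def herm (a b : E N) : ℂ := ∑ j, a j * (starRingEnd ℂ) (b j)

/-- Euclidean distance to the boundary of `Ω`. -/
def bdist (Ω : Set (E N)) (x : E N) : ℝ := Metric.infDist x (frontier Ω)

/-- `π` selects, for each point of `Ω`, a closest point on the boundary. -/
def IsClosestPointSelection (Ω : Set (E N)) (π : E N → E N) : Prop :=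
  ∀ z ∈ Ω, π z ∈ frontier Ω ∧ dist z (π z) = bdist Ω z

/-- `‖v_z‖`: modulus of the complex normal component of `v` with respect to the
closest boundary point `π z`; the outer unit normal at `π z` is `(π z - z)/‖π z - z‖`. -/
def ncomp (Ω : Set (E N)) (π : E N → E N) (z v : E N) : ℝ :=
  ‖herm v (π z - z)‖ / bdist Ω z

/-- `‖v_z^ℝ‖`: modulus of the real normal component of `v` at `π z`. -/
def ncompR (Ω : Set (E N)) (π : E N → E N) (z v : E N) : ℝ :=
  |(herm v (π z - z)).re| / bdist Ω z

/-- The quantity `A_Ω(z,w)`. -/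
def Afun (Ω : Set (E N)) (π : E N → E N) (z w : E N) : ℝ :=
  (ncomp Ω π z (z - w) + ‖z - w‖ ^ 2 + ‖z - w‖ * Real.sqrt (bdist Ω z)) /
    (Real.sqrt (bdist Ω z) * Real.sqrt (bdist Ω w))

/-- `h_Ω(z,w) = ‖(z-w)_z‖ + ‖z-w‖ δ_Ω(z)^{1/2}`. -/
def hfun (Ω : Set (E N)) (π : E N → E N) (z w : E N) : ℝ :=
  ncomp Ω π z (z - w) + ‖z - w‖ * Real.sqrt (bdist Ω z)

/-- real analogue of `h_Ω`. -/
def hfunR (Ω : Set (E N)) (π : E N → E N) (z w : E N) : ℝ :=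
  ncompR Ω π z (z - w) + ‖z - w‖ * Real.sqrt (bdist Ω z)

/-- inverse hyperbolic tangent -/
def artanh (x : ℝ) : ℝ := Real.log ((1 + x) / (1 - x)) / 2

/-- The Lempert function of `Ω`. -/
def lempert (Ω : Set (E N)) (z w : E N) : ℝ :=
  artanh (sInf { r : ℝ | ∃ φ : ℂ → E N, DifferentiableOn ℂ φ (ball 0 1) ∧
    MapsTo φ (ball (0:ℂ) 1) Ω ∧ φ 0 = z ∧ ∃ a ∈ ball (0:ℂ) 1, φ a = w ∧ r = ‖a‖ })

/-- The Carathéodory distance of `Ω`. -/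
def caratheodory (Ω : Set (E N)) (z w : E N) : ℝ :=
  artanh (sSup { r : ℝ | ∃ f : E N → ℂ, DifferentiableOn ℂ f Ω ∧
    MapsTo f Ω (ball (0:ℂ) 1) ∧ f z = 0 ∧ r = ‖f w‖ })

/-- The Kobayashi distance: the largest pseudodistance not exceeding the Lempert
function, given as an infimum over chains. -/
def kobayashi (Ω : Set (E N)) (z w : E N) : ℝ :=
  sInf { r : ℝ | ∃ (n : ℕ) (p : Fin (n + 1) → E N), p 0 = z ∧ p (Fin.last n) = w ∧
    (∀ i, p i ∈ Ω) ∧ r = ∑ i : Fin n, lempert Ω (p i.castSucc) (p i.succ) }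

/-- The Poincaré distance on the unit disc. -/
def poincare (ζ ξ : ℂ) : ℝ := artanh ‖(ζ - ξ) / (1 - (starRingEnd ℂ) ζ * ξ)‖

/-- A complex geodesic of `Ω`. -/
def IsComplexGeodesic (Ω : Set (E N)) (φ : ℂ → E N) : Prop :=
  DifferentiableOn ℂ φ (ball 0 1) ∧ MapsTo φ (ball (0:ℂ) 1) Ω ∧
    ∀ ζ ∈ ball (0:ℂ) 1, ∀ ξ ∈ ball (0:ℂ) 1, kobayashi Ω (φ ζ) (φ ξ) = poincare ζ ξ

/-- `ρ` is `C^k` on `U` with `α`-Hölder `k`-th derivative. -/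
def IsCkHolderOn (k : ℕ) (α : ℝ) (ρ : E N → ℝ) (U : Set (E N)) : Prop :=
  ContDiffOn ℝ k ρ U ∧ ∃ M : ℝ, ∀ x ∈ U, ∀ y ∈ U,
    ‖iteratedFDeriv ℝ k ρ x - iteratedFDeriv ℝ k ρ y‖ ≤ M * ‖x - y‖ ^ α

/-- The Levi form of `ρ` at `p` evaluated at `v`. -/
def levi (ρ : E N → ℝ) (p v : E N) : ℝ :=
  (iteratedFDeriv ℝ 2 ρ p ![v, v] +
    iteratedFDeriv ℝ 2 ρ p ![(Complex.I : ℂ) • v, (Complex.I : ℂ) • v]) / 4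

/-- Bounded strongly pseudoconvex domain with `C^{k,α}`-smooth boundary. -/
def IsStronglyPseudoconvexDomain (k : ℕ) (α : ℝ) (Ω : Set (E N)) : Prop :=
  IsOpen Ω ∧ IsConnected Ω ∧ Bornology.IsBounded Ω ∧
  ∃ (U : Set (E N)) (ρ : E N → ℝ), IsOpen U ∧ closure Ω ⊆ U ∧
    IsCkHolderOn k α ρ U ∧ Ω = {x ∈ U | ρ x < 0} ∧
    (∀ p ∈ frontier Ω, fderiv ℝ ρ p ≠ 0) ∧
    ∀ p ∈ frontier Ω, ∀ v : E N, v ≠ 0 → fderiv ℝ ρ p v = 0 →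
      fderiv ℝ ρ p ((Complex.I : ℂ) • v) = 0 → 0 < levi ρ p v

/-- `η` is the outer unit normal of `Ω` at the boundary point `p`. -/
def IsOuterUnitNormalAt (Ω : Set (E N)) (p η : E N) : Prop :=
  ‖η‖ = 1 ∧ p ∈ frontier Ω ∧ ∃ ε > 0, ∀ t : ℝ, 0 < t → t < ε →
    p - t • η ∈ Ω ∧ bdist Ω (p - t • η) = t

open Classical in
/-- signed boundary distance -/
def signedDist (Ω : Set (E N)) (x : E N) : ℝ :=
  if x ∈ closure Ω then -(bdist Ω x) else bdist Ω x

/-- Hessian quadratic form of the signed boundary distance. -/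
def hessSD (Ω : Set (E N)) (p v : E N) : ℝ :=
  iteratedFDeriv ℝ 2 (signedDist Ω) p ![v, v]

/-- strict linear convexity at `p` (with outer unit normal `η`). -/
def StrictlyLinearlyConvexAt (Ω : Set (E N)) (p η : E N) : Prop :=
  ∀ v : E N, v ≠ 0 → herm v η = 0 → 0 < hessSD Ω p v

/-- strong convexity at `p` (with outer unit normal `η`). -/
def StronglyConvexAt (Ω : Set (E N)) (p η : E N) : Prop :=
  ∀ v : E N, v ≠ 0 → (herm v η).re = 0 → 0 < hessSD Ω p v

/-- `p` is a `C^k`-smooth boundary point of `Ω`. -/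
def IsCkBoundaryPoint (k : ℕ) (Ω : Set (E N)) (p : E N) : Prop :=
  p ∈ frontier Ω ∧ ∃ (U : Set (E N)) (ρ : E N → ℝ), IsOpen U ∧ p ∈ U ∧
    ContDiffOn ℝ k ρ U ∧ (∀ x ∈ U, (x ∈ Ω ↔ ρ x < 0)) ∧
    ∀ x ∈ U ∩ frontier Ω, fderiv ℝ ρ x ≠ 0

/-- bounded domain with `C^k`-smooth boundary. -/
def IsCkDomain (k : ℕ) (Ω : Set (E N)) : Prop :=
  IsOpen Ω ∧ IsConnected Ω ∧ Bornology.IsBounded Ω ∧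
    ∀ p ∈ frontier Ω, IsCkBoundaryPoint k Ω p

/-- bounded domain with `C^{1,1}`-smooth boundary. -/
def IsC11Domain (Ω : Set (E N)) : Prop :=
  IsOpen Ω ∧ IsConnected Ω ∧ Bornology.IsBounded Ω ∧
  ∀ p ∈ frontier Ω, ∃ (U : Set (E N)) (ρ : E N → ℝ), IsOpen U ∧ p ∈ U ∧
    IsCkHolderOn 1 1 ρ U ∧ (∀ x ∈ U, (x ∈ Ω ↔ ρ x < 0)) ∧
    ∀ x ∈ U ∩ frontier Ω, fderiv ℝ ρ x ≠ 0

/-- `p` is a `C^{2,α}`-smooth strongly pseudoconvex boundary point of `Ω`. -/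
def IsSPSCBoundaryPoint (α : ℝ) (Ω : Set (E N)) (p : E N) : Prop :=
  p ∈ frontier Ω ∧ ∃ (U : Set (E N)) (ρ : E N → ℝ), IsOpen U ∧ p ∈ U ∧
    IsCkHolderOn 2 α ρ U ∧ (∀ x ∈ U, (x ∈ Ω ↔ ρ x < 0)) ∧
    (∀ x ∈ U ∩ frontier Ω, fderiv ℝ ρ x ≠ 0) ∧
    ∀ x ∈ U ∩ frontier Ω, ∀ v : E N, v ≠ 0 → fderiv ℝ ρ x v = 0 →
      fderiv ℝ ρ x ((Complex.I : ℂ) • v) = 0 → 0 < levi ρ x v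

instance (N : ℕ) : MeasurableSpace (E N) := borel _

instance (N : ℕ) : BorelSpace (E N) := ⟨rfl⟩

/-- Lebesgue measure on `E N`. -/
def vol (N : ℕ) : Measure (E N) :=
  letI : InnerProductSpace ℝ (E N) := InnerProductSpace.rclikeToReal ℂ (E N)
  letI : MeasureSpace (E N) := measureSpaceOfInnerProductSpace
  volume

/-- Bergman kernel on the diagonal. -/
def bergmanKernelDiag (Ω : Set (E N)) (z : E N) : ℝ :=
  sSup { r : ℝ | ∃ f : E N → ℂ, DifferentiableOn ℂ f Ω ∧
    (∫ x in Ω, ‖f x‖ ^ 2 ∂(vol N)) ≤ 1 ∧ r = ‖f z‖ ^ 2 }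

/-- `M_Ω(z;v)`. -/
def bergmanM (Ω : Set (E N)) (z v : E N) : ℝ :=
  sSup { r : ℝ | ∃ f : E N → ℂ, DifferentiableOn ℂ f Ω ∧
    (∫ x in Ω, ‖f x‖ ^ 2 ∂(vol N)) ≤ 1 ∧ f z = 0 ∧ r = ‖fderiv ℂ f z v‖ }

/-- The Bergman metric. -/
def bergmanMetric (Ω : Set (E N)) (z v : E N) : ℝ :=
  bergmanM Ω z v / Real.sqrt (bergmanKernelDiag Ω z)

/-- The Bergman distance: inner distance of the Bergman metric. -/
def bergmanDist (Ω : Set (E N)) (z w : E N) : ℝ :=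
  sInf { r : ℝ | ∃ γ : ℝ → E N, ContDiffOn ℝ 1 γ (Icc 0 1) ∧ γ 0 = z ∧ γ 1 = w ∧
    (∀ t ∈ Icc (0:ℝ) 1, γ t ∈ Ω) ∧
    r = ∫ t in (0:ℝ)..(1:ℝ), bergmanMetric Ω (γ t) (derivWithin γ (Icc 0 1) t) }

/-- Continuous on the closed unit disc and holomorphic inside. -/
abbrev DiskAlg {F : Type*} [NormedAddCommGroup F] [NormedSpace ℂ F] (f : ℂ → F) : Prop :=
  DiffContOnCl ℂ f (ball (0 : ℂ) 1)

/-- The average over the unit circle. -/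
abbrev cavg {F : Type*} [NormedAddCommGroup F] [NormedSpace ℝ F] (f : ℂ → F) : F :=
  Real.circleAverage f 0 1

section DiskAlg
variable {F : Type*} [NormedAddCommGroup F] [NormedSpace ℂ F]

lemma DiskAlg.cont {f : ℂ → F} (hf : DiskAlg f) : ContinuousOn f (closedBall 0 1) :=
  hf.continuousOn_ball

lemma DiskAlg.contS {f : ℂ → F} (hf : DiskAlg f) : ContinuousOn f (sphere 0 1) :=
  hf.cont.mono sphere_subset_closedBall

lemma diskAlg_mk {f : ℂ → F} (h1 : DifferentiableOn ℂ f (ball 0 1))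
    (h2 : ContinuousOn f (closedBall 0 1)) : DiskAlg f := DiffContOnCl.mk_ball h1 h2

lemma DiskAlg.diffAt {f : ℂ → F} (hf : DiskAlg f) {z : ℂ} (hz : z ∈ ball (0 : ℂ) 1) :
    DifferentiableAt ℂ f z := hf.differentiableAt isOpen_ball hz

lemma circleIntegrable_of_contS {G : Type*} [NormedAddCommGroup G] {f : ℂ → G}
    (hf : ContinuousOn f (sphere 0 1)) : CircleIntegrable f 0 1 := by
  apply ContinuousOn.circleIntegrable zero_le_one hf

lemma norm_cavg_le {f : ℂ → ℂ} :
    ‖cavg f‖ ≤ cavg (fun ζ => ‖f ζ‖) := by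
  rw [cavg, cavg, Real.circleAverage, Real.circleAverage, norm_smul, smul_eq_mul,
    Real.norm_of_nonneg (by positivity)]
  gcongr
  exact intervalIntegral.norm_integral_le_integral_norm (by positivity)

lemma cavg_mono {f g : ℂ → ℝ} (hf : ContinuousOn f (sphere 0 1)) (hg : ContinuousOn g (sphere 0 1))
    (h : ∀ ζ ∈ sphere (0 : ℂ) 1, f ζ ≤ g ζ) : cavg f ≤ cavg g :=
  Real.circleAverage_mono (circleIntegrable_of_contS hf) (circleIntegrable_of_contS hg)
    (by simpa using h)

lemma cavg_congr {G : Type*} [NormedAddCommGroup G] [NormedSpace ℝ G] {f g : ℂ → G}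
    (h : ∀ ζ ∈ sphere (0 : ℂ) 1, f ζ = g ζ) : cavg f = cavg g :=
  Real.circleAverage_congr_sphere (by simpa [EqOn] using h)

lemma cavg_conj {f : ℂ → ℂ} (hf : ContinuousOn f (sphere 0 1)) :
    cavg (fun ζ => (starRingEnd ℂ) (f ζ)) = (starRingEnd ℂ) (cavg f) := by
  have := ContinuousLinearMap.circleAverage_comp_comm (R := 1) (c := 0)
    (Complex.conjCLE : ℂ →L[ℝ] ℂ) (circleIntegrable_of_contS hf)
  simpa [cavg, Function.comp_def] using this

lemma DiskAlg.mean {f : ℂ → ℂ} (hf : DiskAlg f) : cavg f = f 0 := by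
  have : DiffContOnCl ℂ f (ball 0 |1|) := by simpa using hf
  exact this.circleAverage

lemma DiskAlg.cauchy {f : ℂ → ℂ} (hf : DiskAlg f) {z : ℂ} (hz : z ∈ ball (0 : ℂ) 1) :
    cavg (fun ζ => ζ / (ζ - z) * f ζ) = f z := by
  have : DiffContOnCl ℂ f (ball 0 |1|) := by simpa using hf
  simpa using this.circleAverage_smul_div (w := z) (by simpa using hz)

lemma DiskAlg.dslope [CompleteSpace F] {f : ℂ → F} (hf : DiskAlg f) {z : ℂ} (hz : z ∈ ball (0 : ℂ) 1) :
    DiskAlg (dslope f z) := by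
  apply diskAlg_mk
  · exact (Complex.differentiableOn_dslope (isOpen_ball.mem_nhds hz)).2 hf.1
  · exact (continuousOn_dslope (mem_of_superset (isOpen_ball.mem_nhds hz) ball_subset_closedBall)).2
      ⟨hf.cont, hf.diffAt hz⟩

lemma conj_eq_inv_of_sphere {ζ : ℂ} (h : ζ ∈ sphere (0 : ℂ) 1) : (starRingEnd ℂ) ζ = ζ⁻¹ := by
  rw [mem_sphere_zero_iff_norm] at h
  rw [Complex.inv_def, Complex.normSq_eq_norm_sq, h]; simp

lemma ne_zero_of_sphere {ζ : ℂ} (h : ζ ∈ sphere (0 : ℂ) 1) : ζ ≠ 0 := by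
  rintro rfl; simp at h

lemma sub_ne_zero_of_sphere {ζ z : ℂ} (h : ζ ∈ sphere (0 : ℂ) 1) (hz : z ∈ ball (0 : ℂ) 1) :
    ζ - z ≠ 0 := by
  intro h0; rw [sub_eq_zero] at h0; subst h0; simp at h hz; linarith

lemma one_sub_conj_mul_ne_zero {ζ z : ℂ} (h : ζ ∈ closedBall (0 : ℂ) 1)
    (hz : z ∈ ball (0 : ℂ) 1) : 1 - (starRingEnd ℂ) z * ζ ≠ 0 := by
  intro h0
  rw [sub_eq_zero] at h0
  have : ‖(starRingEnd ℂ) z * ζ‖ = 1 := by rw [← h0]; simp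
  simp at h hz this
  nlinarith [norm_nonneg z, norm_nonneg ζ]

lemma diskAlg_const (c : F) : DiskAlg (fun _ : ℂ => c) := diffContOnCl_const
lemma diskAlg_id : DiskAlg (fun z : ℂ => z) := differentiable_id.diffContOnCl

lemma DiskAlg.mul {f g : ℂ → ℂ} (hf : DiskAlg f) (hg : DiskAlg g) :
    DiskAlg (fun z => f z * g z) := hf.smul hg

lemma diskAlg_inv_one_sub_conj_mul {z : ℂ} (hz : z ∈ ball (0 : ℂ) 1) :
    DiskAlg (fun ζ => (1 - (starRingEnd ℂ) z * ζ)⁻¹) := by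
  refine DiffContOnCl.inv ?_ ?_
  · exact Differentiable.diffContOnCl (by fun_prop)
  · intro x hx
    rw [closure_ball _ one_ne_zero] at hx
    exact one_sub_conj_mul_ne_zero hx hz

lemma conj_div_sub {ζ z : ℂ} (h : ζ ∈ sphere (0 : ℂ) 1) (hz : z ∈ ball (0 : ℂ) 1) :
    (starRingEnd ℂ) (ζ / (ζ - z)) = (1 - (starRingEnd ℂ) z * ζ)⁻¹ := by
  have h0 := ne_zero_of_sphere h
  have h1 := one_sub_conj_mul_ne_zero (sphere_subset_closedBall h) hz
  rw [map_div₀, map_sub, conj_eq_inv_of_sphere h]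
  have : ζ⁻¹ - (starRingEnd ℂ) z = ζ⁻¹ * (1 - (starRingEnd ℂ) z * ζ) := by field_simp
  rw [this]; field_simp

lemma DiskAlg.cauchy_conj {f : ℂ → ℂ} (hf : DiskAlg f) {z : ℂ} (hz : z ∈ ball (0 : ℂ) 1) :
    cavg (fun ζ => ζ / (ζ - z) * (starRingEnd ℂ) (f ζ)) = (starRingEnd ℂ) (f 0) := by
  have h1 : DiskAlg (fun ζ => (1 - (starRingEnd ℂ) z * ζ)⁻¹ * f ζ) :=
    (diskAlg_inv_one_sub_conj_mul hz).mul hf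
  have h2 := h1.mean
  simp at h2
  rw [← h2, ← cavg_conj h1.contS]
  apply cavg_congr
  intro ζ hζ
  rw [map_mul, ← conj_div_sub hζ hz, Complex.conj_conj]

lemma continuousOn_div_sub {z : ℂ} (hz : z ∈ ball (0 : ℂ) 1) :
    ContinuousOn (fun ζ : ℂ => ζ / (ζ - z)) (sphere 0 1) := by
  apply ContinuousOn.div (by fun_prop) (by fun_prop)
  intro x hx; exact sub_ne_zero_of_sphere hx hz

lemma cavg_sub {f g : ℂ → ℂ} (hf : ContinuousOn f (sphere 0 1)) (hg : ContinuousOn g (sphere 0 1)) :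
    cavg (fun ζ => f ζ - g ζ) = cavg f - cavg g :=
  Real.circleAverage_fun_sub (circleIntegrable_of_contS hf) (circleIntegrable_of_contS hg)

lemma cavg_add {f g : ℂ → ℂ} (hf : ContinuousOn f (sphere 0 1)) (hg : ContinuousOn g (sphere 0 1)) :
    cavg (fun ζ => f ζ + g ζ) = cavg f + cavg g :=
  Real.circleAverage_fun_add (circleIntegrable_of_contS hf) (circleIntegrable_of_contS hg)

lemma cavg_smul (a : ℂ) (f : ℂ → ℂ) : cavg (fun ζ => a * f ζ) = a * cavg f :=
  Real.circleAverage_fun_smul (a := a) (f := f)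

/-- Approximate conjugacy on the circle controls the values inside. -/
lemma norm_sub_conj_le {P G : ℂ → ℂ} (hP : DiskAlg P) (hG : DiskAlg G) {z : ℂ}
    (hz : z ∈ ball (0 : ℂ) 1) :
    ‖G z - (starRingEnd ℂ) (P 0)‖ ≤
      cavg (fun ζ => ‖P ζ - (starRingEnd ℂ) (G ζ)‖ / ‖ζ - z‖) := by
  have c1 := continuousOn_div_sub hz
  have c2 : ContinuousOn (fun ζ => (starRingEnd ℂ) (P ζ)) (sphere 0 1) :=
    Complex.continuous_conj.comp_continuousOn hP.contS
  rw [← hG.cauchy hz, ← hP.cauchy_conj hz,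
    ← cavg_sub (f := fun ζ => ζ / (ζ - z) * G ζ)
      (g := fun ζ => ζ / (ζ - z) * (starRingEnd ℂ) (P ζ)) (c1.mul hG.contS) (c1.mul c2)]
  refine norm_cavg_le.trans_eq (cavg_congr fun ζ hζ => ?_)
  rw [← mul_sub, norm_mul, norm_div, mem_sphere_zero_iff_norm.1 hζ]
  rw [← Complex.norm_conj (P ζ - _), map_sub, Complex.conj_conj, norm_sub_rev (G ζ)]
  ring

/-- Approximate conjugacy on the circle controls derivatives inside. -/
lemma norm_deriv_sub_conj_le {S G : ℂ → ℂ} (hS : DiskAlg S) (hG : DiskAlg G) {z : ℂ}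
    (hz : z ∈ ball (0 : ℂ) 1) :
    ‖deriv G z - (starRingEnd ℂ) (S 0)‖ ≤
      cavg (fun ζ => ‖S ζ / ζ - (starRingEnd ℂ) (G ζ)‖ / ‖ζ - z‖ ^ 2) := by
  have c1 := continuousOn_div_sub hz
  set T : ℂ → ℂ := fun ζ => (S ζ - (starRingEnd ℂ) (G z) * ζ) * (1 - (starRingEnd ℂ) z * ζ)⁻¹
    with hT
  have hTd : DiskAlg T := by
    refine DiskAlg.mul (DiffContOnCl.sub hS ?_) (diskAlg_inv_one_sub_conj_mul hz)
    exact (diskAlg_const _).mul diskAlg_id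
  have c2 : ContinuousOn (fun ζ => (starRingEnd ℂ) (T ζ)) (sphere 0 1) :=
    Complex.continuous_conj.comp_continuousOn hTd.contS
  have e1 : T 0 = S 0 := by simp [hT]
  have hD := hG.dslope hz
  rw [← e1, ← hTd.cauchy_conj hz, ← dslope_same, ← hD.cauchy hz,
    ← cavg_sub (f := fun ζ => ζ / (ζ - z) * dslope G z ζ)
      (g := fun ζ => ζ / (ζ - z) * (starRingEnd ℂ) (T ζ)) (c1.mul hD.contS) (c1.mul c2)]
  refine norm_cavg_le.trans_eq (cavg_congr fun ζ hζ => ?_)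
  have h0 := ne_zero_of_sphere hζ
  have h1 := sub_ne_zero_of_sphere hζ hz
  have hne : ζ ≠ z := fun h => h1 (by simp [h])
  have e2 : dslope G z ζ = (G ζ - G z) / (ζ - z) := by
    rw [dslope_of_ne _ hne, slope_def_field]
  have e3 : (starRingEnd ℂ) (T ζ) = ((starRingEnd ℂ) (S ζ / ζ) - G z) / (ζ - z) := by
    have := conj_div_sub hζ hz
    rw [hT]; simp only [map_mul, map_sub]
    rw [← this]; simp only [Complex.conj_conj, conj_eq_inv_of_sphere hζ, map_div₀,
      map_inv₀, inv_inv]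
    field_simp
  rw [e2, e3, ← mul_sub, ← sub_div, norm_mul, norm_div, norm_div, mem_sphere_zero_iff_norm.1 hζ]
  rw [← Complex.norm_conj (S ζ / ζ - _), map_sub, Complex.conj_conj, norm_sub_rev _ (G ζ)]
  rw [sub_sub_sub_cancel_right]
  have := norm_pos_iff.2 h1
  field_simp

end DiskAlg

section CircleEstimates

lemma le_norm_circleMap_sub {η θ : ℝ} (h0 : 0 ≤ θ) (h1 : θ ≤ Real.pi) :
    2 / Real.pi * θ ≤ ‖circleMap 0 1 (θ + η) - circleMap 0 1 η‖ := by
  have e : circleMap 0 1 (θ + η) - circleMap 0 1 η =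
      Complex.exp (η * Complex.I) * (Complex.exp (Complex.I * θ) - 1) := by
    simp only [circleMap, Complex.ofReal_add, add_mul, Complex.exp_add]
    rw [mul_comm Complex.I]; push_cast; ring
  rw [e, norm_mul, Complex.norm_exp_ofReal_mul_I, one_mul, Complex.norm_exp_I_mul_ofReal_sub_one,
    Real.norm_of_nonneg]
  · have := Real.mul_le_sin (x := θ / 2) (by linarith) (by linarith)
    calc 2 / Real.pi * θ = 2 * (2 / Real.pi * (θ / 2)) := by ring
      _ ≤ _ := by linarith
  · have := Real.sin_nonneg_of_nonneg_of_le_pi (x := θ / 2) (by linarith) (by linarith)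
    positivity

/-- Circle averages of functions dominated by a function of the distance to a point. -/
lemma cavg_le_half_integral {f : ℂ → ℝ} (hf : ContinuousOn f (sphere 0 1)) {F : ℝ → ℝ}
    (hF : IntervalIntegrable F volume 0 2) {ζ₀ : ℂ} (h0 : ζ₀ ∈ sphere (0 : ℂ) 1)
    (h : ∀ ζ ∈ sphere (0 : ℂ) 1, ∀ s, 0 < s → s ≤ ‖ζ - ζ₀‖ → f ζ ≤ F s) :
    cavg f ≤ (∫ s in (0:ℝ)..2, F s) / 2 := by
  have hpi := Real.pi_pos
  obtain ⟨η, rfl⟩ : ∃ η : ℝ, circleMap 0 1 η = ζ₀ := by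
    have := image_circleMap_Ioc (0 : ℂ) 1
    simp only [abs_one] at this
    rw [← this] at h0
    obtain ⟨x, _, hx⟩ := h0
    exact ⟨x, hx⟩
  have hc : ∀ g : ℝ → ℝ, Continuous g → Continuous (fun θ => f (circleMap 0 1 (g θ))) := by
    intro g hg
    refine hf.comp_continuous ((continuous_circleMap 0 1).comp hg) fun x => ?_
    exact circleMap_mem_sphere _ zero_le_one _
  have hFi : IntervalIntegrable (fun θ => F (2 / Real.pi * θ)) volume 0 Real.pi := by
    have := hF.comp_mul_left (c := 2 / Real.pi)
    simpa [show (2:ℝ) / (2 / Real.pi) = Real.pi by field_simp] using this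
  have hval : ∫ θ in (0:ℝ)..Real.pi, F (2 / Real.pi * θ) = Real.pi / 2 * ∫ s in (0:ℝ)..2, F s := by
    rw [intervalIntegral.integral_comp_mul_left _ (by positivity)]
    simp
  have h1 : ∫ θ in (0:ℝ)..Real.pi, f (circleMap 0 1 (θ + η)) ≤ Real.pi / 2 * ∫ s in (0:ℝ)..2, F s := by
    rw [← hval]
    apply intervalIntegral.integral_mono_on_of_le_Ioo hpi.le ((hc _ (by fun_prop)).intervalIntegrable _ _) hFi
    intro θ hθ
    exact h _ (circleMap_mem_sphere _ zero_le_one _) _ (by have := hθ.1; positivity)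
      (le_norm_circleMap_sub hθ.1.le hθ.2.le)
  have h2 : ∫ θ in Real.pi..(2 * Real.pi), f (circleMap 0 1 (θ + η)) ≤
      Real.pi / 2 * ∫ s in (0:ℝ)..2, F s := by
    have e : ∫ θ in Real.pi..(2 * Real.pi), f (circleMap 0 1 (θ + η)) =
        ∫ θ in (0:ℝ)..Real.pi, f (circleMap 0 1 (-θ + η)) := by
      have := intervalIntegral.integral_comp_sub_left (a := 0) (b := Real.pi)
        (fun θ => f (circleMap 0 1 (θ + η))) (2 * Real.pi)
      rw [show 2 * Real.pi - Real.pi = Real.pi by ring, sub_zero] at this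
      rw [← this]
      congr 1; ext θ
      rw [← periodic_circleMap 0 1 (-θ + η)]
      congr 2; ring
    rw [← hval, e]
    apply intervalIntegral.integral_mono_on_of_le_Ioo hpi.le ((hc _ (by fun_prop)).intervalIntegrable _ _) hFi
    intro θ hθ
    refine h _ (circleMap_mem_sphere _ zero_le_one _) _ (by have := hθ.1; positivity) ?_
    have := le_norm_circleMap_sub (η := -θ + η) hθ.1.le hθ.2.le
    rw [norm_sub_rev]
    simpa using this
  have hadd := intervalIntegral.integral_add_adjacent_intervals
    (f := fun θ => f (circleMap 0 1 (θ + η))) (μ := volume) (a := 0) (b := Real.pi) (c := 2 * Real.pi)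
    ((hc _ (by fun_prop)).intervalIntegrable _ _) ((hc _ (by fun_prop)).intervalIntegrable _ _)
  rw [cavg, Real.circleAverage_eq_integral_add η, ← hadd, smul_eq_mul]
  calc (2 * Real.pi)⁻¹ * _ ≤ (2 * Real.pi)⁻¹ * (Real.pi / 2 * (∫ s in (0:ℝ)..2, F s) +
        Real.pi / 2 * ∫ s in (0:ℝ)..2, F s) := by gcongr
    _ = _ := by field_simp; ring

lemma cavg_le_of_split {f : ℂ → ℝ} (hf : ContinuousOn f (sphere 0 1)) {F₁ F₂ : ℝ → ℝ} {t : ℝ}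
    (ht0 : 0 < t) (ht2 : t ≤ 2) (hF₁ : IntervalIntegrable F₁ volume 0 t)
    (hF₂ : IntervalIntegrable F₂ volume t 2) {ζ₀ : ℂ} (h0 : ζ₀ ∈ sphere (0 : ℂ) 1)
    (h1 : ∀ ζ ∈ sphere (0 : ℂ) 1, ∀ s, 0 < s → s ≤ ‖ζ - ζ₀‖ → f ζ ≤ F₁ s)
    (h2 : ∀ ζ ∈ sphere (0 : ℂ) 1, ∀ s, 0 < s → s ≤ ‖ζ - ζ₀‖ → f ζ ≤ F₂ s) :
    cavg f ≤ ((∫ s in (0:ℝ)..t, F₁ s) + ∫ s in t..2, F₂ s) / 2 := by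
  set F : ℝ → ℝ := fun s => if s < t then F₁ s else F₂ s with hFdef
  have i1 : IntervalIntegrable F volume 0 t := by
    refine hF₁.congr_uIoo fun s hs => ?_
    rw [uIoo_of_le ht0.le] at hs
    simp [hFdef, hs.2]
  have i2 : IntervalIntegrable F volume t 2 := by
    refine hF₂.congr_uIoo fun s hs => ?_
    rw [uIoo_of_le ht2] at hs
    simp [hFdef, not_lt.2 hs.1.le]
  have e1 : ∫ s in (0:ℝ)..t, F₁ s = ∫ s in (0:ℝ)..t, F s := by
    apply intervalIntegral.integral_congr_uIoo
    intro s hs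
    rw [uIoo_of_le ht0.le] at hs
    simp [hFdef, hs.2]
  have e2 : ∫ s in t..2, F₂ s = ∫ s in t..2, F s := by
    apply intervalIntegral.integral_congr_uIoo
    intro s hs
    rw [uIoo_of_le ht2] at hs
    simp [hFdef, not_lt.2 hs.1.le]
  rw [e1, e2, intervalIntegral.integral_add_adjacent_intervals i1 i2]
  refine cavg_le_half_integral hf (i1.trans i2) h0 fun ζ hζ s hs hs' => ?_
  by_cases hst : s < t
  · simpa [hFdef, hst] using h1 ζ hζ s hs hs'
  · simpa [hFdef, hst] using h2 ζ hζ s hs hs'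

lemma cavg_le_of_power_split {f : ℂ → ℝ} (hf : ContinuousOn f (sphere 0 1)) {a b t γ : ℝ}
    (hb : 0 ≤ b) (ht0 : 0 < t) (ht2 : t ≤ 2) (hγ : 0 < γ) (ha : 0 ≤ a)
    {ζ₀ : ℂ} (h0 : ζ₀ ∈ sphere (0 : ℂ) 1)
    (h1 : ∀ ζ ∈ sphere (0 : ℂ) 1, ∀ s, 0 < s → s ≤ ‖ζ - ζ₀‖ → f ζ ≤ a * s ^ (γ - 1))
    (h2 : ∀ ζ ∈ sphere (0 : ℂ) 1, ∀ s, 0 < s → s ≤ ‖ζ - ζ₀‖ → f ζ ≤ b * s ^ (-2 : ℝ)) :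
    cavg f ≤ a * t ^ γ / γ + b / t := by
  have hn : (0:ℝ) ∉ Set.uIcc t 2 := by
    rw [uIcc_of_le ht2]; intro h; linarith [h.1]
  have := cavg_le_of_split hf ht0 ht2 (F₁ := fun s => a * s ^ (γ - 1))
    (F₂ := fun s => b * s ^ (-2 : ℝ))
    ((intervalIntegral.intervalIntegrable_rpow' (by linarith)).const_mul _)
    ((intervalIntegral.intervalIntegrable_rpow (Or.inr hn)).const_mul _) h0 h1 h2
  rw [intervalIntegral.integral_const_mul, intervalIntegral.integral_const_mul,
    integral_rpow (Or.inl (by linarith)), integral_rpow (Or.inr ⟨by norm_num, hn⟩)] at this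
  refine this.trans ?_
  have e1 : γ - 1 + 1 = γ := by ring
  have e2 : (-2 : ℝ) + 1 = -1 := by norm_num
  rw [e1, e2, Real.zero_rpow hγ.ne', Real.rpow_neg_one, Real.rpow_neg_one]
  have p1 : 0 ≤ a * t ^ γ / γ := by positivity
  have p2 : 0 ≤ b / t := by positivity
  have : a * ((t ^ γ - 0) / γ) + b * ((2⁻¹ - t⁻¹) / -1) = a * t ^ γ / γ + b / t - b / 2 := by
    field_simp; ring
  rw [this]; linarith

lemma cavg_le_of_power {f : ℂ → ℝ} (hf : ContinuousOn f (sphere 0 1)) {a γ : ℝ}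
    (hγ : 0 < γ) (hγ1 : γ ≤ 1) (ha : 0 ≤ a)
    {ζ₀ : ℂ} (h0 : ζ₀ ∈ sphere (0 : ℂ) 1)
    (h1 : ∀ ζ ∈ sphere (0 : ℂ) 1, ∀ s, 0 < s → s ≤ ‖ζ - ζ₀‖ → f ζ ≤ a * s ^ (γ - 1)) :
    cavg f ≤ a / γ := by
  have := cavg_le_half_integral hf (F := fun s => a * s ^ (γ - 1))
    ((intervalIntegral.intervalIntegrable_rpow' (by linarith)).const_mul _) h0 h1
  rw [intervalIntegral.integral_const_mul, integral_rpow (Or.inl (by linarith))] at this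
  refine this.trans ?_
  have e1 : γ - 1 + 1 = γ := by ring
  rw [e1, Real.zero_rpow hγ.ne']
  have : (2:ℝ) ^ γ ≤ 2 := by
    calc (2:ℝ) ^ γ ≤ 2 ^ (1:ℝ) := Real.rpow_le_rpow_of_exponent_le (by norm_num) hγ1
      _ = 2 := by simp
  rw [sub_zero, ← mul_div_assoc, div_div, div_le_div_iff₀ (by positivity) hγ]
  nlinarith [mul_nonneg ha hγ.le, mul_le_mul_of_nonneg_left this (mul_nonneg ha hγ.le)]

lemma cavg_le_of_log_split {f : ℂ → ℝ} (hf : ContinuousOn f (sphere 0 1)) {a b t : ℝ}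
    (ht0 : 0 < t) (ht2 : t ≤ 2) 
    {ζ₀ : ℂ} (h0 : ζ₀ ∈ sphere (0 : ℂ) 1)
    (h1 : ∀ ζ ∈ sphere (0 : ℂ) 1, f ζ ≤ a)
    (h2 : ∀ ζ ∈ sphere (0 : ℂ) 1, ∀ s, 0 < s → s ≤ ‖ζ - ζ₀‖ → f ζ ≤ b * (1 / s)) :
    cavg f ≤ (a * t + b * Real.log (2 / t)) / 2 := by
  have hn : (0:ℝ) ∉ Set.uIcc t 2 := by
    rw [uIcc_of_le ht2]; intro h; linarith [h.1]
  have := cavg_le_of_split hf ht0 ht2 (F₁ := fun _ => a)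
    (F₂ := fun s => b * (1 / s)) (by simp)
    ((intervalIntegral.intervalIntegrable_one_div (fun x hx h => hn (h ▸ hx))
      (by fun_prop)).const_mul _) h0 (fun ζ hζ _ _ _ => h1 ζ hζ) h2
  rw [intervalIntegral.integral_const_mul, integral_one_div hn] at this
  refine this.trans_eq ?_
  simp; ring

lemma half_norm_sub_le {ζ ζ₀ : ℂ} {r : ℝ} (hζ : ζ ∈ sphere (0 : ℂ) 1)
    (h0 : ζ₀ ∈ sphere (0 : ℂ) 1) (hr0 : 0 ≤ r) (hr1 : r ≤ 1) :
    ‖ζ - ζ₀‖ / 2 ≤ ‖ζ - r * ζ₀‖ ∧ 1 - r ≤ ‖ζ - r * ζ₀‖ := by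
  rw [mem_sphere_zero_iff_norm] at hζ h0
  have h1 : 1 - r ≤ ‖ζ - r * ζ₀‖ := by
    have := norm_sub_norm_le ζ (r * ζ₀)
    rw [norm_mul, hζ, h0, Complex.norm_real, Real.norm_of_nonneg hr0] at this
    linarith
  refine ⟨?_, h1⟩
  have h2 : ‖ζ - ζ₀‖ ≤ ‖ζ - r * ζ₀‖ + ‖(r * ζ₀) - ζ₀‖ := norm_sub_le_norm_sub_add_norm_sub _ _ _
  have h3 : ‖(r * ζ₀) - ζ₀‖ = 1 - r := by
    rw [show (r * ζ₀) - ζ₀ = ((r - 1 : ℝ) : ℂ) * ζ₀ by push_cast; ring, norm_mul, h0,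
      Complex.norm_real, Real.norm_of_nonpos (by linarith)]; ring
  linarith

end CircleEstimates

section HardyLittlewood
variable {F : Type*} [NormedAddCommGroup F] [NormedSpace ℂ F]

lemma smul_mem_ball_of {ζ : ℂ} (hζ : ζ ∈ sphere (0 : ℂ) 1) {r : ℝ} (h0 : 0 ≤ r) (h1 : r < 1) :
    (r : ℂ) * ζ ∈ ball (0 : ℂ) 1 := by
  rw [mem_sphere_zero_iff_norm] at hζ
  simp [hζ, abs_of_nonneg h0, h1]

lemma smul_mem_closedBall_of {ζ : ℂ} (hζ : ζ ∈ sphere (0 : ℂ) 1) {r : ℝ} (h0 : 0 ≤ r) (h1 : r ≤ 1) :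
    (r : ℂ) * ζ ∈ closedBall (0 : ℂ) 1 := by
  rw [mem_sphere_zero_iff_norm] at hζ
  simp [hζ, abs_of_nonneg h0, h1]

/-- Radial Hardy-Littlewood estimate. -/
lemma norm_sub_radial_le {h : ℂ → F} (hh : DiskAlg h) {K γ : ℝ} (hγ : 0 < γ)
    (hd : ∀ ζ ∈ sphere (0 : ℂ) 1, ∀ r : ℝ, 0 ≤ r → r < 1 →
      ‖deriv h (r * ζ)‖ ≤ K * (1 - r) ^ (γ - 1))
    {ζ : ℂ} (hζ : ζ ∈ sphere (0 : ℂ) 1) {r : ℝ} (hr0 : 0 ≤ r) (hr1 : r ≤ 1) :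
    ‖h ζ - h (r * ζ)‖ ≤ K / γ * (1 - r) ^ γ := by
  have key := image_norm_le_of_norm_deriv_right_le_deriv_boundary' (a := r) (b := 1)
    (f := fun s : ℝ => h (s * ζ) - h (r * ζ)) (f' := fun s : ℝ => ζ • deriv h (s * ζ))
    (B := fun s => K / γ * ((1 - r) ^ γ - (1 - s) ^ γ)) (B' := fun s => K * (1 - s) ^ (γ - 1))
    ?_ ?_ ?_ ?_ ?_ ?_ (x := 1) ⟨hr1, le_rfl⟩
  · simpa [Real.zero_rpow hγ.ne'] using key
  · refine ContinuousOn.sub ?_ continuousOn_const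
    refine hh.cont.comp (by fun_prop) fun s hs => ?_
    exact smul_mem_closedBall_of hζ (hr0.trans hs.1) hs.2
  · intro s hs
    have h1 := (hh.diffAt (smul_mem_ball_of hζ (hr0.trans hs.1) hs.2)).hasDerivAt
    have h2 : HasDerivAt (fun s : ℝ => (s : ℂ) * ζ) ζ s := by
      simpa using (Complex.ofRealCLM.hasDerivAt (x := s)).mul_const ζ
    exact ((h1.scomp s h2).sub_const _).hasDerivWithinAt
  · simp
  · refine ContinuousOn.mul continuousOn_const (continuousOn_const.sub ?_)
    exact ContinuousOn.rpow_const (by fun_prop) fun x _ => Or.inr hγ.le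
  · intro s hs
    have hne : (1 - s) ≠ 0 := by have := hs.2; linarith
    have h1 : HasDerivAt (fun s : ℝ => (1 - s) ^ γ) (-1 * γ * (1 - s) ^ (γ - 1)) s :=
      ((hasDerivAt_id s).const_sub 1).rpow_const (Or.inl hne)
    have h2 := ((h1.const_sub ((1 - r) ^ γ)).const_mul (K / γ)).hasDerivWithinAt (s := Ici s)
    have e : K * (1 - s) ^ (γ - 1) = K / γ * -(-1 * γ * (1 - s) ^ (γ - 1)) := by field_simp
    rw [e]
    exact h2
  · intro s hs
    rw [norm_smul, mem_sphere_zero_iff_norm.1 hζ, one_mul]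
    exact hd ζ hζ s (hr0.trans hs.1) hs.2

/-- Hardy-Littlewood: growth of the derivative gives Hölder boundary values. -/
lemma norm_sub_le_of_deriv_growth {h : ℂ → F} (hh : DiskAlg h) {K γ : ℝ} (hγ : 0 < γ) (hγ1 : γ ≤ 1)
    (hd : ∀ ζ ∈ sphere (0 : ℂ) 1, ∀ r : ℝ, 0 ≤ r → r < 1 →
      ‖deriv h (r * ζ)‖ ≤ K * (1 - r) ^ (γ - 1))
    {ζ ξ : ℂ} (hζ : ζ ∈ sphere (0 : ℂ) 1) (hξ : ξ ∈ sphere (0 : ℂ) 1) :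
    ‖h ζ - h ξ‖ ≤ (2 / γ + 1) * K * ‖ζ - ξ‖ ^ γ := by
  have hK : 0 ≤ K := by
    have := (norm_nonneg _).trans (hd ζ hζ 0 le_rfl one_pos); simpa using this
  rcases eq_or_ne ζ ξ with rfl | hne
  · simp [Real.zero_rpow hγ.ne']
  have hs : 0 < ‖ζ - ξ‖ := norm_pos_iff.2 (sub_ne_zero.2 hne)
  set s := ‖ζ - ξ‖
  have main : ∀ r : ℝ, 0 ≤ r → r ≤ 1 → 1 - r ≤ s → ‖h (r * ζ) - h (r * ξ)‖ ≤ K * s ^ γ →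
      ‖h ζ - h ξ‖ ≤ (2 / γ + 1) * K * s ^ γ := by
    intro r h0 h1 h2 h3
    have a1 := norm_sub_radial_le hh hγ hd hζ h0 h1
    have a2 := norm_sub_radial_le hh hγ hd hξ h0 h1
    have a3 : K / γ * (1 - r) ^ γ ≤ K / γ * s ^ γ := by
      gcongr
    have : h ζ - h ξ = (h ζ - h (r * ζ)) + (h (r * ζ) - h (r * ξ)) - (h ξ - h (r * ξ)) := by abel
    rw [this]
    calc _ ≤ ‖h ζ - h (r * ζ)‖ + ‖h (r * ζ) - h (r * ξ)‖ + ‖h ξ - h (r * ξ)‖ :=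
          (norm_sub_le _ _).trans (by gcongr; exact norm_add_le _ _)
      _ ≤ K / γ * s ^ γ + K * s ^ γ + K / γ * s ^ γ := by linarith
      _ = _ := by ring
  by_cases h1 : s < 1
  · refine main (1 - s) (by linarith) (by linarith) (by linarith) ?_
    set r : ℝ := 1 - s
    have hr0 : 0 ≤ r := by simp only [r]; linarith
    have hr1 : r < 1 := by simp only [r]; linarith
    have hsub : closedBall (0 : ℂ) r ⊆ ball 0 1 := closedBall_subset_ball hr1
    have hbound : ∀ x ∈ closedBall (0 : ℂ) r, ‖deriv h x‖ ≤ K * s ^ (γ - 1) := by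
      intro x hx
      simp at hx
      obtain ⟨ω, hω, hxω⟩ : ∃ ω ∈ sphere (0 : ℂ) 1, x = (‖x‖ : ℂ) * ω := by
        rcases eq_or_ne x 0 with rfl | hx0
        · exact ⟨1, by simp, by simp⟩
        · exact ⟨x / ‖x‖, by simp [hx0],
            (mul_div_cancel₀ _ (Complex.ofReal_ne_zero.2 (norm_ne_zero_iff.2 hx0))).symm⟩
      rw [hxω]
      refine (hd ω hω ‖x‖ (norm_nonneg _) (by linarith)).trans ?_
      gcongr ?_ * ?_
      apply Real.rpow_le_rpow_of_nonpos hs (by simp only [r] at hx; linarith) (by linarith)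
    have := (convex_closedBall (0 : ℂ) r).norm_image_sub_le_of_norm_deriv_le
      (fun x hx => hh.diffAt (hsub hx)) hbound (x := r * ξ) (y := r * ζ)
      (by simp [mem_sphere_zero_iff_norm.1 hξ, abs_of_nonneg hr0])
      (by simp [mem_sphere_zero_iff_norm.1 hζ, abs_of_nonneg hr0])
    refine this.trans ?_
    rw [← mul_sub, norm_mul, Complex.norm_real, Real.norm_of_nonneg hr0]
    calc K * s ^ (γ - 1) * (r * ‖ζ - ξ‖) ≤ K * s ^ (γ - 1) * (1 * s) := by gcongr
      _ = K * s ^ γ := by rw [Real.rpow_sub_one hs.ne']; field_simp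
  · refine main 0 le_rfl zero_le_one (by simpa using h1) ?_
    simp; positivity

end HardyLittlewood

section Poisson

lemma continuousOn_poissonKernel {z : ℂ} (hz : z ∈ ball (0 : ℂ) 1) :
    ContinuousOn (poissonKernel 0 z) (sphere (0 : ℂ) 1) := by
  have : poissonKernel 0 z = fun ζ => (‖ζ‖ ^ 2 - ‖z‖ ^ 2) / ‖ζ - z‖ ^ 2 := by
    ext ζ; simp [poissonKernel_def]
  rw [this]
  refine ContinuousOn.div (by fun_prop) (by fun_prop) fun ζ hζ => ?_
  have := norm_pos_iff.2 (sub_ne_zero_of_sphere hζ hz)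
  positivity

lemma poissonKernel_nonneg' {z ζ : ℂ} (hz : z ∈ ball (0 : ℂ) 1) (hζ : ζ ∈ sphere (0 : ℂ) 1) :
    0 ≤ poissonKernel 0 z ζ := by
  simp at hz hζ
  simp only [poissonKernel_def, sub_zero, hζ]
  have : 0 ≤ 1 ^ 2 - ‖z‖ ^ 2 := by nlinarith [norm_nonneg z]
  positivity

lemma poissonKernel_eq_of_sphere {z ζ : ℂ} (hz : z ∈ ball (0 : ℂ) 1)
    (hζ : ζ ∈ sphere (0 : ℂ) 1) :
    (poissonKernel 0 z ζ : ℂ) = (1 / 2) * herglotzRieszKernel 0 z ζ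
      + ((1 - (starRingEnd ℂ) z * ζ)⁻¹ - 1 / 2) := by
  have h1 := sub_ne_zero_of_sphere hζ hz
  have e : (1 / 2) * herglotzRieszKernel 0 z ζ = ζ / (ζ - z) - 1 / 2 := by
    rw [herglotzRieszKernel_def]; simp only [sub_zero]; field_simp; ring
  rw [e, ← conj_div_sub hζ hz, poissonKernel_eq_re_herglotzRieszKernel]
  have e2 : herglotzRieszKernel 0 z ζ = 2 * (ζ / (ζ - z)) - 1 := by linear_combination 2 * e
  simp only [Function.comp_apply, e2, Complex.sub_re, Complex.mul_re, Complex.re_ofNat, Complex.im_ofNat,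
    Complex.one_re, zero_mul, sub_zero]
  have := Complex.add_conj (ζ / (ζ - z))
  push_cast at this ⊢
  linear_combination -this

lemma cavg_poissonKernel {z : ℂ} (hz : z ∈ ball (0 : ℂ) 1) : cavg (poissonKernel 0 z) = 1 := by
  have h := (diskAlg_const (1 : ℂ)).circleAverage_poissonKernel_smul hz
  have h2 := ContinuousLinearMap.circleAverage_comp_comm (R := 1) (c := 0)
    (Complex.ofRealCLM : ℝ →L[ℝ] ℂ) (circleIntegrable_of_contS (continuousOn_poissonKernel hz))
  have e : (poissonKernel 0 z • fun _ => (1 : ℂ)) = (Complex.ofRealCLM ∘ poissonKernel 0 z) := by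
    ext ζ; simp
  rw [e, h2] at h
  simpa using h

/-- The Poisson integral. -/
def poi (u : ℂ → ℂ) (z : ℂ) : ℂ := cavg (fun ζ => (poissonKernel 0 z ζ : ℂ) * u ζ)

lemma norm_poi_le {u : ℂ → ℂ} (hu : ContinuousOn u (sphere 0 1)) {ε : ℝ}
    (h : ∀ ζ ∈ sphere (0 : ℂ) 1, ‖u ζ‖ ≤ ε) {z : ℂ} (hz : z ∈ ball (0 : ℂ) 1) :
    ‖poi u z‖ ≤ ε := by
  have c1 := continuousOn_poissonKernel hz
  have c2 : ContinuousOn (fun ζ => (poissonKernel 0 z ζ : ℂ) * u ζ) (sphere 0 1) :=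
    (Complex.continuous_ofReal.comp_continuousOn c1).mul hu
  have h0 := norm_cavg_le (f := fun ζ => (poissonKernel 0 z ζ : ℂ) * u ζ)
  have h1 := Real.circleAverage_fun_smul (a := ε) (f := poissonKernel 0 z) (c := 0) (R := 1)
  have h2 : Real.circleAverage (poissonKernel 0 z) 0 1 = 1 := cavg_poissonKernel hz
  rw [h2, smul_eq_mul, mul_one] at h1
  have h3 : cavg (fun ζ => ‖(poissonKernel 0 z ζ : ℂ) * u ζ‖) ≤
      cavg (fun ζ => ε • poissonKernel 0 z ζ) := by
    refine cavg_mono c2.norm (c1.const_smul ε) fun ζ hζ => ?_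
    rw [norm_mul, Complex.norm_real, Real.norm_of_nonneg (poissonKernel_nonneg' hz hζ),
      mul_comm, smul_eq_mul]
    exact mul_le_mul_of_nonneg_right (h ζ hζ) (poissonKernel_nonneg' hz hζ)
  exact (h0.trans h3).trans_eq h1

lemma DiskAlg.poi {f : ℂ → ℂ} (hf : DiskAlg f) {z : ℂ} (hz : z ∈ ball (0 : ℂ) 1) :
    poi f z = f z := by
  have := hf.circleAverage_poissonKernel_smul hz
  rw [← this]
  refine cavg_congr (f := fun ζ => (poissonKernel 0 z ζ : ℂ) * f ζ) fun ζ _ => ?_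
  simp

lemma DiskAlg.poi_conj {f : ℂ → ℂ} (hf : DiskAlg f) {z : ℂ} (hz : z ∈ ball (0 : ℂ) 1) :
    InvDist.poi (fun ζ => (starRingEnd ℂ) (f ζ)) z = (starRingEnd ℂ) (f z) := by
  rw [← hf.poi hz, InvDist.poi, InvDist.poi, ← cavg_conj]
  · simp
  · exact (Complex.continuous_ofReal.comp_continuousOn (continuousOn_poissonKernel hz)).mul hf.contS

lemma norm_poi_sub_le {u f g : ℂ → ℂ} (hu : ContinuousOn u (sphere 0 1)) (hf : DiskAlg f)
    (hg : DiskAlg g) {ε : ℝ}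
    (h : ∀ ζ ∈ sphere (0 : ℂ) 1, ‖u ζ - (f ζ + (starRingEnd ℂ) (g ζ))‖ ≤ ε)
    {z : ℂ} (hz : z ∈ ball (0 : ℂ) 1) :
    ‖poi u z - (f z + (starRingEnd ℂ) (g z))‖ ≤ ε := by
  have c1 : ContinuousOn (fun ζ => (poissonKernel 0 z ζ : ℂ)) (sphere 0 1) :=
    Complex.continuous_ofReal.comp_continuousOn (continuousOn_poissonKernel hz)
  have cg : ContinuousOn (fun ζ => (starRingEnd ℂ) (g ζ)) (sphere 0 1) :=
    Complex.continuous_conj.comp_continuousOn hg.contS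
  have e : poi (fun ζ => u ζ - (f ζ + (starRingEnd ℂ) (g ζ))) z =
      poi u z - (f z + (starRingEnd ℂ) (g z)) := by
    rw [← hf.poi hz, ← hg.poi_conj hz]
    unfold poi
    rw [← cavg_add (f := fun ζ => (poissonKernel 0 z ζ : ℂ) * f ζ)
        (g := fun ζ => (poissonKernel 0 z ζ : ℂ) * (starRingEnd ℂ) (g ζ)) (c1.mul hf.contS)
        (c1.mul cg), ← cavg_sub (f := fun ζ => (poissonKernel 0 z ζ : ℂ) * u ζ)
        (g := fun ζ => (poissonKernel 0 z ζ : ℂ) * f ζ +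
          (poissonKernel 0 z ζ : ℂ) * (starRingEnd ℂ) (g ζ)) (c1.mul hu)
        ((c1.mul hf.contS).add (c1.mul cg))]
    refine cavg_congr fun ζ _ => ?_
    ring
  rw [← e]
  exact norm_poi_le (hu.sub (hf.contS.add cg)) h hz

end Poisson

section Density

lemma exists_diskAlg_approx {u : ℂ → ℂ} (hu : ContinuousOn u (sphere 0 1)) {ε : ℝ} (hε : 0 < ε) :
    ∃ f g : ℂ → ℂ, DiskAlg f ∧ DiskAlg g ∧
      ∀ ζ ∈ sphere (0 : ℂ) 1, ‖u ζ - (f ζ + (starRingEnd ℂ) (g ζ))‖ ≤ ε := by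
  have : Fact (0 < 2 * Real.pi) := ⟨by positivity⟩
  let v : C(AddCircle (2 * Real.pi), ℂ) := ⟨fun x => u (AddCircle.toCircle x), by
    refine hu.comp_continuous (continuous_subtype_val.comp AddCircle.continuous_toCircle) ?_
    intro x; simpa using Circle.norm_coe _⟩
  have hv : v ∈ (Submodule.span ℂ (range <| @fourier (2 * Real.pi))).topologicalClosure := by
    rw [span_fourier_closure_eq_top]; trivial
  obtain ⟨w, hw, hd⟩ := Metric.mem_closure_iff.1 hv ε hε
  have key : ∃ f g : ℂ → ℂ, DiskAlg f ∧ DiskAlg g ∧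
      ∀ x : AddCircle (2 * Real.pi), w x = f (AddCircle.toCircle x) +
        (starRingEnd ℂ) (g (AddCircle.toCircle x)) := by
    clear hd
    induction hw using Submodule.span_induction with
    | mem x hx =>
      obtain ⟨n, rfl⟩ := hx
      rcases le_total 0 n with hn | hn
      · lift n to ℕ using hn
        refine ⟨fun z => z ^ n, fun _ => 0, (Differentiable.diffContOnCl (by fun_prop)),
          diskAlg_const 0, fun x => ?_⟩
        simp [AddCircle.toCircle_nsmul]
      · obtain ⟨m, rfl⟩ : ∃ m : ℕ, n = -m := ⟨(-n).toNat, by omega⟩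
        refine ⟨fun _ => 0, fun z => z ^ m, 
          diskAlg_const 0, (Differentiable.diffContOnCl (by fun_prop)), fun x => ?_⟩
        simp [AddCircle.toCircle_nsmul, AddCircle.toCircle_neg, ← Circle.coe_inv_eq_conj]
    | zero => exact ⟨fun _ => 0, fun _ => 0, diskAlg_const 0, diskAlg_const 0, by simp⟩
    | add x y _ _ hx hy =>
      obtain ⟨f, g, hf, hg, h⟩ := hx
      obtain ⟨f', g', hf', hg', h'⟩ := hy
      refine ⟨_, _, hf.add hf', hg.add hg', fun x => ?_⟩
      simp [h, h']; ring
    | smul a x _ hx =>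
      obtain ⟨f, g, hf, hg, h⟩ := hx
      refine ⟨_, _, hf.const_smul a, hg.const_smul ((starRingEnd ℂ) a), fun x => ?_⟩
      simp [h]; ring
  obtain ⟨f, g, hf, hg, h⟩ := key
  refine ⟨f, g, hf, hg, fun ζ hζ => ?_⟩
  set x : AddCircle (2 * Real.pi) := AddCircle.homeomorphCircle'.symm ⟨ζ, by
    simpa [Submonoid.unitSphere] using hζ⟩ with hx
  have hx' : (AddCircle.toCircle x : ℂ) = ζ := by
    rw [← AddCircle.homeomorphCircle_apply (by positivity)]
    have : AddCircle.homeomorphCircle' x = ⟨ζ, by simpa [Submonoid.unitSphere] using hζ⟩ := by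
      exact AddCircle.homeomorphCircle'.apply_symm_apply _
    have h2 : AddCircle.toCircle x = AddCircle.homeomorphCircle' x := by
      induction x using QuotientAddGroup.induction_on with
      | H y =>
        rw [AddCircle.homeomorphCircle'_apply_mk, AddCircle.toCircle_apply_mk]
        congr 1; field_simp
    rw [AddCircle.homeomorphCircle_apply, h2, this]
  have := (ContinuousMap.dist_apply_le_dist (f := v) (g := w) x).trans hd.le
  rw [dist_eq_norm, h, hx'] at this
  simpa [v, hx'] using this

lemma exists_diskAlg_re_approx {u : ℂ → ℝ} (hu : ContinuousOn u (sphere 0 1)) {ε : ℝ}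
    (hε : 0 < ε) : ∃ q : ℂ → ℂ, DiskAlg q ∧ ∀ ζ ∈ sphere (0 : ℂ) 1, |u ζ - (q ζ).re| ≤ ε := by
  obtain ⟨f, g, hf, hg, h⟩ := exists_diskAlg_approx
    (u := fun ζ => (u ζ : ℂ)) (Complex.continuous_ofReal.comp_continuousOn hu) hε
  refine ⟨_, hf.add hg, fun ζ hζ => ?_⟩
  have := (Complex.abs_re_le_norm _).trans (h ζ hζ)
  simpa using this

end Density

section Extension

/-- A continuous function on the circle annihilated by `ζ A(Δ)` extends to the disc algebra. -/
lemma exists_diskAlg_extension {u : ℂ → ℂ} (hu : ContinuousOn u (sphere 0 1))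
    (h0 : ∀ q : ℂ → ℂ, DiskAlg q → cavg (fun ζ => ζ * q ζ * u ζ) = 0) :
    ∃ G : ℂ → ℂ, DiskAlg G ∧ EqOn G u (sphere 0 1) := by
  classical
  let G : ℂ → ℂ := fun z => if z ∈ ball (0 : ℂ) 1 then poi u z else u z
  have hGS : EqOn G u (sphere 0 1) := fun ζ hζ => by
    have : ζ ∉ ball (0 : ℂ) 1 := by simp at hζ ⊢; simp [hζ]
    simp only [G, if_neg this]
  refine ⟨G, diskAlg_mk ?_ ?_, hGS⟩
  · have h1 := (differentiableOn_circleAverage_herglotzRieszKernel_smul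
      (circleIntegrable_of_contS hu)).const_mul (1 / 2 : ℂ)
    refine (h1.add_const ((1 / 2) * cavg u)).congr fun z hz => ?_
    simp only [G, if_pos hz]
    have cH : ContinuousOn (herglotzRieszKernel 0 z) (sphere 0 1) :=
      by simpa using continuousOn_herglotzRieszKernel_sphere hz
    have cI := (diskAlg_inv_one_sub_conj_mul hz)
    have e0 : cavg (fun ζ => (1 - (starRingEnd ℂ) z * ζ)⁻¹ * u ζ) = cavg u := by
      have := h0 _ ((diskAlg_const ((starRingEnd ℂ) z)).mul cI)
      rw [← sub_eq_zero, ← cavg_sub (f := fun ζ => (1 - (starRingEnd ℂ) z * ζ)⁻¹ * u ζ)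
        (g := u) (cI.contS.mul hu) hu, ← this]
      apply cavg_congr
      intro ζ hζ
      have := one_sub_conj_mul_ne_zero (sphere_subset_closedBall hζ) hz
      field_simp; ring
    have e1 : poi u z = cavg (fun ζ => ((1 / 2 : ℂ) • (herglotzRieszKernel 0 z ζ * u ζ)
        + (1 - (starRingEnd ℂ) z * ζ)⁻¹ * u ζ) - (1 / 2 : ℂ) • u ζ) := by
      refine cavg_congr (f := fun ζ => (poissonKernel 0 z ζ : ℂ) * u ζ) fun ζ hζ => ?_
      rw [poissonKernel_eq_of_sphere hz hζ]; simp; ring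
    have cu : ContinuousOn (fun ζ => (1 / 2 : ℂ) • u ζ) (sphere 0 1) := hu.const_smul (1 / 2 : ℂ)
    have cHu : ContinuousOn (fun ζ => (1 / 2 : ℂ) • (herglotzRieszKernel 0 z ζ * u ζ))
      (sphere 0 1) := (cH.mul hu).const_smul (1 / 2 : ℂ)
    rw [e1, cavg_sub (f := fun ζ => (1 / 2 : ℂ) • (herglotzRieszKernel 0 z ζ * u ζ)
        + (1 - (starRingEnd ℂ) z * ζ)⁻¹ * u ζ) (g := fun ζ => (1 / 2 : ℂ) • u ζ)
      (cHu.add (cI.contS.mul hu)) cu,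
      cavg_add (f := fun ζ => (1 / 2 : ℂ) • (herglotzRieszKernel 0 z ζ * u ζ))
        (g := fun ζ => (1 - (starRingEnd ℂ) z * ζ)⁻¹ * u ζ) cHu
        (cI.contS.mul hu), e0, cavg, cavg, cavg, Real.circleAverage_fun_smul,
        Real.circleAverage_fun_smul]
    simp; ring
  · refine continuousOn_of_uniform_approx_of_continuousOn fun V hV => ?_
    obtain ⟨ε, hε, hV⟩ := Metric.mem_uniformity_dist.1 hV
    obtain ⟨f, g, hf, hg, h⟩ := exists_diskAlg_approx hu (half_pos hε)
    refine ⟨fun z => f z + (starRingEnd ℂ) (g z),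
      hf.cont.add (Complex.continuous_conj.comp_continuousOn hg.cont), fun z hz => hV ?_⟩
    rw [dist_eq_norm]
    refine lt_of_le_of_lt ?_ (half_lt_self hε)
    by_cases hz' : z ∈ ball (0 : ℂ) 1
    · simp only [G, if_pos hz']
      exact norm_poi_sub_le hu hf hg h hz'
    · have : z ∈ sphere (0 : ℂ) 1 := by
        simp at hz hz' ⊢; linarith
      simp only [G, if_neg hz']
      exact h z this

end Extension

section MaxPrinciple

lemma DiskAlg.norm_le {F : Type*} [NormedAddCommGroup F] [NormedSpace ℂ F] {f : ℂ → F}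
    (hf : DiskAlg f) {C : ℝ} (h : ∀ ζ ∈ sphere (0 : ℂ) 1, ‖f ζ‖ ≤ C) {z : ℂ}
    (hz : z ∈ closedBall (0 : ℂ) 1) : ‖f z‖ ≤ C := by
  refine Complex.norm_le_of_forall_mem_frontier_norm_le (U := ball 0 1) isBounded_ball hf ?_ ?_
  · intro ζ hζ
    rw [frontier_ball _ one_ne_zero] at hζ
    exact h ζ hζ
  · rwa [closure_ball _ one_ne_zero]

lemma DiskAlg.le_re {f : ℂ → ℂ} (hf : DiskAlg f) {m : ℝ}
    (h : ∀ ζ ∈ sphere (0 : ℂ) 1, m ≤ (f ζ).re) {z : ℂ}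
    (hz : z ∈ closedBall (0 : ℂ) 1) : m ≤ (f z).re := by
  have h1 : DiskAlg (fun z => Complex.exp (-f z)) :=
    diskAlg_mk hf.1.neg.cexp (Complex.continuous_exp.comp_continuousOn hf.cont.neg)
  have := h1.norm_le (C := Real.exp (-m)) (fun ζ hζ => by
    rw [Complex.norm_exp]; exact Real.exp_le_exp.2 (by simpa using h ζ hζ)) hz
  rw [Complex.norm_exp, Real.exp_le_exp] at this
  simpa using this

end MaxPrinciple

section Mobius

/-- The disc automorphism `ζ ↦ (ζ + a) / (1 + ā ζ)`. -/
def mob (a ζ : ℂ) : ℂ := (ζ + a) / (1 + (starRingEnd ℂ) a * ζ)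

/-- The pseudohyperbolic distance of the disc. -/
def psd (ζ ξ : ℂ) : ℝ := ‖(ζ - ξ) / (1 - (starRingEnd ℂ) ζ * ξ)‖

lemma mob_den_ne {a ζ : ℂ} (ha : a ∈ ball (0 : ℂ) 1) (hζ : ζ ∈ closedBall (0 : ℂ) 1) :
    1 + (starRingEnd ℂ) a * ζ ≠ 0 := by
  have := one_sub_conj_mul_ne_zero (z := -a) hζ (by simpa using ha)
  simpa using this

@[simp] lemma mob_zero (a : ℂ) : mob a 0 = a := by simp [mob]

@[simp] lemma psd_zero_left (ξ : ℂ) : psd 0 ξ = ‖ξ‖ := by simp [psd]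

lemma one_sub_normSq_mob {a ζ : ℂ} (ha : a ∈ ball (0 : ℂ) 1) (hζ : ζ ∈ closedBall (0 : ℂ) 1) :
    1 - ‖mob a ζ‖ ^ 2 = (1 - ‖a‖ ^ 2) * (1 - ‖ζ‖ ^ 2) / ‖1 + (starRingEnd ℂ) a * ζ‖ ^ 2 := by
  have h := mob_den_ne ha hζ
  have hn : ‖1 + (starRingEnd ℂ) a * ζ‖ ^ 2 ≠ 0 := by positivity
  rw [mob, norm_div, div_pow, eq_div_iff hn, sub_mul, div_mul_cancel₀ _ hn]
  rw [← Complex.normSq_eq_norm_sq, ← Complex.normSq_eq_norm_sq, ← Complex.normSq_eq_norm_sq,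
    ← Complex.normSq_eq_norm_sq]
  simp [Complex.normSq_apply]; ring

lemma one_sub_norm_sq_pos {a : ℂ} (ha : a ∈ ball (0 : ℂ) 1) : 0 < 1 - ‖a‖ ^ 2 := by
  simp at ha; nlinarith [norm_nonneg a]

lemma mob_mem_ball {a ζ : ℂ} (ha : a ∈ ball (0 : ℂ) 1) (hζ : ζ ∈ ball (0 : ℂ) 1) :
    mob a ζ ∈ ball (0 : ℂ) 1 := by
  have h := one_sub_normSq_mob ha (ball_subset_closedBall hζ)
  have h1 := mob_den_ne ha (ball_subset_closedBall hζ)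
  have : 0 < 1 - ‖mob a ζ‖ ^ 2 := by
    rw [h]; have := one_sub_norm_sq_pos ha; have := one_sub_norm_sq_pos hζ; positivity
  rw [mem_ball_zero_iff]; nlinarith [norm_nonneg (mob a ζ)]

lemma mob_mem_sphere {a ζ : ℂ} (ha : a ∈ ball (0 : ℂ) 1) (hζ : ζ ∈ sphere (0 : ℂ) 1) :
    mob a ζ ∈ sphere (0 : ℂ) 1 := by
  have h := one_sub_normSq_mob ha (sphere_subset_closedBall hζ)
  rw [mem_sphere_zero_iff_norm] at hζ ⊢
  rw [hζ] at h
  simp at h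
  nlinarith [norm_nonneg (mob a ζ)]

lemma mob_mem_closedBall {a ζ : ℂ} (ha : a ∈ ball (0 : ℂ) 1) (hζ : ζ ∈ closedBall (0 : ℂ) 1) :
    mob a ζ ∈ closedBall (0 : ℂ) 1 := by
  rw [← ball_union_sphere] at hζ ⊢
  exact hζ.imp (mob_mem_ball ha) (mob_mem_sphere ha)

lemma mob_neg_mob {a ζ : ℂ} (ha : a ∈ ball (0 : ℂ) 1) (hζ : ζ ∈ closedBall (0 : ℂ) 1) :
    mob (-a) (mob a ζ) = ζ := by
  have h := mob_den_ne ha hζ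
  have h2 := mob_den_ne (a := -a) (by simpa using ha) (mob_mem_closedBall ha hζ)
  rw [mob, div_eq_iff h2]
  unfold mob
  rw [map_neg]
  generalize (starRingEnd ℂ) a = b at h
  generalize hd : 1 + b * ζ = d at h
  field_simp
  rw [← hd]; ring

lemma mob_mob_neg {a ζ : ℂ} (ha : a ∈ ball (0 : ℂ) 1) (hζ : ζ ∈ closedBall (0 : ℂ) 1) :
    mob a (mob (-a) ζ) = ζ := by
  have := mob_neg_mob (a := -a) (by simpa using ha) hζ
  rwa [neg_neg] at this

/-- The derivative of `mob a`. -/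
def mobd (a ζ : ℂ) : ℂ := (1 - ‖a‖ ^ 2) / (1 + (starRingEnd ℂ) a * ζ) ^ 2

lemma hasDerivAt_mob {a ζ : ℂ} (ha : a ∈ ball (0 : ℂ) 1) (hζ : ζ ∈ closedBall (0 : ℂ) 1) :
    HasDerivAt (mob a) (mobd a ζ) ζ := by
  have h := mob_den_ne ha hζ
  have h1 : HasDerivAt (fun ζ : ℂ => ζ + a) 1 ζ := (hasDerivAt_id ζ).add_const a
  have h2 : HasDerivAt (fun ζ : ℂ => 1 + (starRingEnd ℂ) a * ζ) ((starRingEnd ℂ) a) ζ := by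
    simpa using ((hasDerivAt_id ζ).const_mul ((starRingEnd ℂ) a)).const_add 1
  have h3 := h1.div h2 h
  have e : mobd a ζ = (1 * (1 + (starRingEnd ℂ) a * ζ) - (ζ + a) * (starRingEnd ℂ) a) /
      (1 + (starRingEnd ℂ) a * ζ) ^ 2 := by
    rw [mobd, ← Complex.mul_conj']; ring
  rw [e]; exact h3

lemma mobd_ne_zero {a ζ : ℂ} (ha : a ∈ ball (0 : ℂ) 1) (hζ : ζ ∈ closedBall (0 : ℂ) 1) :
    mobd a ζ ≠ 0 := by
  have h := mob_den_ne ha hζ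
  have h2 := one_sub_norm_sq_pos ha
  refine div_ne_zero ?_ (pow_ne_zero _ h)
  exact_mod_cast h2.ne'

lemma diskAlg_mob {a : ℂ} (ha : a ∈ ball (0 : ℂ) 1) : DiskAlg (mob a) :=
  diskAlg_mk (fun _ hz => (hasDerivAt_mob ha (ball_subset_closedBall hz)).differentiableAt.differentiableWithinAt)
    (fun _ hz => (hasDerivAt_mob ha hz).continuousAt.continuousWithinAt)

lemma diskAlg_mobd {a : ℂ} (ha : a ∈ ball (0 : ℂ) 1) : DiskAlg (mobd a) := by
  have h : DiskAlg (fun ζ => ((1 + (starRingEnd ℂ) a * ζ))⁻¹) := by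
    refine DiffContOnCl.inv (Differentiable.diffContOnCl (by fun_prop)) fun x hx => ?_
    rw [closure_ball _ one_ne_zero] at hx
    exact mob_den_ne ha hx
  have := (diskAlg_const ((1 : ℂ) - ‖a‖ ^ 2)).mul (h.mul h)
  have e : mobd a = fun ζ => ((1 : ℂ) - ‖a‖ ^ 2) * ((1 + (starRingEnd ℂ) a * ζ)⁻¹ *
      (1 + (starRingEnd ℂ) a * ζ)⁻¹) := by
    ext ζ; rw [mobd, div_eq_mul_inv, sq (1 + (starRingEnd ℂ) a * ζ), mul_inv]
  rwa [e]

lemma DiskAlg.comp_mob {F : Type*} [NormedAddCommGroup F] [NormedSpace ℂ F] {f : ℂ → F}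
    (hf : DiskAlg f) {a : ℂ} (ha : a ∈ ball (0 : ℂ) 1) : DiskAlg (fun ζ => f (mob a ζ)) :=
  hf.comp (diskAlg_mob ha) (fun _ => mob_mem_ball ha)

lemma psd_mob {a ζ ξ : ℂ} (ha : a ∈ ball (0 : ℂ) 1) (hζ : ζ ∈ ball (0 : ℂ) 1)
    (hξ : ξ ∈ ball (0 : ℂ) 1) : psd (mob a ζ) (mob a ξ) = psd ζ ξ := by
  have d1 := mob_den_ne ha (ball_subset_closedBall hζ)
  have d2 := mob_den_ne ha (ball_subset_closedBall hξ)
  have d3 := one_sub_conj_mul_ne_zero (ball_subset_closedBall hξ) hζ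
  have d1' : 1 + a * (starRingEnd ℂ) ζ ≠ 0 := by
    intro h; apply d1; have := congrArg (starRingEnd ℂ) h; simpa using this
  have d4 : (1 - (starRingEnd ℂ) a * a) ≠ 0 := by
    have h2 := one_sub_norm_sq_pos ha
    rw [Complex.conj_mul']; exact_mod_cast h2.ne'
  have n1 : ‖1 + (starRingEnd ℂ) a * ζ‖ = ‖1 + a * (starRingEnd ℂ) ζ‖ := by
    rw [← Complex.norm_conj]; simp
  have e1 : mob a ζ - mob a ξ = (ζ - ξ) * (1 - (starRingEnd ℂ) a * a) /
      ((1 + (starRingEnd ℂ) a * ζ) * (1 + (starRingEnd ℂ) a * ξ)) := by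
    unfold mob
    generalize (starRingEnd ℂ) a = b at d1 d2
    rw [div_sub_div _ _ d1 d2]; congr 1; ring
  have e2 : 1 - (starRingEnd ℂ) (mob a ζ) * mob a ξ =
      (1 - (starRingEnd ℂ) a * a) * (1 - (starRingEnd ℂ) ζ * ξ) /
      ((1 + a * (starRingEnd ℂ) ζ) * (1 + (starRingEnd ℂ) a * ξ)) := by
    unfold mob
    simp only [map_div₀, map_add, map_mul, map_one, RingHomCompTriple.comp_apply, RingHom.id_apply]
    rw [div_mul_div_comm, eq_div_iff (mul_ne_zero d1' d2), sub_mul,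
      div_mul_cancel₀ _ (mul_ne_zero d1' d2)]
    ring
  unfold psd
  rw [e1, e2]
  simp only [norm_div, norm_mul, n1]
  have a1 := norm_ne_zero_iff.2 d1'
  have a2 := norm_ne_zero_iff.2 d2
  have a3 := norm_ne_zero_iff.2 d3
  have a4 := norm_ne_zero_iff.2 d4
  generalize ‖1 + a * (starRingEnd ℂ) ζ‖ = x1 at *
  generalize ‖1 + (starRingEnd ℂ) a * ξ‖ = x2 at *
  generalize ‖1 - (starRingEnd ℂ) ζ * ξ‖ = x3 at *
  generalize ‖1 - (starRingEnd ℂ) a * a‖ = x4 at *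
  field_simp

lemma psd_lt_one {ζ ξ : ℂ} (hζ : ζ ∈ ball (0 : ℂ) 1) (hξ : ξ ∈ ball (0 : ℂ) 1) :
    psd ζ ξ < 1 := by
  have h : -ζ ∈ ball (0 : ℂ) 1 := by simpa using hζ
  rw [← psd_mob h hζ hξ]
  have : mob (-ζ) ζ = 0 := by simp [mob]
  rw [this, psd_zero_left]
  simpa using mob_mem_ball h hξ

lemma psd_nonneg (ζ ξ : ℂ) : 0 ≤ psd ζ ξ := norm_nonneg _

end Mobius

section Artanh

lemma artanh_le_artanh {x y : ℝ} (hx : -1 < x) (hxy : x ≤ y) (hy : y < 1) :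
    artanh x ≤ artanh y := by
  unfold artanh
  have : 0 < 1 - x := by linarith
  have : 0 < 1 - y := by linarith
  have : 0 < 1 + x := by linarith
  have : 0 < 1 + y := by linarith
  gcongr

lemma artanh_le_iff {x y : ℝ} (hx : x ∈ Ico (0 : ℝ) 1) (hy : y ∈ Ico (0 : ℝ) 1) :
    artanh x ≤ artanh y ↔ x ≤ y := by
  refine ⟨fun h => ?_, fun h => artanh_le_artanh (by linarith [hx.1]) h hy.2⟩
  unfold artanh at h
  have h1 : 0 < 1 - x := by linarith [hx.2]
  have h2 : 0 < 1 - y := by linarith [hy.2]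
  have h3 : 0 < 1 + x := by linarith [hx.1]
  have h4 : 0 < 1 + y := by linarith [hy.1]
  have := (Real.log_le_log_iff (by positivity) (by positivity)).1 (by linarith :
    Real.log ((1 + x) / (1 - x)) ≤ Real.log ((1 + y) / (1 - y)))
  rw [div_le_div_iff₀ h1 h2] at this
  nlinarith

@[simp] lemma artanh_zero : artanh 0 = 0 := by simp [artanh]

lemma artanh_nonneg {x : ℝ} (h0 : 0 ≤ x) (h1 : x < 1) : 0 ≤ artanh x := by
  rw [← artanh_zero]; exact artanh_le_artanh (by norm_num) h0 h1

lemma half_log_le_artanh {x : ℝ} (h0 : 0 ≤ x) (h1 : x < 1) :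
    Real.log (1 / (1 - x)) / 2 ≤ artanh x := by
  unfold artanh
  have : 0 < 1 - x := by linarith
  gcongr; linarith

lemma poincare_eq (ζ ξ : ℂ) : poincare ζ ξ = artanh (psd ζ ξ) := rfl

end Artanh

section Invariant
variable {Ω : Set (E N)}

lemma lempert_set_mem {z w : E N} : 0 ≤ sInf { r : ℝ | ∃ φ : ℂ → E N,
    DifferentiableOn ℂ φ (ball 0 1) ∧ MapsTo φ (ball (0:ℂ) 1) Ω ∧ φ 0 = z ∧
    ∃ a ∈ ball (0:ℂ) 1, φ a = w ∧ r = ‖a‖ } ∧ sInf { r : ℝ | ∃ φ : ℂ → E N,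
    DifferentiableOn ℂ φ (ball 0 1) ∧ MapsTo φ (ball (0:ℂ) 1) Ω ∧ φ 0 = z ∧
    ∃ a ∈ ball (0:ℂ) 1, φ a = w ∧ r = ‖a‖ } < 1 := by
  set S := { r : ℝ | ∃ φ : ℂ → E N,
    DifferentiableOn ℂ φ (ball 0 1) ∧ MapsTo φ (ball (0:ℂ) 1) Ω ∧ φ 0 = z ∧
    ∃ a ∈ ball (0:ℂ) 1, φ a = w ∧ r = ‖a‖ }
  have hS : ∀ r ∈ S, 0 ≤ r ∧ r < 1 := by
    rintro r ⟨φ, -, -, -, a, ha, -, rfl⟩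
    exact ⟨norm_nonneg _, by simpa using ha⟩
  refine ⟨Real.sInf_nonneg fun r hr => (hS r hr).1, ?_⟩
  rcases S.eq_empty_or_nonempty with h | ⟨r, hr⟩
  · rw [h]; simp
  · exact (csInf_le ⟨0, fun r hr => (hS r hr).1⟩ hr).trans_lt (hS r hr).2

lemma lempert_nonneg (z w : E N) : 0 ≤ lempert Ω z w :=
  artanh_nonneg lempert_set_mem.1 lempert_set_mem.2

lemma lempert_le_poincare {ψ : ℂ → E N} (h1 : DifferentiableOn ℂ ψ (ball 0 1))
    (h2 : MapsTo ψ (ball (0 : ℂ) 1) Ω) {s t : ℂ} (hs : s ∈ ball (0 : ℂ) 1)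
    (ht : t ∈ ball (0 : ℂ) 1) : lempert Ω (ψ s) (ψ t) ≤ poincare s t := by
  have hs' : -s ∈ ball (0 : ℂ) 1 := by simpa using hs
  rw [poincare_eq]
  refine artanh_le_artanh (by linarith [(lempert_set_mem (Ω := Ω) (z := ψ s) (w := ψ t)).1])
    (csInf_le ⟨0, ?_⟩ ?_) (psd_lt_one hs ht)
  · rintro r ⟨φ, -, -, -, a, ha, -, rfl⟩
    exact norm_nonneg _
  · refine ⟨fun ζ => ψ (mob s ζ), h1.comp (diskAlg_mob hs).1 (fun _ => mob_mem_ball hs),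
      fun ζ hζ => h2 (mob_mem_ball hs hζ), by simp, mob (-s) t, mob_mem_ball hs' ht, ?_, ?_⟩
    · simp only [mob_mob_neg hs (ball_subset_closedBall ht)]
    · rw [← psd_mob hs' hs ht]
      have : mob (-s) s = 0 := by simp [mob]
      rw [this, psd_zero_left]

lemma kobayashi_le_sum {n : ℕ} (p : Fin (n + 1) → E N) (hp : ∀ i, p i ∈ Ω) :
    kobayashi Ω (p 0) (p (Fin.last n)) ≤ ∑ i : Fin n, lempert Ω (p i.castSucc) (p i.succ) := by
  refine csInf_le ⟨0, ?_⟩ ⟨n, p, rfl, rfl, hp, rfl⟩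
  rintro r ⟨n, p, -, -, -, rfl⟩
  exact Finset.sum_nonneg fun _ _ => lempert_nonneg _ _

lemma kobayashi_le_lempert {z w : E N} (hz : z ∈ Ω) (hw : w ∈ Ω) :
    kobayashi Ω z w ≤ lempert Ω z w := by
  have := kobayashi_le_sum (Ω := Ω) ![z, w] (fun i => by fin_cases i <;> simpa)
  simpa using this

lemma kobayashi_le_chain {a b c d e f : E N} (ha : a ∈ Ω) (hb : b ∈ Ω) (hc : c ∈ Ω) (hd : d ∈ Ω)
    (he : e ∈ Ω) (hf : f ∈ Ω) : kobayashi Ω a f ≤ lempert Ω a b + lempert Ω b c + lempert Ω c d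
      + lempert Ω d e + lempert Ω e f := by
  have := kobayashi_le_sum (Ω := Ω) ![a, b, c, d, e, f] (fun i => by fin_cases i <;> simpa)
  simpa [Fin.sum_univ_five] using this

lemma lempert_self {z : E N} (hz : z ∈ Ω) : lempert Ω z z = 0 := by
  refine le_antisymm ?_ (lempert_nonneg _ _)
  have := lempert_le_poincare (Ω := Ω) (ψ := fun _ => z) (differentiableOn_const z) (fun _ _ => hz)
    (s := 0) (t := 0) (by simp) (by simp)
  simpa [poincare_eq] using this

lemma IsComplexGeodesic.psd_le {φ ψ : ℂ → E N} (hφ : IsComplexGeodesic Ω φ)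
    (h1 : DifferentiableOn ℂ ψ (ball 0 1))
    (h2 : MapsTo ψ (ball (0 : ℂ) 1) Ω) {s t ζ ξ : ℂ} (hs : s ∈ ball (0 : ℂ) 1)
    (ht : t ∈ ball (0 : ℂ) 1) (hζ : ζ ∈ ball (0 : ℂ) 1) (hξ : ξ ∈ ball (0 : ℂ) 1)
    (e1 : ψ s = φ ζ) (e2 : ψ t = φ ξ) : psd ζ ξ ≤ psd s t := by
  have := kobayashi_le_lempert (Ω := Ω) (hφ.2.1 hζ) (hφ.2.1 hξ)
  rw [hφ.2.2 ζ hζ ξ hξ, ← e1, ← e2] at this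
  exact (artanh_le_iff ⟨psd_nonneg _ _, psd_lt_one hζ hξ⟩ ⟨psd_nonneg _ _, psd_lt_one hs ht⟩).1
    (this.trans (lempert_le_poincare h1 h2 hs ht))

end Invariant

section Geo
variable {Ω : Set (E N)}

/-- A complex geodesic with `C¹` boundary regularity, `φd` being its derivative. -/
structure Geo (Ω : Set (E N)) (φ φd : ℂ → E N) : Prop where
  geod : IsComplexGeodesic Ω φ
  cont : ContinuousOn φ (closedBall 0 1)
  contd : ContinuousOn φd (closedBall 0 1)
  eq : ∀ ζ ∈ ball (0 : ℂ) 1, φd ζ = deriv φ ζ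

lemma Geo.diskAlg {φ φd : ℂ → E N} (h : Geo Ω φ φd) : DiskAlg φ := diskAlg_mk h.geod.1 h.cont

lemma Geo.mapsTo {φ φd : ℂ → E N} (h : Geo Ω φ φd) {ζ : ℂ} (hζ : ζ ∈ ball (0 : ℂ) 1) : φ ζ ∈ Ω :=
  h.geod.2.1 hζ

lemma Geo.hasDerivAt {φ φd : ℂ → E N} (h : Geo Ω φ φd) {ζ : ℂ} (hζ : ζ ∈ ball (0 : ℂ) 1) :
    HasDerivAt φ (φd ζ) ζ := by
  rw [h.eq ζ hζ]; exact (h.diskAlg.diffAt hζ).hasDerivAt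

lemma Geo.diskAlgd {φ φd : ℂ → E N} (h : Geo Ω φ φd) : DiskAlg φd :=
  diskAlg_mk ((h.geod.1.deriv isOpen_ball).congr h.eq) h.contd

lemma Geo.comp_mob {φ φd : ℂ → E N} (h : Geo Ω φ φd) {a : ℂ} (ha : a ∈ ball (0 : ℂ) 1) :
    Geo Ω (fun ζ => φ (mob a ζ)) (fun ζ => mobd a ζ • φd (mob a ζ)) where
  geod := by
    refine ⟨(h.diskAlg.comp_mob ha).1, fun ζ hζ => h.mapsTo (mob_mem_ball ha hζ),
      fun ζ hζ ξ hξ => ?_⟩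
    rw [h.geod.2.2 _ (mob_mem_ball ha hζ) _ (mob_mem_ball ha hξ), poincare_eq, poincare_eq,
      psd_mob ha hζ hξ]
  cont := (h.diskAlg.comp_mob ha).cont
  contd := (diskAlg_mobd ha).cont.smul (h.diskAlgd.comp_mob ha).cont
  eq ζ hζ := ((h.hasDerivAt (mob_mem_ball ha hζ)).scomp ζ
    (hasDerivAt_mob ha (ball_subset_closedBall hζ))).deriv.symm

end Geo

section DefFn

/-- The Hessian of `ρ`. -/
abbrev hess (ρ : E N → ℝ) (x : E N) : E N →L[ℝ] E N →L[ℝ] ℝ := fderiv ℝ (fderiv ℝ ρ) x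

/-- Uniform estimates for a defining function `ρ` of `Ω` on the `η`-neighbourhood of its closure. -/
structure DefFn (Ω : Set (E N)) (α : ℝ) (ρ : E N → ℝ) (η C : ℝ) : Prop where
  isOpen : IsOpen Ω
  α_pos : 0 < α
  α_le : α ≤ 1
  η_pos : 0 < η
  one_le : 1 ≤ C
  norm_le : ∀ x ∈ closure Ω, ‖x‖ ≤ C
  contDiffAt : ∀ y ∈ closure Ω, ∀ x, ‖x - y‖ ≤ η → ContDiffAt ℝ 2 ρ x
  mem_iff : ∀ y ∈ closure Ω, ∀ x, ‖x - y‖ ≤ η → (x ∈ Ω ↔ ρ x < 0)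
  lip : ∀ y ∈ closure Ω, ∀ x, ‖x - y‖ ≤ η → |ρ x - ρ y| ≤ C * ‖x - y‖
  lipd : ∀ y ∈ closure Ω, ∀ x, ‖x - y‖ ≤ η → ‖fderiv ℝ ρ x - fderiv ℝ ρ y‖ ≤ C * ‖x - y‖
  taylor : ∀ y ∈ closure Ω, ∀ x, ‖x - y‖ ≤ η →
    |ρ x - ρ y - fderiv ℝ ρ y (x - y)| ≤ C * ‖x - y‖ ^ 2
  taylord : ∀ y ∈ closure Ω, ∀ x, ‖x - y‖ ≤ η →
    ‖fderiv ℝ ρ x - fderiv ℝ ρ y - hess ρ y (x - y)‖ ≤ C * ‖x - y‖ ^ (1 + α)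
  abs_le : ∀ y ∈ closure Ω, |ρ y| ≤ C
  normd_le : ∀ y ∈ closure Ω, ‖fderiv ℝ ρ y‖ ≤ C
  normdd_le : ∀ y ∈ closure Ω, ‖hess ρ y‖ ≤ C
  grad : ∀ q ∈ frontier Ω, 1 ≤ C * ‖fderiv ℝ ρ q‖
  cont2 : ContinuousOn (hess ρ) (closure Ω)
  strict : ∀ p ∈ frontier Ω, ∀ v : E N, v ≠ 0 → fderiv ℝ ρ p v = 0 →
      fderiv ℝ ρ p ((Complex.I : ℂ) • v) = 0 → 0 < levi ρ p v

lemma norm_hess_sub_le (ρ : E N → ℝ) (x y : E N) :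
    ‖hess ρ x - hess ρ y‖ ≤ ‖iteratedFDeriv ℝ 2 ρ x - iteratedFDeriv ℝ 2 ρ y‖ := by
  refine ContinuousLinearMap.opNorm_le_bound₂ _ (norm_nonneg _) fun v w => ?_
  have := (iteratedFDeriv ℝ 2 ρ x - iteratedFDeriv ℝ 2 ρ y).le_opNorm ![v, w]
  rw [sub_apply, iteratedFDeriv_two_apply, iteratedFDeriv_two_apply] at this
  simpa [Fin.prod_univ_two, mul_assoc] using this

lemma levi_eq (ρ : E N → ℝ) (p v : E N) : levi ρ p v =
    (hess ρ p v v + hess ρ p ((Complex.I : ℂ) • v) ((Complex.I : ℂ) • v)) / 4 := by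
  rw [levi, iteratedFDeriv_two_apply, iteratedFDeriv_two_apply]; simp

theorem exists_defFn {α : ℝ} (hα : α ∈ Set.Ioc (0 : ℝ) 1) {Ω : Set (E N)}
    (hΩ : IsStronglyPseudoconvexDomain 2 α Ω) :
    ∃ ρ η C, DefFn Ω α ρ η C := by
  obtain ⟨hO, -, hB, U, ρ, hU, hcl, ⟨hC2, M, hM⟩, hdef, hg, hs⟩ := hΩ
  have hcomp : IsCompact (closure Ω) := hB.isCompact_closure
  obtain ⟨η, hη, hKU⟩ := hcomp.exists_cthickening_subset_open hU hcl
  set K := cthickening η (closure Ω)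
  have hK : IsCompact K := hcomp.cthickening
  have hball : ∀ y ∈ closure Ω, ∀ x, ‖x - y‖ ≤ η → x ∈ K := fun y hy x hx =>
    closedBall_subset_cthickening hy η (by simpa [dist_eq_norm] using hx)
  have hclK : closure Ω ⊆ K := self_subset_cthickening _
  have c1 : ContDiffOn ℝ 1 (fderiv ℝ ρ) U := by
    have := hC2.fderiv_of_isOpen hU (m := 1) (by norm_num)
    exact this
  have c2 : ContinuousOn (hess ρ) U := by
    exact c1.continuousOn_fderiv_of_isOpen hU (by norm_num)
  have dAt : ∀ x ∈ U, HasFDerivAt ρ (fderiv ℝ ρ x) x := fun x hx =>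
    ((hC2.differentiableOn (by norm_num)).differentiableAt (hU.mem_nhds hx)).hasFDerivAt
  have ddAt : ∀ x ∈ U, HasFDerivAt (fderiv ℝ ρ) (hess ρ x) x := fun x hx =>
    ((c1.differentiableOn (by norm_num)).differentiableAt (hU.mem_nhds hx)).hasFDerivAt
  obtain ⟨C0, h0⟩ := hK.exists_bound_of_continuousOn (hC2.continuousOn.mono hKU)
  obtain ⟨C1, h1⟩ := hK.exists_bound_of_continuousOn (c1.continuousOn.mono hKU)
  have c2n : ContinuousOn (fun x => ‖hess ρ x‖) K :=
    ContinuousOn.norm (E := E N →L[ℝ] E N →L[ℝ] ℝ) (c2.mono hKU)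
  obtain ⟨C2, h2'⟩ := hK.exists_bound_of_continuousOn c2n
  have h2 : ∀ x ∈ K, ‖hess ρ x‖ ≤ C2 := fun x hx => (le_abs_self _).trans (h2' x hx)
  obtain ⟨C3, h3⟩ := hcomp.exists_bound_of_continuousOn (continuousOn_id)
  have hfr : IsCompact (frontier Ω) := hcomp.of_isClosed_subset isClosed_frontier frontier_subset_closure
  have c4 : ContinuousOn (fun q => ‖fderiv ℝ ρ q‖⁻¹) (frontier Ω) := by
    refine ContinuousOn.inv₀ ?_ fun q hq => norm_ne_zero_iff.2 (hg q hq)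
    exact (c1.continuousOn.mono (frontier_subset_closure.trans hcl)).norm
  obtain ⟨C4, h4⟩ := hfr.exists_bound_of_continuousOn c4
  set C := |C0| + |C1| + |C2| + |C3| + |C4| + |M| + 1
  have b0 := abs_nonneg C0
  have b1 := abs_nonneg C1
  have b2 := abs_nonneg C2
  have b3 := abs_nonneg C3
  have b4 := abs_nonneg C4
  have b5 := abs_nonneg M
  have l0 : C0 ≤ C := (le_abs_self _).trans (by simp only [C]; linarith)
  have l1 : C1 ≤ C := (le_abs_self _).trans (by simp only [C]; linarith)
  have l2 : C2 ≤ C := (le_abs_self _).trans (by simp only [C]; linarith)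
  have l3 : C3 ≤ C := (le_abs_self _).trans (by simp only [C]; linarith)
  have l4 : C4 ≤ C := (le_abs_self _).trans (by simp only [C]; linarith)
  have l5 : M ≤ C := (le_abs_self _).trans (by simp only [C]; linarith)
  have hC0 : 0 ≤ C := by simp only [C]; linarith
  have seg : ∀ y ∈ closure Ω, ∀ x, ‖x - y‖ ≤ η → ∀ w ∈ closedBall y ‖x - y‖, w ∈ K ∧ ‖w - y‖ ≤ ‖x - y‖ := by
    intro y hy x hx w hw
    rw [mem_closedBall, dist_eq_norm] at hw
    exact ⟨hball y hy w (hw.trans hx), hw⟩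
  have lipd : ∀ y ∈ closure Ω, ∀ x, ‖x - y‖ ≤ η →
      ‖fderiv ℝ ρ x - fderiv ℝ ρ y‖ ≤ C * ‖x - y‖ := by
    intro y hy x hx
    exact (convex_closedBall y ‖x - y‖).norm_image_sub_le_of_norm_hasFDerivWithin_le
      (fun w hw => (ddAt w (hKU (seg y hy x hx w hw).1)).hasFDerivWithinAt)
      (fun w hw => (h2 w (seg y hy x hx w hw).1).trans l2)
      (mem_closedBall_self (norm_nonneg _)) (by simp [dist_eq_norm])
  refine ⟨ρ, η, C, hO, hα.1, hα.2, hη, by simp only [C]; linarith, fun x hx => (h3 x hx).trans l3,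
    fun y hy x hx => hC2.contDiffAt (hU.mem_nhds (hKU (hball y hy x hx))), ?_, ?_, lipd, ?_, ?_,
    fun y hy => (h0 y (hclK hy)).trans l0, fun y hy => (h1 y (hclK hy)).trans l1,
    fun y hy => (h2 y (hclK hy)).trans l2, ?_, c2.mono hcl, hs⟩
  · intro y hy x hx
    have : x ∈ U := hKU (hball y hy x hx)
    rw [hdef]; exact ⟨fun h => h.2, fun h => ⟨this, h⟩⟩
  · intro y hy x hx
    exact (convex_closedBall y ‖x - y‖).norm_image_sub_le_of_norm_hasFDerivWithin_le
      (fun w hw => (dAt w (hKU (seg y hy x hx w hw).1)).hasFDerivWithinAt)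
      (fun w hw => (h1 w (seg y hy x hx w hw).1).trans l1)
      (mem_closedBall_self (norm_nonneg _)) (by simp [dist_eq_norm])
  · intro y hy x hx
    have := (convex_closedBall y ‖x - y‖).norm_image_sub_le_of_norm_hasFDerivWithin_le'
      (φ := fderiv ℝ ρ y) (C := C * ‖x - y‖)
      (fun w hw => (dAt w (hKU (seg y hy x hx w hw).1)).hasFDerivWithinAt)
      (fun w hw => (lipd y hy w ((seg y hy x hx w hw).2.trans hx)).trans
        (mul_le_mul_of_nonneg_left (seg y hy x hx w hw).2 hC0))
      (mem_closedBall_self (norm_nonneg _)) (y := x) (by simp [dist_eq_norm])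
    rw [← Real.norm_eq_abs, sq, ← mul_assoc]
    exact this
  · intro y hy x hx
    rcases eq_or_ne x y with rfl | hxy
    · simp [Real.zero_rpow (by linarith [hα.1] : (1 + α) ≠ 0)]
    have hpos : 0 < ‖x - y‖ := norm_pos_iff.2 (sub_ne_zero.2 hxy)
    have := (convex_closedBall y ‖x - y‖).norm_image_sub_le_of_norm_hasFDerivWithin_le'
      (f := fderiv ℝ ρ) (φ := hess ρ y) (C := C * ‖x - y‖ ^ α)
      (fun w hw => (ddAt w (hKU (seg y hy x hx w hw).1)).hasFDerivWithinAt)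
      (fun w hw => by
        have s := seg y hy x hx w hw
        calc ‖hess ρ w - hess ρ y‖ ≤ M * ‖w - y‖ ^ α :=
              (norm_hess_sub_le ρ w y).trans (hM w (hKU s.1) y (hcl hy))
          _ ≤ C * ‖w - y‖ ^ α := by gcongr
          _ ≤ C * ‖x - y‖ ^ α := by
            gcongr
            · exact hα.1.le
            · exact s.2)
      (mem_closedBall_self (norm_nonneg _)) (y := x) (by simp [dist_eq_norm])
    refine this.trans_eq ?_
    rw [Real.rpow_add hpos, Real.rpow_one]; ring
  · intro q hq
    have := (h4 q hq).trans l4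
    rw [norm_inv, norm_norm] at this
    have h : 0 < ‖fderiv ℝ ρ q‖ := norm_pos_iff.2 (hg q hq)
    rw [inv_le_iff_one_le_mul₀ h] at this
    exact this

end DefFn

section Forms
variable (ρ : E N → ℝ)

/-- The complex gradient functional: `re (nu ρ q v) = dρ_q v`. -/
def nu (q : E N) : E N →L[ℂ] ℂ := StrongDual.extendRCLike (fderiv ℝ ρ q)

/-- Multiplication by `I` as a real linear map. -/
def mulI (N : ℕ) : E N →L[ℝ] E N := Complex.I • ContinuousLinearMap.id ℝ (E N)

/-- The complex bilinear part of the derivative of `nu`. -/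
def formA (q τ : E N) : E N →L[ℂ] ℂ := StrongDual.extendRCLike
  ((1 / 2 : ℝ) • ((hess ρ q).flip τ - ((hess ρ q).flip (Complex.I • τ)).comp (mulI N)))

/-- The conjugate of the sesquilinear part of the derivative of `nu`. -/
def formB (q τ : E N) : E N →L[ℂ] ℂ := StrongDual.extendRCLike
  ((1 / 2 : ℝ) • ((hess ρ q).flip τ + ((hess ρ q).flip (Complex.I • τ)).comp (mulI N)))

/-- The complex gradient vector. -/
def nrm (q : E N) : E N := (InnerProductSpace.toDual ℂ (E N)).symm (nu ρ q)

variable {ρ}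

@[simp] lemma mulI_apply (v : E N) : mulI N v = Complex.I • v := rfl

lemma norm_mulI_le : ‖mulI N‖ ≤ 1 :=
  ContinuousLinearMap.opNorm_le_bound _ zero_le_one fun v => by simp [norm_smul]

lemma norm_ext (f : E N →L[ℝ] ℝ) : ‖(StrongDual.extendRCLike f : E N →L[ℂ] ℂ)‖ = ‖f‖ :=
  (StrongDual.extendRCLikeₗᵢ (𝕜 := ℂ) (F := E N)).norm_map f

lemma ext_sub (f g : E N →L[ℝ] ℝ) : (StrongDual.extendRCLike (f - g) : E N →L[ℂ] ℂ) =
    StrongDual.extendRCLike f - StrongDual.extendRCLike g :=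
  (StrongDual.extendRCLikeₗᵢ (𝕜 := ℂ) (F := E N)).map_sub f g

lemma nu_re (q v : E N) : (nu ρ q v).re = fderiv ℝ ρ q v :=
  StrongDual.re_extendRCLike_apply (𝕜 := ℂ) (fderiv ℝ ρ q) v

lemma nu_im (q v : E N) : (nu ρ q v).im = -fderiv ℝ ρ q (Complex.I • v) :=
  StrongDual.im_extendRCLike_apply (𝕜 := ℂ) (fderiv ℝ ρ q) v

lemma norm_nu (q : E N) : ‖nu ρ q‖ = ‖fderiv ℝ ρ q‖ := norm_ext _

lemma norm_nu_sub (z q : E N) : ‖nu ρ z - nu ρ q‖ = ‖fderiv ℝ ρ z - fderiv ℝ ρ q‖ := by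
  rw [nu, nu, ← ext_sub, norm_ext]

lemma norm_flip_le (q τ : E N) : ‖(hess ρ q).flip τ‖ ≤ ‖hess ρ q‖ * ‖τ‖ := by
  have := (hess ρ q).flip.le_opNorm τ
  rwa [ContinuousLinearMap.opNorm_flip] at this

lemma norm_flip_comp_le (q τ : E N) :
    ‖((hess ρ q).flip (Complex.I • τ)).comp (mulI N)‖ ≤ ‖hess ρ q‖ * ‖τ‖ := by
  have h1 := ContinuousLinearMap.opNorm_comp_le ((hess ρ q).flip (Complex.I • τ)) (mulI N)
  have h2 := norm_flip_le (ρ := ρ) q (Complex.I • τ)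
  rw [norm_smul, Complex.norm_I, one_mul] at h2
  refine h1.trans ?_
  calc _ ≤ ‖(hess ρ q).flip (Complex.I • τ)‖ * 1 := by gcongr; exact norm_mulI_le
    _ ≤ _ := by rw [mul_one]; exact h2

lemma norm_formA_le (q τ : E N) : ‖formA ρ q τ‖ ≤ ‖hess ρ q‖ * ‖τ‖ := by
  rw [formA, norm_ext, norm_smul, Real.norm_of_nonneg (by norm_num)]
  have := norm_sub_le ((hess ρ q).flip τ) (((hess ρ q).flip (Complex.I • τ)).comp (mulI N))
  linarith [norm_flip_le (ρ := ρ) q τ, norm_flip_comp_le (ρ := ρ) q τ]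

lemma norm_formB_le (q τ : E N) : ‖formB ρ q τ‖ ≤ ‖hess ρ q‖ * ‖τ‖ := by
  rw [formB, norm_ext, norm_smul, Real.norm_of_nonneg (by norm_num)]
  have := norm_add_le ((hess ρ q).flip τ) (((hess ρ q).flip (Complex.I • τ)).comp (mulI N))
  linarith [norm_flip_le (ρ := ρ) q τ, norm_flip_comp_le (ρ := ρ) q τ]

lemma formA_add_conj_formB (q τ w : E N) : formA ρ q τ w + (starRingEnd ℂ) (formB ρ q τ w) =
    (StrongDual.extendRCLike (hess ρ q w) : E N →L[ℂ] ℂ) τ := by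
  have h : ∀ v : E N, Complex.I • Complex.I • v = -v := fun v => by
    rw [smul_smul, Complex.I_mul_I, neg_one_smul]
  rw [formA, formB, StrongDual.extendRCLike_apply, StrongDual.extendRCLike_apply,
    StrongDual.extendRCLike_apply]
  apply Complex.ext <;> simp [h] <;> ring

lemma formB_self_re (q τ : E N) : (formB ρ q τ τ).re = 2 * levi ρ q τ := by
  have := StrongDual.re_extendRCLike_apply (𝕜 := ℂ)
    ((1 / 2 : ℝ) • ((hess ρ q).flip τ + ((hess ρ q).flip (Complex.I • τ)).comp (mulI N))) τ
  rw [levi_eq]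
  refine this.trans ?_
  simp
  ring

lemma inner_eq_herm (a b : E N) : inner ℂ a b = herm b a := by
  simp [herm, PiLp.inner_apply]

lemma nu_eq_inner (q v : E N) : nu ρ q v = inner ℂ (nrm ρ q) v := by
  rw [nrm, InnerProductSpace.toDual_symm_apply]

lemma norm_nrm (q : E N) : ‖nrm ρ q‖ = ‖nu ρ q‖ := by rw [nrm, LinearIsometryEquiv.norm_map]

lemma nu_nrm (q : E N) : nu ρ q (nrm ρ q) = (‖nu ρ q‖ : ℂ) ^ 2 := by
  rw [nu_eq_inner, inner_self_eq_norm_sq_to_K, norm_nrm]; rfl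

end Forms

section Basic
variable {Ω : Set (E N)} {α η C : ℝ} {ρ : E N → ℝ}

namespace DefFn
variable (D : DefFn Ω α ρ η C)
include D

lemma C_pos : 0 < C := lt_of_lt_of_le one_pos D.one_le

lemma cont : ContinuousOn ρ (closure Ω) := fun y hy =>
  ((D.contDiffAt y hy y (by simpa using D.η_pos.le)).continuousAt).continuousWithinAt

lemma contd : ContinuousOn (fderiv ℝ ρ) (closure Ω) := fun y hy =>
  (((D.contDiffAt y hy y (by simpa using D.η_pos.le)).fderiv_right (m := 1)
    (by norm_num)).continuousAt).continuousWithinAt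

lemma isBounded : Bornology.IsBounded (closure Ω) :=
  (isBounded_iff_forall_norm_le.2 ⟨C, D.norm_le⟩)

lemma isCompact : IsCompact (closure Ω) :=
  isCompact_of_isClosed_isBounded isClosed_closure D.isBounded

lemma isCompact_frontier : IsCompact (frontier Ω) :=
  D.isCompact.of_isClosed_subset isClosed_frontier frontier_subset_closure

lemma neg {z : E N} (hz : z ∈ Ω) : ρ z < 0 :=
  (D.mem_iff z (subset_closure hz) z (by simpa using D.η_pos.le)).1 hz

lemma nonpos {z : E N} (hz : z ∈ closure Ω) : ρ z ≤ 0 := by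
  have := D.cont.mono (subset_refl _)
  have h := closure_minimal (s := Ω) (t := closure Ω ∩ ρ ⁻¹' Iic 0)
    (fun z hz => ⟨subset_closure hz, (D.neg hz).le⟩)
    (D.cont.preimage_isClosed_of_isClosed isClosed_closure isClosed_Iic)
  exact (h hz).2

lemma not_mem {q : E N} (hq : q ∈ frontier Ω) : q ∉ Ω := by
  rw [D.isOpen.frontier_eq] at hq; exact hq.2

lemma zero {q : E N} (hq : q ∈ frontier Ω) : ρ q = 0 := by
  refine le_antisymm (D.nonpos (frontier_subset_closure hq)) ?_
  have := mt (D.mem_iff q (frontier_subset_closure hq) q (by simpa using D.η_pos.le)).2 (D.not_mem hq)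
  exact not_lt.1 this

lemma frontier_nonempty {z : E N} (hz : z ∈ Ω) (hN : Nontrivial (E N)) :
    (frontier Ω).Nonempty := by
  by_contra h
  rw [Set.not_nonempty_iff_eq_empty] at h
  have hcl : IsClopen Ω := isClopen_iff_frontier_eq_empty.2 h
  have hu : Ω = univ := hcl.eq_univ ⟨z, hz⟩
  have hb := D.isBounded
  rw [hu, closure_univ] at hb
  exact NormedSpace.unbounded_univ ℝ (E N) hb

/-- the segment from an interior point to a non-interior one meets the frontier. -/
lemma exists_frontier_of_segment {z w : E N} (hz : z ∈ Ω) (hw : w ∉ Ω) :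
    ∃ q ∈ frontier Ω, dist z q ≤ dist z w := by
  have hc : IsPreconnected (segment ℝ z w) := (convex_segment z w).isPreconnected
  obtain ⟨q, hq, hqf⟩ : ∃ q ∈ segment ℝ z w, q ∈ frontier Ω := by
    by_contra! h
    have hcov : segment ℝ z w ⊆ Ω ∪ (closure Ω)ᶜ := fun x hx => by
      by_contra hn
      rw [mem_union, not_or, mem_compl_iff, not_not] at hn
      exact h x hx (by rw [D.isOpen.frontier_eq]; exact ⟨hn.2, hn.1⟩)
    obtain ⟨x, -, hx1, hx2⟩ := hc Ω (closure Ω)ᶜ D.isOpen isClosed_closure.isOpen_compl hcov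
      ⟨z, left_mem_segment ℝ z w, hz⟩ ⟨w, right_mem_segment ℝ z w, fun hn =>
        h w (right_mem_segment ℝ z w) (by rw [D.isOpen.frontier_eq]; exact ⟨hn, hw⟩)⟩
    exact hx2 (subset_closure hx1)
  refine ⟨q, hqf, ?_⟩
  have := (convex_closedBall z (dist z w)).segment_subset (mem_closedBall_self dist_nonneg)
    (by rw [mem_closedBall, dist_comm]) hq
  rwa [mem_closedBall, dist_comm] at this

lemma bdist_pos {z : E N} (hz : z ∈ Ω) (h : (frontier Ω).Nonempty) : 0 < bdist Ω z :=
  (isClosed_frontier.notMem_iff_infDist_pos h).1 fun hq => D.not_mem hq hz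

lemma ball_subset {z : E N} (hz : z ∈ Ω) : ball z (bdist Ω z) ⊆ Ω := by
  intro w hw
  by_contra h
  obtain ⟨q, hq, hd⟩ := D.exists_frontier_of_segment hz h
  have : bdist Ω z ≤ dist z q := infDist_le_dist_of_mem hq
  rw [mem_ball, dist_comm] at hw
  linarith

lemma bdist_le {z : E N} (hz : z ∈ closure Ω) : bdist Ω z ≤ 2 * C := by
  rcases (frontier Ω).eq_empty_or_nonempty with h | ⟨q, hq⟩
  · rw [bdist, h, infDist_empty]; linarith [D.C_pos]
  · refine (infDist_le_dist_of_mem hq).trans ?_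
    rw [dist_eq_norm]
    linarith [norm_sub_le z q, D.norm_le z hz, D.norm_le q (frontier_subset_closure hq)]

omit D in
lemma exists_closest {z : E N} (h : (frontier Ω).Nonempty) :
    ∃ q ∈ frontier Ω, bdist Ω z = ‖z - q‖ := by
  obtain ⟨q, hq, h⟩ := isClosed_frontier.exists_infDist_eq_dist h z
  exact ⟨q, hq, by rw [bdist, h, dist_eq_norm]⟩

lemma neg_le_bdist : ∃ C', 1 ≤ C' ∧ ∀ z ∈ closure Ω, (frontier Ω).Nonempty → -ρ z ≤ C' * bdist Ω z := by
  refine ⟨C + C / η, by linarith [D.one_le, div_pos D.C_pos D.η_pos], fun z hz hne => ?_⟩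
  obtain ⟨q, hq, h⟩ := exists_closest (z := z) hne
  rw [h]
  have hC := D.C_pos
  have hη := D.η_pos
  have h0 := norm_nonneg (z - q)
  rcases le_total ‖z - q‖ η with h1 | h1
  · have := D.lip q (frontier_subset_closure hq) z h1
    rw [D.zero hq] at this
    have h2 := neg_abs_le (ρ z - 0)
    have : 0 ≤ C / η * ‖z - q‖ := by positivity
    linarith
  · have := (neg_le_abs _).trans (D.abs_le z hz)
    have h2 : C ≤ C / η * ‖z - q‖ := by
      rw [div_mul_eq_mul_div, le_div_iff₀ hη]; gcongr
    nlinarith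

lemma bdist_le_neg : ∃ C', 1 ≤ C' ∧ ∀ z ∈ closure Ω, bdist Ω z ≤ C' * (-ρ z) := by
  have hC := D.C_pos
  have hη := D.η_pos
  -- a uniform lower bound for the gradient near the boundary
  have hcov : ∃ σ > 0, ∀ z ∈ closure Ω, -σ < ρ z → 1 ≤ 2 * C * ‖fderiv ℝ ρ z‖ := by
    have hK : IsCompact (closure Ω ∩ {z | 2 * C * ‖fderiv ℝ ρ z‖ ≤ 1}) := by
      have := (continuousOn_const (c := 2 * C)).mul D.contd.norm
      have hc := this.preimage_isClosed_of_isClosed isClosed_closure (isClosed_Iic (a := (1:ℝ)))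
      exact D.isCompact.of_isClosed_subset hc inter_subset_left
    rcases (closure Ω ∩ {z | 2 * C * ‖fderiv ℝ ρ z‖ ≤ 1}).eq_empty_or_nonempty with he | hne
    · refine ⟨1, one_pos, fun z hz _ => ?_⟩
      by_contra hc
      have : z ∈ closure Ω ∩ {z | 2 * C * ‖fderiv ℝ ρ z‖ ≤ 1} := ⟨hz, (not_le.1 hc).le⟩
      rw [he] at this; exact this
    · obtain ⟨z0, hz0, hm⟩ := hK.exists_isMaxOn hne (D.cont.mono inter_subset_left)
      have hneg : ρ z0 < 0 := by
        refine D.neg ?_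
        by_contra hn
        have hf : z0 ∈ frontier Ω := by rw [D.isOpen.frontier_eq]; exact ⟨hz0.1, hn⟩
        have := D.grad z0 hf
        have h2 := hz0.2
        simp only [mem_ofPred_eq] at h2
        linarith
      refine ⟨-ρ z0, by linarith, fun z hz hlt => ?_⟩
      by_contra hc
      have := hm ⟨hz, (not_le.1 hc).le⟩
      simp only [mem_ofPred_eq] at this
      linarith
  obtain ⟨σ, hσ, hg⟩ := hcov
  set σ' := min σ (min (η / (8 * C)) (1 / (128 * C ^ 3)))
  have hσ' : 0 < σ' := by simp only [σ']; positivity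
  refine ⟨8 * C + 2 * C / σ', by linarith [D.one_le, show 0 < 2 * C / σ' by positivity], fun z hz => ?_⟩
  rcases le_or_gt (ρ z) (-σ') with h1 | h1
  · have h2 : 2 * C ≤ 2 * C / σ' * (-ρ z) := by
      rw [div_mul_eq_mul_div, le_div_iff₀ hσ']; gcongr; linarith
    nlinarith [D.bdist_le hz]
  · by_cases hzΩ : z ∈ Ω
    swap
    · have hf : z ∈ frontier Ω := by rw [D.isOpen.frontier_eq]; exact ⟨hz, hzΩ⟩
      rw [D.zero hf, bdist, infDist_zero_of_mem hf]; simp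
    have hneg := D.neg hzΩ
    have h3 : -σ < ρ z := lt_of_le_of_lt (neg_le_neg (min_le_left _ _)) h1
    have h4 : -ρ z < η / (8 * C) := by
      have : σ' ≤ η / (8 * C) := (min_le_right _ _).trans (min_le_left _ _)
      linarith
    have h5 : -ρ z < 1 / (128 * C ^ 3) := by
      have : σ' ≤ 1 / (128 * C ^ 3) := (min_le_right _ _).trans (min_le_right _ _)
      linarith
    have hgz := hg z hz h3
    set s := 8 * C * (-ρ z) with hs
    have hspos : 0 < s := by simp only [hs]; nlinarith
    -- a unit direction of growth
    obtain ⟨e, he1, he⟩ : ∃ e : E N, ‖e‖ ≤ 1 ∧ 1 / (4 * C) ≤ fderiv ℝ ρ z e := by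
      have hlt : 1 / (4 * C) < ‖fderiv ℝ ρ z‖ := by
        rw [div_lt_iff₀ (by positivity)]; nlinarith
      obtain ⟨e, he, hlt'⟩ := (fderiv ℝ ρ z).exists_lt_apply_of_lt_opNorm hlt
      rw [Real.norm_eq_abs] at hlt'
      rcases abs_cases (fderiv ℝ ρ z e) with ⟨h, -⟩ | ⟨h, -⟩
      · exact ⟨e, he.le, by linarith⟩
      · exact ⟨-e, by rw [norm_neg]; exact he.le, by rw [map_neg]; linarith⟩
    have hse : ‖(z + s • e) - z‖ ≤ s := by
      rw [add_sub_cancel_left, norm_smul, Real.norm_of_nonneg hspos.le]; nlinarith [norm_nonneg e]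
    have hsη : s ≤ η := by
      rw [lt_div_iff₀ (by positivity)] at h4; simp only [hs]; linarith
    have hout : z + s • e ∉ Ω := by
      rw [D.mem_iff z hz _ (hse.trans hsη), not_lt]
      have := D.taylor z hz (z + s • e) (hse.trans hsη)
      rw [add_sub_cancel_left, map_smul, smul_eq_mul] at this
      rw [add_sub_cancel_left] at hse
      have h6 := neg_abs_le (ρ (z + s • e) - ρ z - s * fderiv ℝ ρ z e)
      have h7 : s * (1 / (4 * C)) ≤ s * fderiv ℝ ρ z e := by gcongr
      have h8 : C * ‖s • e‖ ^ 2 ≤ C * s ^ 2 := by gcongr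
      have h9 : s * (1 / (4 * C)) = 2 * (-ρ z) := by simp only [hs]; field_simp; ring
      have h10 : C * s ^ 2 ≤ -ρ z := by
        have : C * s ^ 2 = 64 * C ^ 3 * (-ρ z) * (-ρ z) := by simp only [hs]; ring
        rw [this]
        have h11 : 64 * C ^ 3 * (-ρ z) ≤ 1 := by
          rw [lt_div_iff₀ (by positivity)] at h5; linarith
        nlinarith
      linarith
    obtain ⟨q, hq, hd⟩ := D.exists_frontier_of_segment hzΩ hout
    have h12 : bdist Ω z ≤ dist z q := infDist_le_dist_of_mem hq
    rw [dist_comm z (z + s • e), dist_eq_norm (z + s • e)] at hd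
    have : 0 ≤ 2 * C / σ' * (-ρ z) := by
      apply mul_nonneg; positivity; linarith
    nlinarith

end DefFn
end Basic

section Pkg
variable {Ω : Set (E N)} {α η C : ℝ} {ρ : E N → ℝ}

/-- The geometric estimates used for geodesics. -/
structure Pkg (Ω : Set (E N)) (α : ℝ) (ρ : E N → ℝ) (C : ℝ) : Prop where
  isOpen : IsOpen Ω
  ne : (frontier Ω).Nonempty
  α_pos : 0 < α
  α_le : α ≤ 1
  one_le : 1 ≤ C
  norm_le : ∀ x ∈ closure Ω, ‖x‖ ≤ C
  cont : ContinuousOn ρ (closure Ω)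
  neg : ∀ z ∈ Ω, ρ z < 0
  zero : ∀ q ∈ frontier Ω, ρ q = 0
  bdist_le : ∀ z ∈ closure Ω, bdist Ω z ≤ C * (-ρ z)
  le_bdist : ∀ z ∈ closure Ω, -ρ z ≤ C * bdist Ω z
  one_le_nu : ∀ q ∈ frontier Ω, 1 ≤ C * ‖nu ρ q‖
  nu_le : ∀ z ∈ closure Ω, ‖nu ρ z‖ ≤ C
  nu_lip : ∀ z ∈ closure Ω, ∀ q ∈ closure Ω, ‖nu ρ z - nu ρ q‖ ≤ C * ‖z - q‖
  val : ∀ z ∈ closure Ω, ∀ q ∈ frontier Ω, |ρ z - (nu ρ q (z - q)).re| ≤ C * ‖z - q‖ ^ 2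
  dnu : ∀ z ∈ closure Ω, ∀ q ∈ closure Ω, ∀ τ : E N,
    ‖nu ρ z τ - nu ρ q τ - (formA ρ q τ (z - q) + (starRingEnd ℂ) (formB ρ q τ (z - q)))‖ ≤
      C * ‖τ‖ * ‖z - q‖ ^ (1 + α)
  formA_le : ∀ q ∈ closure Ω, ∀ τ, ‖formA ρ q τ‖ ≤ C * ‖τ‖
  formB_le : ∀ q ∈ closure Ω, ∀ τ, ‖formB ρ q τ‖ ≤ C * ‖τ‖
  strict : ∀ q ∈ frontier Ω, ∀ τ, nu ρ q τ = 0 → ‖τ‖ ^ 2 ≤ C * (formB ρ q τ τ).re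
  push : ∀ M c : ℝ, 0 < c → ∃ t₀ > 0, ∀ z ∈ closure Ω, ∀ h : E N, ‖h‖ ≤ M →
    (nu ρ z h).re ≤ -c → ∀ t : ℝ, 0 < t → t ≤ t₀ → z + t • h ∈ Ω
  normal : ∀ z ∈ Ω, ∀ q ∈ frontier Ω, dist z q = bdist Ω z → ∀ v,
    ‖herm v (q - z)‖ * ‖nu ρ q‖ = ‖nu ρ q v‖ * bdist Ω z

lemma continuousOn_clm_apply₂ {X F : Type*} [TopologicalSpace X] [NormedAddCommGroup F]
    [NormedSpace ℝ F] {s : Set X} {H : X → F →L[ℝ] F →L[ℝ] ℝ} {v : X → F}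
    (hH : ContinuousOn H s) (hv : ContinuousOn v s) : ContinuousOn (fun x => H x (v x) (v x)) s :=
  (hH.clm_apply hv).clm_apply hv

namespace DefFn
variable (D : DefFn Ω α ρ η C)
include D

lemma nu_lip : ∃ C', ∀ z ∈ closure Ω, ∀ q ∈ closure Ω, ‖nu ρ z - nu ρ q‖ ≤ C' * ‖z - q‖ := by
  have hC := D.C_pos
  have hη := D.η_pos
  refine ⟨C + 2 * C / η, fun z hz q hq => ?_⟩
  rw [norm_nu_sub]
  rcases le_total ‖z - q‖ η with h | h
  · have := D.lipd q hq z h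
    have : 0 ≤ 2 * C / η * ‖z - q‖ := by positivity
    linarith
  · have h1 := norm_sub_le (fderiv ℝ ρ z) (fderiv ℝ ρ q)
    have h2 : 2 * C ≤ 2 * C / η * ‖z - q‖ := by
      rw [div_mul_eq_mul_div, le_div_iff₀ hη]; gcongr
    have : 0 ≤ C * ‖z - q‖ := by positivity
    linarith [D.normd_le z hz, D.normd_le q hq]

lemma val : ∃ C', ∀ z ∈ closure Ω, ∀ q ∈ frontier Ω,
    |ρ z - (nu ρ q (z - q)).re| ≤ C' * ‖z - q‖ ^ 2 := by
  have hC := D.C_pos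
  have hη := D.η_pos
  refine ⟨C + C / η ^ 2 + C / η, fun z hz q hq => ?_⟩
  rw [nu_re]
  have hq' := frontier_subset_closure hq
  rcases le_total ‖z - q‖ η with h | h
  · have := D.taylor q hq' z h
    rw [D.zero hq, sub_zero] at this
    have : 0 ≤ (C / η ^ 2 + C / η) * ‖z - q‖ ^ 2 := by positivity
    linarith
  · have h1 := abs_sub (ρ z) (fderiv ℝ ρ q (z - q))
    have h2 : C ≤ C / η ^ 2 * ‖z - q‖ ^ 2 := by
      rw [div_mul_eq_mul_div, le_div_iff₀ (by positivity)]; gcongr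
    have h3 : C * ‖z - q‖ ≤ C / η * ‖z - q‖ ^ 2 := by
      rw [div_mul_eq_mul_div, le_div_iff₀ hη, sq, mul_assoc]; gcongr
    have h4 := (fderiv ℝ ρ q).le_opNorm (z - q)
    rw [Real.norm_eq_abs] at h4
    have h5 : ‖fderiv ℝ ρ q‖ * ‖z - q‖ ≤ C * ‖z - q‖ := by gcongr; exact D.normd_le q hq'
    have : 0 ≤ C * ‖z - q‖ ^ 2 := by positivity
    linarith [D.abs_le z hz]

lemma dnu : ∃ C', ∀ z ∈ closure Ω, ∀ q ∈ closure Ω, ∀ τ : E N,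
    ‖nu ρ z τ - nu ρ q τ - (formA ρ q τ (z - q) + (starRingEnd ℂ) (formB ρ q τ (z - q)))‖ ≤
      C' * ‖τ‖ * ‖z - q‖ ^ (1 + α) := by
  have hC := D.C_pos
  have hη := D.η_pos
  have hα := D.α_pos
  refine ⟨C + 2 * C / η ^ (1 + α) + C / η ^ α, fun z hz q hq τ => ?_⟩
  have key : nu ρ z τ - nu ρ q τ - (formA ρ q τ (z - q) + (starRingEnd ℂ) (formB ρ q τ (z - q))) =
      (StrongDual.extendRCLike (fderiv ℝ ρ z - fderiv ℝ ρ q - hess ρ q (z - q)) : E N →L[ℂ] ℂ) τ := by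
    rw [formA_add_conj_formB, ext_sub, ext_sub]; rfl
  rw [key]
  refine (ContinuousLinearMap.le_opNorm _ _).trans ?_
  rw [norm_ext, mul_comm, mul_assoc, mul_left_comm]
  gcongr
  have h0 := norm_nonneg (z - q)
  rcases le_total ‖z - q‖ η with h | h
  · have := D.taylord q hq z h
    have : 0 ≤ (2 * C / η ^ (1 + α) + C / η ^ α) * ‖z - q‖ ^ (1 + α) := by positivity
    linarith
  · have h1 := norm_sub_le (fderiv ℝ ρ z - fderiv ℝ ρ q) (hess ρ q (z - q))
    have h1' := norm_sub_le (fderiv ℝ ρ z) (fderiv ℝ ρ q)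
    have h2 : 2 * C ≤ 2 * C / η ^ (1 + α) * ‖z - q‖ ^ (1 + α) := by
      rw [div_mul_eq_mul_div, le_div_iff₀ (by positivity)]; gcongr
    have h3 : C * ‖z - q‖ ≤ C / η ^ α * ‖z - q‖ ^ (1 + α) := by
      rw [div_mul_eq_mul_div, le_div_iff₀ (by positivity), Real.rpow_add (by linarith), Real.rpow_one,
        ← mul_assoc]
      gcongr
    have h4 := (hess ρ q).le_opNorm (z - q)
    have h5 : ‖hess ρ q‖ * ‖z - q‖ ≤ C * ‖z - q‖ := by gcongr; exact D.normdd_le q hq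
    have : 0 ≤ C * ‖z - q‖ ^ (1 + α) := by positivity
    linarith [D.normd_le z hz, D.normd_le q hq]

lemma continuousOn_levi : ContinuousOn (fun x : E N × E N => levi ρ x.1 x.2) (closure Ω ×ˢ univ) := by
  simp_rw [levi_eq]
  have h1 : ContinuousOn (fun x : E N × E N => hess ρ x.1) (closure Ω ×ˢ univ) :=
    ContinuousOn.comp (g := hess ρ) D.cont2 continuousOn_fst fun x hx => hx.1
  have h2 : ContinuousOn (fun x : E N × E N => Complex.I • x.2) (closure Ω ×ˢ univ) :=
    continuousOn_snd.const_smul Complex.I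
  exact ContinuousOn.div_const (ContinuousOn.add (continuousOn_clm_apply₂ h1 continuousOn_snd)
    (continuousOn_clm_apply₂ h1 h2)) _

lemma strict_uniform : ∃ C', ∀ q ∈ frontier Ω, ∀ τ, nu ρ q τ = 0 →
    ‖τ‖ ^ 2 ≤ C' * (formB ρ q τ τ).re := by
  have hnu : ContinuousOn (fun x : E N × E N => nu ρ x.1 x.2) (closure Ω ×ˢ univ) := by
    have h1 : ContinuousOn (fun x : E N × E N => fderiv ℝ ρ x.1) (closure Ω ×ˢ univ) :=
      D.contd.comp continuousOn_fst fun x hx => hx.1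
    have : ∀ x : E N × E N, nu ρ x.1 x.2 = (fderiv ℝ ρ x.1 x.2 : ℂ) -
      Complex.I * (fderiv ℝ ρ x.1 (Complex.I • x.2) : ℂ) := fun x => rfl
    simp_rw [this]
    refine ContinuousOn.sub ?_ (continuousOn_const.mul ?_)
    · exact Complex.continuous_ofReal.comp_continuousOn (h1.clm_apply continuousOn_snd)
    · exact Complex.continuous_ofReal.comp_continuousOn
        (h1.clm_apply (continuousOn_snd.const_smul Complex.I :
          ContinuousOn (fun x : E N × E N => Complex.I • x.2) _))
  have hS : IsCompact (frontier Ω ×ˢ sphere (0 : E N) 1) := D.isCompact_frontier.prod (isCompact_sphere _ _)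
  have hsub : frontier Ω ×ˢ sphere (0 : E N) 1 ⊆ closure Ω ×ˢ univ :=
    prod_mono frontier_subset_closure (subset_univ _)
  set K := (frontier Ω ×ˢ sphere (0 : E N) 1) ∩ (fun x : E N × E N => nu ρ x.1 x.2) ⁻¹' {0}
  have hK : IsCompact K := hS.of_isClosed_subset
    ((hnu.mono hsub).preimage_isClosed_of_isClosed hS.isClosed isClosed_singleton) inter_subset_left
  have hpos : ∀ x ∈ K, 0 < levi ρ x.1 x.2 := fun x hx => by
    have h0 : nu ρ x.1 x.2 = 0 := hx.2
    refine D.strict x.1 hx.1.1 x.2 (ne_zero_of_norm_ne_zero ?_) ?_ ?_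
    · have := hx.1.2; rw [mem_sphere_zero_iff_norm] at this; rw [this]; exact one_ne_zero
    · rw [← nu_re, h0]; rfl
    · rw [← neg_eq_zero, ← nu_im, h0]; rfl
  obtain ⟨m, hm, hmK⟩ : ∃ m > 0, ∀ x ∈ K, m ≤ levi ρ x.1 x.2 := by
    rcases K.eq_empty_or_nonempty with he | hne
    · exact ⟨1, one_pos, fun x hx => by rw [he] at hx; exact hx.elim⟩
    · obtain ⟨x, hx, hmin⟩ := hK.exists_isMinOn hne
        (D.continuousOn_levi.mono (inter_subset_left.trans hsub))
      exact ⟨_, hpos x hx, fun y hy => hmin hy⟩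
  refine ⟨1 / (2 * m), fun q hq τ hτ => ?_⟩
  rw [formB_self_re]
  rcases eq_or_ne τ 0 with rfl | h0
  · simp [levi_eq]
  have hn : 0 < ‖τ‖ := norm_pos_iff.2 h0
  have := hmK (q, (‖τ‖⁻¹ : ℝ) • τ) ⟨⟨hq, by simp [norm_smul, hn.ne']⟩, by
    change nu ρ q ((‖τ‖⁻¹ : ℝ) • τ) = 0
    rw [← Complex.coe_smul, map_smul, hτ, smul_zero]⟩
  have hl : levi ρ q ((‖τ‖⁻¹ : ℝ) • τ) = ‖τ‖⁻¹ ^ 2 * levi ρ q τ := by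
    rw [levi_eq, levi_eq, smul_comm]; simp; ring
  simp only [hl] at this
  rw [inv_pow, inv_mul_eq_div, le_div_iff₀ (by positivity)] at this
  rw [div_mul_eq_mul_div, le_div_iff₀ (by positivity)]
  linarith

lemma push : ∀ M c : ℝ, 0 < c → ∃ t₀ > 0, ∀ z ∈ closure Ω, ∀ h : E N, ‖h‖ ≤ M →
    (nu ρ z h).re ≤ -c → ∀ t : ℝ, 0 < t → t ≤ t₀ → z + t • h ∈ Ω := by
  intro M c hc
  have hC := D.C_pos
  have hη := D.η_pos
  set M' := |M| + 1
  have hM' : 0 < M' := by positivity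
  refine ⟨min (η / M') (c / (2 * C * M' ^ 2)), by positivity, fun z hz h hh hn t ht htt => ?_⟩
  have hh' : ‖h‖ ≤ M' := hh.trans ((le_abs_self M).trans (by simp [M']))
  have h1 := htt.trans (min_le_left _ _)
  have h2 := htt.trans (min_le_right _ _)
  rw [le_div_iff₀ (by positivity)] at h1 h2
  have hth : ‖(z + t • h) - z‖ ≤ t * M' := by
    rw [add_sub_cancel_left, norm_smul, Real.norm_of_nonneg ht.le]; gcongr
  rw [D.mem_iff z hz _ (hth.trans h1)]
  have h3 := D.taylor z hz _ (hth.trans h1)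
  rw [add_sub_cancel_left, map_smul, smul_eq_mul, ← nu_re] at h3
  rw [add_sub_cancel_left] at hth
  have h4 := le_abs_self (ρ (z + t • h) - ρ z - t * (nu ρ z h).re)
  have h5 : C * ‖t • h‖ ^ 2 ≤ C * (t * M') ^ 2 := by gcongr
  have h6 := D.nonpos hz
  have h7 : t * (nu ρ z h).re ≤ t * (-c) := by gcongr
  have h8 : C * (t * M') ^ 2 ≤ t * (c / 2) := by nlinarith
  nlinarith

/-- At a closest boundary point, `nu` is a positive multiple of the inner product with `q - z`. -/
lemma nu_closest {z q : E N} (hz : z ∈ Ω) (hq : q ∈ frontier Ω) (hd : dist z q = bdist Ω z) :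
    ∃ s : ℝ, 0 < s ∧ nrm ρ q = (s : ℂ) • (q - z) := by
  have hq' := frontier_subset_closure hq
  have hη := D.η_pos
  have hC := D.C_pos
  have hdp : 0 < bdist Ω z := D.bdist_pos hz ⟨q, hq⟩
  have hnz : q - z ≠ 0 := by
    rw [← norm_ne_zero_iff, ← dist_eq_norm, dist_comm, hd]; exact hdp.ne'
  have key : ∀ w : E N, (inner ℂ (q - z) w).re < 0 → (nu ρ q w).re ≤ 0 := by
    intro w hw
    by_contra! hpos
    have hw0 : 0 < ‖w‖ := by
      rw [norm_pos_iff]; rintro rfl; simp at hw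
    set a := -(inner ℂ (q - z) w).re
    have ha : 0 < a := by simp only [a]; linarith
    set t := min (η / ‖w‖) (min (a / ‖w‖ ^ 2) ((nu ρ q w).re / (2 * C * ‖w‖ ^ 2)))
    have ht : 0 < t := by positivity
    have t1 : t * ‖w‖ ≤ η := (le_div_iff₀ hw0).1 (min_le_left _ _)
    have t2 : t * ‖w‖ ^ 2 ≤ a :=
      (le_div_iff₀ (by positivity)).1 ((min_le_right _ _).trans (min_le_left _ _))
    have t3 : t * (2 * C * ‖w‖ ^ 2) ≤ (nu ρ q w).re :=
      (le_div_iff₀ (by positivity)).1 ((min_le_right _ _).trans (min_le_right _ _))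
    have hn : ‖(q + t • w) - q‖ = t * ‖w‖ := by
      rw [add_sub_cancel_left, norm_smul, Real.norm_of_nonneg ht.le]
    have hin : q + t • w ∈ Ω := by
      refine D.ball_subset hz ?_
      rw [mem_ball, dist_eq_norm, ← hd, dist_comm, dist_eq_norm]
      refine lt_of_pow_lt_pow_left₀ 2 (norm_nonneg _) ?_
      have : q + t • w - z = (q - z) + (t : ℂ) • w := by rw [Complex.coe_smul]; abel
      rw [this, norm_add_sq (𝕜 := ℂ), inner_smul_right, norm_smul, Complex.norm_real,
        Real.norm_of_nonneg ht.le]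
      have h2 : RCLike.re ((t : ℂ) * inner ℂ (q - z) w) = -(t * a) := by
        change ((t : ℂ) * inner ℂ (q - z) w).re = _
        rw [Complex.re_ofReal_mul]; simp only [a]; ring
      rw [h2]
      have : (t * ‖w‖) ^ 2 = t * (t * ‖w‖ ^ 2) := by ring
      nlinarith [mul_pos ht ha, mul_le_mul_of_nonneg_left t2 ht.le]
    have h1 := D.taylor q hq' _ (hn.trans_le t1)
    rw [hn, D.zero hq, add_sub_cancel_left, map_smul, smul_eq_mul, ← nu_re] at h1
    have h2 := neg_abs_le (ρ (q + t • w) - 0 - t * (nu ρ q w).re)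
    have h3 := D.neg hin
    have h4 : C * (t * ‖w‖) ^ 2 = t * (t * (2 * C * ‖w‖ ^ 2)) / 2 := by ring
    nlinarith [mul_le_mul_of_nonneg_left t3 ht.le, mul_pos ht hpos]
  -- weak version by continuity
  have key' : ∀ w : E N, (inner ℂ (q - z) w).re ≤ 0 → (nu ρ q w).re ≤ 0 := by
    intro w hw
    by_contra! hpos
    set b := (nu ρ q (q - z)).re
    set ε := (nu ρ q w).re / (2 * (|b| + 1))
    have hε : 0 < ε := by positivity
    have := key (w - (ε : ℂ) • (q - z)) (by
      rw [inner_sub_right, inner_smul_right, Complex.sub_re, Complex.re_ofReal_mul,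
        inner_self_eq_norm_sq_to_K]
      have : ((‖q - z‖ : ℂ) ^ 2).re = ‖q - z‖ ^ 2 := by norm_cast
      have h2 : 0 < ‖q - z‖ ^ 2 := by have := norm_pos_iff.2 hnz; positivity
      change _ - ε * ((‖q - z‖ : ℂ) ^ 2).re < 0
      rw [this]
      nlinarith)
    rw [map_sub, map_smul, smul_eq_mul, Complex.sub_re, Complex.re_ofReal_mul] at this
    have h3 : ε * b ≤ (nu ρ q w).re / 2 := by
      calc ε * b ≤ ε * (|b| + 1) := by gcongr; linarith [le_abs_self b]
        _ = _ := by simp only [ε]; field_simp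
    linarith
  have key0 : ∀ w : E N, (inner ℂ (q - z) w).re = 0 → (nu ρ q w).re = 0 := fun w hw => by
    have h1 := key' w hw.le
    have h2 := key' (-w) (by rw [inner_neg_right, Complex.neg_re, hw, neg_zero])
    rw [map_neg, Complex.neg_re] at h2
    linarith
  set s := (nu ρ q (q - z)).re / ‖q - z‖ ^ 2
  have hn2 : 0 < ‖q - z‖ ^ 2 := by have := norm_pos_iff.2 hnz; positivity
  have hself : (inner ℂ (q - z) (q - z)).re = ‖q - z‖ ^ 2 := by
    rw [inner_self_eq_norm_sq_to_K]
    norm_cast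
  have hre : ∀ w, (nu ρ q w).re = s * (inner ℂ (q - z) w).re := by
    intro w
    set b := (inner ℂ (q - z) w).re / ‖q - z‖ ^ 2
    have := key0 (w - (b : ℂ) • (q - z)) (by
      rw [inner_sub_right, inner_smul_right, Complex.sub_re, Complex.re_ofReal_mul, hself]
      simp only [b]; field_simp; ring)
    rw [map_sub, map_smul, smul_eq_mul, Complex.sub_re, Complex.re_ofReal_mul] at this
    rw [sub_eq_zero.1 this]
    simp only [b, s]; field_simp
  have heq : nrm ρ q = (s : ℂ) • (q - z) := by
    refine ext_inner_right ℂ fun w => ?_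
    rw [← nu_eq_inner, inner_smul_left, Complex.conj_ofReal]
    apply Complex.ext
    · rw [hre, Complex.re_ofReal_mul]
    · have h1 := hre (Complex.I • w)
      rw [map_smul, inner_smul_right, smul_eq_mul] at h1
      simp at h1
      rw [Complex.im_ofReal_mul, h1]
  refine ⟨s, lt_of_le_of_ne ?_ ?_, heq⟩
  · have := key' (-(q - z)) (by rw [inner_neg_right, Complex.neg_re, hself]; linarith)
    rw [map_neg, Complex.neg_re] at this
    exact div_nonneg (by linarith) hn2.le
  · intro h
    rw [← h, Complex.ofReal_zero, zero_smul] at heq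
    have h1 := D.grad q hq
    rw [← norm_nu, ← norm_nrm, heq, norm_zero] at h1
    linarith

theorem exists_pkg (hne : (frontier Ω).Nonempty) : ∃ C', Pkg Ω α ρ C' := by
  obtain ⟨C1, -, h1⟩ := D.bdist_le_neg
  obtain ⟨C2, -, h2⟩ := D.neg_le_bdist
  obtain ⟨C3, h3⟩ := D.nu_lip
  obtain ⟨C4, h4⟩ := D.val
  obtain ⟨C5, h5⟩ := D.dnu
  obtain ⟨C6, h6⟩ := D.strict_uniform
  have hC := D.C_pos
  have e1 := abs_nonneg C1
  have e2 := abs_nonneg C2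
  have e3 := abs_nonneg C3
  have e4 := abs_nonneg C4
  have e5 := abs_nonneg C5
  have e6 := abs_nonneg C6
  obtain ⟨B, hB⟩ : ∃ B, B = C + |C1| + |C2| + |C3| + |C4| + |C5| + |C6| := ⟨_, rfl⟩
  have l0 : C ≤ B := by linarith
  have l1 : C1 ≤ B := (le_abs_self _).trans (by linarith)
  have l2 : C2 ≤ B := (le_abs_self _).trans (by linarith)
  have l3 : C3 ≤ B := (le_abs_self _).trans (by linarith)
  have l4 : C4 ≤ B := (le_abs_self _).trans (by linarith)
  have l5 : C5 ≤ B := (le_abs_self _).trans (by linarith)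
  have l6 : C6 ≤ B := (le_abs_self _).trans (by linarith)
  refine ⟨B, D.isOpen, hne, D.α_pos, D.α_le, D.one_le.trans l0, fun x hx => (D.norm_le x hx).trans l0,
    D.cont, fun z hz => D.neg hz, fun q hq => D.zero hq, ?_, ?_, ?_, ?_, ?_, ?_, ?_, ?_, ?_, ?_, D.push, ?_⟩
  · intro z hz
    have := D.nonpos hz
    exact (h1 z hz).trans (mul_le_mul_of_nonneg_right l1 (by linarith))
  · intro z hz
    exact (h2 z hz hne).trans (mul_le_mul_of_nonneg_right l2 infDist_nonneg)
  · intro q hq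
    rw [norm_nu]
    exact (D.grad q hq).trans (mul_le_mul_of_nonneg_right l0 (norm_nonneg _))
  · intro q hq; rw [norm_nu]; exact (D.normd_le q hq).trans l0
  · intro z hz q hq
    exact (h3 z hz q hq).trans (mul_le_mul_of_nonneg_right l3 (norm_nonneg _))
  · intro z hz q hq
    exact (h4 z hz q hq).trans (mul_le_mul_of_nonneg_right l4 (by positivity))
  · intro z hz q hq τ
    exact (h5 z hz q hq τ).trans (by gcongr)
  · intro q hq τ
    exact (norm_formA_le q τ).trans (by gcongr; exact (D.normdd_le q hq).trans l0)
  · intro q hq τ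
    exact (norm_formB_le q τ).trans (by gcongr; exact (D.normdd_le q hq).trans l0)
  · intro q hq τ hτ
    have hle := h6 q hq τ hτ
    have : 0 ≤ (formB ρ q τ τ).re := by
      rw [formB_self_re]
      rcases eq_or_ne τ 0 with rfl | h0
      · simp [levi_eq]
      · have := D.strict q hq τ h0 (by rw [← nu_re, hτ]; rfl)
          (by rw [← neg_eq_zero, ← nu_im, hτ]; rfl)
        linarith
    exact hle.trans (mul_le_mul_of_nonneg_right l6 this)
  · intro z hz q hq hd v
    obtain ⟨s, hs, he⟩ := D.nu_closest hz hq hd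
    rw [← norm_nrm, nu_eq_inner, ← inner_eq_herm, he, inner_smul_left, norm_mul, norm_smul,
      Complex.conj_ofReal, ← hd, dist_comm, dist_eq_norm]
    ring

end DefFn
end Pkg

section Lap

lemma fderiv_fderiv_apply {V W : Type*} [NormedAddCommGroup V] [NormedSpace ℝ V]
    [NormedAddCommGroup W] [NormedSpace ℝ W] {f : V → W} {x : V}
    (hf : ContDiffAt ℝ 2 f x) (u v : V) :
    fderiv ℝ (fderiv ℝ f) x u v = fderiv ℝ (fun y => fderiv ℝ f y v) x u := by
  have hd : DifferentiableAt ℝ (fderiv ℝ f) x :=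
    (hf.fderiv_right (m := 1) (by norm_num)).differentiableAt (by norm_num)
  rw [fderiv_clm_apply hd (differentiableAt_const v)]
  simp

variable {V : Type*} [NormedAddCommGroup V] [NormedSpace ℂ V] [NormedSpace ℝ V] [IsScalarTower ℝ ℂ V]

lemma laplacian_comp [CompleteSpace V] {Q : V → ℝ} {φ : ℂ → V} {a : ℂ}
    (hQ : ContDiffAt ℝ 2 Q (φ a)) (hφ : AnalyticAt ℂ φ a) :
    ContDiffAt ℝ 2 (fun ζ => Q (φ ζ)) a ∧ Laplacian.laplacian (fun ζ => Q (φ ζ)) a =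
      fderiv ℝ (fderiv ℝ Q) (φ a) (deriv φ a) (deriv φ a) +
      fderiv ℝ (fderiv ℝ Q) (φ a) (Complex.I • deriv φ a) (Complex.I • deriv φ a) := by
  have hφR : ContDiffAt ℝ 2 φ a := (hφ.contDiffAt (n := 2)).restrict_scalars ℝ
  have hc : ContDiffAt ℝ 2 (fun ζ => Q (φ ζ)) a := hQ.comp a hφR
  refine ⟨hc, ?_⟩
  have hφ' := hφ.deriv
  have hfd : ∀ e : ℂ, (fun ζ => fderiv ℝ (fun ζ => Q (φ ζ)) ζ e) =ᶠ[𝓝 a]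
      fun ζ => fderiv ℝ Q (φ ζ) (e • deriv φ ζ) := by
    intro e
    have e1 : ∀ᶠ ζ in 𝓝 a, DifferentiableAt ℂ φ ζ :=
      hφ.eventually_analyticAt.mono fun ζ h => h.differentiableAt
    have e2 : ∀ᶠ w in 𝓝 (φ a), ContDiffAt ℝ 2 Q w := hQ.eventually (by norm_num)
    filter_upwards [e1, hφ.continuousAt.eventually e2] with ζ h1 h2
    have h3 := (h2.differentiableAt (by norm_num)).hasFDerivAt.comp ζ
      (h1.hasDerivAt.hasFDerivAt.restrictScalars ℝ)
    have h4 := h3.fderiv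
    change fderiv ℝ (Q ∘ φ) ζ e = _
    rw [h4]
    simp
  have hQd : DifferentiableAt ℝ (fderiv ℝ Q) (φ a) :=
    (hQ.fderiv_right (m := 1) (by norm_num)).differentiableAt (by norm_num)
  have h2 : ∀ e : ℂ, fderiv ℝ (fderiv ℝ (fun ζ => Q (φ ζ))) a e e =
      fderiv ℝ (fderiv ℝ Q) (φ a) (e • deriv φ a) (e • deriv φ a) +
      fderiv ℝ Q (φ a) ((e * e) • deriv (deriv φ) a) := by
    intro e
    rw [fderiv_fderiv_apply hc, (hfd e).fderiv_eq]
    have g1 : HasFDerivAt (fun ζ => fderiv ℝ Q (φ ζ)) _ a := hQd.hasFDerivAt.comp a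
      (hφ.differentiableAt.hasDerivAt.hasFDerivAt.restrictScalars ℝ)
    have g2 : HasFDerivAt (fun ζ => e • deriv φ ζ) _ a :=
      ((hφ'.differentiableAt.hasDerivAt.const_smul e).hasFDerivAt.restrictScalars ℝ)
    rw [(g1.clm_apply g2).fderiv]
    simp [smul_smul]
    ring
  have h3 : Laplacian.laplacian (fun ζ => Q (φ ζ)) a = fderiv ℝ (fderiv ℝ (fun ζ => Q (φ ζ))) a 1 1 +
      fderiv ℝ (fderiv ℝ (fun ζ => Q (φ ζ))) a Complex.I Complex.I := by
    rw [InnerProductSpace.laplacian_eq_iteratedFDeriv_complexPlane]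
    simp [iteratedFDeriv_two_apply]
  rw [h3, h2, h2]
  simp
  ring

lemma laplacian_nonpos_of_isLocalMax {f : ℂ → ℝ} {a : ℂ} (hf : ContDiffAt ℝ 2 f a)
    (hm : IsLocalMax f a) : Laplacian.laplacian f a ≤ 0 := by
  have key : ∀ e : ℂ, fderiv ℝ (fderiv ℝ f) a e e ≤ 0 := by
    intro e
    by_contra! hpos
    set g : ℝ → ℝ := fun t => f (a + t * e)
    have hl : ∀ t : ℝ, HasDerivAt (fun t : ℝ => a + t * e) e t := fun t => by
      simpa using ((Complex.ofRealCLM.hasDerivAt (x := t)).mul_const e).const_add a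
    have hcl : Tendsto (fun t : ℝ => a + t * e) (𝓝 0) (𝓝 a) := by
      have := (hl 0).continuousAt.tendsto; simpa using this
    have hg : ∀ᶠ t : ℝ in 𝓝 0, deriv g t = fderiv ℝ f (a + t * e) e := by
      filter_upwards [hcl.eventually (hf.eventually (by norm_num))] with t ht
      exact ((ht.differentiableAt (by norm_num)).hasFDerivAt.comp_hasDerivAt t (hl t)).deriv
    have hgm : IsLocalMax g 0 := by
      have := hcl.eventually hm
      filter_upwards [this] with t ht
      change f (a + t * e) ≤ f (a + (0 : ℝ) * e)
      rw [Complex.ofReal_zero, zero_mul, add_zero]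
      exact ht
    have hdd : deriv (deriv g) 0 = fderiv ℝ (fderiv ℝ f) a e e := by
      rw [EventuallyEq.deriv_eq hg]
      have hd : HasFDerivAt (fderiv ℝ f) (fderiv ℝ (fderiv ℝ f) a) (a + (0 : ℝ) * e) := by
        rw [Complex.ofReal_zero, zero_mul, add_zero]
        exact ((hf.fderiv_right (m := 1) (by norm_num)).differentiableAt (by norm_num)).hasFDerivAt
      have h1 : HasDerivAt (fun t : ℝ => fderiv ℝ f (a + t * e)) (fderiv ℝ (fderiv ℝ f) a e) 0 :=
        hd.comp_hasDerivAt (0 : ℝ) (hl 0)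
      have h2 : HasDerivAt (fun t : ℝ => fderiv ℝ f (a + t * e) e) _ 0 :=
        (ContinuousLinearMap.apply ℝ ℝ e).hasFDerivAt.comp_hasDerivAt (0 : ℝ) h1
      exact h2.deriv
    have hmin := isLocalMin_of_deriv_deriv_pos (f := g) (x₀ := 0) (by rw [hdd]; exact hpos)
      hgm.deriv_eq_zero (by
        have : ContinuousAt f (a + (0 : ℝ) * e) := by simpa using hf.continuousAt
        exact ContinuousAt.comp (g := f) this (hl 0).continuousAt)
    have hconst : g =ᶠ[𝓝 0] fun _ => g 0 := by
      filter_upwards [hgm, hmin] with t h1 h2 using le_antisymm h1 h2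
    have : deriv (deriv g) 0 = 0 := by
      rw [hconst.deriv.deriv_eq]; simp
    rw [hdd] at this
    linarith
  rw [InnerProductSpace.laplacian_eq_iteratedFDeriv_complexPlane]
  simp only [iteratedFDeriv_two_apply]
  have := key 1
  have := key Complex.I
  simp
  linarith

lemma hess_norm_sq {V : Type*} [NormedAddCommGroup V] [InnerProductSpace ℝ V] (z₀ z v : V) :
    fderiv ℝ (fderiv ℝ (fun x => ‖x - z₀‖ ^ 2)) z v v = 2 * ‖v‖ ^ 2 := by
  have h1 : fderiv ℝ (fun x : V => ‖x - z₀‖ ^ 2) = fun x => (2 : ℝ) • innerSL ℝ (x - z₀) := by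
    funext x
    have := ((hasFDerivAt_id x).sub_const z₀).norm_sq
    refine this.fderiv.trans ?_
    ext w; simp
  rw [h1]
  have h2 : HasFDerivAt (fun x : V => (2 : ℝ) • innerSL ℝ (x - z₀)) ((2 : ℝ) • innerSL ℝ) z := by
    have := ((innerSL ℝ (E := V)).hasFDerivAt.comp z ((hasFDerivAt_id z).sub_const z₀)).const_smul (2 : ℝ)
    exact this
  rw [h2.fderiv]
  change (2 : ℝ) • inner ℝ v v = _
  rw [real_inner_self_eq_norm_sq, smul_eq_mul]

lemma contDiff_norm_sub_sq {V : Type*} [NormedAddCommGroup V] [InnerProductSpace ℝ V] (z₀ : V) :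
    ContDiff ℝ 2 (fun x => ‖x - z₀‖ ^ 2) := (contDiff_id.sub contDiff_const).norm_sq ℝ

lemma laplacian_norm_sub_sq {N : ℕ} {φ : ℂ → E N} {a : ℂ} (z₀ : E N) (hφ : AnalyticAt ℂ φ a) :
    ContDiffAt ℝ 2 (fun ζ => ‖φ ζ - z₀‖ ^ 2) a ∧
    Laplacian.laplacian (fun ζ => ‖φ ζ - z₀‖ ^ 2) a = 4 * ‖deriv φ a‖ ^ 2 := by
  obtain ⟨h1, h2⟩ := laplacian_comp (Q := fun x : E N => ‖x - z₀‖ ^ 2) (φ := φ)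
    (contDiff_norm_sub_sq z₀).contDiffAt hφ
  refine ⟨h1, h2.trans ?_⟩
  rw [hess_norm_sq, hess_norm_sq, norm_smul, Complex.norm_I]
  ring

lemma laplacian_norm_sq {φ : ℂ → ℂ} {a : ℂ} (hφ : AnalyticAt ℂ φ a) :
    ContDiffAt ℝ 2 (fun ζ => ‖φ ζ‖ ^ 2) a ∧
    Laplacian.laplacian (fun ζ => ‖φ ζ‖ ^ 2) a = 4 * ‖deriv φ a‖ ^ 2 := by
  obtain ⟨h1, h2⟩ := laplacian_comp (Q := fun x : ℂ => ‖x - 0‖ ^ 2) (φ := φ)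
    (contDiff_norm_sub_sq 0).contDiffAt hφ
  rw [hess_norm_sq, hess_norm_sq, norm_smul, Complex.norm_I] at h2
  simp only [sub_zero] at h1 h2
  exact ⟨h1, h2.trans (by ring)⟩

lemma laplacian_re {φ : ℂ → ℂ} {a : ℂ} (hφ : AnalyticAt ℂ φ a) :
    ContDiffAt ℝ 2 (fun ζ => (φ ζ).re) a ∧ Laplacian.laplacian (fun ζ => (φ ζ).re) a = 0 := by
  obtain ⟨h1, h2⟩ := laplacian_comp (Q := fun x : ℂ => x.re) (φ := φ)
    Complex.reCLM.contDiff.contDiffAt hφ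
  refine ⟨h1, h2.trans ?_⟩
  have : fderiv ℝ (fun x : ℂ => x.re) = fun _ => Complex.reCLM := by
    funext x; exact Complex.reCLM.hasFDerivAt.fderiv
  rw [this]
  simp

end Lap

section Psh
variable {Ω : Set (E N)} {α : ℝ} {ρ : E N → ℝ} {η C : ℝ}

lemma exists_add_mul_pos {X : Type*} [TopologicalSpace X] {K : Set X} (hK : IsCompact K) {f g : X → ℝ}
    (hf : ContinuousOn f K) (hg : ContinuousOn g K) (hg0 : ∀ x ∈ K, 0 ≤ g x)
    (h : ∀ x ∈ K, g x = 0 → 0 < f x) : ∃ L > 0, ∃ c > 0, ∀ x ∈ K, c ≤ f x + L * g x := by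
  obtain ⟨B, hB⟩ := hK.exists_bound_of_continuousOn hf
  obtain ⟨m, hm, hmg⟩ : ∃ m > 0, ∀ x ∈ K, f x ≤ m → m ≤ g x := by
    by_contra! hcon
    rcases K.eq_empty_or_nonempty with rfl | hne
    · obtain ⟨x, hx, -⟩ := hcon 1 one_pos; exact hx
    obtain ⟨x, hx, hmin⟩ := hK.exists_isMinOn hne
      (ContinuousOn.sup hf hg : ContinuousOn (fun x => max (f x) (g x)) K)
    have hpos : 0 < max (f x) (g x) := by
      rcases (hg0 x hx).eq_or_lt with h0 | h0
      · exact lt_max_of_lt_left (h x hx h0.symm)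
      · exact lt_max_of_lt_right h0
    obtain ⟨y, hy, h1, h2⟩ := hcon (max (f x) (g x) / 2) (by positivity)
    have h3 : max (f x) (g x) ≤ max (f y) (g y) := hmin hy
    have h4 := max_lt (h1.trans_lt (by linarith : _ < max (f x) (g x))) (h2.trans (by linarith : _ < max (f x) (g x)))
    linarith
  refine ⟨(|B| + 1) / m, by positivity, min m 1, by positivity, fun x hx => ?_⟩
  rcases le_total (f x) m with h1 | h1
  · have h2 := hmg x hx h1
    have h3 := (abs_le.1 ((hB x hx).trans (le_abs_self B))).1
    have : |B| + 1 ≤ (|B| + 1) / m * g x := by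
      rw [div_mul_eq_mul_div, le_div_iff₀ hm]; gcongr
    linarith [min_le_right m 1]
  · have : 0 ≤ (|B| + 1) / m * g x := mul_nonneg (by positivity) (hg0 x hx)
    linarith [min_le_left m 1]

lemma norm_nu_apply_sq (q v : E N) :
    ‖nu ρ q v‖ ^ 2 = fderiv ℝ ρ q v ^ 2 + fderiv ℝ ρ q (Complex.I • v) ^ 2 := by
  rw [← Complex.normSq_eq_norm_sq, Complex.normSq_apply, nu_re, nu_im]; ring

lemma levi_smul (z v : E N) (t : ℝ) : levi ρ z (t • v) = t ^ 2 * levi ρ z v := by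
  rw [levi_eq, levi_eq, smul_comm Complex.I t v]
  simp; ring

lemma levi_add_mul_sq {z : E N} (h : ContDiffAt ℝ 2 ρ z) (K : ℝ) :
    ContDiffAt ℝ 2 (fun w => ρ w + K * ρ w ^ 2) z ∧ ∀ v,
    levi (fun w => ρ w + K * ρ w ^ 2) z v = (1 + 2 * K * ρ z) * levi ρ z v + K / 2 * ‖nu ρ z v‖ ^ 2 := by
  refine ⟨h.add (contDiffAt_const.mul (h.pow 2)), fun v => ?_⟩
  have h1 : fderiv ℝ (fun w => ρ w + K * ρ w ^ 2) =ᶠ[𝓝 z] fun w => (1 + 2 * K * ρ w) • fderiv ℝ ρ w := by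
    filter_upwards [h.eventually (by norm_num)] with w hw
    have hd := (hw.differentiableAt (by norm_num)).hasFDerivAt
    refine (hd.add ((hd.pow 2).const_mul K)).fderiv.trans ?_
    ext u; simp; ring
  have hd := (h.differentiableAt (by norm_num)).hasFDerivAt
  have hdd := ((h.fderiv_right (m := 1) (by norm_num)).differentiableAt (by norm_num)).hasFDerivAt
  have h2 := ((hd.const_mul (2 * K)).const_add 1).smul hdd
  have h2' : fderiv ℝ (fun w => (1 + 2 * K * ρ w) • fderiv ℝ ρ w) z = _ := h2.fderiv
  rw [levi_eq, levi_eq, hess, h1.fderiv_eq, h2', norm_nu_apply_sq]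
  simp
  ring

lemma levi_norm_sq (z v : E N) (ε b : ℝ) :
    ContDiffAt ℝ 2 (fun w => ε * ‖w - 0‖ ^ 2 - b) z ∧
    levi (fun w => ε * ‖w - 0‖ ^ 2 - b) z v = ε * ‖v‖ ^ 2 := by
  have hc := (contDiff_norm_sub_sq (0 : E N))
  refine ⟨(contDiffAt_const.mul hc.contDiffAt).sub contDiffAt_const, ?_⟩
  have h1 : fderiv ℝ (fun w : E N => ε * ‖w - 0‖ ^ 2 - b) = fun w => ε • fderiv ℝ (fun w : E N => ‖w - 0‖ ^ 2) w := by
    funext w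
    exact (((hc.differentiable (by norm_num) w).hasFDerivAt.const_mul ε).sub_const b).fderiv
  have h2 : fderiv ℝ (fun w => ε • fderiv ℝ (fun w : E N => ‖w - 0‖ ^ 2) w) z =
      ε • hess (fun w : E N => ‖w - 0‖ ^ 2) z :=
    ((((hc.fderiv_right (m := 1) (by norm_num)).differentiable (by norm_num) z).hasFDerivAt).const_smul ε).fderiv
  rw [levi_eq, hess, h1, h2]
  simp only [_root_.smul_apply, hess_norm_sq, norm_smul, Complex.norm_I, smul_eq_mul]
  ring

/-- A continuous strictly plurisubharmonic exhaustion comparable to the defining function. -/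
structure PshExh (Ω : Set (E N)) (ρ Ψ : E N → ℝ) (ε C : ℝ) : Prop where
  isOpen : IsOpen Ω
  neg : ∀ z ∈ Ω, ρ z < 0
  ε_pos : 0 < ε
  C_pos : 0 < C
  cont : ContinuousOn Ψ (closure Ω)
  le : ∀ z ∈ closure Ω, -ρ z ≤ C * -Ψ z
  ge : ∀ z ∈ closure Ω, -Ψ z ≤ C * -ρ z
  branch : ∀ z ∈ Ω, ∃ Q : E N → ℝ, ContDiffAt ℝ 2 Q z ∧ Q z = Ψ z ∧ (∀ᶠ w in 𝓝 z, Q w ≤ Ψ w) ∧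
    ∀ v, ε * ‖v‖ ^ 2 ≤ levi Q z v

lemma DefFn.continuousOn_nu_apply (D : DefFn Ω α ρ η C) :
    ContinuousOn (fun x : E N × E N => ‖nu ρ x.1 x.2‖ ^ 2) (closure Ω ×ˢ univ) := by
  simp_rw [norm_nu_apply_sq]
  have h1 : ContinuousOn (fun x : E N × E N => fderiv ℝ ρ x.1) (closure Ω ×ˢ univ) :=
    D.contd.comp continuousOn_fst fun x hx => hx.1
  exact ((h1.clm_apply continuousOn_snd).pow 2).add
    ((h1.clm_apply (continuousOn_snd.const_smul Complex.I)).pow 2)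

lemma DefFn.levi_add_pos (D : DefFn Ω α ρ η C) :
    ∃ K > 0, ∃ c > 0, ∃ σ > 0, ∀ z ∈ closure Ω, -σ ≤ ρ z → ∀ v,
      c * ‖v‖ ^ 2 ≤ levi ρ z v + K * ‖nu ρ z v‖ ^ 2 := by
  obtain ⟨K, hK, c₁, hc₁, h1⟩ := exists_add_mul_pos (K := frontier Ω ×ˢ sphere (0 : E N) 1)
    (D.isCompact_frontier.prod (isCompact_sphere _ _))
    (D.continuousOn_levi.mono (prod_mono frontier_subset_closure (subset_univ _)))
    (D.continuousOn_nu_apply.mono (prod_mono frontier_subset_closure (subset_univ _)))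
    (fun x _ => by positivity) (by
      rintro ⟨q, v⟩ ⟨hq, hv⟩ h0
      change ‖nu ρ q v‖ ^ 2 = 0 at h0
      have h0' : nu ρ q v = 0 := by simpa using h0
      have hre := nu_re (ρ := ρ) q v
      have him := nu_im (ρ := ρ) q v
      rw [h0'] at hre him
      refine D.strict q hq v (by rintro rfl; simp at hv) hre.symm ?_
      simpa using him.symm)
  obtain ⟨L, hL, c, hc, h2⟩ := exists_add_mul_pos (K := closure Ω ×ˢ sphere (0 : E N) 1)
    (f := fun x => levi ρ x.1 x.2 + K * ‖nu ρ x.1 x.2‖ ^ 2) (g := fun x => -ρ x.1)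
    (D.isCompact.prod (isCompact_sphere _ _))
    ((D.continuousOn_levi.mono (prod_mono_right (subset_univ _))).add
      (continuousOn_const.mul (D.continuousOn_nu_apply.mono (prod_mono_right (subset_univ _)))))
    (D.cont.neg.comp continuousOn_fst fun x hx => hx.1)
    (fun x hx => by linarith [D.nonpos hx.1]) (by
      rintro ⟨q, v⟩ ⟨hq, hv⟩ h0
      have hqf : q ∈ frontier Ω := by
        rw [D.isOpen.frontier_eq]
        exact ⟨hq, fun hm => by have := D.neg hm; simp only at h0; linarith⟩
      exact hc₁.trans_le (h1 (q, v) ⟨hqf, hv⟩))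
  refine ⟨K, hK, c / 2, by positivity, c / (2 * L), by positivity, fun z hz hρ v => ?_⟩
  rcases eq_or_ne v 0 with rfl | hv
  · simp [levi_eq]
  have hn : 0 < ‖v‖ := norm_pos_iff.2 hv
  have h3 := h2 (z, (‖v‖⁻¹ : ℝ) • v) ⟨hz, by simp [norm_smul, hn.ne']⟩
  simp only at h3
  have h4 : nu ρ z ((‖v‖⁻¹ : ℝ) • v) = (‖v‖⁻¹ : ℝ) • nu ρ z v := by
    rw [← Complex.coe_smul, map_smul, Complex.coe_smul]
  rw [levi_smul, h4, norm_smul, Real.norm_of_nonneg (by positivity)] at h3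
  have h5 : L * -ρ z ≤ c / 2 := by
    calc L * -ρ z ≤ L * (c / (2 * L)) := by gcongr; linarith
      _ = c / 2 := by field_simp
  have h6 : c / 2 ≤ (‖v‖⁻¹) ^ 2 * (levi ρ z v + K * ‖nu ρ z v‖ ^ 2) := by
    rw [mul_pow] at h3; linarith
  calc c / 2 * ‖v‖ ^ 2 ≤ (‖v‖⁻¹) ^ 2 * (levi ρ z v + K * ‖nu ρ z v‖ ^ 2) * ‖v‖ ^ 2 := by gcongr
    _ = _ := by field_simp

theorem DefFn.exists_pshExh (D : DefFn Ω α ρ η C) : ∃ Ψ ε C', PshExh Ω ρ Ψ ε C' := by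
  obtain ⟨K, hK, c, hc, σ₀, hσ₀, hl⟩ := D.levi_add_pos
  have hC := D.C_pos
  set σ := min σ₀ (1 / (8 * K)) with hσdef
  have hσ : 0 < σ := by positivity
  have hσ1 : σ ≤ σ₀ := min_le_left _ _
  have hσ2 : 2 * K * σ ≤ 1 / 4 := by
    calc 2 * K * σ ≤ 2 * K * (1 / (8 * K)) := by gcongr; exact min_le_right _ _
      _ = 1 / 4 := by field_simp; norm_num
  set ε := σ / (8 * C ^ 2) with hε
  have hεp : 0 < ε := by positivity
  have hεR : ε * C ^ 2 = σ / 8 := by rw [hε]; field_simp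
  set b := σ / 4 with hb
  let g : ℝ → ℝ := fun t => t + 2 * K * t ^ 2
  let br : E N → ℝ := fun z => ε * ‖z - 0‖ ^ 2 - b
  have hbr1 : ∀ z ∈ closure Ω, br z ≤ -σ / 8 := fun z hz => by
    have : ε * ‖z - 0‖ ^ 2 ≤ ε * C ^ 2 := by rw [sub_zero]; gcongr; exact D.norm_le z hz
    simp only [br]; linarith
  have hbr2 : ∀ z, -σ / 4 ≤ br z := fun z => by
    have : 0 ≤ ε * ‖z - 0‖ ^ 2 := by positivity
    simp only [br]; linarith
  have hg1 : ∀ t, -σ ≤ t → t ≤ 0 → g t ≤ 3 / 4 * t := fun t h1 h2 => by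
    simp only [g]
    have : 2 * K * t ≥ - (1 / 4) := by nlinarith
    nlinarith
  have hg2 : ∀ t, t ≤ g t := fun t => by
    have : 0 ≤ 2 * K * t ^ 2 := by positivity
    simp only [g]; linarith
  have hgσ : ∀ z, g (-σ) ≤ br z := fun z => by
    have := hg1 (-σ) le_rfl (by linarith)
    linarith [hbr2 z]
  refine ⟨fun z => max (g (max (ρ z) (-σ))) (br z), min (c / 2) ε, 2 + 8 * C / σ, D.isOpen, fun z hz => D.neg hz, by positivity,
    by positivity, ?_, fun z hz => ?_, fun z hz => ?_, fun z hz => ?_⟩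
  · have h1 : ContinuousOn (fun z => max (ρ z) (-σ)) (closure Ω) := D.cont.sup continuousOn_const
    have hgc : Continuous g := by fun_prop
    have hbc : Continuous br := by fun_prop
    exact (hgc.comp_continuousOn h1).sup hbc.continuousOn
  · have h0 := D.nonpos hz
    have hρC := _root_.abs_le.1 (D.abs_le z hz)
    have hA : -ρ z ≤ (2 + 8 * C / σ) * -g (max (ρ z) (-σ)) := by
      rcases le_total (-σ) (ρ z) with h | h
      · rw [max_eq_left h]
        have := hg1 _ h h0
        have h8 : 0 ≤ 8 * C / σ * -g (ρ z) := mul_nonneg (by positivity) (by linarith)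
        nlinarith
      · rw [max_eq_right h]
        have := hg1 (-σ) le_rfl (by linarith)
        have h8 : 8 * C / σ * (3 / 4 * σ) ≤ 8 * C / σ * -g (-σ) := by gcongr; linarith
        have h9 : 8 * C / σ * (3 / 4 * σ) = 6 * C := by field_simp; norm_num
        nlinarith
    have hB : -ρ z ≤ (2 + 8 * C / σ) * -br z := by
      have := hbr1 z hz
      have h8 : 8 * C / σ * (σ / 8) ≤ 8 * C / σ * -br z := by gcongr; linarith
      have h9 : 8 * C / σ * (σ / 8) = C := by field_simp
      nlinarith
    rcases max_choice (g (max (ρ z) (-σ))) (br z) with h | h <;> simp only [h]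
    exacts [hA, hB]
  · have h1 := le_max_left (g (max (ρ z) (-σ))) (br z)
    have h2 := hg2 (max (ρ z) (-σ))
    have h3 := le_max_left (ρ z) (-σ)
    have h4 : 0 ≤ 8 * C / σ * -ρ z := mul_nonneg (by positivity) (by linarith [D.nonpos hz])
    have := D.nonpos hz
    nlinarith
  · have hcl := subset_closure hz
    have hcd := D.contDiffAt z hcl z (by simpa using D.η_pos.le)
    have hneg := D.neg hz
    by_cases hcase : -σ < ρ z ∧ br z ≤ g (ρ z)
    · obtain ⟨h1, h2⟩ := levi_add_mul_sq hcd (2 * K)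
      refine ⟨fun w => ρ w + 2 * K * ρ w ^ 2, h1, ?_, ?_, fun v => ?_⟩
      · simp only [max_eq_left hcase.1.le]
        exact (max_eq_left hcase.2).symm
      · filter_upwards [hcd.continuousAt.eventually (lt_mem_nhds hcase.1)] with w hw
        rw [max_eq_left hw.le]
        exact le_max_left _ _
      · rw [h2]
        have h3 := hl z hcl (by linarith [hcase.1]) v
        have hs : (1 : ℝ) / 2 ≤ 1 + 2 * (2 * K) * ρ z := by nlinarith [hcase.1]
        have hs' : 1 + 2 * (2 * K) * ρ z ≤ 1 := by nlinarith
        have h4 : 0 ≤ K * ‖nu ρ z v‖ ^ 2 := by positivity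
        have h5 : min (c / 2) ε * ‖v‖ ^ 2 ≤ c / 2 * ‖v‖ ^ 2 := by gcongr; exact min_le_left _ _
        have h6 : 0 ≤ c * ‖v‖ ^ 2 := by positivity
        nlinarith
    · refine ⟨br, (levi_norm_sq z 0 ε b).1, ?_, Eventually.of_forall fun w => le_max_right _ _, fun v => ?_⟩
      · refine (max_eq_right ?_).symm
        rcases le_or_gt (ρ z) (-σ) with h | h
        · rw [max_eq_right h]; exact hgσ z
        · rw [max_eq_left h.le]
          exact (not_le.1 fun h' => hcase ⟨h, h'⟩).le
      · rw [(levi_norm_sq z v ε b).2]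
        gcongr; exact min_le_right _ _

end Psh

section Psh2
variable {Ω : Set (E N)} {α : ℝ} {ρ Ψ : E N → ℝ} {ε C : ℝ}

lemma PshExh.neg' (H : PshExh Ω ρ Ψ ε C) {z : E N} (hz : z ∈ Ω) : Ψ z < 0 := by
  have h1 := H.le z (subset_closure hz)
  have h2 := H.neg z hz
  by_contra! h
  nlinarith [mul_nonneg H.C_pos.le h]

lemma laplacian_add_fun {f g : ℂ → ℝ} {a : ℂ} (hf : ContDiffAt ℝ 2 f a) (hg : ContDiffAt ℝ 2 g a) :
    Laplacian.laplacian (fun ζ => f ζ + g ζ) a = Laplacian.laplacian f a + Laplacian.laplacian g a :=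
  hf.laplacian_add hg

lemma laplacian_mul_fun {f : ℂ → ℝ} {a : ℂ} (hf : ContDiffAt ℝ 2 f a) (c : ℝ) :
    ContDiffAt ℝ 2 (fun ζ => c * f ζ) a ∧
    Laplacian.laplacian (fun ζ => c * f ζ) a = c * Laplacian.laplacian f a :=
  ⟨contDiffAt_const.mul hf, InnerProductSpace.laplacian_smul c hf⟩

lemma PshExh.not_isLocalMax (H : PshExh Ω ρ Ψ ε C) {ψ : ℂ → E N} {a : ℂ} (hψ : AnalyticAt ℂ ψ a)
    (ha : ψ a ∈ Ω) {f : ℂ → ℝ} (hf : ContDiffAt ℝ 2 f a)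
    (hlap : 0 < 4 * ε * ‖deriv ψ a‖ ^ 2 + Laplacian.laplacian f a) :
    ¬ IsLocalMax (fun ζ => Ψ (ψ ζ) + f ζ) a := by
  intro hm
  obtain ⟨Q, hQ, hQe, hQl, hQv⟩ := H.branch _ ha
  obtain ⟨hc, hl⟩ := laplacian_comp hQ hψ
  have hloc : IsLocalMax (fun ζ => Q (ψ ζ) + f ζ) a := by
    filter_upwards [hm, hψ.continuousAt.eventually hQl] with ζ h1 h2
    rw [hQe]
    linarith
  have h1 := laplacian_nonpos_of_isLocalMax (hc.add hf) hloc
  rw [laplacian_add_fun hc hf, hl] at h1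
  have h2 := hQv (deriv ψ a)
  rw [levi_eq] at h2
  linarith

lemma PshExh.sq_norm_deriv_le (H : PshExh Ω ρ Ψ ε C) {ψ : ℂ → E N} (hψ : DifferentiableOn ℂ ψ (ball 0 1))
    (hm : MapsTo ψ (ball 0 1) Ω) : ‖deriv ψ 0‖ ^ 2 ≤ 4 * C / ε * -ρ (ψ 0) := by
  have hε := H.ε_pos
  set p := deriv ψ 0 with hp
  set φ₁ := dslope ψ 0 with hφ₁
  have h0b : (0 : ℂ) ∈ ball (0 : ℂ) 1 := by simp
  have hφd : DifferentiableOn ℂ φ₁ (ball 0 1) :=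
    (Complex.differentiableOn_dslope (isOpen_ball.mem_nhds h0b)).2 hψ
  have hsub : closedBall (0 : ℂ) (1 / 2) ⊆ ball 0 1 := closedBall_subset_ball (by norm_num)
  have hdc : DifferentiableOn ℂ (fun ζ => (ε / 4 : ℂ) * (2 * inner ℂ p (φ₁ ζ) - (‖p‖ ^ 2 : ℝ))) (ball 0 1) := by
    have h1 : DifferentiableOn ℂ (fun ζ => innerSL ℂ p (φ₁ ζ)) (ball 0 1) :=
      (innerSL ℂ p).differentiable.comp_differentiableOn hφd
    exact (h1.const_mul 2).sub_const _ |>.const_mul _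
  set h : ℂ → ℂ := fun ζ => (ε / 4 : ℂ) * (2 * inner ℂ p (φ₁ ζ) - (‖p‖ ^ 2 : ℝ)) with hh
  have hre : ∀ ζ, (h ζ).re = ε / 4 * (2 * (inner ℂ p (φ₁ ζ)).re - ‖p‖ ^ 2) := fun ζ => by
    have : h ζ = ((ε / 4 : ℝ) : ℂ) * (2 * inner ℂ p (φ₁ ζ) - (‖p‖ ^ 2 : ℝ)) := by simp [hh]
    rw [this, Complex.re_ofReal_mul, Complex.sub_re, Complex.ofReal_re]
    simp
  have key : ∀ s > 0, Ψ (ψ 0) + ε / 4 * ‖p‖ ^ 2 ≤ s := by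
    intro s hs
    let f : ℂ → ℝ := fun ζ => ((h ζ).re + -ε * ‖ψ ζ - ψ 0‖ ^ 2) + s * ‖id ζ‖ ^ 2
    let W : ℂ → ℝ := fun ζ => Ψ (ψ ζ) + f ζ
    have hcont : ContinuousOn W (closedBall 0 (1 / 2)) := by
      have c1 : ContinuousOn ψ (closedBall 0 (1 / 2)) := hψ.continuousOn.mono hsub
      have c2 : ContinuousOn h (closedBall 0 (1 / 2)) := hdc.continuousOn.mono hsub
      refine ContinuousOn.add (H.cont.comp c1 fun ζ hζ => subset_closure (hm (hsub hζ)))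
        (ContinuousOn.add (ContinuousOn.add (Complex.continuous_re.comp_continuousOn c2) ?_) ?_)
      · exact continuousOn_const.mul ((c1.sub continuousOn_const).norm.pow 2)
      · simp only [id]; fun_prop
    obtain ⟨x, hx, hmax⟩ := (isCompact_closedBall (0 : ℂ) (1 / 2)).exists_isMaxOn ⟨0, by simp⟩ hcont
    have hxs : ‖x‖ = 1 / 2 := by
      by_contra hne
      have hlt : x ∈ ball (0 : ℂ) (1 / 2) := by
        rw [mem_ball_zero_iff]; exact lt_of_le_of_ne (by simpa using hx) hne
      have hxb := hsub hx
      have hn : ball (0 : ℂ) 1 ∈ 𝓝 x := isOpen_ball.mem_nhds hxb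
      have a1 : AnalyticAt ℂ ψ x := hψ.analyticAt hn
      have a2 : AnalyticAt ℂ h x := hdc.analyticAt hn
      obtain ⟨l1, l1'⟩ := laplacian_re a2
      obtain ⟨l2, l2'⟩ := laplacian_norm_sub_sq (ψ 0) a1
      obtain ⟨l3, l3'⟩ := laplacian_norm_sq (analyticAt_id (𝕜 := ℂ) (z := x))
      obtain ⟨m2, m2'⟩ := laplacian_mul_fun l2 (-ε)
      obtain ⟨m3, m3'⟩ := laplacian_mul_fun l3 s
      refine H.not_isLocalMax (f := f) a1 (hm hxb) ((l1.add m2).add m3) ?_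
        (hmax.isLocalMax (Filter.mem_of_superset (isOpen_ball.mem_nhds hlt) ball_subset_closedBall))
      have := laplacian_add_fun (l1.add m2) m3
      rw [laplacian_add_fun l1 m2, m2', m3', l1', l2', l3'] at this
      refine lt_of_lt_of_eq ?_ (congrArg _ this.symm)
      rw [deriv_id, norm_one]
      linarith
    have h1 : W 0 ≤ W x := hmax (by simp)
    have hxb := hsub hx
    have h2 : Ψ (ψ x) ≤ 0 := (H.neg' (hm hxb)).le
    have h3 : ψ x - ψ 0 = x • φ₁ x := by
      have := sub_smul_dslope ψ 0 x
      rw [sub_zero] at this; exact this.symm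
    have h4 : W 0 = Ψ (ψ 0) + ε / 4 * ‖p‖ ^ 2 := by
      have : (inner ℂ p (φ₁ 0)).re = ‖p‖ ^ 2 := by
        rw [hφ₁, dslope_same, inner_self_eq_norm_sq_to_K]; norm_cast
      simp only [W, f, hre, this, sub_self, norm_zero, id]
      ring
    have h5 : (h x).re + -ε * ‖ψ x - ψ 0‖ ^ 2 ≤ 0 := by
      rw [h3, norm_smul, hxs, hre]
      have : 0 ≤ ‖φ₁ x - p‖ ^ 2 := by positivity
      rw [norm_sub_sq (𝕜 := ℂ)] at this
      have h6 : RCLike.re (inner ℂ (φ₁ x) p) = (inner ℂ p (φ₁ x)).re := by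
        rw [← inner_conj_symm]; exact Complex.conj_re _
      rw [h6] at this
      nlinarith
    have h7 : W x = Ψ (ψ x) + (((h x).re + -ε * ‖ψ x - ψ 0‖ ^ 2) + s * ‖x‖ ^ 2) := rfl
    rw [hxs] at h7
    linarith
  have h1 : Ψ (ψ 0) + ε / 4 * ‖p‖ ^ 2 ≤ 0 := le_of_forall_pos_le_add fun s hs => by linarith [key s hs]
  have h2 := H.ge _ (subset_closure (hm h0b))
  rw [div_mul_eq_mul_div, le_div_iff₀ hε]
  linarith

lemma PshExh.sq_norm_deriv_le' (H : PshExh Ω ρ Ψ ε C) {ψ : ℂ → E N} (hψ : DifferentiableOn ℂ ψ (ball 0 1))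
    (hm : MapsTo ψ (ball 0 1) Ω) {a : ℂ} (ha : a ∈ ball (0 : ℂ) 1) :
    (1 - ‖a‖) ^ 2 * ‖deriv ψ a‖ ^ 2 ≤ 4 * C / ε * -ρ (ψ a) := by
  have ha' : 0 < 1 - ‖a‖ := by have := mem_ball_zero_iff.1 ha; linarith
  have hin : MapsTo (fun ζ : ℂ => a + ((1 - ‖a‖ : ℝ) : ℂ) * ζ) (ball 0 1) (ball 0 1) := fun ζ hζ => by
    rw [mem_ball_zero_iff] at hζ ⊢
    refine (norm_add_le _ _).trans_lt ?_
    rw [norm_mul, Complex.norm_real, Real.norm_of_nonneg ha'.le]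
    nlinarith
  have hd : ∀ ζ, HasDerivAt (fun ζ : ℂ => a + ((1 - ‖a‖ : ℝ) : ℂ) * ζ) ((1 - ‖a‖ : ℝ) : ℂ) ζ := fun ζ => by
    simpa using ((hasDerivAt_id ζ).const_mul ((1 - ‖a‖ : ℝ) : ℂ)).const_add a
  have hc : DifferentiableOn ℂ (fun ζ : ℂ => ψ (a + ((1 - ‖a‖ : ℝ) : ℂ) * ζ)) (ball 0 1) :=
    hψ.comp (fun ζ _ => (hd ζ).differentiableAt.differentiableWithinAt) hin
  have h := H.sq_norm_deriv_le hc (hm.comp hin)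
  have he : deriv (fun ζ : ℂ => ψ (a + ((1 - ‖a‖ : ℝ) : ℂ) * ζ)) 0 = ((1 - ‖a‖ : ℝ) : ℂ) • deriv ψ a := by
    have h1 : HasDerivAt ψ (deriv ψ a) (a + ((1 - ‖a‖ : ℝ) : ℂ) * 0) := by
      rw [mul_zero, add_zero]; exact (hψ.differentiableAt (isOpen_ball.mem_nhds ha)).hasDerivAt
    exact (h1.scomp (0 : ℂ) (hd 0)).deriv
  rw [he, norm_smul, Complex.norm_real, Real.norm_of_nonneg ha'.le, mul_pow, mul_zero, add_zero] at h
  exact h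

lemma PshExh.hopf (H : PshExh Ω ρ Ψ ε C) {ψ : ℂ → E N} (hψ : DifferentiableOn ℂ ψ (ball 0 1))
    (hm : MapsTo ψ (ball 0 1) Ω) {r₀ m : ℝ} (hr₀ : 0 < r₀) (hr₁ : r₀ < 1) (hm0 : 0 < m)
    (hin : ∀ ζ ∈ closedBall (0 : ℂ) r₀, m ≤ -Ψ (ψ ζ)) {ζ : ℂ} (hζ : ζ ∈ ball (0 : ℂ) 1) :
    m * r₀ ^ 2 * (1 - ‖ζ‖) ≤ -Ψ (ψ ζ) := by
  have hζ1 := mem_ball_zero_iff.1 hζ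
  rcases le_or_gt ‖ζ‖ r₀ with hle | hgt
  · refine le_trans ?_ (hin ζ (by simpa using hle))
    have : r₀ ^ 2 * (1 - ‖ζ‖) ≤ 1 := mul_le_one₀ (by nlinarith) (by linarith) (by linarith [norm_nonneg ζ])
    nlinarith
  have hε := H.ε_pos
  set c := m * r₀ ^ 2 with hc
  have hcp : 0 < c := by positivity
  let f : ℂ → ℝ := fun ζ => c * ‖ζ⁻¹‖ ^ 2
  have key : ∀ R, ‖ζ‖ < R → R < 1 → Ψ (ψ ζ) + f ζ ≤ c * (R⁻¹) ^ 2 := by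
    intro R hR hR1
    have hR0 : 0 < R := (norm_nonneg ζ).trans_lt hR
    set K : Set ℂ := closedBall 0 R \ ball 0 r₀ with hK
    have hKc : IsCompact K := (isCompact_closedBall _ _).diff isOpen_ball
    have hK1 : ∀ x ∈ K, x ∈ ball (0 : ℂ) 1 ∧ r₀ ≤ ‖x‖ ∧ ‖x‖ ≤ R := fun x hx => by
      have h1 : ‖x‖ ≤ R := by simpa using hx.1
      have h2 : ¬ ‖x‖ < r₀ := by simpa using hx.2
      exact ⟨by simpa using h1.trans_lt hR1, not_lt.1 h2, h1⟩
    have hne : ∀ x ∈ K, x ≠ 0 := fun x hx => by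
      have := (hK1 x hx).2.1
      exact norm_pos_iff.1 (hr₀.trans_le this)
    have hcont : ContinuousOn (fun ζ => Ψ (ψ ζ) + f ζ) K := by
      refine ContinuousOn.add (H.cont.comp (hψ.continuousOn.mono fun x hx => (hK1 x hx).1)
        fun x hx => subset_closure (hm (hK1 x hx).1)) (continuousOn_const.mul ?_)
      exact ((continuousOn_id.inv₀ hne).norm.pow 2)
    obtain ⟨x, hx, hmax⟩ := hKc.exists_isMaxOn ⟨ζ, by simpa using hR.le, by simpa using hgt.le⟩ hcont
    have h1 : Ψ (ψ ζ) + f ζ ≤ Ψ (ψ x) + f x := hmax ⟨by simpa using hR.le, by simpa using hgt.le⟩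
    obtain ⟨hxb, hx1, hx2⟩ := hK1 x hx
    refine h1.trans ?_
    have hfx : f x = c * (‖x‖⁻¹) ^ 2 := by simp [f]
    rw [hfx]
    rcases hx1.eq_or_lt with e | hx1
    · have h2 := hin x (by simp [← e])
      rw [← e]
      have h3 : c * (r₀⁻¹) ^ 2 = m := by rw [hc]; field_simp
      have : 0 < c * (R⁻¹) ^ 2 := by positivity
      linarith
    rcases hx2.eq_or_lt with e | hx2
    · rw [e]; linarith [H.neg' (hm hxb)]
    exfalso
    have hn : ball (0 : ℂ) 1 ∈ 𝓝 x := isOpen_ball.mem_nhds hxb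
    have a1 : AnalyticAt ℂ ψ x := hψ.analyticAt hn
    have a2 : AnalyticAt ℂ (fun ζ : ℂ => ζ⁻¹) x := analyticAt_inv (hne x hx)
    obtain ⟨l1, l1'⟩ := laplacian_norm_sq a2
    obtain ⟨m1, m1'⟩ := laplacian_mul_fun l1 c
    refine H.not_isLocalMax (f := f) a1 (hm hxb) m1 ?_ (hmax.isLocalMax ?_)
    · have : Laplacian.laplacian f x = _ := m1'
      rw [this, l1', deriv_inv]
      have : 0 < ‖-(x ^ 2)⁻¹‖ := by
        rw [norm_pos_iff]; have := hne x hx; simpa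
      positivity
    · refine Filter.mem_of_superset (((isOpen_ball (x := (0:ℂ)) (ε := R)).sdiff
        (isClosed_closedBall (x := (0:ℂ)) (ε := r₀))).mem_nhds (x := x) ⟨?_, ?_⟩) ?_
      · simpa using hx2
      · simpa using hx1
      · exact fun y hy => ⟨ball_subset_closedBall hy.1, fun h => hy.2 (ball_subset_closedBall h)⟩
  have hlim : Tendsto (fun R : ℝ => c * (R⁻¹) ^ 2) (𝓝[<] 1) (𝓝 (c * ((1 : ℝ)⁻¹) ^ 2)) := by
    refine (ContinuousAt.tendsto ?_).mono_left nhdsWithin_le_nhds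
    exact continuousAt_const.mul ((continuousAt_inv₀ one_ne_zero).pow 2)
  have h2 : Ψ (ψ ζ) + f ζ ≤ c * ((1 : ℝ)⁻¹) ^ 2 := by
    refine ge_of_tendsto hlim ?_
    filter_upwards [Ioo_mem_nhdsLT hζ1] with R hR using key R hR.1 hR.2
  have h3 : f ζ = c * (‖ζ‖⁻¹) ^ 2 := by simp [f]
  have h0 : 0 < ‖ζ‖ := hr₀.trans hgt
  have h4 : 1 + (1 - ‖ζ‖) ≤ (‖ζ‖⁻¹) ^ 2 := by
    rw [inv_pow, ← one_div, le_div_iff₀ (by positivity)]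
    nlinarith [sq_nonneg (1 - ‖ζ‖), norm_nonneg ζ]
  nlinarith
end Psh2

section Dom
variable {Ω : Set (E N)} {α η C ε : ℝ} {ρ Ψ : E N → ℝ}

lemma psd_zero_right (ξ : ℂ) : psd ξ 0 = ‖ξ‖ := by simp [psd]

lemma lempert_le_artanh_of_zero {ψ : ℂ → E N} (h1 : DifferentiableOn ℂ ψ (ball 0 1))
    (h2 : MapsTo ψ (ball 0 1) Ω) {s : ℂ} (hs : s ∈ ball (0 : ℂ) 1) :
    lempert Ω (ψ 0) (ψ s) ≤ artanh ‖s‖ ∧ lempert Ω (ψ s) (ψ 0) ≤ artanh ‖s‖ := by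
  have h0 : (0 : ℂ) ∈ ball (0 : ℂ) 1 := by simp
  constructor
  · simpa only [poincare_eq, psd_zero_left] using lempert_le_poincare h1 h2 h0 hs
  · simpa only [poincare_eq, psd_zero_right] using lempert_le_poincare h1 h2 hs h0

lemma DefFn.exists_inner_disc (D : DefFn Ω α ρ η C) : ∃ r₀ : ℝ, 0 < r₀ ∧ r₀ ≤ 1 / 4 ∧
    ∀ q ∈ frontier Ω, ∀ w : E N, ‖w‖ = 1 → (nu ρ q w = -(‖nu ρ q‖ : ℂ)) → ∀ l ∈ ball (0 : ℂ) 1,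
      q + ((r₀ : ℂ) * (1 - l)) • w ∈ Ω ∧
      ρ (q + ((r₀ : ℂ) * (1 - l)) • w) ≤ -(r₀ / (2 * C)) * (1 - l).re := by
  have hC := D.C_pos
  have h1C := D.one_le
  have hη := D.η_pos
  have hr : 0 < min (η / 2) (1 / (4 * C ^ 2)) := by positivity
  have e1 : min (η / 2) (1 / (4 * C ^ 2)) ≤ η / 2 := min_le_left _ _
  have e2 : min (η / 2) (1 / (4 * C ^ 2)) ≤ 1 / (4 * C ^ 2) := min_le_right _ _
  generalize min (η / 2) (1 / (4 * C ^ 2)) = r₀ at hr e1 e2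
  have e3 : r₀ * (4 * C ^ 2) ≤ 1 := by rwa [le_div_iff₀ (by positivity)] at e2
  refine ⟨r₀, hr, by nlinarith [mul_le_mul h1C h1C zero_le_one hC.le], fun q hq w hw hn l hl => ?_⟩
  have hq' := frontier_subset_closure hq
  have hl1 := mem_ball_zero_iff.1 hl
  set x := (1 - l).re with hx
  have hsq : ‖1 - l‖ ^ 2 ≤ 2 * x := by
    have h1 : ‖l‖ ^ 2 ≤ 1 := by nlinarith [norm_nonneg l]
    rw [← Complex.normSq_eq_norm_sq, Complex.normSq_apply] at h1 ⊢
    simp only [hx, Complex.sub_re, Complex.sub_im, Complex.one_re, Complex.one_im]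
    nlinarith
  have hxp : 0 < x := by
    have := Complex.re_le_norm l
    simp only [hx, Complex.sub_re, Complex.one_re]; linarith
  have hnorm : ‖((r₀ : ℂ) * (1 - l)) • w‖ = r₀ * ‖1 - l‖ := by
    rw [norm_smul, norm_mul, Complex.norm_real, Real.norm_of_nonneg hr.le, hw, mul_one]
  have h2 : ‖1 - l‖ ≤ 2 := (norm_sub_le _ _).trans (by rw [norm_one]; linarith)
  have hle : ‖q + ((r₀ : ℂ) * (1 - l)) • w - q‖ ≤ η := by
    rw [add_sub_cancel_left, hnorm]; nlinarith
  have ht := (_root_.abs_le.1 (D.taylor q hq' _ hle)).2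
  rw [D.zero hq, add_sub_cancel_left, hnorm, ← nu_re, map_smul, hn, smul_eq_mul] at ht
  have hre : ((r₀ : ℂ) * (1 - l) * -(‖nu ρ q‖ : ℂ)).re = -(r₀ * x * ‖nu ρ q‖) := by
    simp [Complex.mul_re, hx]
  rw [hre] at ht
  have hg := D.grad q hq
  rw [← norm_nu] at hg
  have hν : 1 / C ≤ ‖nu ρ q‖ := by rwa [div_le_iff₀' hC]
  have hk : ρ (q + ((r₀ : ℂ) * (1 - l)) • w) ≤ -(r₀ / (2 * C)) * x := by
    have h3 : r₀ * x * (1 / C) ≤ r₀ * x * ‖nu ρ q‖ := by gcongr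
    have h4 : C * (r₀ * ‖1 - l‖) ^ 2 ≤ r₀ * x * (1 / (2 * C)) := by
      rw [mul_pow, mul_one_div, le_div_iff₀ (by positivity)]
      calc C * (r₀ ^ 2 * ‖1 - l‖ ^ 2) * (2 * C) ≤ C * (r₀ ^ 2 * (2 * x)) * (2 * C) := by gcongr
        _ = r₀ * x * (r₀ * (4 * C ^ 2)) := by ring
        _ ≤ r₀ * x * 1 := by gcongr
        _ = _ := mul_one _
    have h5 : r₀ * x * (1 / C) = r₀ * x * (1 / (2 * C)) + r₀ / (2 * C) * x := by field_simp; ring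
    linarith
  exact ⟨(D.mem_iff q hq' _ hle).2 (hk.trans_lt (by rw [neg_mul, neg_lt_zero]; positivity)), hk⟩

lemma DefFn.exists_lempert_le (D : DefFn Ω α ρ η C) (hne : (frontier Ω).Nonempty) :
    ∃ C₁, ∃ K ⊆ Ω, IsCompact K ∧ ∀ z ∈ Ω, ∃ c ∈ K,
      lempert Ω z c ≤ C₁ + Real.log (1 / bdist Ω z) / 2 ∧
      lempert Ω c z ≤ C₁ + Real.log (1 / bdist Ω z) / 2 := by
  obtain ⟨r₀, hr, hr4, H⟩ := D.exists_inner_disc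
  obtain ⟨C', hC', hb⟩ := D.bdist_le_neg
  have hC := D.C_pos
  have h1C := D.one_le
  set κ := min (r₀ / (2 * C)) (r₀ / C') with hκ
  have hκ0 : 0 < κ := by positivity
  have hK : IsClosed {z ∈ closure Ω | ρ z ∈ Iic (-κ)} :=
    D.cont.preimage_isClosed_of_isClosed isClosed_closure isClosed_Iic
  refine ⟨Real.log (2 * C) / 2, {z ∈ closure Ω | ρ z ∈ Iic (-κ)}, ?_,
    D.isCompact.of_isClosed_subset hK fun _ h => h.1, fun z hz => ?_⟩
  · rintro z ⟨hz, hz'⟩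
    rw [D.mem_iff z hz z (by simpa using D.η_pos.le)]
    exact lt_of_le_of_lt hz' (by linarith)
  have hd := D.bdist_pos hz hne
  set δ := bdist Ω z with hδ
  have hlog : 0 ≤ Real.log (2 * C) / 2 := by
    have := Real.log_nonneg (x := 2 * C) (by linarith)
    positivity
  rcases le_or_gt δ r₀ with h | h
  · obtain ⟨q, hq, hqd⟩ := DefFn.exists_closest (z := z) hne
    obtain ⟨s, hs, hsq⟩ := D.nu_closest hz hq (by rw [dist_eq_norm, hqd])
    set w : E N := ((δ⁻¹ : ℝ) : ℂ) • (z - q) with hw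
    have hw1 : ‖w‖ = 1 := by
      rw [hw, norm_smul, ← hqd, Complex.norm_real, norm_inv, Real.norm_of_nonneg hd.le, inv_mul_cancel₀ hd.ne']
    have hn : nu ρ q w = -(‖nu ρ q‖ : ℂ) := by
      have h1 : ‖nu ρ q‖ = s * δ := by
        rw [← norm_nrm, hsq, norm_smul, Complex.norm_real, Real.norm_of_nonneg hs.le, norm_sub_rev, ← hqd]
      have h2 : w = -(((δ⁻¹ : ℝ) : ℂ) * ((s⁻¹ : ℝ) : ℂ)) • nrm ρ q := by
        rw [hsq, smul_smul, neg_mul, mul_assoc, ← Complex.ofReal_mul, inv_mul_cancel₀ hs.ne',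
          Complex.ofReal_one, mul_one, hw, neg_smul, ← smul_neg, neg_sub]
      rw [h2, map_smul, nu_nrm, h1, smul_eq_mul]
      push_cast
      have : (δ : ℂ) ≠ 0 := by exact_mod_cast hd.ne'
      have : (s : ℂ) ≠ 0 := by exact_mod_cast hs.ne'
      field_simp
    have H' := H q hq w hw1 hn
    have h0 : (0 : ℂ) ∈ ball (0 : ℂ) 1 := by simp
    have hx : 0 ≤ 1 - δ / r₀ := by rw [sub_nonneg, div_le_one hr]; exact h
    have hx1 : 1 - δ / r₀ < 1 := by have : 0 < δ / r₀ := by positivity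
                                    linarith
    have hxn : ‖((1 - δ / r₀ : ℝ) : ℂ)‖ = 1 - δ / r₀ := by rw [Complex.norm_real, Real.norm_of_nonneg hx]
    have hL := lempert_le_artanh_of_zero (Ω := Ω) (ψ := fun l : ℂ => q + ((r₀ : ℂ) * (1 - l)) • w)
      (by fun_prop) (fun l hl => (H' l hl).1) (s := ((1 - δ / r₀ : ℝ) : ℂ))
      (by rw [mem_ball_zero_iff, hxn]; exact hx1)
    have he : q + ((r₀ : ℂ) * (1 - ((1 - δ / r₀ : ℝ) : ℂ))) • w = z := by
      have : (r₀ : ℂ) * (1 - ((1 - δ / r₀ : ℝ) : ℂ)) * ((δ⁻¹ : ℝ) : ℂ) = 1 := by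
        push_cast
        have : (δ : ℂ) ≠ 0 := by exact_mod_cast hd.ne'
        have : (r₀ : ℂ) ≠ 0 := by exact_mod_cast hr.ne'
        field_simp
        ring
      rw [hw, smul_smul, this, one_smul, add_sub_cancel]
    have hA : artanh (1 - δ / r₀) ≤ Real.log (1 / δ) / 2 := by
      unfold artanh
      refine div_le_div_of_nonneg_right (Real.log_le_log (by apply div_pos <;> linarith) ?_) zero_le_two
      · rw [sub_sub_cancel, div_le_div_iff₀ (by positivity) hd]
        have : δ / r₀ * 4 ≥ δ * 16 := by
          rw [ge_iff_le, div_mul_eq_mul_div, le_div_iff₀ hr]; nlinarith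
        have : 0 < δ / r₀ := by positivity
        nlinarith
    rw [hxn] at hL
    simp only [he] at hL
    refine ⟨_, ⟨subset_closure (H' 0 h0).1, (H' 0 h0).2.trans ?_⟩, hL.2.trans ?_, hL.1.trans ?_⟩
    · have := min_le_left (r₀ / (2 * C)) (r₀ / C')
      simp only [sub_zero, Complex.one_re, mul_one]
      linarith
    · linarith
    · linarith
  · refine ⟨z, ⟨subset_closure hz, ?_⟩, ?_⟩
    · have h1 := hb z (subset_closure hz)
      have h2 : r₀ / C' ≤ -ρ z := by rw [div_le_iff₀ (by positivity)]; linarith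
      have := min_le_right (r₀ / (2 * C)) (r₀ / C')
      show ρ z ≤ -κ
      linarith
    · rw [lempert_self hz, and_self, ← add_div, ← Real.log_mul (by positivity) (by positivity)]
      have : 1 ≤ 2 * C * (1 / δ) := by
        rw [mul_one_div, le_div_iff₀ hd, one_mul]; exact D.bdist_le (subset_closure hz)
      have := Real.log_nonneg this
      positivity

lemma exists_lempert_le_of_isCompact {K : Set (E N)} (hK : IsCompact K) (hΩ : IsOpen Ω) (hs : K ⊆ Ω) :
    ∃ M, ∀ z ∈ K, ∀ w ∈ K, ∃ a ∈ Ω, ∃ b ∈ Ω,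
      lempert Ω z a + lempert Ω a b + lempert Ω b w ≤ M := by
  have h1 : ∀ x : K, ∃ r > 0, ball (x : E N) (2 * r) ⊆ Ω := fun x => by
    obtain ⟨r, hr, h⟩ := Metric.isOpen_iff.1 hΩ x (hs x.2)
    exact ⟨r / 2, by positivity, by rwa [mul_div_cancel₀ _ two_ne_zero]⟩
  choose r hr hb using h1
  obtain ⟨t, ht⟩ := hK.elim_finite_subcover (fun x : K => ball (x : E N) (r x)) (fun _ => isOpen_ball)
    (fun x hx => mem_iUnion.2 ⟨⟨x, hx⟩, mem_ball_self (hr _)⟩)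
  have h2 : ∀ (x : K) (c : E N), c ∈ ball (x : E N) (r x) →
      lempert Ω x c ≤ artanh (1 / 2) ∧ lempert Ω c x ≤ artanh (1 / 2) := fun x c hc => by
    have := lempert_le_artanh_of_zero (Ω := Ω) (ψ := fun l : ℂ => (x : E N) + l • ((2 : ℂ) • (c - x)))
      (by fun_prop) (fun l hl => hb x ?_) (s := 1 / 2) (by norm_num)
    · simpa [smul_smul] using this
    · rw [mem_ball_zero_iff] at hl
      rw [mem_ball_iff_norm] at hc
      rw [mem_ball_iff_norm, add_sub_cancel_left, norm_smul, norm_smul, Complex.norm_ofNat]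
      nlinarith [norm_nonneg (c - x), norm_nonneg l, hr x]
  refine ⟨artanh (1 / 2) + (∑ i ∈ t, ∑ j ∈ t, lempert Ω (i : E N) (j : E N)) + artanh (1 / 2),
    fun z hz w hw => ?_⟩
  obtain ⟨i, hi, hzi⟩ := mem_iUnion₂.1 (ht hz)
  obtain ⟨j, hj, hwj⟩ := mem_iUnion₂.1 (ht hw)
  refine ⟨i, hs i.2, j, hs j.2, ?_⟩
  have h3 : lempert Ω (i : E N) (j : E N) ≤ ∑ i ∈ t, ∑ j ∈ t, lempert Ω (i : E N) (j : E N) :=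
    (Finset.single_le_sum (f := fun j : K => lempert Ω (i : E N) (j : E N))
      (fun _ _ => lempert_nonneg _ _) hj).trans
    (Finset.single_le_sum (f := fun i : K => ∑ j ∈ t, lempert Ω (i : E N) (j : E N))
      (fun _ _ => Finset.sum_nonneg fun _ _ => lempert_nonneg _ _) hi)
  linarith [(h2 i z hzi).2, (h2 j w hwj).1]

lemma DefFn.exists_kobayashi_le (D : DefFn Ω α ρ η C) (hne : (frontier Ω).Nonempty) :
    ∃ C₁, ∀ z ∈ Ω, ∀ w ∈ Ω, kobayashi Ω z w ≤
      C₁ + Real.log (1 / bdist Ω z) / 2 + Real.log (1 / bdist Ω w) / 2 := by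
  obtain ⟨C₁, K, hK, hKc, H⟩ := D.exists_lempert_le hne
  obtain ⟨M, hM⟩ := exists_lempert_le_of_isCompact hKc D.isOpen hK
  refine ⟨C₁ + C₁ + M, fun z hz w hw => ?_⟩
  obtain ⟨c, hc, h1, -⟩ := H z hz
  obtain ⟨d, hd, -, h2⟩ := H w hw
  obtain ⟨a, ha, b, hb, h3⟩ := hM c hc d hd
  have := kobayashi_le_chain hz (hK hc) ha hb (hK hd) hw
  linarith

/-- The properties of a strongly pseudoconvex domain used for its geodesics. -/
structure Dom (Ω : Set (E N)) (α : ℝ) (ρ : E N → ℝ) (C : ℝ) : Prop extends Pkg Ω α ρ C where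
  kob : ∀ ψ : ℂ → E N, DifferentiableOn ℂ ψ (ball 0 1) → MapsTo ψ (ball 0 1) Ω →
    ∀ a ∈ ball (0 : ℂ) 1, (1 - ‖a‖) ^ 2 * ‖deriv ψ a‖ ^ 2 ≤ C * bdist Ω (ψ a)
  hopf : ∀ m > 0, ∃ c > 0, ∀ ψ : ℂ → E N, DifferentiableOn ℂ ψ (ball 0 1) → MapsTo ψ (ball 0 1) Ω →
    m ≤ bdist Ω (ψ 0) → ∀ ζ ∈ ball (0 : ℂ) 1, c * (1 - ‖ζ‖) ≤ bdist Ω (ψ ζ)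
  chain : ∀ z ∈ Ω, ∀ w ∈ Ω, kobayashi Ω z w ≤
    C + Real.log (1 / bdist Ω z) / 2 + Real.log (1 / bdist Ω w) / 2

lemma Pkg.mono {C' : ℝ} (P : Pkg Ω α ρ C) (h : C ≤ C') : Pkg Ω α ρ C' where
  isOpen := P.isOpen
  ne := P.ne
  α_pos := P.α_pos
  α_le := P.α_le
  one_le := P.one_le.trans h
  norm_le := fun x hx => (P.norm_le x hx).trans h
  cont := P.cont
  neg := P.neg
  zero := P.zero
  bdist_le := fun z hz => (P.bdist_le z hz).trans <| by
    have h1 := P.bdist_le z hz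
    have h2 : 0 ≤ bdist Ω z := infDist_nonneg
    have h3 : 0 ≤ -ρ z := by by_contra! h4; nlinarith [P.one_le]
    gcongr
  le_bdist := fun z hz => (P.le_bdist z hz).trans <| by
    have h2 : 0 ≤ bdist Ω z := infDist_nonneg
    gcongr
  one_le_nu := fun q hq => (P.one_le_nu q hq).trans (by gcongr)
  nu_le := fun z hz => (P.nu_le z hz).trans h
  nu_lip := fun z hz q hq => (P.nu_lip z hz q hq).trans (by gcongr)
  val := fun z hz q hq => (P.val z hz q hq).trans (by gcongr)
  dnu := fun z hz q hq τ => (P.dnu z hz q hq τ).trans (by gcongr)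
  formA_le := fun q hq τ => (P.formA_le q hq τ).trans (by gcongr)
  formB_le := fun q hq τ => (P.formB_le q hq τ).trans (by gcongr)
  strict := fun q hq τ hτ => (P.strict q hq τ hτ).trans <| by
    have h1 := P.strict q hq τ hτ
    have h3 : 0 ≤ (formB ρ q τ τ).re := by by_contra! h4; nlinarith [P.one_le, sq_nonneg ‖τ‖]
    gcongr
  push := P.push
  normal := P.normal

theorem DefFn.exists_dom (D : DefFn Ω α ρ η C) (hne : (frontier Ω).Nonempty) :
    ∃ C', Dom Ω α ρ C' := by
  obtain ⟨C₁, P⟩ := D.exists_pkg hne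
  obtain ⟨Ψ, ε, C₂, H⟩ := D.exists_pshExh
  obtain ⟨C₃, hC₃⟩ := D.exists_kobayashi_le hne
  have hε := H.ε_pos
  have hC2 := H.C_pos
  have hC1 : 0 < C₁ := by linarith [P.one_le]
  refine ⟨max (max C₁ C₃) (4 * C₂ / ε * C₁), P.mono (by simp), fun ψ h1 h2 a ha => ?_,
    fun m hm => ?_, fun z hz w hw => ?_⟩
  · have hz := h2 ha
    refine (H.sq_norm_deriv_le' h1 h2 ha).trans ?_
    have h3 := P.le_bdist _ (subset_closure hz)
    have h4 : 0 ≤ bdist Ω (ψ a) := infDist_nonneg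
    calc 4 * C₂ / ε * -ρ (ψ a) ≤ 4 * C₂ / ε * (C₁ * bdist Ω (ψ a)) := by gcongr
      _ = 4 * C₂ / ε * C₁ * bdist Ω (ψ a) := by ring
      _ ≤ _ := by gcongr; exact le_max_right _ _
  · set r₀ : ℝ := min (1 / 2) (m / (4 * (2 * C + 1))) with hr
    have hC := D.C_pos
    have hr0 : 0 < r₀ := by positivity
    have hr1 : r₀ ≤ 1 / 2 := min_le_left _ _
    have hr2 : r₀ * (2 * (2 * C + 1)) ≤ m / 2 := by
      have : r₀ ≤ m / (4 * (2 * C + 1)) := min_le_right _ _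
      rw [le_div_iff₀ (by positivity)] at this; linarith
    refine ⟨m / 2 / C₁ / C₂ * r₀ ^ 2 / C₂ / C₁, by positivity, fun ψ h1 h2 h3 ζ hζ => ?_⟩
    have hin : ∀ ζ ∈ closedBall (0 : ℂ) r₀, m / 2 / C₁ / C₂ ≤ -Ψ (ψ ζ) := fun ξ hξ => by
      have hξ' : ξ ∈ ball (0 : ℂ) 1 := closedBall_subset_ball (by linarith) hξ
      have hξ0 : ‖ξ‖ ≤ r₀ := by simpa using hξ
      have h0 : (0 : ℂ) ∈ ball (0 : ℂ) 1 := by simp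
      have hmaps : MapsTo ψ (ball 0 1) (ball (ψ 0) (2 * C + 1)) := fun x hx => by
        rw [mem_ball, dist_eq_norm]
        have := norm_sub_le (ψ x) (ψ 0)
        linarith [D.norm_le _ (subset_closure (h2 hx)), D.norm_le _ (subset_closure (h2 h0))]
      have hd := Complex.dist_le_div_mul_dist_of_mapsTo_ball h1
        (hmaps.mono_right ball_subset_closedBall) hξ'
      rw [dist_zero_right, div_one] at hd
      have h4 : bdist Ω (ψ 0) ≤ bdist Ω (ψ ξ) + dist (ψ 0) (ψ ξ) := infDist_le_infDist_add_dist
      rw [dist_comm] at h4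
      have h5 : (2 * C + 1) * ‖ξ‖ ≤ (2 * C + 1) * r₀ := by gcongr
      have h6 : m / 2 ≤ bdist Ω (ψ ξ) := by linarith
      have h7 := P.bdist_le _ (subset_closure (h2 hξ'))
      have h8 := H.le _ (subset_closure (h2 hξ'))
      rw [div_div, div_le_iff₀ (by positivity)]
      nlinarith
    have h9 := H.hopf h1 h2 hr0 (by linarith) (by positivity) hin hζ
    have h10 := H.ge _ (subset_closure (h2 hζ))
    have h11 := P.le_bdist _ (subset_closure (h2 hζ))
    have : m / 2 / C₁ / C₂ * r₀ ^ 2 / C₂ / C₁ * (1 - ‖ζ‖) =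
      m / 2 / C₁ / C₂ * r₀ ^ 2 * (1 - ‖ζ‖) / (C₂ * C₁) := by field_simp
    rw [this, div_le_iff₀ (by positivity)]
    nlinarith
  · refine (hC₃ z hz w hw).trans ?_
    have : C₃ ≤ max (max C₁ C₃) (4 * C₂ / ε * C₁) := le_max_of_le_left (le_max_right _ _)
    linarith

end Dom

section Boundary
variable {Ω : Set (E N)} {α C : ℝ} {ρ : E N → ℝ} {φ φd : ℂ → E N}

lemma hasDerivWithinAt_of_quadratic {F : Type*} [NormedAddCommGroup F] [NormedSpace ℝ F]
    {v : ℝ → F} {v' : F} {S : Set ℝ} {s₀ : ℝ} (hv : HasDerivWithinAt v v' S s₀) (h0 : v s₀ = 0)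
    (hs : s₀ ∈ S) {L : F →L[ℝ] ℝ} {u : ℝ → ℝ} {C : ℝ}
    (hu : ∀ s ∈ S, |u s - L (v s)| ≤ C * ‖v s‖ ^ 2) : HasDerivWithinAt u (L v') S s₀ := by
  have h1 : HasDerivWithinAt (fun s => L (v s)) (L v') S s₀ :=
    L.hasFDerivAt.comp_hasDerivWithinAt s₀ hv
  have h2 : HasDerivWithinAt (fun s => u s - L (v s)) 0 S s₀ := by
    have hu0 : u s₀ - L (v s₀) = 0 := by
      have := hu s₀ hs
      rw [h0, norm_zero] at this
      rw [h0]
      exact abs_nonpos_iff.1 (by simpa using this)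
    rw [hasDerivWithinAt_iff_isLittleO]
    simp only [hu0, smul_zero, sub_zero]
    have hO : v =O[𝓝[S] s₀] fun s => s - s₀ := by
      simpa [h0] using hv.hasFDerivWithinAt.isBigO_sub
    have h3 : (fun s => u s - L (v s)) =O[𝓝[S] s₀] fun s => ‖v s‖ ^ 2 := by
      refine Asymptotics.IsBigO.of_bound C (eventually_nhdsWithin_of_forall fun s hs => ?_)
      rw [Real.norm_eq_abs, Real.norm_of_nonneg (sq_nonneg _)]
      exact hu s hs
    refine h3.trans_isLittleO (((Asymptotics.isBigO_norm_left.2 hO).pow 2).trans_isLittleO ?_)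
    have : Tendsto (fun s : ℝ => s - s₀) (𝓝[S] s₀) (𝓝 0) := by
      have : Tendsto (fun s : ℝ => s - s₀) (𝓝 s₀) (𝓝 (s₀ - s₀)) :=
        (continuous_id.sub continuous_const).tendsto _
      rw [sub_self] at this
      exact this.mono_left nhdsWithin_le_nhds
    simpa [pow_two] using ((Asymptotics.isLittleO_one_iff ℝ).2 this).mul_isBigO
      (Asymptotics.isBigO_refl (fun s : ℝ => s - s₀) (𝓝[S] s₀))
  have h4 := h2.add h1
  rw [zero_add] at h4
  exact h4.congr (fun s _ => by simp) (by simp)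

lemma Pkg.bdist_pos (P : Pkg Ω α ρ C) {z : E N} (hz : z ∈ Ω) : 0 < bdist Ω z := by
  have h1 := P.le_bdist z (subset_closure hz)
  have h2 := P.neg z hz
  have := P.one_le
  by_contra! h
  nlinarith

lemma Geo.mem_closure (G : Geo Ω φ φd) {ζ : ℂ} (hζ : ζ ∈ closedBall (0 : ℂ) 1) : φ ζ ∈ closure Ω := by
  rw [← closure_ball (0 : ℂ) one_ne_zero] at hζ
  have hc : ContinuousOn φ (closure (ball 0 1)) := by
    rw [closure_ball (0 : ℂ) one_ne_zero]; exact G.cont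
  exact (hc.image_closure.trans (closure_mono G.geod.2.1.image_subset)) (mem_image_of_mem _ hζ)

lemma Geo.mem_frontier (G : Geo Ω φ φd) (hΩ : IsOpen Ω) {ζ : ℂ} (hζ : ζ ∈ sphere (0 : ℂ) 1) :
    φ ζ ∈ frontier Ω := by
  rw [hΩ.frontier_eq]
  refine ⟨G.mem_closure (sphere_subset_closedBall hζ), fun hin => ?_⟩
  obtain ⟨b, hb, hball⟩ := Metric.isOpen_iff.1 hΩ _ hin
  have hζ1 : ‖ζ‖ = 1 := by simpa using hζ
  obtain ⟨d, hd, hcont⟩ := Metric.continuousOn_iff.1 G.cont ζ (sphere_subset_closedBall hζ) (b / 5)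
    (by positivity)
  have key : ∀ r : ℝ, 0 ≤ r → r < 1 → 1 - d < r →
      ((r : ℂ) * ζ) ∈ ball (0 : ℂ) 1 ∧ dist (φ (r * ζ)) (φ ζ) < b / 5 := fun r h0 h1 hr => by
    have hn : ‖(r : ℂ) * ζ‖ = r := by rw [norm_mul, hζ1, Complex.norm_real, Real.norm_of_nonneg h0, mul_one]
    refine ⟨by rw [mem_ball_zero_iff, hn]; exact h1, hcont _ (by rw [mem_closedBall_zero_iff, hn]; exact h1.le) ?_⟩
    have : (r : ℂ) * ζ - ζ = ((r - 1 : ℝ) : ℂ) * ζ := by push_cast; ring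
    rw [dist_eq_norm, this, norm_mul, hζ1, Complex.norm_real, Real.norm_eq_abs, abs_of_neg (by linarith)]
    linarith
  set s : ℝ := max 0 (1 - d / 2) with hs
  have hs0 : 0 ≤ s := le_max_left _ _
  have hs1 : s < 1 := max_lt one_pos (by linarith)
  have hsd : 1 - d < s := lt_of_lt_of_le (by linarith) (le_max_right _ _)
  set x : ℝ := (1 + 2 * s) / (2 + s) with hx
  have hx1 : x < 1 := by rw [hx, div_lt_one (by linarith)]; linarith
  have hsx : s ≤ x := by rw [hx, le_div_iff₀ (by linarith)]; nlinarith
  set r : ℝ := (1 + x) / 2 with hr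
  have hr1 : r < 1 := by linarith
  have hxr : x < r := by linarith
  obtain ⟨m1, d1⟩ := key s hs0 hs1 hsd
  obtain ⟨m2, d2⟩ := key r (by linarith) hr1 (by linarith)
  have hle := G.geod.psd_le (ψ := fun l : ℂ => φ (s * ζ) + l • ((2 : ℂ) • (φ (r * ζ) - φ (s * ζ))))
    (by fun_prop) (fun l hl => hball ?_) (s := 0) (t := 1 / 2) (by simp) (by norm_num) m1 m2
    (by simp) (by simp [smul_smul])
  · rw [psd_zero_left] at hle
    have hz : (starRingEnd ℂ) ζ * ζ = 1 := by
      rw [mul_comm, Complex.mul_conj, Complex.normSq_eq_norm_sq, hζ1]; simp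
    have he : (s * ζ - r * ζ) / (1 - (starRingEnd ℂ) (s * ζ) * (r * ζ)) = ((s - r) / (1 - s * r) : ℝ) * ζ := by
      rw [map_mul, Complex.conj_ofReal]
      have : (1 : ℂ) - s * (starRingEnd ℂ) ζ * (r * ζ) = 1 - s * r * ((starRingEnd ℂ) ζ * ζ) := by ring
      rw [this, hz]; push_cast; ring
    rw [psd, he, norm_mul, hζ1, Complex.norm_real, Real.norm_eq_abs, mul_one, abs_div,
      abs_of_neg (by linarith), abs_of_pos (by nlinarith), div_le_iff₀ (by nlinarith)] at hle
    norm_num at hle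
    rw [hx, div_lt_iff₀ (by linarith)] at hxr
    nlinarith
  · rw [mem_ball_zero_iff] at hl
    rw [dist_eq_norm] at d1 d2
    rw [mem_ball_iff_norm]
    have e : φ (s * ζ) + l • ((2 : ℂ) • (φ (r * ζ) - φ (s * ζ))) - φ ζ =
      (φ (s * ζ) - φ ζ) + l • ((2 : ℂ) • ((φ (r * ζ) - φ ζ) - (φ (s * ζ) - φ ζ))) := by
      abel_nf
    rw [e]
    refine (norm_add_le _ _).trans_lt ?_
    rw [norm_smul, norm_smul, Complex.norm_ofNat]
    have := norm_sub_le (φ (r * ζ) - φ ζ) (φ (s * ζ) - φ ζ)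
    nlinarith [norm_nonneg ((φ (r * ζ) - φ ζ) - (φ (s * ζ) - φ ζ)), norm_nonneg l]

lemma Geo.hasDerivWithinAt (G : Geo Ω φ φd) {ζ : ℂ} (hζ : ζ ∈ closedBall (0 : ℂ) 1) :
    HasDerivWithinAt φ (φd ζ) (closedBall 0 1) ζ := by
  have hcl := closure_ball (0 : ℂ) one_ne_zero
  have h := hasFDerivWithinAt_closure_of_tendsto_fderiv (f := φ) (s := ball 0 1) (x := ζ)
    (f' := (ContinuousLinearMap.toSpanSingleton ℂ (φd ζ)).restrictScalars ℝ)
    (G.geod.1.restrictScalars ℝ) (convex_ball _ _) isOpen_ball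
    (fun y hy => by rw [hcl] at hy; exact (G.cont y hy).mono ball_subset_closedBall) ?_
  · rw [hcl] at h
    exact hasDerivWithinAt_iff_hasFDerivWithinAt.2 (h.of_restrictScalars ℝ rfl)
  · have h1 : Tendsto φd (𝓝[ball 0 1] ζ) (𝓝 (φd ζ)) :=
      ((G.contd ζ hζ).mono ball_subset_closedBall).tendsto
    have h2 : Continuous fun v : E N => (ContinuousLinearMap.toSpanSingleton ℂ v).restrictScalars ℝ := by
      exact (ContinuousLinearMap.restrictScalarsL ℂ ℂ (E N) ℝ ℝ).continuous.comp
        (ContinuousLinearMap.toSpanSingletonLIE ℂ (E N)).continuous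
    refine ((h2.tendsto _).comp h1).congr' ?_
    filter_upwards [self_mem_nhdsWithin] with y hy
    exact ((G.hasDerivAt hy).hasFDerivAt.restrictScalars ℝ).fderiv.symm

lemma Geo.hasDerivWithinAt_radial (G : Geo Ω φ φd) {ζ : ℂ} (hζ : ζ ∈ sphere (0 : ℂ) 1) :
    HasDerivWithinAt (fun r : ℝ => φ (r * ζ) - φ ζ) (ζ • φd ζ) (Icc 0 1) 1 := by
  have h1 : HasDerivWithinAt (fun r : ℝ => (r : ℂ) * ζ) ζ (Icc 0 1) 1 := by
    simpa using (Complex.ofRealCLM.hasDerivAt (x := (1 : ℝ))).hasDerivWithinAt.mul_const ζ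
  have h2 : HasDerivWithinAt φ (φd ζ) (closedBall 0 1) (((1 : ℝ) : ℂ) * ζ) := by
    simpa using G.hasDerivWithinAt (sphere_subset_closedBall hζ)
  refine (h2.scomp (1 : ℝ) h1 fun r hr => ?_).sub_const _
  have hζ1 : ‖ζ‖ = 1 := by simpa using hζ
  simp [hζ1, abs_of_nonneg hr.1, hr.2]

lemma Geo.hasDerivAt_angular (G : Geo Ω φ φd) {ζ : ℂ} (hζ : ζ ∈ sphere (0 : ℂ) 1) :
    HasDerivWithinAt (fun s : ℝ => φ (Complex.exp (s * Complex.I) * ζ) - φ ζ)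
      (Complex.I • ζ • φd ζ) univ 0 := by
  have h1 : HasDerivWithinAt (fun s : ℝ => Complex.exp (s * Complex.I) * ζ) (Complex.I * ζ) univ 0 := by
    have h0 : HasDerivAt (fun s : ℝ => (s : ℂ) * Complex.I) (1 * Complex.I) 0 :=
      (Complex.ofRealCLM.hasDerivAt (x := (0 : ℝ))).mul_const _
    simpa using (h0.cexp.mul_const ζ).hasDerivWithinAt (s := univ)
  have h2 : HasDerivWithinAt φ (φd ζ) (closedBall 0 1) (Complex.exp ((0 : ℝ) * Complex.I) * ζ) := by
    simpa using G.hasDerivWithinAt (sphere_subset_closedBall hζ)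
  have hζ1 : ‖ζ‖ = 1 := by simpa using hζ
  have := (h2.scomp (0 : ℝ) h1 fun s _ => by simp [hζ1, Complex.norm_exp_ofReal_mul_I]).sub_const (φ ζ)
  rwa [mul_smul] at this

lemma Geo.tendsto_radial (G : Geo Ω φ φd) (P : Pkg Ω α ρ C) {ζ : ℂ} (hζ : ζ ∈ sphere (0 : ℂ) 1) :
    Tendsto (fun r : ℝ => -ρ (φ (r * ζ)) / (1 - r)) (𝓝[<] 1) (𝓝 (nu ρ (φ ζ) (ζ • φd ζ)).re) := by
  have hζ1 : ‖ζ‖ = 1 := by simpa using hζ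
  have hq := G.mem_frontier P.isOpen hζ
  have h := hasDerivWithinAt_of_quadratic (G.hasDerivWithinAt_radial hζ) (by simp) (by simp)
    (L := Complex.reCLM.comp ((nu ρ (φ ζ)).restrictScalars ℝ)) (u := fun r : ℝ => ρ (φ (r * ζ))) (C := C)
    (fun r hr => by
      refine P.val _ (G.mem_closure ?_) _ hq
      simp [hζ1, abs_of_nonneg hr.1, hr.2])
  have h2 := (hasDerivWithinAt_iff_tendsto_slope.1 h).mono_left
    (nhdsWithin_mono (1 : ℝ) (show Ioo 0 1 ⊆ Icc 0 1 \ {1} from fun r hr =>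
      ⟨⟨hr.1.le, hr.2.le⟩, hr.2.ne⟩))
  rw [nhdsWithin_Ioo_eq_nhdsLT one_pos] at h2
  refine h2.congr fun r => ?_
  rw [slope_def_field, Complex.ofReal_one, one_mul, P.zero _ hq, sub_zero, neg_div, ← div_neg, neg_sub]

lemma Geo.nu_im_eq_zero (G : Geo Ω φ φd) (P : Pkg Ω α ρ C) {ζ : ℂ} (hζ : ζ ∈ sphere (0 : ℂ) 1) :
    (nu ρ (φ ζ) (ζ • φd ζ)).im = 0 := by
  have hζ1 : ‖ζ‖ = 1 := by simpa using hζ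
  have hq := G.mem_frontier P.isOpen hζ
  have h := hasDerivWithinAt_of_quadratic (G.hasDerivAt_angular hζ) (by simp) (mem_univ _)
    (L := Complex.reCLM.comp ((nu ρ (φ ζ)).restrictScalars ℝ)) (u := fun _ => 0) (C := C)
    (fun s _ => by
      have hm : Complex.exp (s * Complex.I) * ζ ∈ sphere (0 : ℂ) 1 := by
        simp [hζ1, Complex.norm_exp_ofReal_mul_I]
      have := P.val _ (G.mem_closure (sphere_subset_closedBall hm)) _ hq
      rwa [P.zero _ (G.mem_frontier P.isOpen hm)] at this)
  have h2 := (hasDerivWithinAt_univ.1 h).unique (hasDerivAt_const (0 : ℝ) (0 : ℝ))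
  have h3 : nu ρ (φ ζ) (Complex.I • ζ • φd ζ) = Complex.I * nu ρ (φ ζ) (ζ • φd ζ) := by
    rw [map_smul, smul_eq_mul]
  have h4 : (nu ρ (φ ζ) (Complex.I • ζ • φd ζ)).re = 0 := h2
  rw [h3, Complex.I_mul_re] at h4
  linarith

lemma Geo.nu_eq_ofReal (G : Geo Ω φ φd) (P : Pkg Ω α ρ C) {ζ : ℂ} (hζ : ζ ∈ sphere (0 : ℂ) 1) :
    nu ρ (φ ζ) (ζ • φd ζ) = ((nu ρ (φ ζ) (ζ • φd ζ)).re : ℂ) :=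
  Complex.ext rfl (by rw [G.nu_im_eq_zero P hζ, Complex.ofReal_im])

/-- If the distance to the boundary decays at least linearly then the normal derivative is bounded
below. -/
lemma Geo.le_nu_of (G : Geo Ω φ φd) (P : Pkg Ω α ρ C) {c : ℝ}
    (hc : ∀ ζ ∈ ball (0 : ℂ) 1, c * (1 - ‖ζ‖) ≤ bdist Ω (φ ζ)) {ζ : ℂ} (hζ : ζ ∈ sphere (0 : ℂ) 1) :
    c / C ≤ (nu ρ (φ ζ) (ζ • φd ζ)).re := by
  have hC : 0 < C := lt_of_lt_of_le one_pos P.one_le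
  have hζ1 : ‖ζ‖ = 1 := by simpa using hζ
  refine ge_of_tendsto (G.tendsto_radial P hζ) ?_
  filter_upwards [Ioo_mem_nhdsLT (zero_lt_one (α := ℝ))] with r hr
  have hn : ‖(r : ℂ) * ζ‖ = r := by rw [norm_mul, hζ1, Complex.norm_real, Real.norm_of_nonneg hr.1.le, mul_one]
  have hm : (r : ℂ) * ζ ∈ ball (0 : ℂ) 1 := by rw [mem_ball_zero_iff, hn]; exact hr.2
  have h1 := hc _ hm
  have h2 := P.bdist_le _ (subset_closure (G.mapsTo hm))
  rw [hn] at h1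
  rw [div_le_div_iff₀ hC (by linarith [hr.2])]
  linarith

lemma Geo.nu_le_of (G : Geo Ω φ φd) (P : Pkg Ω α ρ C) {c : ℝ}
    (hc : ∀ ζ ∈ ball (0 : ℂ) 1, bdist Ω (φ ζ) ≤ c * (1 - ‖ζ‖)) {ζ : ℂ} (hζ : ζ ∈ sphere (0 : ℂ) 1) :
    (nu ρ (φ ζ) (ζ • φd ζ)).re ≤ C * c := by
  have hC : 0 < C := lt_of_lt_of_le one_pos P.one_le
  have hζ1 : ‖ζ‖ = 1 := by simpa using hζ
  refine le_of_tendsto (G.tendsto_radial P hζ) ?_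
  filter_upwards [Ioo_mem_nhdsLT (zero_lt_one (α := ℝ))] with r hr
  have hn : ‖(r : ℂ) * ζ‖ = r := by rw [norm_mul, hζ1, Complex.norm_real, Real.norm_of_nonneg hr.1.le, mul_one]
  have hm : (r : ℂ) * ζ ∈ ball (0 : ℂ) 1 := by rw [mem_ball_zero_iff, hn]; exact hr.2
  have h1 := hc _ hm
  have h2 := P.le_bdist _ (subset_closure (G.mapsTo hm))
  rw [hn] at h1
  rw [div_le_iff₀ (by linarith [hr.2])]
  nlinarith

lemma Geo.nu_pos (G : Geo Ω φ φd) (P : Dom Ω α ρ C) {ζ : ℂ} (hζ : ζ ∈ sphere (0 : ℂ) 1) :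
    0 < (nu ρ (φ ζ) (ζ • φd ζ)).re := by
  have hC : 0 < C := lt_of_lt_of_le one_pos P.one_le
  obtain ⟨c, hc, h⟩ := P.hopf _ (P.toPkg.bdist_pos (G.mapsTo (ζ := 0) (by simp)))
  have := G.le_nu_of P.toPkg (h φ G.geod.1 G.geod.2.1 le_rfl) hζ
  exact lt_of_lt_of_le (by positivity) this

end Boundary

section Dual
variable {Ω : Set (E N)} {α C : ℝ} {ρ : E N → ℝ} {φ φd : ℂ → E N}

lemma cavg_re {f : ℂ → ℂ} (hf : ContinuousOn f (sphere 0 1)) :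
    cavg (fun ζ => (f ζ).re) = (cavg f).re := by
  have := ContinuousLinearMap.circleAverage_comp_comm (R := 1) (c := 0)
    Complex.reCLM (circleIntegrable_of_contS hf)
  simpa [cavg, Function.comp_def] using this

lemma abs_cavg_re_sub_le {f : ℂ → ℂ} (hf : ContinuousOn f (sphere 0 1)) {a ε : ℝ}
    (h : ∀ ζ ∈ sphere (0 : ℂ) 1, |(f ζ).re - a| ≤ ε) : |(cavg f).re - a| ≤ ε := by
  have hc : ContinuousOn (fun ζ => (f ζ).re) (sphere 0 1) := Complex.continuous_re.comp_continuousOn hf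
  have hconst : ∀ b : ℝ, cavg (fun _ : ℂ => b) = b := fun b => Real.circleAverage_const b 0 1
  rw [← cavg_re hf, abs_le]
  have h1 := cavg_mono (f := fun ζ => (f ζ).re) (g := fun _ => a + ε) hc continuousOn_const
    (fun ζ hζ => by linarith [(abs_le.1 (h ζ hζ)).2])
  have h2 := cavg_mono (f := fun _ => a - ε) (g := fun ζ => (f ζ).re) continuousOn_const hc
    (fun ζ hζ => by linarith [(abs_le.1 (h ζ hζ)).1])
  rw [hconst] at h1 h2
  constructor <;> linarith

/-- No disc in `Ω` has a larger derivative at the origin in the direction of a geodesic. -/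
lemma Geo.not_exists_larger (G : Geo Ω φ φd) (hΩ : IsOpen Ω) {ψ : ℂ → E N} (hψ : DiskAlg ψ)
    (hm : MapsTo ψ (closedBall 0 1) Ω) (h0 : ψ 0 = φ 0) {κ : ℝ} (hκ : 1 < κ) :
    deriv ψ 0 ≠ κ • φd 0 := by
  intro hd
  have h00 : (0 : ℂ) ∈ ball (0 : ℂ) 1 := by simp
  have hκ0 : 0 < κ := by linarith
  obtain ⟨e, he, hth⟩ := ((isCompact_closedBall (0 : ℂ) 1).image_of_continuousOn
    hψ.cont).exists_thickening_subset_open hΩ hm.image_subset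
  set w : ℝ → E N := fun b => φ (b : ℂ) - ψ ((b / κ : ℝ) : ℂ) with hw
  have hw0 : w 0 = 0 := by simp [hw, h0]
  have hwd : HasDerivAt w 0 0 := by
    have h1 : HasDerivAt (fun b : ℝ => φ (b : ℂ)) (φd 0) 0 := by
      have := (G.hasDerivAt h00).scomp_of_eq (0 : ℝ) (Complex.ofRealCLM.hasDerivAt (x := (0 : ℝ))) (by simp)
      simp only [Complex.ofRealCLM_apply, Complex.ofReal_one, one_smul] at this
      exact this
    have h2 : HasDerivAt (fun b : ℝ => ψ ((b / κ : ℝ) : ℂ)) (φd 0) 0 := by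
      have h3 : HasDerivAt (fun b : ℝ => ((b / κ : ℝ) : ℂ)) ((1 / κ : ℝ) : ℂ) 0 :=
        ((hasDerivAt_id (0 : ℝ)).div_const κ).ofReal_comp
      have := (hψ.diffAt h00).hasDerivAt.scomp_of_eq (0 : ℝ) h3 (by simp)
      rw [hd, Complex.coe_smul, smul_smul, one_div, inv_mul_cancel₀ hκ0.ne', one_smul] at this
      exact this
    have h3 := h1.sub h2
    rw [sub_self] at h3
    exact h3
  have hsmall : ∀ᶠ b in 𝓝[>] (0 : ℝ), ‖w b‖ ≤ e / (2 * κ) * ‖b‖ := by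
    have := (hasDerivAt_iff_isLittleO.1 hwd).def (c := e / (2 * κ)) (by positivity)
    simp only [hw0, smul_zero, sub_zero] at this
    exact nhdsWithin_le_nhds this
  obtain ⟨b, hb1, hb2⟩ := (hsmall.and (Ioo_mem_nhdsGT (zero_lt_one (α := ℝ)))).exists
  have hb : ‖b‖ = b := Real.norm_of_nonneg hb2.1.le
  rw [hb] at hb1
  set a : ℝ := b / κ with ha
  have ha0 : 0 < a := div_pos hb2.1 hκ0
  have hab : a < b := div_lt_self hb2.1 hκ
  have ha1 : (a : ℂ) ∈ ball (0 : ℂ) 1 := by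
    rw [mem_ball_zero_iff, Complex.norm_real, Real.norm_of_nonneg ha0.le]; linarith [hb2.2]
  have hbm : (b : ℂ) ∈ ball (0 : ℂ) 1 := by
    rw [mem_ball_zero_iff, Complex.norm_real, hb]; exact hb2.2
  have hle := G.geod.psd_le (ψ := fun l => ψ l + l • ((a⁻¹ : ℝ) • w b))
    (hψ.1.add (differentiableOn_id.smul_const _)) (fun l hl => hth ?_) (s := 0) (t := a)
    (by simp) ha1 (ζ := 0) (ξ := b) (by simp) hbm (by simp [h0]) ?_
  · rw [psd_zero_left, psd_zero_left, Complex.norm_real, Complex.norm_real, hb,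
      Real.norm_of_nonneg ha0.le] at hle
    linarith
  · rw [mem_thickening_iff]
    refine ⟨ψ l, mem_image_of_mem _ (ball_subset_closedBall hl), ?_⟩
    rw [dist_eq_norm, add_sub_cancel_left, norm_smul, norm_smul, norm_inv, Real.norm_of_nonneg ha0.le]
    rw [mem_ball_zero_iff] at hl
    have : a⁻¹ * ‖w b‖ ≤ e / 2 := by
      rw [inv_mul_le_iff₀ ha0, ha]
      calc ‖w b‖ ≤ e / (2 * κ) * b := hb1
        _ = _ := by field_simp
    have h3 : 0 ≤ a⁻¹ * ‖w b‖ := by positivity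
    nlinarith [norm_nonneg l]
  · have : (a : ℂ) • ((a⁻¹ : ℝ) • w b) = w b := by
      rw [Complex.coe_smul, smul_smul, mul_inv_cancel₀ ha0.ne', one_smul]
    rw [this, hw]
    simp [ha]

lemma Pkg.continuousOn_nu (P : Pkg Ω α ρ C) : ContinuousOn (nu ρ) (closure Ω) := by
  have hC : 0 ≤ C := by linarith [P.one_le]
  refine LipschitzOnWith.continuousOn (K := ⟨C, hC⟩) (LipschitzOnWith.of_dist_le_mul fun x hx y hy => ?_)
  rw [dist_eq_norm, dist_eq_norm]
  exact P.nu_lip x hx y hy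

lemma Geo.continuousOn_nu (G : Geo Ω φ φd) (P : Pkg Ω α ρ C) :
    ContinuousOn (fun ζ => nu ρ (φ ζ)) (closedBall 0 1) :=
  P.continuousOn_nu.comp G.cont fun _ h => G.mem_closure h

/-- A first order deformation pointing inwards along the boundary stays in `Ω`. -/
lemma Geo.exists_push (G : Geo Ω φ φd) (P : Pkg Ω α ρ C) {h : ℂ → E N}
    (hh : ContinuousOn h (closedBall 0 1))
    (hn : ∀ ζ ∈ sphere (0 : ℂ) 1, (nu ρ (φ ζ) (h ζ)).re < 0) :
    ∃ t : ℝ, 0 < t ∧ ∀ ζ ∈ closedBall (0 : ℂ) 1, φ ζ + t • h ζ ∈ Ω := by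
  set F : ℂ → ℝ := fun ζ => (nu ρ (φ ζ) (h ζ)).re with hF
  have hFc : ContinuousOn F (closedBall 0 1) :=
    Complex.continuous_re.comp_continuousOn ((G.continuousOn_nu P).clm_apply hh)
  obtain ⟨ζ₀, hζ₀, hmax⟩ := (isCompact_sphere (0 : ℂ) 1).exists_isMaxOn
    (NormedSpace.sphere_nonempty.2 zero_le_one) (hFc.mono sphere_subset_closedBall)
  set c : ℝ := -F ζ₀ / 2 with hc
  have hc0 : 0 < c := by have := hn ζ₀ hζ₀; simp only [hc, hF]; linarith
  set K : Set ℂ := {ζ ∈ closedBall (0 : ℂ) 1 | F ζ ∈ Ici (-c)} with hK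
  have hKc : IsCompact K := (isCompact_closedBall _ _).of_isClosed_subset
    (hFc.preimage_isClosed_of_isClosed isClosed_closedBall isClosed_Ici) fun _ h => h.1
  have hKb : K ⊆ ball 0 1 := fun ζ hζ => by
    rcases (mem_closedBall_zero_iff.1 hζ.1).lt_or_eq with h1 | h1
    · simpa using h1
    · have h2 : F ζ ≤ F ζ₀ := hmax (by simpa using h1 : ζ ∈ sphere (0 : ℂ) 1)
      have h3 : -c ≤ F ζ := hζ.2
      linarith
  obtain ⟨e, he, hth⟩ := (hKc.image_of_continuousOn
    (G.cont.mono fun _ h => h.1)).exists_thickening_subset_open P.isOpen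
    (image_subset_iff.2 fun ζ hζ => G.mapsTo (hKb hζ))
  obtain ⟨M, hM⟩ := (isCompact_closedBall (0 : ℂ) 1).exists_bound_of_continuousOn hh
  have hM0 : 0 ≤ M := (norm_nonneg _).trans (hM 0 (by simp))
  obtain ⟨t₀, ht₀, hp⟩ := P.push M c hc0
  have ht : 0 < min t₀ (e / (2 * (M + 1))) := by positivity
  refine ⟨_, ht, fun ζ hζ => ?_⟩
  by_cases hζK : ζ ∈ K
  · refine hth (mem_thickening_iff.2 ⟨φ ζ, mem_image_of_mem _ hζK, ?_⟩)
    rw [dist_eq_norm, add_sub_cancel_left, norm_smul, Real.norm_of_nonneg ht.le]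
    calc min t₀ (e / (2 * (M + 1))) * ‖h ζ‖ ≤ e / (2 * (M + 1)) * (M + 1) := by
          gcongr
          · exact min_le_right _ _
          · linarith [hM ζ hζ]
      _ = e / 2 := by field_simp
      _ < e := by linarith
  · refine hp _ (G.mem_closure hζ) _ (hM ζ hζ) ?_ _ ht (min_le_left _ _)
    have : ¬ -c ≤ F ζ := fun h => hζK ⟨hζ, h⟩
    linarith

lemma Geo.continuousOn_nuX (G : Geo Ω φ φd) (P : Pkg Ω α ρ C) :
    ContinuousOn (fun ζ => nu ρ (φ ζ) (ζ • φd ζ)) (sphere 0 1) :=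
  ((G.continuousOn_nu P).clm_apply (continuousOn_id.smul G.contd)).mono sphere_subset_closedBall

lemma Geo.nuX_ne_zero (G : Geo Ω φ φd) (P : Dom Ω α ρ C) {ζ : ℂ} (hζ : ζ ∈ sphere (0 : ℂ) 1) :
    nu ρ (φ ζ) (ζ • φd ζ) ≠ 0 := fun h => by
  have := G.nu_pos P hζ
  rw [h] at this
  simp at this

lemma Geo.variation_nonneg (G : Geo Ω φ φd) (P : Dom Ω α ρ C) {k : ℂ → E N} (hk : DiskAlg k) :
    0 ≤ (cavg fun ζ => nu ρ (φ ζ) (ζ ^ 2 • k ζ) / nu ρ (φ ζ) (ζ • φd ζ)).re := by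
  set r : ℂ → ℂ := fun ζ => nu ρ (φ ζ) (ζ ^ 2 • k ζ) / nu ρ (φ ζ) (ζ • φd ζ) with hr
  have hrc : ContinuousOn r (sphere 0 1) := by
    refine ContinuousOn.div ?_ (G.continuousOn_nuX P.toPkg) fun ζ hζ => G.nuX_ne_zero P hζ
    exact ((G.continuousOn_nu P.toPkg).clm_apply
      ((continuousOn_id.pow 2).smul hk.cont)).mono sphere_subset_closedBall
  by_contra! hneg
  set μ : ℝ := -(cavg r).re with hμ
  have hμ0 : 0 < μ := by linarith
  obtain ⟨p, hp, hpa⟩ := exists_diskAlg_re_approx (u := fun ζ => -((r ζ).re + μ))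
    ((Complex.continuous_re.comp_continuousOn hrc).add continuousOn_const).neg
    (ε := μ / 16) (by positivity)
  -- the mean of `p` is small
  have hp0 : |(p 0).re| ≤ μ / 16 := by
    have h1 := abs_cavg_re_sub_le (f := fun ζ => p ζ + r ζ) (hp.contS.add hrc) (a := -μ) (ε := μ / 16)
      (fun ζ hζ => by
        have := hpa ζ hζ
        rw [abs_sub_comm] at this
        rw [Complex.add_re]
        convert this using 2
        ring)
    rw [cavg_add hp.contS hrc, hp.mean, Complex.add_re] at h1
    convert h1 using 2
    rw [hμ]; ring
  set q : ℂ → ℂ := fun ζ => p ζ - p 0 + (μ / 4 : ℝ) with hq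
  have hqA : DiskAlg q := (hp.sub (diskAlg_const _)).add (diskAlg_const _)
  set h₁ : ℂ → E N := fun ζ => ζ • k ζ + q ζ • φd ζ with hh₁
  have hh₁A : DiskAlg h₁ := (diskAlg_id.smul hk).add (hqA.smul G.diskAlgd)
  set h : ℂ → E N := fun ζ => ζ • h₁ ζ with hh
  have hhA : DiskAlg h := diskAlg_id.smul hh₁A
  obtain ⟨t, ht, hin⟩ := G.exists_push P.toPkg hhA.cont fun ζ hζ => by
    have e1 : nu ρ (φ ζ) (h ζ) = nu ρ (φ ζ) (ζ • φd ζ) * (r ζ + q ζ) := by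
      have e2 : h ζ = ζ ^ 2 • k ζ + q ζ • (ζ • φd ζ) := by
        simp only [hh, hh₁, smul_add, smul_smul, pow_two, mul_comm]
      rw [e2, map_add, map_smul (nu ρ (φ ζ)) (q ζ), smul_eq_mul, mul_add, hr,
        mul_div_cancel₀ _ (G.nuX_ne_zero P hζ)]
      ring
    rw [e1, G.nu_eq_ofReal P.toPkg hζ, Complex.re_ofReal_mul]
    refine mul_neg_of_pos_of_neg (G.nu_pos P hζ) ?_
    have := (abs_le.1 (hpa ζ hζ)).1
    have := (abs_le.1 hp0).1
    simp only [hq, Complex.add_re, Complex.sub_re, Complex.ofReal_re]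
    linarith
  have hκ : (1 : ℝ) < 1 + t * (μ / 4) := by have : 0 < t * (μ / 4) := by positivity
                                            linarith
  refine G.not_exists_larger P.isOpen (ψ := fun ζ => φ ζ + (t : ℂ) • h ζ)
    (G.diskAlg.add ((diskAlg_const (t : ℂ)).smul hhA)) (fun ζ hζ => by simpa using hin ζ hζ)
    (by simp [hh]) hκ ?_
  have h00 : (0 : ℂ) ∈ ball (0 : ℂ) 1 := by simp
  have hd : HasDerivAt h (h₁ 0) 0 := by
    have := (hasDerivAt_id (0 : ℂ)).smul (hh₁A.diffAt h00).hasDerivAt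
    simp only [id_eq, zero_smul, one_smul, zero_add] at this
    exact this
  have := ((G.hasDerivAt h00).add (hd.const_smul (t : ℂ))).deriv
  refine this.trans ?_
  simp only [hh₁, hq, zero_smul, zero_add, sub_self, add_smul, one_smul, mul_smul, Complex.coe_smul]

lemma Geo.orthogonality (G : Geo Ω φ φd) (P : Dom Ω α ρ C) {k : ℂ → E N} (hk : DiskAlg k) :
    (cavg fun ζ => nu ρ (φ ζ) (ζ ^ 2 • k ζ) / nu ρ (φ ζ) (ζ • φd ζ)) = 0 := by
  have h : ∀ a : ℂ, 0 ≤ (a * cavg fun ζ => nu ρ (φ ζ) (ζ ^ 2 • k ζ) / nu ρ (φ ζ) (ζ • φd ζ)).re := fun a => by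
    rw [← cavg_smul]
    convert G.variation_nonneg P (k := fun ζ => a • k ζ) ((diskAlg_const a).smul hk) using 4 with ζ
    rw [smul_comm, map_smul (nu ρ (φ ζ)) a, smul_eq_mul, mul_div_assoc]
  have h1 := h 1
  have h2 := h (-1)
  have h3 := h Complex.I
  have h4 := h (-Complex.I)
  simp only [neg_mul, one_mul, Complex.neg_re, Complex.I_mul_re] at h1 h2 h3 h4
  exact Complex.ext (by rw [Complex.zero_re]; linarith) (by rw [Complex.zero_im]; linarith)

/-- The dual map of a geodesic. -/
structure DualMap (ρ : E N → ℝ) (φ φd : ℂ → E N) (g : ℂ → E N →L[ℂ] ℂ) : Prop where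
  diskAlg : DiskAlg g
  eq : ∀ ζ ∈ sphere (0 : ℂ) 1, g ζ = (ζ / nu ρ (φ ζ) (ζ • φd ζ)) • nu ρ (φ ζ)
  apply : ∀ ζ ∈ closedBall (0 : ℂ) 1, g ζ (φd ζ) = 1

lemma DualMap.diskAlg_apply {g : ℂ → E N →L[ℂ] ℂ} (H : DualMap ρ φ φd g) {v : ℂ → E N}
    (hv : DiskAlg v) : DiskAlg fun ζ => g ζ (v ζ) :=
  diskAlg_mk (H.diskAlg.1.clm_apply hv.1) (H.diskAlg.cont.clm_apply hv.cont)

lemma eq_sum_proj (L : E N →L[ℂ] ℂ) :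
    L = ∑ j, L (EuclideanSpace.single j 1) • (EuclideanSpace.proj j : E N →L[ℂ] ℂ) := by
  ext v
  conv_lhs => rw [← (EuclideanSpace.basisFun (Fin N) ℂ).sum_repr v]
  simp [map_sum, mul_comm]

theorem Geo.exists_dualMap (G : Geo Ω φ φd) (P : Dom Ω α ρ C) : ∃ g, DualMap ρ φ φd g := by
  have hc : ∀ e : E N, ContinuousOn (fun ζ => ζ / nu ρ (φ ζ) (ζ • φd ζ) * nu ρ (φ ζ) e) (sphere 0 1) :=
    fun e => (continuousOn_id.div (G.continuousOn_nuX P.toPkg) fun ζ hζ => G.nuX_ne_zero P hζ).mul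
      (((G.continuousOn_nu P.toPkg).clm_apply continuousOn_const).mono sphere_subset_closedBall)
  have hex : ∀ j : Fin N, ∃ F : ℂ → ℂ, DiskAlg F ∧ EqOn F (fun ζ => ζ / nu ρ (φ ζ) (ζ • φd ζ) *
      nu ρ (φ ζ) (EuclideanSpace.single j 1)) (sphere 0 1) := fun j =>
    exists_diskAlg_extension (hc _) fun q hq => by
      convert G.orthogonality P (k := fun ζ => q ζ • (EuclideanSpace.single j 1 : E N))
        (hq.smul (diskAlg_const _)) using 3 with ζ
      rw [smul_smul, map_smul (nu ρ (φ ζ)) (ζ ^ 2 * q ζ), smul_eq_mul]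
      ring
  choose F hF hFe using hex
  set g : ℂ → E N →L[ℂ] ℂ := fun ζ => ∑ j, F j ζ • (EuclideanSpace.proj j : E N →L[ℂ] ℂ) with hg
  have hgA : DiskAlg g := by
    refine diskAlg_mk ?_ ?_
    · exact DifferentiableOn.fun_sum fun j _ => (hF j).1.smul_const _
    · exact continuousOn_finsetSum _ fun j _ => (hF j).cont.smul continuousOn_const
  have hge : ∀ ζ ∈ sphere (0 : ℂ) 1, g ζ = (ζ / nu ρ (φ ζ) (ζ • φd ζ)) • nu ρ (φ ζ) := fun ζ hζ => by
    have e := congrArg (fun L => (ζ / nu ρ (φ ζ) (ζ • φd ζ)) • L) (eq_sum_proj (nu ρ (φ ζ)))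
    refine Eq.trans (Finset.sum_congr rfl fun j _ => ?_) (e.trans Finset.smul_sum).symm
    rw [hFe j hζ, smul_smul]
  refine ⟨g, hgA, hge, fun ζ hζ => ?_⟩
  have h1 : DiskAlg fun ζ => g ζ (φd ζ) - 1 :=
    diskAlg_mk ((hgA.1.clm_apply G.diskAlgd.1).sub_const 1)
      ((hgA.cont.clm_apply G.contd).sub continuousOn_const)
  have := h1.norm_le (C := 0) (fun ξ hξ => by
    have e : (g ξ) (φd ξ) = 1 := by
      rw [hge ξ hξ, smul_apply, smul_eq_mul, div_mul_eq_mul_div, ← smul_eq_mul,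
        ← map_smul]
      exact div_self (G.nuX_ne_zero P hξ)
    rw [e, sub_self, norm_zero]) hζ
  exact sub_eq_zero.1 (norm_le_zero_iff.1 this)

end Dual

section BoundaryEstimates
variable {F : Type*} [NormedAddCommGroup F]

lemma tendsto_radial_within {ζ₀ : ℂ} (h0 : ζ₀ ∈ sphere (0 : ℂ) 1) :
    Tendsto (fun r : ℝ => (r : ℂ) * ζ₀) (𝓝[<] 1) (𝓝[closedBall 0 1] ζ₀) := by
  refine tendsto_nhdsWithin_iff.2 ⟨?_, ?_⟩
  · have : Continuous fun r : ℝ => (r : ℂ) * ζ₀ := by fun_prop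
    simpa using (this.tendsto 1).mono_left nhdsWithin_le_nhds
  · filter_upwards [Ioo_mem_nhdsLT (zero_lt_one (α := ℝ))] with r hr
    exact smul_mem_closedBall_of h0 hr.1.le hr.2.le

lemma norm_le_of_radial {f : ℂ → F} (hf : ContinuousOn f (closedBall 0 1)) {ζ₀ : ℂ}
    (h0 : ζ₀ ∈ sphere (0 : ℂ) 1) {K : ℝ} (h : ∀ r : ℝ, 0 ≤ r → r < 1 → ‖f (r * ζ₀)‖ ≤ K) :
    ‖f ζ₀‖ ≤ K := by
  have h1 : Tendsto (fun r : ℝ => ‖f (r * ζ₀)‖) (𝓝[<] 1) (𝓝 ‖f ζ₀‖) :=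
    ((hf ζ₀ (sphere_subset_closedBall h0)).tendsto.comp (tendsto_radial_within h0)).norm
  refine le_of_tendsto h1 ?_
  filter_upwards [Ioo_mem_nhdsLT (zero_lt_one (α := ℝ))] with r hr
  exact h r hr.1.le hr.2

lemma continuousOn_div_norm_sub_pow {e : ℂ → ℝ} (he : ContinuousOn e (sphere 0 1)) {z : ℂ}
    (hz : z ∈ ball (0 : ℂ) 1) (k : ℕ) :
    ContinuousOn (fun ζ => e ζ / ‖ζ - z‖ ^ k) (sphere 0 1) :=
  he.div (by fun_prop) fun ζ hζ => pow_ne_zero _ (norm_ne_zero_iff.2 (sub_ne_zero_of_sphere hζ hz))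

lemma continuousOn_stationarity_error {S G : ℂ → ℂ} (hS : DiskAlg S) (hG : DiskAlg G) :
    ContinuousOn (fun ζ => ‖S ζ / ζ - (starRingEnd ℂ) (G ζ)‖) (sphere 0 1) :=
  ((hS.contS.div continuousOn_id fun _ hζ => ne_zero_of_sphere hζ).sub
    (Complex.continuous_conj.comp_continuousOn hG.contS)).norm

lemma norm_deriv_sub_conj_le_split {S G : ℂ → ℂ} (hS : DiskAlg S) (hG : DiskAlg G) {ζ₀ : ℂ}
    (h0 : ζ₀ ∈ sphere (0 : ℂ) 1) {a b t γ : ℝ} (ha : 0 ≤ a) (hb : 0 ≤ b) (ht0 : 0 < t) (ht2 : t ≤ 2)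
    (hγ : 0 < γ) (hγ1 : γ ≤ 1)
    (h1 : ∀ ζ ∈ sphere (0 : ℂ) 1, ‖S ζ / ζ - (starRingEnd ℂ) (G ζ)‖ ≤ a * ‖ζ - ζ₀‖ ^ (1 + γ))
    (h2 : ∀ ζ ∈ sphere (0 : ℂ) 1, ‖S ζ / ζ - (starRingEnd ℂ) (G ζ)‖ ≤ b) {r : ℝ} (hr0 : 0 ≤ r)
    (hr1 : r < 1) :
    ‖deriv G (r * ζ₀) - (starRingEnd ℂ) (S 0)‖ ≤ 4 * (a * t ^ γ / γ + b / t) := by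
  have hz := smul_mem_ball_of h0 hr0 hr1
  refine (norm_deriv_sub_conj_le hS hG hz).trans ?_
  have key : ∀ ζ ∈ sphere (0 : ℂ) 1, ∀ s, 0 < s → s ≤ ‖ζ - ζ₀‖ → ∀ e : ℝ, 0 ≤ e →
      e / ‖ζ - r * ζ₀‖ ^ 2 ≤ 4 * e / ‖ζ - ζ₀‖ ^ 2 := fun ζ hζ s hs hs1 e he => by
    have hT : 0 < ‖ζ - ζ₀‖ := hs.trans_le hs1
    have := (half_norm_sub_le hζ h0 hr0 hr1.le).1
    calc e / ‖ζ - r * ζ₀‖ ^ 2 ≤ e / (‖ζ - ζ₀‖ / 2) ^ 2 := by gcongr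
      _ = _ := by field_simp; norm_num
  have := cavg_le_of_power_split
    (continuousOn_div_norm_sub_pow (continuousOn_stationarity_error hS hG) hz 2)
    (a := 4 * a) (b := 4 * b) (t := t) (γ := γ) (by positivity) ht0 ht2 hγ (by positivity) h0 ?_ ?_
  · calc _ ≤ _ := this
      _ = _ := by ring
  · intro ζ hζ s hs hs1
    have hT : 0 < ‖ζ - ζ₀‖ := hs.trans_le hs1
    refine (key ζ hζ s hs hs1 _ (norm_nonneg _)).trans ?_
    calc 4 * ‖S ζ / ζ - (starRingEnd ℂ) (G ζ)‖ / ‖ζ - ζ₀‖ ^ 2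
        ≤ 4 * (a * ‖ζ - ζ₀‖ ^ (1 + γ)) / ‖ζ - ζ₀‖ ^ 2 := by gcongr; exact h1 ζ hζ
      _ = 4 * a * ‖ζ - ζ₀‖ ^ (γ - 1) := by
          rw [show γ - 1 = 1 + γ - 2 by ring, Real.rpow_sub hT (1 + γ) 2, Real.rpow_two]; ring
      _ ≤ 4 * a * s ^ (γ - 1) := by
          have := Real.rpow_le_rpow_of_nonpos hs hs1 (by linarith : γ - 1 ≤ 0)
          gcongr
  · intro ζ hζ s hs hs1
    have hT : 0 < ‖ζ - ζ₀‖ := hs.trans_le hs1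
    refine (key ζ hζ s hs hs1 _ (norm_nonneg _)).trans ?_
    calc 4 * ‖S ζ / ζ - (starRingEnd ℂ) (G ζ)‖ / ‖ζ - ζ₀‖ ^ 2 ≤ 4 * b / s ^ 2 := by
          gcongr; exact h2 ζ hζ
      _ = 4 * b * s ^ (-2 : ℝ) := by
          rw [Real.rpow_neg hs.le, Real.rpow_two]; rfl

lemma norm_deriv_sub_conj_le_sqrt {S G : ℂ → ℂ} (hS : DiskAlg S) (hG : DiskAlg G) {ζ₀ : ℂ}
    (h0 : ζ₀ ∈ sphere (0 : ℂ) 1) {a : ℝ} (ha : 0 ≤ a)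
    (h1 : ∀ ζ ∈ sphere (0 : ℂ) 1,
      ‖S ζ / ζ - (starRingEnd ℂ) (G ζ)‖ ≤ a * ‖ζ - ζ₀‖ ^ (1 / 2 : ℝ)) {r : ℝ} (hr0 : 0 ≤ r)
    (hr1 : r < 1) :
    ‖deriv G (r * ζ₀) - (starRingEnd ℂ) (S 0)‖ ≤ 16 * a * (1 - r) ^ (1 / 4 - 1 : ℝ) := by
  have hz := smul_mem_ball_of h0 hr0 hr1
  refine (norm_deriv_sub_conj_le hS hG hz).trans ?_
  have hx : 0 < 1 - r := by linarith
  have := cavg_le_of_power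
    (continuousOn_div_norm_sub_pow (continuousOn_stationarity_error hS hG) hz 2)
    (a := 4 * a * (1 - r) ^ (1 / 4 - 1 : ℝ)) (γ := 1 / 4) (by norm_num) (by norm_num) (by positivity)
    h0 ?_
  · calc _ ≤ _ := this
      _ = _ := by ring
  · intro ζ hζ s hs hs1
    have hT : 0 < ‖ζ - ζ₀‖ := hs.trans_le hs1
    obtain ⟨k1, k2⟩ := half_norm_sub_le hζ h0 hr0 hr1.le
    have hD : 0 < ‖ζ - r * ζ₀‖ := hx.trans_le k2
    have e1 : (‖ζ - ζ₀‖ / 2) ^ (5 / 4 : ℝ) * (1 - r) ^ (3 / 4 : ℝ) ≤ ‖ζ - r * ζ₀‖ ^ 2 := by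
      calc _ ≤ ‖ζ - r * ζ₀‖ ^ (5 / 4 : ℝ) * ‖ζ - r * ζ₀‖ ^ (3 / 4 : ℝ) := by gcongr
        _ = _ := by rw [← Real.rpow_add hD, ← Real.rpow_natCast]; norm_num
    have e2 : (2 : ℝ) ^ (5 / 4 : ℝ) ≤ 4 := by
      calc (2 : ℝ) ^ (5 / 4 : ℝ) ≤ 2 ^ (2 : ℝ) :=
            Real.rpow_le_rpow_of_exponent_le (by norm_num) (by norm_num)
        _ = 4 := by norm_num
    calc ‖S ζ / ζ - (starRingEnd ℂ) (G ζ)‖ / ‖ζ - r * ζ₀‖ ^ 2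
        ≤ a * ‖ζ - ζ₀‖ ^ (1 / 2 : ℝ) / ((‖ζ - ζ₀‖ / 2) ^ (5 / 4 : ℝ) * (1 - r) ^ (3 / 4 : ℝ)) := by
          gcongr; exact h1 ζ hζ
      _ = 2 ^ (5 / 4 : ℝ) * a * (1 - r) ^ (1 / 4 - 1 : ℝ) * ‖ζ - ζ₀‖ ^ (1 / 4 - 1 : ℝ) := by
          rw [Real.div_rpow hT.le (by norm_num), show (1 / 4 - 1 : ℝ) = -(3 / 4) by norm_num,
            Real.rpow_neg hx.le, Real.rpow_neg hT.le]
          have : ‖ζ - ζ₀‖ ^ (5 / 4 : ℝ) = ‖ζ - ζ₀‖ ^ (1 / 2 : ℝ) * ‖ζ - ζ₀‖ ^ (3 / 4 : ℝ) := by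
            rw [← Real.rpow_add hT]; norm_num
          rw [this]
          have : ‖ζ - ζ₀‖ ^ (1 / 2 : ℝ) ≠ 0 := (by positivity : 0 < ‖ζ - ζ₀‖ ^ (1 / 2 : ℝ)).ne'
          field_simp
      _ ≤ 4 * a * (1 - r) ^ (1 / 4 - 1 : ℝ) * s ^ (1 / 4 - 1 : ℝ) := by
          have := Real.rpow_le_rpow_of_nonpos hs hs1 (by norm_num : (1 / 4 - 1 : ℝ) ≤ 0)
          gcongr

lemma norm_sub_conj_le_log {P G : ℂ → ℂ} (hP : DiskAlg P) (hG : DiskAlg G) {ζ₀ : ℂ}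
    (h0 : ζ₀ ∈ sphere (0 : ℂ) 1) {a b t : ℝ} (ha : 0 ≤ a) (hb : 0 ≤ b) (ht0 : 0 < t) (ht2 : t ≤ 2)
    (h1 : ∀ ζ ∈ sphere (0 : ℂ) 1, ‖P ζ - (starRingEnd ℂ) (G ζ)‖ ≤ a * ‖ζ - ζ₀‖)
    (h2 : ∀ ζ ∈ sphere (0 : ℂ) 1, ‖P ζ - (starRingEnd ℂ) (G ζ)‖ ≤ b) :
    ‖G ζ₀ - (starRingEnd ℂ) (P 0)‖ ≤ a * t + b * Real.log (2 / t) := by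
  refine norm_le_of_radial (hG.cont.sub continuousOn_const) h0 fun r hr0 hr1 => ?_
  have hz := smul_mem_ball_of h0 hr0 hr1
  refine (norm_sub_conj_le hP hG hz).trans ?_
  have hc : ContinuousOn (fun ζ => ‖P ζ - (starRingEnd ℂ) (G ζ)‖ / ‖ζ - r * ζ₀‖) (sphere 0 1) := by
    simpa using continuousOn_div_norm_sub_pow
      ((hP.contS.sub (Complex.continuous_conj.comp_continuousOn hG.contS)).norm) hz 1
  have := cavg_le_of_log_split hc (a := 2 * a) (b := 2 * b) ht0 ht2 h0 ?_ ?_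
  · calc _ ≤ _ := this
      _ = _ := by ring
  · intro ζ hζ
    obtain ⟨k1, k2⟩ := half_norm_sub_le hζ h0 hr0 hr1.le
    have hD : 0 < ‖ζ - r * ζ₀‖ := (by linarith : 0 < 1 - r).trans_le k2
    rw [div_le_iff₀ hD]
    calc _ ≤ _ := h1 ζ hζ
      _ = 2 * a * (‖ζ - ζ₀‖ / 2) := by ring
      _ ≤ _ := by gcongr
  · intro ζ hζ s hs hs1
    have hT : 0 < ‖ζ - ζ₀‖ := hs.trans_le hs1
    obtain ⟨k1, k2⟩ := half_norm_sub_le hζ h0 hr0 hr1.le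
    calc ‖P ζ - (starRingEnd ℂ) (G ζ)‖ / ‖ζ - r * ζ₀‖ ≤ b / (‖ζ - ζ₀‖ / 2) := by
          gcongr; exact h2 ζ hζ
      _ = 2 * b * (1 / ‖ζ - ζ₀‖) := by field_simp
      _ ≤ 2 * b * (1 / s) := by gcongr

/-- A disc algebra function vanishing linearly at a boundary point decays linearly along the radius. -/
lemma DiskAlg.norm_radial_le [NormedSpace ℂ F] {h : ℂ → F} (hh : DiskAlg h) {ζ₀ : ℂ}
    (h0 : ζ₀ ∈ sphere (0 : ℂ) 1) {L : ℝ} (hL : ∀ ζ ∈ sphere (0 : ℂ) 1, ‖h ζ‖ ≤ L * ‖ζ - ζ₀‖)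
    {r : ℝ} (hr0 : 0 ≤ r) (hr1 : r < 1) : ‖h (r * ζ₀)‖ ≤ 4 * L * (1 - r) := by
  have hL0 : 0 ≤ L := by
    have h1 := (norm_nonneg _).trans (hL (-ζ₀) (by simpa using h0))
    rw [mem_sphere_zero_iff_norm] at h0
    have : ‖-ζ₀ - ζ₀‖ = 2 := by rw [← neg_add', norm_neg, ← two_mul, norm_mul, h0]; norm_num
    rw [this] at h1
    linarith
  have hn : ‖ζ₀‖ = 1 := by simpa using h0
  set x : ℝ := 1 - r with hx
  have hx0 : 0 < x := by linarith
  have hden : ∀ ζ ∈ closedBall (0 : ℂ) 1, x ≤ ‖ζ - ((1 + x : ℝ) : ℂ) * ζ₀‖ := fun ζ hζ => by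
    have h1 := norm_sub_norm_le (((1 + x : ℝ) : ℂ) * ζ₀) ζ
    rw [norm_mul, hn, Complex.norm_real, Real.norm_of_nonneg (by linarith), norm_sub_rev] at h1
    rw [mem_closedBall_zero_iff] at hζ
    linarith
  have hne : ∀ ζ ∈ closedBall (0 : ℂ) 1, ζ - ((1 + x : ℝ) : ℂ) * ζ₀ ≠ 0 := fun ζ hζ h => by
    have := hden ζ hζ
    rw [h, norm_zero] at this
    linarith
  have hk : DiskAlg fun ζ => (ζ - ((1 + x : ℝ) : ℂ) * ζ₀)⁻¹ • h ζ :=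
    diskAlg_mk
      (((differentiableOn_id.sub_const _).inv fun ζ hζ => hne ζ (ball_subset_closedBall hζ)).smul hh.1)
      (((continuousOn_id.sub continuousOn_const).inv₀ hne).smul hh.cont)
  have hz := smul_mem_closedBall_of h0 hr0 hr1.le
  have h3 := hk.norm_le (C := 2 * L) (fun ζ hζ => by
    have hD := hden ζ (sphere_subset_closedBall hζ)
    rw [norm_smul, norm_inv, inv_mul_le_iff₀ (by linarith)]
    refine (hL ζ hζ).trans ?_
    have : ‖ζ - ζ₀‖ ≤ ‖ζ - ((1 + x : ℝ) : ℂ) * ζ₀‖ + x := by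
      calc ‖ζ - ζ₀‖ = ‖(ζ - ((1 + x : ℝ) : ℂ) * ζ₀) + (x : ℂ) * ζ₀‖ := by push_cast; ring_nf
        _ ≤ _ := norm_add_le _ _
        _ = _ := by rw [norm_mul, hn, Complex.norm_real, Real.norm_of_nonneg hx0.le, mul_one]
    nlinarith) hz
  rw [norm_smul, norm_inv, inv_mul_le_iff₀ (by linarith [hden _ hz])] at h3
  have : ‖(r : ℂ) * ζ₀ - ((1 + x : ℝ) : ℂ) * ζ₀‖ = 2 * x := by
    rw [← sub_mul, norm_mul, hn, ← Complex.ofReal_sub, Complex.norm_real, mul_one,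
      Real.norm_of_nonpos (by linarith)]
    rw [hx]; ring
  rw [this] at h3
  linarith

end BoundaryEstimates

section Comparison
variable {Ω : Set (E N)} {α C : ℝ} {ρ : E N → ℝ}

/-- Splitting of a vector in its complex tangential and complex normal components. -/
lemma Pkg.exists_split (P : Pkg Ω α ρ C) {q : E N} (hq : q ∈ frontier Ω) (v : E N) :
    ∃ τ n : E N, v = τ + n ∧ nu ρ q τ = 0 ∧ ‖τ‖ ≤ ‖v‖ ∧ ‖n‖ * ‖nu ρ q‖ = ‖nu ρ q v‖ := by
  have hκ : 0 < ‖nu ρ q‖ := by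
    have := P.one_le_nu q hq
    have := P.one_le
    by_contra! h
    nlinarith
  have hκ' : ((‖nu ρ q‖ : ℝ) : ℂ) ≠ 0 := by exact_mod_cast hκ.ne'
  set a : ℂ := nu ρ q v / (‖nu ρ q‖ : ℂ) ^ 2 with ha
  have h0 : nu ρ q (v - a • nrm ρ q) = 0 := by
    rw [map_sub, map_smul, nu_nrm, smul_eq_mul, ha, div_mul_cancel₀ _ (pow_ne_zero 2 hκ'), sub_self]
  refine ⟨v - a • nrm ρ q, a • nrm ρ q, by simp, h0, ?_, ?_⟩
  · have h1 : inner ℂ (v - a • nrm ρ q) (a • nrm ρ q) = (0 : ℂ) := by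
      rw [nu_eq_inner] at h0
      rw [inner_smul_right, ← inner_conj_symm, h0, map_zero, mul_zero]
    have h2 := norm_add_sq_eq_norm_sq_add_norm_sq_of_inner_eq_zero (𝕜 := ℂ) _ _ h1
    rw [sub_add_cancel] at h2
    nlinarith [norm_nonneg (v - a • nrm ρ q), norm_nonneg v, norm_nonneg (a • nrm ρ q)]
  · rw [norm_smul, norm_nrm, ha, norm_div, norm_pow, Complex.norm_real, norm_norm]
    field_simp

lemma Pkg.norm_le_of_formB (P : Pkg Ω α ρ C) {q : E N} (hq : q ∈ frontier Ω) {v : E N} {b : ℝ}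
    (hb : 0 ≤ b) (h : ∀ τ, nu ρ q τ = 0 → ‖formB ρ q τ v‖ ≤ b * ‖τ‖) :
    ‖v‖ ≤ 2 * C ^ 3 * (b + ‖nu ρ q v‖) := by
  obtain ⟨τ, n, hv, hτ, hτv, hn⟩ := P.exists_split hq v
  have hC := P.one_le
  have hn' : ‖n‖ ≤ C * ‖nu ρ q v‖ := by
    have := P.one_le_nu q hq
    rw [← hn]
    nlinarith [norm_nonneg n]
  have h1 := P.strict q hq τ hτ
  have h2 : formB ρ q τ τ = formB ρ q τ v - formB ρ q τ n := by rw [hv, map_add]; ring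
  have h3 : (formB ρ q τ τ).re ≤ b * ‖τ‖ + C * ‖τ‖ * ‖n‖ := by
    refine (Complex.re_le_norm _).trans ?_
    rw [h2]
    refine (norm_sub_le _ _).trans (add_le_add (h τ hτ) ?_)
    refine (ContinuousLinearMap.le_opNorm _ _).trans ?_
    gcongr
    exact P.formB_le q (frontier_subset_closure hq) τ
  have h4 : ‖τ‖ ≤ C * (b + C * ‖n‖) := by
    rcases (norm_nonneg τ).eq_or_lt with h0 | h0
    · rw [← h0]; positivity
    · have : ‖τ‖ * ‖τ‖ ≤ C * (b + C * ‖n‖) * ‖τ‖ := by nlinarith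
      exact le_of_mul_le_mul_right this h0
  have h5 : ‖v‖ ≤ ‖τ‖ + ‖n‖ := by rw [hv]; exact norm_add_le _ _
  have hu := norm_nonneg (nu ρ q v)
  have c2 : C ≤ C ^ 3 := le_self_pow₀ hC (by norm_num)
  calc ‖v‖ ≤ C * b + C ^ 2 * ‖n‖ + ‖n‖ := by linarith
    _ ≤ C * b + C ^ 2 * (C * ‖nu ρ q v‖) + C * ‖nu ρ q v‖ := by gcongr
    _ ≤ C ^ 3 * b + C ^ 2 * (C * ‖nu ρ q v‖) + C ^ 3 * ‖nu ρ q v‖ := by gcongr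
    _ ≤ _ := by nlinarith [mul_nonneg (by positivity : (0:ℝ) ≤ C ^ 3) hb]

end Comparison

section Nice
variable {Ω : Set (E N)} {α C : ℝ} {ρ : E N → ℝ} {φ φd : ℂ → E N}

lemma exists_polar {ζ : ℂ} (hζ : ζ ∈ ball (0 : ℂ) 1) :
    ∃ r : ℝ, ∃ ζ₀ ∈ sphere (0 : ℂ) 1, 0 ≤ r ∧ r < 1 ∧ ζ = r * ζ₀ ∧ ‖ζ‖ = r := by
  rw [mem_ball_zero_iff] at hζ
  refine ⟨‖ζ‖, Complex.exp (ζ.arg * Complex.I), ?_, norm_nonneg _, hζ, ?_, rfl⟩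
  · rw [mem_sphere_zero_iff_norm, Complex.norm_exp_ofReal_mul_I]
  · exact (Complex.norm_mul_exp_arg_mul_I ζ).symm

lemma Geo.norm_sub_le (G : Geo Ω φ φd) {M : ℝ} (hM : ∀ ζ ∈ closedBall (0 : ℂ) 1, ‖φd ζ‖ ≤ M) {ζ ξ : ℂ}
    (hζ : ζ ∈ closedBall (0 : ℂ) 1) (hξ : ξ ∈ closedBall (0 : ℂ) 1) : ‖φ ζ - φ ξ‖ ≤ M * ‖ζ - ξ‖ :=
  (convex_closedBall (0 : ℂ) 1).norm_image_sub_le_of_norm_hasDerivWithin_le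
    (fun _ h => G.hasDerivWithinAt h) hM hξ hζ

lemma Geo.norm_nu_eq (G : Geo Ω φ φd) (P : Dom Ω α ρ C) {ζ : ℂ} (hζ : ζ ∈ sphere (0 : ℂ) 1) :
    ‖nu ρ (φ ζ) (φd ζ)‖ = (nu ρ (φ ζ) (ζ • φd ζ)).re := by
  have h := G.nu_eq_ofReal P.toPkg hζ
  have h1 := congrArg norm h
  rw [Complex.norm_real, Real.norm_of_nonneg (G.nu_pos P hζ).le, map_smul, norm_smul,
    mem_sphere_zero_iff_norm.1 hζ, one_mul] at h1
  rw [map_smul]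
  exact h1

lemma DualMap.norm_apply {g : ℂ → E N →L[ℂ] ℂ} (H : DualMap ρ φ φd g) (G : Geo Ω φ φd)
    (P : Dom Ω α ρ C) {ζ : ℂ} (hζ : ζ ∈ sphere (0 : ℂ) 1) (v : E N) :
    ‖g ζ v‖ = ‖nu ρ (φ ζ) v‖ / ‖nu ρ (φ ζ) (φd ζ)‖ := by
  rw [H.eq ζ hζ, G.nu_eq_ofReal P.toPkg hζ, G.norm_nu_eq P hζ, smul_apply, norm_smul,
    norm_div, mem_sphere_zero_iff_norm.1 hζ, Complex.norm_real,
    Real.norm_of_nonneg (G.nu_pos P hζ).le]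
  ring

/-- A geodesic whose derivatives have the size dictated by the diameter `d`. -/
structure Nice (ρ : E N → ℝ) (φ φd : ℂ → E N) (C d : ℝ) : Prop where
  pos : 0 < d
  dist_le : ∀ ζ ∈ closedBall (0 : ℂ) 1, ∀ ξ ∈ closedBall (0 : ℂ) 1, ‖φ ζ - φ ξ‖ ≤ d
  upper : ∀ ζ ∈ closedBall (0 : ℂ) 1, ‖φd ζ‖ ≤ C * d
  lower : ∀ ζ ∈ closedBall (0 : ℂ) 1, d ≤ C * ‖φd ζ‖
  nu_le : ∀ ζ ∈ sphere (0 : ℂ) 1, ‖nu ρ (φ ζ) (φd ζ)‖ ≤ C * d ^ 2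
  le_nu : ∀ ζ ∈ sphere (0 : ℂ) 1, d ^ 2 ≤ C * ‖nu ρ (φ ζ) (φd ζ)‖

lemma Nice.mono {C' d : ℝ} (H : Nice ρ φ φd C d) (h : C ≤ C') : Nice ρ φ φd C' d where
  pos := H.pos
  dist_le := H.dist_le
  upper ζ hζ := (H.upper ζ hζ).trans (by have := H.pos; gcongr)
  lower ζ hζ := (H.lower ζ hζ).trans (by gcongr)
  nu_le ζ hζ := (H.nu_le ζ hζ).trans (by gcongr)
  le_nu ζ hζ := (H.le_nu ζ hζ).trans (by gcongr)

variable {d : ℝ}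

lemma Nice.boundary (H : Nice ρ φ φd C d) (hC : 1 ≤ C) {ζ : ℂ} (hζ : ζ ∈ sphere (0 : ℂ) 1) :
    d ≤ C ^ 2 * (‖nu ρ (φ ζ) (φd ζ)‖ / ‖φd ζ‖) ∧ ‖nu ρ (φ ζ) (φd ζ)‖ / ‖φd ζ‖ ≤ C ^ 2 * d := by
  have hd := H.pos
  have h1 := H.upper ζ (sphere_subset_closedBall hζ)
  have h2 := H.lower ζ (sphere_subset_closedBall hζ)
  have h3 := H.nu_le ζ hζ
  have h4 := H.le_nu ζ hζ
  have hn : 0 < ‖φd ζ‖ := by by_contra! h; nlinarith [norm_nonneg (φd ζ)]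
  constructor
  · rw [← mul_div_assoc, le_div_iff₀ hn]
    calc d * ‖φd ζ‖ ≤ d * (C * d) := by gcongr
      _ = C * d ^ 2 := by ring
      _ ≤ C * (C * ‖nu ρ (φ ζ) (φd ζ)‖) := by gcongr
      _ = _ := by ring
  · rw [div_le_iff₀ hn]
    calc _ ≤ C * d ^ 2 := h3
      _ = C * d * d := by ring
      _ ≤ C * d * (C * ‖φd ζ‖) := by gcongr
      _ = _ := by ring

lemma Nice.interior_le (H : Nice ρ φ φd C d) (G : Geo Ω φ φd) (P : Dom Ω α ρ C) {ζ : ℂ}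
    (hζ : ζ ∈ ball (0 : ℂ) 1) {q : E N} (hq : q ∈ frontier Ω) (hqz : dist (φ ζ) q = bdist Ω (φ ζ)) :
    ‖nu ρ q (φd ζ)‖ / ‖nu ρ q‖ / ‖φd ζ‖ + Real.sqrt (bdist Ω (φ ζ)) ≤ 6 * C ^ 4 * d := by
  have hd := H.pos
  have hC := P.one_le
  have hζc := ball_subset_closedBall hζ
  have one : (1 : ℂ) ∈ sphere (0 : ℂ) 1 := by simp
  have onec := sphere_subset_closedBall one
  have hq1 := G.mem_frontier P.isOpen one
  have h2 := H.lower ζ hζc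
  have hn : 0 < ‖φd ζ‖ := by by_contra! h; nlinarith [norm_nonneg (φd ζ)]
  have hκ : 0 < ‖nu ρ q‖ := by have := P.one_le_nu q hq; by_contra! h; nlinarith
  have hδ : bdist Ω (φ ζ) ≤ d := by
    refine (infDist_le_dist_of_mem hq1).trans ?_
    rw [dist_eq_norm]
    exact H.dist_le _ hζc _ onec
  have hnu1 : ‖nu ρ (φ 1) (φd ζ)‖ ≤ 2 * C ^ 2 * d ^ 2 := by
    have hA : DiskAlg fun ξ => nu ρ (φ 1) (φd ξ) :=
      (nu ρ (φ 1)).differentiable.comp_diffContOnCl G.diskAlgd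
    refine hA.norm_le (fun ξ hξ => ?_) hζc
    have hξc := sphere_subset_closedBall hξ
    have e : nu ρ (φ 1) (φd ξ) = nu ρ (φ ξ) (φd ξ) + (nu ρ (φ 1) - nu ρ (φ ξ)) (φd ξ) := by simp
    rw [e]
    calc _ ≤ ‖nu ρ (φ ξ) (φd ξ)‖ + ‖nu ρ (φ 1) - nu ρ (φ ξ)‖ * ‖φd ξ‖ :=
          (norm_add_le _ _).trans (add_le_add le_rfl (ContinuousLinearMap.le_opNorm _ _))
      _ ≤ C * d ^ 2 + C * d * (C * d) := by
          gcongr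
          · exact H.nu_le ξ hξ
          · refine (P.nu_lip _ (G.mem_closure onec) _ (G.mem_closure hξc)).trans ?_
            gcongr
            exact H.dist_le _ onec _ hξc
          · exact H.upper ξ hξc
      _ ≤ _ := by nlinarith [mul_nonneg (sub_nonneg.2 hC) (sq_nonneg d)]
  have hnuq : ‖nu ρ q (φd ζ)‖ ≤ 4 * C ^ 2 * d ^ 2 := by
    have e : nu ρ q (φd ζ) = nu ρ (φ 1) (φd ζ) + (nu ρ q - nu ρ (φ 1)) (φd ζ) := by simp
    have hqq : ‖q - φ 1‖ ≤ 2 * d := by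
      calc ‖q - φ 1‖ = ‖(φ ζ - φ 1) - (φ ζ - q)‖ := by congr 1; abel
        _ ≤ ‖φ ζ - φ 1‖ + ‖φ ζ - q‖ := norm_sub_le _ _
        _ ≤ d + d := by
            refine add_le_add (H.dist_le _ hζc _ onec) ?_
            rw [← dist_eq_norm, hqz]; exact hδ
        _ = 2 * d := by ring
    rw [e]
    calc _ ≤ ‖nu ρ (φ 1) (φd ζ)‖ + ‖nu ρ q - nu ρ (φ 1)‖ * ‖φd ζ‖ :=
          (norm_add_le _ _).trans (add_le_add le_rfl (ContinuousLinearMap.le_opNorm _ _))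
      _ ≤ 2 * C ^ 2 * d ^ 2 + C * (2 * d) * (C * d) := by
          gcongr
          · refine (P.nu_lip _ (frontier_subset_closure hq) _ (G.mem_closure onec)).trans ?_
            gcongr
          · exact H.upper ζ hζc
      _ = _ := by ring
  have ht1 : ‖nu ρ q (φd ζ)‖ / ‖nu ρ q‖ / ‖φd ζ‖ ≤ 4 * C ^ 4 * d := by
    rw [div_div, div_le_iff₀ (by positivity)]
    calc _ ≤ 4 * C ^ 2 * d ^ 2 := hnuq
      _ = 4 * C ^ 2 * d * 1 * d := by ring
      _ ≤ 4 * C ^ 2 * d * (C * ‖nu ρ q‖) * (C * ‖φd ζ‖) := by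
          gcongr
          exact P.one_le_nu q hq
      _ = _ := by ring
  have hre : -(C * d ^ 2) ≤ (nu ρ (φ 1) (φ ζ - φ 1)).re := by
    have hA : DiskAlg fun ξ => nu ρ (φ 1) (φ ξ - φ 1) :=
      (nu ρ (φ 1)).differentiable.comp_diffContOnCl (G.diskAlg.sub (diskAlg_const _))
    refine hA.le_re (fun ξ hξ => ?_) hζc
    have hξc := sphere_subset_closedBall hξ
    have h1 := P.val (φ ξ) (G.mem_closure hξc) (φ 1) hq1
    rw [P.zero _ (G.mem_frontier P.isOpen hξ), zero_sub, abs_neg] at h1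
    have h3 : C * ‖φ ξ - φ 1‖ ^ 2 ≤ C * d ^ 2 := by
      gcongr; exact H.dist_le _ hξc _ onec
    linarith [(abs_le.1 h1).1]
  have hδ2 : bdist Ω (φ ζ) ≤ (2 * C * d) ^ 2 := by
    have h1 := P.val (φ ζ) (G.mem_closure hζc) (φ 1) hq1
    have h3 : C * ‖φ ζ - φ 1‖ ^ 2 ≤ C * d ^ 2 := by
      gcongr; exact H.dist_le _ hζc _ onec
    have h4 := P.bdist_le (φ ζ) (G.mem_closure hζc)
    have h5 : -ρ (φ ζ) ≤ 2 * C * d ^ 2 := by linarith [(abs_le.1 h1).1]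
    calc _ ≤ C * (2 * C * d ^ 2) := h4.trans (by gcongr)
      _ ≤ _ := by nlinarith [sq_nonneg (C * d)]
  have ht2 : Real.sqrt (bdist Ω (φ ζ)) ≤ 2 * C * d := Real.sqrt_le_iff.2 ⟨by positivity, hδ2⟩
  have c4 : C ≤ C ^ 4 := le_self_pow₀ hC (by norm_num)
  nlinarith

lemma Nice.le_interior (H : Nice ρ φ φd C d) (G : Geo Ω φ φd) (P : Dom Ω α ρ C) {ζ : ℂ}
    (hζ : ζ ∈ ball (0 : ℂ) 1) {q : E N} (hq : q ∈ frontier Ω) (hqz : dist (φ ζ) q = bdist Ω (φ ζ)) :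
    d ≤ 8 * C ^ 8 * (‖nu ρ q (φd ζ)‖ / ‖nu ρ q‖ / ‖φd ζ‖ + Real.sqrt (bdist Ω (φ ζ))) := by
  have hd := H.pos
  have hC := P.one_le
  have hζc := ball_subset_closedBall hζ
  have h2 := H.lower ζ hζc
  have hup := H.upper ζ hζc
  have hn : 0 < ‖φd ζ‖ := by by_contra! h; nlinarith [norm_nonneg (φd ζ)]
  have hκ : 0 < ‖nu ρ q‖ := by have := P.one_le_nu q hq; by_contra! h; nlinarith
  obtain ⟨r, ζ₀, h0, hr0, hr1, hζr, hζn⟩ := exists_polar hζ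
  have h0c := sphere_subset_closedBall h0
  have h0n := mem_sphere_zero_iff_norm.1 h0
  have hp0 := G.mem_frontier P.isOpen h0
  set x : ℝ := 1 - r with hx
  have hx0 : 0 < x := by linarith
  have hnn : 0 ≤ ‖nu ρ q (φd ζ)‖ / ‖nu ρ q‖ / ‖φd ζ‖ := by positivity
  have hsn := Real.sqrt_nonneg (bdist Ω (φ ζ))
  rcases le_or_gt 1 (8 * C ^ 6 * x) with hx1 | hx1
  · have hk := P.kob φ G.geod.1 G.geod.2.1 ζ hζ
    rw [hζn, ← G.eq ζ hζ] at hk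
    have h3 : d ≤ 8 * C ^ 8 * Real.sqrt (bdist Ω (φ ζ)) := by
      rw [← Real.sqrt_sq hd.le, ← Real.sqrt_sq (by positivity : 0 ≤ 8 * C ^ 8), ← Real.sqrt_mul (by positivity)]
      refine Real.sqrt_le_sqrt ?_
      calc d ^ 2 = 1 ^ 2 * d ^ 2 := by ring
        _ ≤ (8 * C ^ 6 * x) ^ 2 * (C * ‖φd ζ‖) ^ 2 := by gcongr
        _ = 64 * C ^ 14 * (x ^ 2 * ‖φd ζ‖ ^ 2) := by ring
        _ ≤ 64 * C ^ 14 * (C * bdist Ω (φ ζ)) := by gcongr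
        _ = 64 * C ^ 15 * bdist Ω (φ ζ) := by ring
        _ ≤ 64 * C ^ 16 * bdist Ω (φ ζ) := by
            have := P.toPkg.bdist_pos (G.mapsTo hζ)
            gcongr
            norm_num
        _ = _ := by ring
    have : 0 ≤ 8 * C ^ 8 * (‖nu ρ q (φd ζ)‖ / ‖nu ρ q‖ / ‖φd ζ‖) := by positivity
    linarith
  · obtain ⟨g, Hg⟩ := G.exists_dualMap P
    obtain ⟨τ, n, hv, hτ, hτv, hnn⟩ := P.toPkg.exists_split hp0 (φd ζ)
    have hcirc : ∀ ξ ∈ sphere (0 : ℂ) 1, ∀ v, ‖g ξ v‖ ≤ C / d ^ 2 * ‖nu ρ (φ ξ) v‖ := fun ξ hξ v => by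
      have h4 := H.le_nu ξ hξ
      have h5 : 0 < ‖nu ρ (φ ξ) (φd ξ)‖ := by rw [G.norm_nu_eq P hξ]; exact G.nu_pos P hξ
      rw [Hg.norm_apply G P hξ, div_le_iff₀ h5]
      calc ‖nu ρ (φ ξ) v‖ = ‖nu ρ (φ ξ) v‖ / d ^ 2 * d ^ 2 := by field_simp
        _ ≤ ‖nu ρ (φ ξ) v‖ / d ^ 2 * (C * ‖nu ρ (φ ξ) (φd ξ)‖) := by gcongr
        _ = _ := by ring
    have hgτ : ‖g ζ τ‖ ≤ 1 / 2 := by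
      have := (Hg.diskAlg_apply (diskAlg_const τ)).norm_radial_le h0 (L := C ^ 4) (fun ξ hξ => by
        have hξc := sphere_subset_closedBall hξ
        have e : nu ρ (φ ξ) τ = (nu ρ (φ ξ) - nu ρ (φ ζ₀)) τ := by simp [hτ]
        calc ‖g ξ τ‖ ≤ C / d ^ 2 * ‖nu ρ (φ ξ) τ‖ := hcirc ξ hξ τ
          _ ≤ C / d ^ 2 * (C * (C * d * ‖ξ - ζ₀‖) * (C * d)) := by
              rw [e]
              gcongr
              refine (ContinuousLinearMap.le_opNorm _ _).trans ?_
              gcongr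
              · refine (P.nu_lip _ (G.mem_closure hξc) _ (G.mem_closure h0c)).trans ?_
                gcongr
                exact G.norm_sub_le H.upper hξc h0c
              · exact hτv.trans hup
          _ = _ := by field_simp) hr0 hr1
      rw [hζr]
      refine this.trans ?_
      have c6 : C ^ 4 ≤ C ^ 6 := pow_le_pow_right₀ hC (by norm_num)
      have : C ^ 4 * x ≤ C ^ 6 * x := by gcongr
      linarith
    have hgn : 1 / 2 ≤ ‖g ζ n‖ := by
      have h1 := Hg.apply ζ hζc
      rw [hv, map_add] at h1
      have h3 := norm_add_le (g ζ τ) (g ζ n)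
      rw [h1, norm_one] at h3
      linarith
    have hgn2 : ‖g ζ n‖ ≤ C / d ^ 2 * (C * ‖n‖) := by
      refine (Hg.diskAlg_apply (diskAlg_const n)).norm_le (fun ξ hξ => ?_) hζc
      refine (hcirc ξ hξ n).trans ?_
      gcongr
      refine (ContinuousLinearMap.le_opNorm _ _).trans ?_
      gcongr
      exact P.nu_le _ (G.mem_closure (sphere_subset_closedBall hξ))
    have hnd : d ^ 2 ≤ 2 * C ^ 2 * ‖n‖ := by
      have : 1 / 2 ≤ C / d ^ 2 * (C * ‖n‖) := hgn.trans hgn2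
      rw [div_mul_eq_mul_div, le_div_iff₀ (by positivity)] at this
      nlinarith
    have hnu0 : d ^ 2 ≤ 2 * C ^ 3 * ‖nu ρ (φ ζ₀) (φd ζ)‖ := by
      have h1 := P.one_le_nu _ hp0
      rw [← hnn]
      calc d ^ 2 ≤ 2 * C ^ 2 * ‖n‖ * 1 := by linarith
        _ ≤ 2 * C ^ 2 * ‖n‖ * (C * ‖nu ρ (φ ζ₀)‖) := by gcongr
        _ = _ := by ring
    have hz0 : ‖φ ζ - φ ζ₀‖ ≤ C * d * x := by
      refine (G.norm_sub_le H.upper hζc h0c).trans (le_of_eq ?_)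
      have : ζ - ζ₀ = ((r - 1 : ℝ) : ℂ) * ζ₀ := by rw [hζr]; push_cast; ring
      rw [this, norm_mul, h0n, Complex.norm_real, Real.norm_of_nonpos (by linarith), hx]
      ring
    have hqq : ‖φ ζ₀ - q‖ ≤ 2 * (C * d * x) := by
      calc ‖φ ζ₀ - q‖ = ‖(φ ζ - q) - (φ ζ - φ ζ₀)‖ := by congr 1; abel
        _ ≤ ‖φ ζ - q‖ + ‖φ ζ - φ ζ₀‖ := norm_sub_le _ _
        _ ≤ C * d * x + C * d * x := by
            refine add_le_add ?_ hz0
            rw [← dist_eq_norm, hqz]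
            refine (infDist_le_dist_of_mem hp0).trans ?_
            rwa [dist_eq_norm]
        _ = _ := by ring
    have hnuq : ‖nu ρ (φ ζ₀) (φd ζ)‖ ≤ ‖nu ρ q (φd ζ)‖ + 2 * C ^ 3 * d ^ 2 * x := by
      have e : nu ρ (φ ζ₀) (φd ζ) = nu ρ q (φd ζ) + (nu ρ (φ ζ₀) - nu ρ q) (φd ζ) := by simp
      rw [e]
      calc _ ≤ ‖nu ρ q (φd ζ)‖ + ‖nu ρ (φ ζ₀) - nu ρ q‖ * ‖φd ζ‖ :=
            (norm_add_le _ _).trans (add_le_add le_rfl (ContinuousLinearMap.le_opNorm _ _))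
        _ ≤ ‖nu ρ q (φd ζ)‖ + C * (2 * (C * d * x)) * (C * d) := by
            gcongr
            refine (P.nu_lip _ (G.mem_closure h0c) _ (frontier_subset_closure hq)).trans ?_
            gcongr
        _ = _ := by ring
    have hfin : d ^ 2 ≤ 4 * C ^ 3 * ‖nu ρ q (φd ζ)‖ := by
      have h4 : 2 * C ^ 3 * (2 * C ^ 3 * d ^ 2 * x) ≤ d ^ 2 / 2 := by
        nlinarith [mul_nonneg (sub_nonneg.2 hx1.le) (sq_nonneg d)]
      have h5 : 2 * C ^ 3 * ‖nu ρ (φ ζ₀) (φd ζ)‖ ≤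
          2 * C ^ 3 * (‖nu ρ q (φd ζ)‖ + 2 * C ^ 3 * d ^ 2 * x) := by gcongr
      linarith
    have hlast : d ≤ 8 * C ^ 8 * (‖nu ρ q (φd ζ)‖ / ‖nu ρ q‖ / ‖φd ζ‖) := by
      rw [div_div, ← mul_div_assoc, le_div_iff₀ (by positivity)]
      calc d * (‖nu ρ q‖ * ‖φd ζ‖) ≤ d * (C * (C * d)) := by
            gcongr
            exact P.nu_le _ (frontier_subset_closure hq)
        _ = C ^ 2 * d ^ 2 := by ring
        _ ≤ C ^ 2 * (4 * C ^ 3 * ‖nu ρ q (φd ζ)‖) := by gcongr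
        _ = 4 * C ^ 5 * ‖nu ρ q (φd ζ)‖ := by ring
        _ ≤ 8 * C ^ 8 * ‖nu ρ q (φd ζ)‖ := by
            gcongr
            · norm_num
            · norm_num
    have : 0 ≤ 8 * C ^ 8 * Real.sqrt (bdist Ω (φ ζ)) := by positivity
    linarith

end Nice

section Small
variable {Ω : Set (E N)} {α C : ℝ} {ρ : E N → ℝ} {φ φd : ℂ → E N}

/-- `d` is the diameter of the image of the closed disc under `φ`. -/
structure IsDiam (φ : ℂ → E N) (d : ℝ) : Prop where
  pos : 0 < d
  dist_le : ∀ ζ ∈ closedBall (0 : ℂ) 1, ∀ ξ ∈ closedBall (0 : ℂ) 1, ‖φ ζ - φ ξ‖ ≤ d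
  le : ∀ b, (∀ ζ ∈ closedBall (0 : ℂ) 1, ∀ ξ ∈ closedBall (0 : ℂ) 1, ‖φ ζ - φ ξ‖ ≤ b) → d ≤ b

lemma IsDiam.comp_mob {d : ℝ} (D : IsDiam φ d) {a : ℂ} (ha : a ∈ ball (0 : ℂ) 1) :
    IsDiam (fun ζ => φ (mob a ζ)) d where
  pos := D.pos
  dist_le ζ hζ ξ hξ := D.dist_le _ (mob_mem_closedBall ha hζ) _ (mob_mem_closedBall ha hξ)
  le b hb := D.le b fun ζ hζ ξ hξ => by
    have ha' : -a ∈ ball (0 : ℂ) 1 := by simpa using ha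
    have := hb _ (mob_mem_closedBall ha' hζ) _ (mob_mem_closedBall ha' hξ)
    rwa [mob_mob_neg ha hζ, mob_mob_neg ha hξ] at this

lemma IsDiam.le_two_mul {d : ℝ} (D : IsDiam φ d) (G : Geo Ω φ φd) {M : ℝ}
    (hM : ∀ ζ ∈ closedBall (0 : ℂ) 1, ‖φd ζ‖ ≤ M) : d ≤ 2 * M := by
  refine D.le _ fun ζ hζ ξ hξ => (G.norm_sub_le hM hζ hξ).trans ?_
  have hM0 : 0 ≤ M := (norm_nonneg _).trans (hM 0 (by simp))
  have : ‖ζ - ξ‖ ≤ 2 := by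
    have h1 := mem_closedBall_zero_iff.1 hζ
    have h2 := mem_closedBall_zero_iff.1 hξ
    linarith [norm_sub_le ζ ξ]
  nlinarith

lemma IsDiam.norm_deriv_zero_le {d : ℝ} (D : IsDiam φ d) (G : Geo Ω φ φd) : ‖φd 0‖ ≤ d := by
  have h0 : (0 : ℂ) ∈ ball (0 : ℂ) 1 := by simp
  have h := Complex.norm_deriv_le_of_forall_mem_sphere_norm_le (F := E N) (c := 0) (R := 1)
    (f := fun ζ => φ ζ - φ 0) one_pos (G.diskAlg.sub (diskAlg_const _)) (C := d)
    fun ζ hζ => D.dist_le _ (sphere_subset_closedBall hζ) _ (by simp)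
  rw [deriv_sub_const, ← G.eq 0 h0] at h
  simpa using h

lemma Pkg.norm_nu_apply_sub_le (P : Pkg Ω α ρ C) {z q : E N} (hz : z ∈ closure Ω)
    (hq : q ∈ closure Ω) (v : E N) : ‖nu ρ z v - nu ρ q v‖ ≤ C * ‖z - q‖ * ‖v‖ := by
  rw [← sub_apply]
  exact ((nu ρ z - nu ρ q).le_opNorm v).trans
    (mul_le_mul_of_nonneg_right (P.nu_lip z hz q hq) (norm_nonneg _))

lemma DualMap.comp_mob {g : ℂ → E N →L[ℂ] ℂ} (H : DualMap ρ φ φd g) {a : ℂ}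
    (ha : a ∈ ball (0 : ℂ) 1) : DualMap ρ (fun ζ => φ (mob a ζ))
      (fun ζ => mobd a ζ • φd (mob a ζ)) (fun ζ => (mobd a ζ)⁻¹ • g (mob a ζ)) where
  diskAlg := ((diskAlg_mobd ha).inv fun ζ hζ => mobd_ne_zero ha
    (by rwa [closure_ball _ one_ne_zero] at hζ)).smul (H.diskAlg.comp_mob ha)
  eq ζ hζ := by
    have h1 := mobd_ne_zero ha (sphere_subset_closedBall hζ)
    have h2 := mob_mem_sphere ha hζ
    have h3 := ne_zero_of_sphere hζ
    have h4 := ne_zero_of_sphere h2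
    rw [H.eq _ h2, smul_smul]
    congr 1
    simp only [map_smul, smul_eq_mul]
    by_cases h5 : nu ρ (φ (mob a ζ)) (φd (mob a ζ)) = 0
    · simp [h5]
    · field_simp
  apply ζ hζ := by
    have h1 := mobd_ne_zero ha hζ
    rw [smul_apply, map_smul, H.apply _ (mob_mem_closedBall ha hζ)]
    simp [h1]

/-- A geodesic of small diameter, normalized so that the normal component of its dual map vanishes
at the origin. -/
structure Small (Ω : Set (E N)) (α : ℝ) (ρ : E N → ℝ) (C : ℝ) (φ φd : ℂ → E N)
    (g : ℂ → E N →L[ℂ] ℂ) (q₀ n₀ : E N) (d : ℝ) : Prop where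
  P : Dom Ω α ρ C
  G : Geo Ω φ φd
  H : DualMap ρ φ φd g
  D : IsDiam φ d
  mem : q₀ ∈ frontier Ω
  near : ∀ ζ ∈ closedBall (0 : ℂ) 1, ‖φ ζ - q₀‖ ≤ d
  small : 2 * C ^ 2 * d ≤ 1
  norm_n : ‖n₀‖ ≤ C
  nu_n : nu ρ q₀ n₀ = 1

variable {g : ℂ → E N →L[ℂ] ℂ} {q₀ n₀ : E N} {d : ℝ}

namespace Small

lemma norm_nu_n_sub_le (S : Small Ω α ρ C φ φd g q₀ n₀ d) {z q : E N} (hz : z ∈ closure Ω)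
    (hq : q ∈ closure Ω) : ‖nu ρ z n₀ - nu ρ q n₀‖ ≤ C ^ 2 * ‖z - q‖ := by
  have hC := S.P.one_le
  have := S.P.norm_nu_apply_sub_le hz hq n₀
  have h2 := mul_le_mul_of_nonneg_left S.norm_n (show 0 ≤ C * ‖z - q‖ by positivity)
  linarith

lemma norm_nu_n_sub_one_le (S : Small Ω α ρ C φ φd g q₀ n₀ d) {ζ : ℂ}
    (hζ : ζ ∈ closedBall (0 : ℂ) 1) : ‖nu ρ (φ ζ) n₀ - 1‖ ≤ 1 / 2 := by
  have h := S.norm_nu_n_sub_le (S.G.mem_closure hζ) (frontier_subset_closure S.mem)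
  rw [S.nu_n] at h
  nlinarith [S.near ζ hζ, S.small, sq_nonneg C]

lemma half_le_re (S : Small Ω α ρ C φ φd g q₀ n₀ d) {ζ : ℂ}
    (hζ : ζ ∈ closedBall (0 : ℂ) 1) : 1 / 2 ≤ (nu ρ (φ ζ) n₀).re := by
  have h := (Complex.abs_re_le_norm _).trans (S.norm_nu_n_sub_one_le hζ)
  rw [Complex.sub_re, Complex.one_re] at h
  linarith [(abs_le.1 h).1]

lemma half_le_norm (S : Small Ω α ρ C φ φd g q₀ n₀ d) {ζ : ℂ}
    (hζ : ζ ∈ closedBall (0 : ℂ) 1) : 1 / 2 ≤ ‖nu ρ (φ ζ) n₀‖ :=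
  (S.half_le_re hζ).trans (Complex.re_le_norm _)

lemma norm_le_two (S : Small Ω α ρ C φ φd g q₀ n₀ d) {ζ : ℂ}
    (hζ : ζ ∈ closedBall (0 : ℂ) 1) : ‖nu ρ (φ ζ) n₀‖ ≤ 2 := by
  have h := norm_sub_norm_le (nu ρ (φ ζ) n₀) 1
  rw [norm_one] at h
  linarith [S.norm_nu_n_sub_one_le hζ]

lemma nu_pos (S : Small Ω α ρ C φ φd g q₀ n₀ d) {ζ : ℂ} (hζ : ζ ∈ sphere (0 : ℂ) 1) :
    0 < ‖nu ρ (φ ζ) (φd ζ)‖ := by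
  rw [S.G.norm_nu_eq S.P hζ]
  exact S.G.nu_pos S.P hζ

lemma apply_eq (S : Small Ω α ρ C φ φd g q₀ n₀ d) {ζ : ℂ} (hζ : ζ ∈ sphere (0 : ℂ) 1) (v : E N) :
    g ζ v = ζ * ((‖nu ρ (φ ζ) (φd ζ)‖⁻¹ : ℝ) * nu ρ (φ ζ) v) := by
  rw [S.H.eq ζ hζ, S.G.nu_eq_ofReal S.P.toPkg hζ, ← S.G.norm_nu_eq S.P hζ, smul_apply,
    smul_eq_mul]
  push_cast
  ring

lemma exists_zero (S : Small Ω α ρ C φ φd g q₀ n₀ d) : ∃ a ∈ ball (0 : ℂ) 1, g a n₀ = 0 := by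
  by_contra! h
  have hA : DiskAlg fun ζ => g ζ n₀ := S.H.diskAlg_apply (diskAlg_const n₀)
  have hne : ∀ ζ ∈ closedBall (0 : ℂ) 1, g ζ n₀ ≠ 0 := fun ζ hζ => by
    rcases (mem_closedBall.1 hζ).lt_or_eq with h1 | h1
    · exact h ζ h1
    · rw [S.apply_eq h1]
      refine mul_ne_zero (ne_zero_of_sphere h1) (mul_ne_zero ?_ ?_)
      · exact_mod_cast (inv_pos.2 (S.nu_pos h1)).ne'
      · intro h0
        have := S.half_le_re hζ
        rw [h0] at this
        norm_num at this
  have hQ : DiskAlg fun ζ => ζ * (g ζ n₀)⁻¹ := diskAlg_id.mul (hA.inv fun ζ hζ => hne ζ (by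
    rwa [closure_ball _ one_ne_zero] at hζ))
  have hcont : ContinuousOn (fun ζ => (ζ * (g ζ n₀)⁻¹).re) (sphere 0 1) :=
    Complex.continuous_re.comp_continuousOn hQ.contS
  obtain ⟨ξ, hξ, hmin⟩ := (isCompact_sphere (0 : ℂ) 1).exists_isMinOn ⟨1, by simp⟩ hcont
  have hle := hQ.le_re (m := (ξ * (g ξ n₀)⁻¹).re) (fun ζ hζ => hmin hζ) (z := 0) (by simp)
  have hpos : 0 < (ξ * (g ξ n₀)⁻¹).re := by
    have e : ξ * (g ξ n₀)⁻¹ = (‖nu ρ (φ ξ) (φd ξ)‖ : ℝ) * (nu ρ (φ ξ) n₀)⁻¹ := by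
      rw [S.apply_eq hξ, mul_inv, mul_inv, ← mul_assoc, mul_inv_cancel₀ (ne_zero_of_sphere hξ)]
      push_cast
      rw [inv_inv, one_mul]
    rw [e, Complex.re_ofReal_mul, Complex.inv_re]
    have h1 := S.half_le_re (sphere_subset_closedBall hξ)
    have h2 := S.half_le_norm (sphere_subset_closedBall hξ)
    have h3 : 0 < Complex.normSq (nu ρ (φ ξ) n₀) := by
      rw [Complex.normSq_eq_norm_sq]; positivity
    have := S.nu_pos hξ
    have h4 : 0 < (nu ρ (φ ξ) n₀).re := by linarith
    positivity
  simp only [zero_mul, Complex.zero_re] at hle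
  linarith

end Small
end Small

section SmallEst
variable {Ω : Set (E N)} {α C : ℝ} {ρ : E N → ℝ} {φ φd : ℂ → E N}
variable {g : ℂ → E N →L[ℂ] ℂ} {q₀ n₀ : E N} {d : ℝ}

/-- The reduced normal component of the dual map. -/
def redn (g : ℂ → E N →L[ℂ] ℂ) (n₀ : E N) : ℂ → ℂ := dslope (fun ζ => g ζ n₀) 0

namespace Small

lemma diskAlg_redn (S : Small Ω α ρ C φ φd g q₀ n₀ d) : DiskAlg (redn g n₀) :=
  DiskAlg.dslope (S.H.diskAlg_apply (diskAlg_const n₀)) (by simp)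

lemma redn_eq (S : Small Ω α ρ C φ φd g q₀ n₀ d) (h0 : g 0 n₀ = 0) {ζ : ℂ}
    (hζ : ζ ∈ sphere (0 : ℂ) 1) :
    redn g n₀ ζ = (‖nu ρ (φ ζ) (φd ζ)‖⁻¹ : ℝ) * nu ρ (φ ζ) n₀ := by
  have h1 := ne_zero_of_sphere hζ
  rw [redn, dslope_of_ne _ h1, slope_def_module, h0, S.apply_eq hζ, sub_zero, sub_zero, smul_eq_mul,
    inv_mul_cancel_left₀ h1]

lemma norm_redn (S : Small Ω α ρ C φ φd g q₀ n₀ d) (h0 : g 0 n₀ = 0) {ζ : ℂ}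
    (hζ : ζ ∈ sphere (0 : ℂ) 1) :
    ‖redn g n₀ ζ‖ = ‖nu ρ (φ ζ) (φd ζ)‖⁻¹ * ‖nu ρ (φ ζ) n₀‖ := by
  rw [S.redn_eq h0 hζ, norm_mul, Complex.norm_real, norm_inv, norm_norm]

lemma redn_re_pos (S : Small Ω α ρ C φ φd g q₀ n₀ d) (h0 : g 0 n₀ = 0) {ζ : ℂ}
    (hζ : ζ ∈ closedBall (0 : ℂ) 1) : 0 < (redn g n₀ ζ).re := by
  have hcont : ContinuousOn (fun ζ => (redn g n₀ ζ).re) (sphere 0 1) :=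
    Complex.continuous_re.comp_continuousOn S.diskAlg_redn.contS
  obtain ⟨ξ, hξ, hmin⟩ := (isCompact_sphere (0 : ℂ) 1).exists_isMinOn ⟨1, by simp⟩ hcont
  refine lt_of_lt_of_le ?_ (S.diskAlg_redn.le_re (fun ζ hζ => hmin hζ) hζ)
  show 0 < (redn g n₀ ξ).re
  rw [S.redn_eq h0 hξ, Complex.re_ofReal_mul]
  have h1 := S.half_le_re (sphere_subset_closedBall hξ)
  have h4 : 0 < (nu ρ (φ ξ) n₀).re := by linarith
  have := S.nu_pos hξ
  positivity

lemma redn_ne_zero (S : Small Ω α ρ C φ φd g q₀ n₀ d) (h0 : g 0 n₀ = 0) {ζ : ℂ}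
    (hζ : ζ ∈ closedBall (0 : ℂ) 1) : redn g n₀ ζ ≠ 0 := fun h => by
  have := S.redn_re_pos h0 hζ
  rw [h] at this
  simp at this

lemma d_le_one (S : Small Ω α ρ C φ φd g q₀ n₀ d) : d ≤ 1 := by
  have h1 := S.P.one_le
  have h2 := S.small
  have h3 := S.D.pos
  nlinarith [one_le_pow₀ h1 (n := 2)]

/-- The left companion of `formB ρ q τ (φ - q)` in the approximate stationarity equation. -/
def leftPart (ρ : E N → ℝ) (φ : ℂ → E N) (g : ℂ → E N →L[ℂ] ℂ) (n₀ q τ : E N) (ζ : ℂ) : ℂ :=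
  g ζ τ * (nu ρ q n₀ * (redn g n₀ ζ)⁻¹) - ζ * formA ρ q τ (φ ζ - q)

lemma diskAlg_leftPart (S : Small Ω α ρ C φ φd g q₀ n₀ d) (h0 : g 0 n₀ = 0) (q τ : E N) :
    DiskAlg (leftPart ρ φ g n₀ q τ) :=
  ((S.H.diskAlg_apply (diskAlg_const τ)).mul ((diskAlg_const _).mul
    (S.diskAlg_redn.inv fun ζ hζ => S.redn_ne_zero h0
      (by rwa [closure_ball _ one_ne_zero] at hζ)))).sub
    (diskAlg_id.mul ((formA ρ q τ).differentiable.comp_diffContOnCl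
      (S.G.diskAlg.sub (diskAlg_const q))))

lemma diskAlg_rightPart (S : Small Ω α ρ C φ φd g q₀ n₀ d) (q τ : E N) :
    DiskAlg fun ζ => formB ρ q τ (φ ζ - q) :=
  (formB ρ q τ).differentiable.comp_diffContOnCl (S.G.diskAlg.sub (diskAlg_const q))

lemma leftPart_zero (q τ : E N) :
    leftPart ρ φ g n₀ q τ 0 = g 0 τ * (nu ρ q n₀ * (redn g n₀ 0)⁻¹) := by
  simp [leftPart]

lemma stationarity (S : Small Ω α ρ C φ φd g q₀ n₀ d) (h0 : g 0 n₀ = 0) {q τ : E N}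
    (hq : q ∈ frontier Ω) (hτ : nu ρ q τ = 0) {ζ : ℂ} (hζ : ζ ∈ sphere (0 : ℂ) 1)
    (hqd : ‖φ ζ - q‖ ≤ d) :
    ‖leftPart ρ φ g n₀ q τ ζ / ζ - (starRingEnd ℂ) (formB ρ q τ (φ ζ - q))‖ ≤
      3 * C ^ 3 * ‖τ‖ * ‖φ ζ - q‖ ^ (1 + α) := by
  have hζc := sphere_subset_closedBall hζ
  have hC := S.P.one_le
  have hz := S.G.mem_closure hζc
  have hq' := frontier_subset_closure hq
  have hne := ne_zero_of_sphere hζ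
  have hx := (S.nu_pos hζ).ne'
  have hx' : (‖nu ρ (φ ζ) (φd ζ)‖ : ℂ) ≠ 0 := by exact_mod_cast hx
  have hwn := S.half_le_norm hζc
  have hw : nu ρ (φ ζ) n₀ ≠ 0 := fun h => by rw [h] at hwn; norm_num at hwn
  have e : leftPart ρ φ g n₀ q τ ζ / ζ - (starRingEnd ℂ) (formB ρ q τ (φ ζ - q)) =
      (nu ρ (φ ζ) τ - nu ρ q τ - (formA ρ q τ (φ ζ - q) + (starRingEnd ℂ) (formB ρ q τ (φ ζ - q))))
      - nu ρ (φ ζ) τ * (nu ρ (φ ζ) n₀ - nu ρ q n₀) / nu ρ (φ ζ) n₀ := by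
    rw [leftPart, S.redn_eq h0 hζ, S.apply_eq hζ, hτ]
    push_cast
    field_simp
    ring
  have h1 := S.P.dnu (φ ζ) hz q hq' τ
  have h2 : ‖nu ρ (φ ζ) τ‖ ≤ C * ‖φ ζ - q‖ * ‖τ‖ := by
    simpa [hτ] using S.P.norm_nu_apply_sub_le hz hq' τ
  have h3 := S.norm_nu_n_sub_le hz hq'
  have hD1 : ‖φ ζ - q‖ ≤ 1 := hqd.trans S.d_le_one
  have hD2 : ‖φ ζ - q‖ ^ 2 ≤ ‖φ ζ - q‖ ^ (1 + α) := by
    rw [← Real.rpow_natCast]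
    have := S.P.α_pos
    have := S.P.α_le
    exact Real.rpow_le_rpow_of_exponent_ge' (norm_nonneg _) hD1 (by linarith)
      (by push_cast; linarith)
  have h4 : ‖nu ρ (φ ζ) τ * (nu ρ (φ ζ) n₀ - nu ρ q n₀) / nu ρ (φ ζ) n₀‖ ≤
      2 * C ^ 3 * ‖τ‖ * ‖φ ζ - q‖ ^ 2 := by
    rw [norm_div, norm_mul, div_le_iff₀ (by linarith)]
    calc _ ≤ C * ‖φ ζ - q‖ * ‖τ‖ * (C ^ 2 * ‖φ ζ - q‖) := by gcongr
      _ = 2 * C ^ 3 * ‖τ‖ * ‖φ ζ - q‖ ^ 2 * (1 / 2) := by ring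
      _ ≤ _ := by gcongr
  rw [e]
  refine (norm_sub_le _ _).trans ((add_le_add h1 h4).trans ?_)
  have h5 : C ≤ C ^ 3 := le_self_pow₀ hC (by norm_num)
  calc _ ≤ C ^ 3 * ‖τ‖ * ‖φ ζ - q‖ ^ (1 + α) + 2 * C ^ 3 * ‖τ‖ * ‖φ ζ - q‖ ^ (1 + α) := by gcongr
    _ = _ := by ring

lemma stationarity_le (S : Small Ω α ρ C φ φd g q₀ n₀ d) (h0 : g 0 n₀ = 0) {q τ : E N}
    (hq : q ∈ frontier Ω) (hτ : nu ρ q τ = 0) {ζ : ℂ} (hζ : ζ ∈ sphere (0 : ℂ) 1) {D : ℝ}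
    (hqd : ‖φ ζ - q‖ ≤ d) (hD : ‖φ ζ - q‖ ≤ D) :
    ‖leftPart ρ φ g n₀ q τ ζ / ζ - (starRingEnd ℂ) (formB ρ q τ (φ ζ - q))‖ ≤
      3 * C ^ 3 * ‖τ‖ * D ^ (1 + α) := by
  have hC := S.P.one_le
  have := S.P.α_pos
  refine (S.stationarity h0 hq hτ hζ hqd).trans ?_
  gcongr

lemma deriv_rightPart (S : Small Ω α ρ C φ φd g q₀ n₀ d) (q τ : E N) {z : ℂ}
    (hz : z ∈ ball (0 : ℂ) 1) : deriv (fun ζ => formB ρ q τ (φ ζ - q)) z = formB ρ q τ (φd z) :=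
  ((formB ρ q τ).hasFDerivAt.comp_hasDerivAt z ((S.G.hasDerivAt hz).sub_const q)).deriv

lemma norm_center_le (S : Small Ω α ρ C φ φd g q₀ n₀ d) (h0 : g 0 n₀ = 0) {q τ : E N}
    (hq : q ∈ frontier Ω) (hτ : nu ρ q τ = 0) (hqd : ∀ ζ ∈ sphere (0 : ℂ) 1, ‖φ ζ - q‖ ≤ d) :
    ‖formB ρ q τ (φd 0) - (starRingEnd ℂ) (leftPart ρ φ g n₀ q τ 0)‖ ≤
      3 * C ^ 3 * ‖τ‖ * d ^ (1 + α) := by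
  have hz : (0 : ℂ) ∈ ball (0 : ℂ) 1 := by simp
  have h := norm_deriv_sub_conj_le (S.diskAlg_leftPart h0 q τ) (S.diskAlg_rightPart q τ) hz
  rw [S.deriv_rightPart q τ hz] at h
  refine h.trans ?_
  refine (cavg_mono (continuousOn_div_norm_sub_pow (continuousOn_stationarity_error
    (S.diskAlg_leftPart h0 q τ) (S.diskAlg_rightPart q τ)) hz 2) continuousOn_const
    (g := fun _ => 3 * C ^ 3 * ‖τ‖ * d ^ (1 + α)) fun ζ hζ => ?_).trans ?_
  · rw [sub_zero, mem_sphere_zero_iff_norm.1 hζ, one_pow, div_one]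
    exact S.stationarity_le h0 hq hτ hζ (hqd ζ hζ) (hqd ζ hζ)
  · simp [cavg, Real.circleAverage_const]

lemma norm_boundary_le (S : Small Ω α ρ C φ φd g q₀ n₀ d) (h0 : g 0 n₀ = 0) {M : ℝ}
    (hM : ∀ ζ ∈ closedBall (0 : ℂ) 1, ‖φd ζ‖ ≤ M) {ζ₀ : ℂ} (hζ₀ : ζ₀ ∈ sphere (0 : ℂ) 1) {τ : E N}
    (hτ : nu ρ (φ ζ₀) τ = 0) :
    ‖formB ρ (φ ζ₀) τ (φd ζ₀) - (starRingEnd ℂ) (leftPart ρ φ g n₀ (φ ζ₀) τ 0)‖ ≤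
      24 * C ^ 3 / α * ‖τ‖ * (M * d ^ α) := by
  have hC := S.P.one_le
  have hα := S.P.α_pos
  have hα1 := S.P.α_le
  have hd := S.D.pos
  have hdM := S.D.le_two_mul S.G hM
  have hM0 : 0 < M := by linarith
  have hc0 := sphere_subset_closedBall hζ₀
  have hq := S.G.mem_frontier S.P.isOpen hζ₀
  refine norm_le_of_radial (f := fun ζ => formB ρ (φ ζ₀) τ (φd ζ) -
    (starRingEnd ℂ) (leftPart ρ φ g n₀ (φ ζ₀) τ 0))
    (((formB ρ (φ ζ₀) τ).continuous.comp_continuousOn S.G.contd).sub continuousOn_const)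
    hζ₀ fun r hr0 hr1 => ?_
  have h := norm_deriv_sub_conj_le_split (S.diskAlg_leftPart h0 (φ ζ₀) τ)
    (S.diskAlg_rightPart (φ ζ₀) τ) hζ₀ (a := 3 * C ^ 3 * ‖τ‖ * M ^ (1 + α))
    (b := 3 * C ^ 3 * ‖τ‖ * d ^ (1 + α)) (t := d / M) (γ := α) (by positivity) (by positivity)
    (by positivity) (by rw [div_le_iff₀ hM0]; exact hdM) hα hα1
    (fun ζ hζ => by
      have hζc := sphere_subset_closedBall hζ
      rw [mul_assoc, ← Real.mul_rpow hM0.le (norm_nonneg _)]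
      exact S.stationarity_le h0 hq hτ hζ (S.D.dist_le _ hζc _ hc0)
        (S.G.norm_sub_le hM hζc hc0))
    (fun ζ hζ => by
      have hζc := sphere_subset_closedBall hζ
      exact S.stationarity_le h0 hq hτ hζ (S.D.dist_le _ hζc _ hc0) (S.D.dist_le _ hζc _ hc0))
    hr0 hr1
  rw [S.deriv_rightPart _ τ (smul_mem_ball_of hζ₀ hr0 hr1)] at h
  refine h.trans ?_
  have e1 : M ^ (1 + α) * (d / M) ^ α = M * d ^ α := by
    rw [Real.div_rpow hd.le hM0.le, Real.rpow_add hM0, Real.rpow_one]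
    have := (Real.rpow_pos_of_pos hM0 α).ne'
    field_simp
  have e2 : d ^ (1 + α) / (d / M) = M * d ^ α := by
    rw [Real.rpow_add hd, Real.rpow_one]
    field_simp
  have e3 : 1 ≤ 1 / α := by rw [le_div_iff₀ hα]; linarith
  have hda := Real.rpow_pos_of_pos hd α
  calc 4 * (3 * C ^ 3 * ‖τ‖ * M ^ (1 + α) * (d / M) ^ α / α +
        3 * C ^ 3 * ‖τ‖ * d ^ (1 + α) / (d / M))
      = 4 * (3 * C ^ 3 * ‖τ‖ * (M ^ (1 + α) * (d / M) ^ α) / α +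
        3 * C ^ 3 * ‖τ‖ * (d ^ (1 + α) / (d / M))) := by ring
    _ = 12 * C ^ 3 * ‖τ‖ * (M * d ^ α) * (1 / α + 1) := by rw [e1, e2]; ring
    _ ≤ 12 * C ^ 3 * ‖τ‖ * (M * d ^ α) * (1 / α + 1 / α) := by gcongr
    _ = _ := by ring

/-- The derivative on the boundary is close to the derivative at the origin. -/
lemma norm_sub_center_le (S : Small Ω α ρ C φ φd g q₀ n₀ d) (h0 : g 0 n₀ = 0) {M L : ℝ}
    (hM : ∀ ζ ∈ closedBall (0 : ℂ) 1, ‖φd ζ‖ ≤ M)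
    (hL : ∀ ζ ∈ sphere (0 : ℂ) 1, ‖nu ρ (φ ζ) (φd ζ)‖ ≤ L) {ζ₀ : ℂ} (hζ₀ : ζ₀ ∈ sphere (0 : ℂ) 1) :
    ‖φd ζ₀ - φd 0‖ ≤ 64 * C ^ 6 / α * (M * d ^ α + L) := by
  have hC := S.P.one_le
  have hα := S.P.α_pos
  have hα1 := S.P.α_le
  have hd := S.D.pos
  have hd1 := S.d_le_one
  have hdM := S.D.le_two_mul S.G hM
  have hM0 : 0 < M := by linarith
  have hL0 : 0 ≤ L := (norm_nonneg _).trans (hL ζ₀ hζ₀)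
  have hc0 := sphere_subset_closedBall hζ₀
  have hq := S.G.mem_frontier S.P.isOpen hζ₀
  have hda := Real.rpow_pos_of_pos hd α
  have e3 : 1 ≤ 1 / α := by rw [le_div_iff₀ hα]; linarith
  have hdα : d ≤ d ^ α := by
    simpa using Real.rpow_le_rpow_of_exponent_ge hd hd1 hα1
  have hnu0 : ‖nu ρ (φ ζ₀) (φd 0)‖ ≤ L + C * d * M := by
    have hA : DiskAlg fun ξ => nu ρ (φ ζ₀) (φd ξ) :=
      (nu ρ (φ ζ₀)).differentiable.comp_diffContOnCl S.G.diskAlgd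
    refine hA.norm_le (fun ξ hξ => ?_) (by simp)
    have hξc := sphere_subset_closedBall hξ
    have e : nu ρ (φ ζ₀) (φd ξ) = nu ρ (φ ξ) (φd ξ) + (nu ρ (φ ζ₀) (φd ξ) - nu ρ (φ ξ) (φd ξ)) := by
      ring
    rw [e]
    refine (norm_add_le _ _).trans (add_le_add (hL ξ hξ) ?_)
    refine (S.P.norm_nu_apply_sub_le (S.G.mem_closure hc0) (S.G.mem_closure hξc) _).trans ?_
    gcongr
    · exact S.D.dist_le _ hc0 _ hξc
    · exact hM ξ hξc
  have hnu : ‖nu ρ (φ ζ₀) (φd ζ₀ - φd 0)‖ ≤ 2 * L + C * (M * d ^ α) := by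
    rw [map_sub]
    refine (norm_sub_le _ _).trans ((add_le_add (hL _ hζ₀) hnu0).trans ?_)
    have : C * d * M ≤ C * (M * d ^ α) := by rw [mul_assoc, mul_comm d]; gcongr
    linarith
  have hB : ∀ τ, nu ρ (φ ζ₀) τ = 0 → ‖formB ρ (φ ζ₀) τ (φd ζ₀ - φd 0)‖ ≤
      30 * C ^ 3 / α * (M * d ^ α) * ‖τ‖ := fun τ hτ => by
    have h1 := S.norm_boundary_le h0 hM hζ₀ hτ
    have h2 := S.norm_center_le h0 hq hτ fun ζ hζ =>
      S.D.dist_le _ (sphere_subset_closedBall hζ) _ hc0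
    have e : formB ρ (φ ζ₀) τ (φd ζ₀ - φd 0) =
        (formB ρ (φ ζ₀) τ (φd ζ₀) - (starRingEnd ℂ) (leftPart ρ φ g n₀ (φ ζ₀) τ 0)) -
        (formB ρ (φ ζ₀) τ (φd 0) - (starRingEnd ℂ) (leftPart ρ φ g n₀ (φ ζ₀) τ 0)) := by
      rw [map_sub]; ring
    rw [e]
    refine (norm_sub_le _ _).trans ((add_le_add h1 h2).trans ?_)
    have h3 : d ^ (1 + α) ≤ 2 * (M * d ^ α) * (1 / α) := by
      rw [Real.rpow_add hd, Real.rpow_one]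
      calc d * d ^ α ≤ 2 * M * d ^ α * 1 := by rw [mul_one]; gcongr
        _ ≤ 2 * M * d ^ α * (1 / α) := by gcongr
        _ = _ := by ring
    calc _ ≤ 24 * C ^ 3 / α * ‖τ‖ * (M * d ^ α) +
          3 * C ^ 3 * ‖τ‖ * (2 * (M * d ^ α) * (1 / α)) := by gcongr
      _ = _ := by ring
  refine (S.P.norm_le_of_formB hq (by positivity) hB).trans ?_
  have h6 : C ^ 3 ≤ C ^ 6 := pow_le_pow_right₀ hC (by norm_num)
  have h4 : C ^ 4 ≤ C ^ 6 := pow_le_pow_right₀ hC (by norm_num)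
  have hy : 0 ≤ M * d ^ α := by positivity
  calc 2 * C ^ 3 * (30 * C ^ 3 / α * (M * d ^ α) + ‖nu ρ (φ ζ₀) (φd ζ₀ - φd 0)‖)
      ≤ 2 * C ^ 3 * (30 * C ^ 3 / α * (M * d ^ α) + (2 * L + C * (M * d ^ α))) := by gcongr
    _ = 60 * C ^ 6 * (1 / α) * (M * d ^ α) + 4 * C ^ 3 * L * 1 + 2 * C ^ 4 * (M * d ^ α) * 1 := by
        ring
    _ ≤ 60 * C ^ 6 * (1 / α) * (M * d ^ α) + 4 * C ^ 6 * L * (1 / α)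
        + 2 * C ^ 6 * (M * d ^ α) * (1 / α) := by gcongr
    _ ≤ 60 * C ^ 6 * (1 / α) * (M * d ^ α) + 4 * C ^ 6 * L * (1 / α)
        + 2 * C ^ 6 * (M * d ^ α) * (1 / α) + (60 * C ^ 6 * (1 / α) * L
        + 2 * C ^ 6 * (M * d ^ α) * (1 / α)) := by
        have : 0 ≤ 60 * C ^ 6 * (1 / α) * L + 2 * C ^ 6 * (M * d ^ α) * (1 / α) := by positivity
        linarith
    _ = _ := by ring

end Small
end SmallEst

section SmallNice
variable {Ω : Set (E N)} {α C : ℝ} {ρ : E N → ℝ} {φ φd : ℂ → E N}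
variable {g : ℂ → E N →L[ℂ] ℂ} {q₀ n₀ : E N} {d : ℝ}

lemma norm_log_sub_log_le {z w : ℂ} (hz : 1 / 2 ≤ z.re) (hw : 1 / 2 ≤ w.re) :
    ‖Complex.log z - Complex.log w‖ ≤ 2 * ‖z - w‖ := by
  refine (convex_halfSpace_re_ge (1 / 2)).norm_image_sub_le_of_norm_hasDerivWithin_le
    (f' := fun z => z⁻¹) (fun u hu => ?_) (fun u hu => ?_) hw hz
  · have hu' : (1 : ℝ) / 2 ≤ u.re := hu
    exact (Complex.hasDerivAt_log (Or.inl (by linarith))).hasDerivWithinAt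
  · have hu' : (1 : ℝ) / 2 ≤ u.re := hu
    rw [norm_inv]
    exact inv_le_of_inv_le₀ two_pos (by linarith [Complex.re_le_norm u])

namespace Small

lemma abs_log_redn_sub_le (S : Small Ω α ρ C φ φd g q₀ n₀ d) (h0 : g 0 n₀ = 0) {M : ℝ}
    (hM : ∀ ζ ∈ closedBall (0 : ℂ) 1, ‖φd ζ‖ ≤ M) {ζ₀ : ℂ} (hζ₀ : ζ₀ ∈ sphere (0 : ℂ) 1) :
    |Real.log ‖redn g n₀ ζ₀‖ - Real.log ‖redn g n₀ 0‖| ≤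
      4 * C ^ 2 * d * (1 + Real.log (2 * M / d)) := by
  have hd := S.D.pos
  have hdM := S.D.le_two_mul S.G hM
  have hM0 : 0 < M := by linarith
  have hc0 := sphere_subset_closedBall hζ₀
  set β : ℝ := (Complex.log (nu ρ (φ ζ₀) n₀)).im
  set G : ℂ → ℂ := fun ζ => Complex.log (redn g n₀ ζ) - β * Complex.I with hG
  have hGA : DiskAlg G := by
    refine DiffContOnCl.sub (diskAlg_mk (fun ζ hζ => ?_) fun ζ hζ => ?_) (diskAlg_const _)
    · exact ((S.diskAlg_redn.diffAt hζ).clog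
        (Or.inl (S.redn_re_pos h0 (ball_subset_closedBall hζ)))).differentiableWithinAt
    · exact (S.diskAlg_redn.cont ζ hζ).clog (Or.inl (S.redn_re_pos h0 hζ))
  have key : ∀ ζ ∈ sphere (0 : ℂ) 1,
      ‖G ζ - (starRingEnd ℂ) (G ζ)‖ ≤ 4 * C ^ 2 * ‖φ ζ - φ ζ₀‖ := fun ζ hζ => by
    have hζc := sphere_subset_closedBall hζ
    have hx := S.nu_pos hζ
    have hw := S.half_le_norm hζc
    have e : G ζ - (starRingEnd ℂ) (G ζ) =
        ((2 * (Complex.log (nu ρ (φ ζ) n₀) - Complex.log (nu ρ (φ ζ₀) n₀)).im : ℝ) : ℂ)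
          * Complex.I := by
      rw [Complex.sub_conj, hG]
      simp only [S.redn_eq h0 hζ]
      rw [Complex.log_ofReal_mul (inv_pos.2 hx) (norm_pos_iff.1 (by linarith))]
      simp [β]
    rw [e, norm_mul, Complex.norm_I, mul_one, Complex.norm_real, Real.norm_eq_abs, abs_mul, abs_two]
    have h1 := (Complex.abs_im_le_norm _).trans
      (norm_log_sub_log_le (S.half_le_re hζc) (S.half_le_re hc0))
    have h2 := S.norm_nu_n_sub_le (S.G.mem_closure hζc) (S.G.mem_closure hc0)
    linarith
  have h := norm_sub_conj_le_log hGA hGA hζ₀ (a := 4 * C ^ 2 * M) (b := 4 * C ^ 2 * d)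
    (t := d / M) (by positivity) (by positivity) (by positivity)
    (by rw [div_le_iff₀ hM0]; exact hdM)
    (fun ζ hζ => (key ζ hζ).trans (by
      rw [mul_assoc (4 * C ^ 2)]
      gcongr
      exact S.G.norm_sub_le hM (sphere_subset_closedBall hζ) hc0))
    (fun ζ hζ => (key ζ hζ).trans (by
      gcongr
      exact S.D.dist_le _ (sphere_subset_closedBall hζ) _ hc0))
  have e : (G ζ₀ - (starRingEnd ℂ) (G 0)).re =
      Real.log ‖redn g n₀ ζ₀‖ - Real.log ‖redn g n₀ 0‖ := by
    simp [hG, Complex.log_re]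
  rw [← e]
  refine (Complex.abs_re_le_norm _).trans (h.trans (le_of_eq ?_))
  rw [show 2 / (d / M) = 2 * M / d by field_simp]
  field_simp

lemma ratio_le (S : Small Ω α ρ C φ φd g q₀ n₀ d) (h0 : g 0 n₀ = 0) {M A : ℝ}
    (hM : ∀ ζ ∈ closedBall (0 : ℂ) 1, ‖φd ζ‖ ≤ M)
    (hA : 4 * C ^ 2 * d * (1 + Real.log (2 * M / d)) ≤ A) {ζ₀ : ℂ}
    (hζ₀ : ζ₀ ∈ sphere (0 : ℂ) 1) :
    ‖nu ρ (φ ζ₀) (φd ζ₀)‖ ≤ 2 * Real.exp A * ‖redn g n₀ 0‖⁻¹ ∧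
      ‖redn g n₀ 0‖⁻¹ ≤ 2 * Real.exp A * ‖nu ρ (φ ζ₀) (φd ζ₀)‖ := by
  have hc0 := sphere_subset_closedBall hζ₀
  have h1 := (abs_le.1 ((S.abs_log_redn_sub_le h0 hM hζ₀).trans hA))
  have hf := norm_pos_iff.2 (S.redn_ne_zero h0 hc0)
  have hf0 := norm_pos_iff.2 (S.redn_ne_zero h0 (ζ := 0) (by simp))
  have hx := S.nu_pos hζ₀
  have hw1 := S.half_le_norm hc0
  have hw2 := S.norm_le_two hc0
  have hw : ‖redn g n₀ ζ₀‖ * ‖nu ρ (φ ζ₀) (φd ζ₀)‖ = ‖nu ρ (φ ζ₀) n₀‖ := by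
    rw [S.norm_redn h0 hζ₀]; field_simp
  have h2 : ‖redn g n₀ ζ₀‖ ≤ Real.exp A * ‖redn g n₀ 0‖ := by
    rw [← Real.log_le_log_iff hf (by positivity), Real.log_mul (Real.exp_pos _).ne' hf0.ne',
      Real.log_exp]
    linarith
  have h3 : ‖redn g n₀ 0‖ ≤ Real.exp A * ‖redn g n₀ ζ₀‖ := by
    rw [← Real.log_le_log_iff hf0 (by positivity), Real.log_mul (Real.exp_pos _).ne' hf.ne',
      Real.log_exp]
    linarith
  constructor
  · rw [← div_eq_mul_inv, le_div_iff₀ hf0]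
    calc _ ≤ ‖nu ρ (φ ζ₀) (φd ζ₀)‖ * (Real.exp A * ‖redn g n₀ ζ₀‖) := by gcongr
      _ = Real.exp A * ‖nu ρ (φ ζ₀) n₀‖ := by rw [← hw]; ring
      _ ≤ Real.exp A * 2 := by gcongr
      _ = _ := by ring
  · rw [inv_le_iff_one_le_mul₀ hf0]
    calc (1 : ℝ) ≤ 2 * ‖nu ρ (φ ζ₀) n₀‖ := by linarith
      _ = 2 * (‖redn g n₀ ζ₀‖ * ‖nu ρ (φ ζ₀) (φd ζ₀)‖) := by rw [hw]
      _ ≤ 2 * (Real.exp A * ‖redn g n₀ 0‖ * ‖nu ρ (φ ζ₀) (φd ζ₀)‖) := by gcongr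
      _ = _ := by ring

/-- The component of the derivative at the origin that is tangential at the base point. -/
def tang (ρ : E N → ℝ) (φd : ℂ → E N) (q₀ n₀ : E N) : E N := φd 0 - nu ρ q₀ (φd 0) • n₀

lemma norm_formB_tang_sub_le (S : Small Ω α ρ C φ φd g q₀ n₀ d) (h0 : g 0 n₀ = 0) :
    ‖formB ρ q₀ (tang ρ φd q₀ n₀) (φd 0) - (starRingEnd ℂ) (redn g n₀ 0)⁻¹‖ ≤
      3 * C ^ 3 * ‖tang ρ φd q₀ n₀‖ * d ^ (1 + α) := by
  have hτ : nu ρ q₀ (tang ρ φd q₀ n₀) = 0 := by simp [tang, S.nu_n]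
  have h := S.norm_center_le h0 S.mem hτ fun ζ hζ => S.near ζ (sphere_subset_closedBall hζ)
  rw [leftPart_zero, S.nu_n, one_mul] at h
  have e : g 0 (tang ρ φd q₀ n₀) = 1 := by
    rw [tang, map_sub, map_smul, h0, S.H.apply 0 (by simp)]; simp
  rwa [e, one_mul] at h

lemma d_rpow_le (S : Small Ω α ρ C φ φd g q₀ n₀ d) : d ^ (1 + α) ≤ d := by
  have := S.P.α_pos
  simpa using Real.rpow_le_rpow_of_exponent_ge S.D.pos S.d_le_one (show 1 ≤ 1 + α by linarith)

lemma inv_redn_le (S : Small Ω α ρ C φ φd g q₀ n₀ d) (h0 : g 0 n₀ = 0) :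
    ‖redn g n₀ 0‖⁻¹ ≤ 8 * C ^ 6 * d ^ 2 := by
  have hC := S.P.one_le
  have hd := S.D.pos
  have hφ := S.D.norm_deriv_zero_le S.G
  have hτ : ‖tang ρ φd q₀ n₀‖ ≤ 2 * C ^ 2 * d := by
    calc _ ≤ ‖φd 0‖ + ‖nu ρ q₀ (φd 0)‖ * ‖n₀‖ := by
          rw [← norm_smul]; exact norm_sub_le _ _
      _ ≤ d + C * d * C := by
          gcongr
          · exact ((nu ρ q₀).le_opNorm _).trans (mul_le_mul (S.P.nu_le _
              (frontier_subset_closure S.mem)) hφ (norm_nonneg _) (by linarith))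
          · exact S.norm_n
      _ ≤ _ := by nlinarith [one_le_pow₀ hC (n := 2)]
  have h1 := S.norm_formB_tang_sub_le h0
  have h2 : ‖formB ρ q₀ (tang ρ φd q₀ n₀) (φd 0)‖ ≤ C * (2 * C ^ 2 * d) * d :=
    ((formB ρ q₀ _).le_opNorm _).trans (mul_le_mul ((S.P.formB_le _
      (frontier_subset_closure S.mem) _).trans (by gcongr)) hφ (norm_nonneg _) (by positivity))
  have h3 := norm_sub_norm_le ((starRingEnd ℂ) (redn g n₀ 0)⁻¹)
    (formB ρ q₀ (tang ρ φd q₀ n₀) (φd 0))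
  rw [norm_sub_rev, RCLike.norm_conj, norm_inv] at h3
  have h4 : 3 * C ^ 3 * ‖tang ρ φd q₀ n₀‖ * d ^ (1 + α) ≤ 3 * C ^ 3 * (2 * C ^ 2 * d) * d := by
    gcongr
    exact S.d_rpow_le
  have h5 : C ^ 3 ≤ C ^ 6 := pow_le_pow_right₀ hC (by norm_num)
  have h6 : C ^ 5 ≤ C ^ 6 := pow_le_pow_right₀ hC (by norm_num)
  have h7 := sq_nonneg d
  calc _ ≤ C * (2 * C ^ 2 * d) * d + 3 * C ^ 3 * (2 * C ^ 2 * d) * d := by linarith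
    _ = 2 * C ^ 3 * d ^ 2 + 6 * C ^ 5 * d ^ 2 := by ring
    _ ≤ 2 * C ^ 6 * d ^ 2 + 6 * C ^ 6 * d ^ 2 := by gcongr
    _ = _ := by ring

lemma norm_sub_center_le_of_mem (S : Small Ω α ρ C φ φd g q₀ n₀ d) (h0 : g 0 n₀ = 0) {M L : ℝ}
    (hM : ∀ ζ ∈ closedBall (0 : ℂ) 1, ‖φd ζ‖ ≤ M)
    (hL : ∀ ζ ∈ sphere (0 : ℂ) 1, ‖nu ρ (φ ζ) (φd ζ)‖ ≤ L) {ζ : ℂ}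
    (hζ : ζ ∈ closedBall (0 : ℂ) 1) :
    ‖φd ζ - φd 0‖ ≤ 64 * C ^ 6 / α * (M * d ^ α + L) :=
  DiskAlg.norm_le (f := fun ζ => φd ζ - φd 0) (S.G.diskAlgd.sub (diskAlg_const _))
    (fun _ hξ => S.norm_sub_center_le h0 hM hL hξ) hζ

variable (S : Small Ω α ρ C φ φd g q₀ n₀ d) (hB : 50000 * C ^ 12 / α * d ^ α ≤ 1)
include S hB

lemma pow_mul_le {k : ℕ} (hk : k ≤ 12) : 50000 * (C ^ k * d ^ α) ≤ 1 := by
  have hC := S.P.one_le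
  have hα := S.P.α_pos
  have hα1 := S.P.α_le
  have hda := Real.rpow_pos_of_pos S.D.pos α
  have e3 : 1 ≤ 1 / α := by rw [le_div_iff₀ hα]; linarith
  have : C ^ k ≤ C ^ 12 := pow_le_pow_right₀ hC hk
  calc 50000 * (C ^ k * d ^ α) ≤ 50000 * (C ^ 12 * d ^ α) * 1 := by rw [mul_one]; gcongr
    _ ≤ 50000 * (C ^ 12 * d ^ α) * (1 / α) := by gcongr
    _ = _ := by ring
    _ ≤ 1 := hB

lemma pow_mul_le' {k : ℕ} (hk : k ≤ 12) : 50000 * (C ^ k * d) ≤ 1 := by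
  have hC := S.P.one_le
  have hdα : d ≤ d ^ α := by
    simpa using Real.rpow_le_rpow_of_exponent_ge S.D.pos S.d_le_one S.P.α_le
  refine le_trans ?_ (S.pow_mul_le hB hk)
  gcongr

lemma deriv_le (h0 : g 0 n₀ = 0) {ζ : ℂ} (hζ : ζ ∈ closedBall (0 : ℂ) 1) : ‖φd ζ‖ ≤ 2 * d := by
  have hC := S.P.one_le
  have hα := S.P.α_pos
  have hα1 := S.P.α_le
  have hd := S.D.pos
  have hda := Real.rpow_pos_of_pos hd α
  have hdα : d ≤ d ^ α := by
    simpa using Real.rpow_le_rpow_of_exponent_ge hd S.d_le_one hα1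
  obtain ⟨ξ, hξ, hmax⟩ := (isCompact_closedBall (0 : ℂ) 1).exists_isMaxOn ⟨0, by simp⟩
    S.G.contd.norm
  have hM : ∀ ζ ∈ closedBall (0 : ℂ) 1, ‖φd ζ‖ ≤ ‖φd ξ‖ := fun ζ hζ => hmax hζ
  refine (hM ζ hζ).trans ?_
  set M := ‖φd ξ‖
  have hdM := S.D.le_two_mul S.G hM
  have hM0 : 0 < M := by linarith
  have hlog : 0 ≤ Real.log (2 * M / d) := Real.log_nonneg (by rw [le_div_iff₀ hd]; linarith)
  have hA : 4 * C ^ 2 * d * (1 + Real.log (2 * M / d)) ≤ 1 + Real.log (2 * M / d) := by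
    have := S.pow_mul_le' hB (k := 2) (by norm_num)
    nlinarith
  have hL : ∀ ζ ∈ sphere (0 : ℂ) 1, ‖nu ρ (φ ζ) (φd ζ)‖ ≤ 96 * C ^ 6 * (M * d) := fun ζ hζ => by
    refine (S.ratio_le h0 hM hA hζ).1.trans ?_
    rw [Real.exp_add, Real.exp_log (by positivity)]
    have h1 := S.inv_redn_le h0
    have h2 : Real.exp 1 ≤ 3 := by have := Real.exp_one_lt_d9; linarith
    calc 2 * (Real.exp 1 * (2 * M / d)) * ‖redn g n₀ 0‖⁻¹
        ≤ 2 * (3 * (2 * M / d)) * (8 * C ^ 6 * d ^ 2) := by gcongr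
      _ = _ := by field_simp; ring
  have h1 := S.norm_sub_center_le_of_mem h0 hM hL hξ
  have h2 := S.D.norm_deriv_zero_le S.G
  have h3 : M ≤ ‖φd 0‖ + ‖φd ξ - φd 0‖ := by
    have := norm_add_le (φd 0) (φd ξ - φd 0)
    rwa [add_sub_cancel] at this
  have h4 : 64 * C ^ 6 / α * (M * d ^ α + 96 * C ^ 6 * (M * d)) ≤
      M / 2 * (50000 * C ^ 12 / α * d ^ α) := by
    have h6 : C ^ 6 ≤ C ^ 12 := pow_le_pow_right₀ hC (by norm_num)
    calc _ ≤ 64 * C ^ 6 / α * (M * d ^ α + 96 * C ^ 6 * (M * d ^ α)) := by gcongr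
      _ = 64 / α * (C ^ 6 * (M * d ^ α) + 96 * C ^ 12 * (M * d ^ α)) := by ring
      _ ≤ 64 / α * (C ^ 12 * (M * d ^ α) + 96 * C ^ 12 * (M * d ^ α)) := by gcongr
      _ = 6208 * (C ^ 12 / α * (M * d ^ α)) := by ring
      _ ≤ 25000 * (C ^ 12 / α * (M * d ^ α)) := by gcongr; norm_num
      _ = _ := by ring
  have h5 : M / 2 * (50000 * C ^ 12 / α * d ^ α) ≤ M / 2 := by
    exact mul_le_of_le_one_right (by positivity) hB
  linarith

lemma log_bound : 4 * C ^ 2 * d * (1 + Real.log (2 * (2 * d) / d)) ≤ 1 := by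
  have hd := S.D.pos
  have e : 2 * (2 * d) / d = 4 := by field_simp; norm_num
  rw [e]
  have h1 : Real.log 4 ≤ 3 := by
    have := Real.log_le_sub_one_of_pos (show (0 : ℝ) < 4 by norm_num)
    linarith
  have := S.pow_mul_le' hB (k := 2) (by norm_num)
  have h2 : 0 ≤ C ^ 2 * d := by positivity
  nlinarith

lemma nu_deriv_le (h0 : g 0 n₀ = 0) {ζ : ℂ} (hζ : ζ ∈ sphere (0 : ℂ) 1) :
    ‖nu ρ (φ ζ) (φd ζ)‖ ≤ 48 * C ^ 6 * d ^ 2 := by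
  refine (S.ratio_le h0 (fun _ h => S.deriv_le hB h0 h) (S.log_bound hB) hζ).1.trans ?_
  have h2 : Real.exp 1 ≤ 3 := by have := Real.exp_one_lt_d9; linarith
  calc _ ≤ 2 * 3 * (8 * C ^ 6 * d ^ 2) := by gcongr; exact S.inv_redn_le h0
    _ = _ := by ring

lemma norm_sub_le_d (h0 : g 0 n₀ = 0) {ζ : ℂ} (hζ : ζ ∈ closedBall (0 : ℂ) 1) :
    ‖φd ζ - φd 0‖ ≤ d / 8 := by
  have hC := S.P.one_le
  have hα := S.P.α_pos
  have hd := S.D.pos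
  have hda := Real.rpow_pos_of_pos hd α
  have hdα : d ≤ d ^ α := by
    simpa using Real.rpow_le_rpow_of_exponent_ge hd S.d_le_one S.P.α_le
  refine (S.norm_sub_center_le_of_mem h0 (fun _ h => S.deriv_le hB h0 h)
    (fun _ h => S.nu_deriv_le hB h0 h) hζ).trans ?_
  have h6 : C ^ 6 ≤ C ^ 12 := pow_le_pow_right₀ hC (by norm_num)
  calc _ = 64 / α * (2 * C ^ 6 * (d * d ^ α) + 48 * C ^ 12 * (d * d)) := by ring
    _ ≤ 64 / α * (2 * C ^ 12 * (d * d ^ α) + 48 * C ^ 12 * (d * d ^ α)) := by gcongr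
    _ = 3200 * (C ^ 12 / α * d ^ α * d) := by ring
    _ ≤ 6250 * (C ^ 12 / α * d ^ α * d) := by gcongr; norm_num
    _ = d / 8 * (50000 * C ^ 12 / α * d ^ α) := by ring
    _ ≤ d / 8 := mul_le_of_le_one_right (by positivity) hB

lemma le_deriv_zero (h0 : g 0 n₀ = 0) : 3 * d / 8 ≤ ‖φd 0‖ := by
  have := S.D.le_two_mul S.G (M := ‖φd 0‖ + d / 8) fun ζ hζ => by
    have h1 := norm_add_le (φd 0) (φd ζ - φd 0)
    rw [add_sub_cancel] at h1
    linarith [S.norm_sub_le_d hB h0 hζ]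
  linarith

lemma le_deriv (h0 : g 0 n₀ = 0) {ζ : ℂ} (hζ : ζ ∈ closedBall (0 : ℂ) 1) : d ≤ 4 * ‖φd ζ‖ := by
  have h1 := norm_sub_norm_le (φd 0) (φd ζ)
  rw [norm_sub_rev] at h1
  linarith [S.norm_sub_le_d hB h0 hζ, S.le_deriv_zero hB h0]

lemma norm_normal_le (h0 : g 0 n₀ = 0) : ‖nu ρ q₀ (φd 0)‖ ≤ 50 * C ^ 6 * d ^ 2 := by
  have hC := S.P.one_le
  have hd := S.D.pos
  have hA : DiskAlg fun ξ => nu ρ q₀ (φd ξ) :=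
    (nu ρ q₀).differentiable.comp_diffContOnCl S.G.diskAlgd
  refine hA.norm_le (fun ξ hξ => ?_) (by simp)
  have hξc := sphere_subset_closedBall hξ
  have e : nu ρ q₀ (φd ξ) = nu ρ (φ ξ) (φd ξ) - (nu ρ (φ ξ) (φd ξ) - nu ρ q₀ (φd ξ)) := by ring
  rw [e]
  calc _ ≤ 48 * C ^ 6 * d ^ 2 + C * d * (2 * d) := by
        refine (norm_sub_le _ _).trans (add_le_add (S.nu_deriv_le hB h0 hξ) ?_)
        refine (S.P.norm_nu_apply_sub_le (S.G.mem_closure hξc)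
          (frontier_subset_closure S.mem) _).trans ?_
        gcongr
        · exact S.near ξ hξc
        · exact S.deriv_le hB h0 hξc
    _ = 48 * C ^ 6 * d ^ 2 + 2 * C * d ^ 2 := by ring
    _ ≤ 48 * C ^ 6 * d ^ 2 + 2 * C ^ 6 * d ^ 2 := by gcongr; exact le_self_pow₀ hC (by norm_num)
    _ = _ := by ring

lemma le_inv_redn (h0 : g 0 n₀ = 0) : d ^ 2 ≤ 32 * C * ‖redn g n₀ 0‖⁻¹ := by
  have hC := S.P.one_le
  have hd := S.D.pos
  have hda := Real.rpow_pos_of_pos hd α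
  have hdα : d ≤ d ^ α := by
    simpa using Real.rpow_le_rpow_of_exponent_ge hd S.d_le_one S.P.α_le
  have hq := frontier_subset_closure S.mem
  set τ := tang ρ φd q₀ n₀ with hτ
  set n := nu ρ q₀ (φd 0) • n₀ with hn
  have eφ : φd 0 = τ + n := by rw [hτ, tang, sub_add_cancel]
  have hnn : ‖n‖ ≤ 50 * C ^ 7 * d ^ 2 := by
    rw [hn, norm_smul]
    calc _ ≤ 50 * C ^ 6 * d ^ 2 * C := by
          gcongr
          · exact S.norm_normal_le hB h0
          · exact S.norm_n
      _ = _ := by ring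
  have hτd : d / 4 ≤ ‖τ‖ := by
    have h1 := norm_add_le τ n
    rw [← eφ] at h1
    have h2 := S.le_deriv_zero hB h0
    have h3 := S.pow_mul_le' hB (k := 7) (by norm_num)
    nlinarith
  have hτ0 : nu ρ q₀ τ = 0 := by simp [hτ, tang, S.nu_n]
  have h1 := S.norm_formB_tang_sub_le h0
  rw [← hτ] at h1
  have h2 := S.P.strict q₀ S.mem τ hτ0
  have h3 : ‖formB ρ q₀ τ n‖ ≤ C * ‖τ‖ * (50 * C ^ 7 * d ^ 2) :=
    ((formB ρ q₀ τ).le_opNorm _).trans (mul_le_mul (S.P.formB_le _ hq _) hnn (norm_nonneg _)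
      (by positivity))
  have h4 : (formB ρ q₀ τ τ).re ≤ ‖redn g n₀ 0‖⁻¹ + 3 * C ^ 3 * ‖τ‖ * d ^ (1 + α)
      + C * ‖τ‖ * (50 * C ^ 7 * d ^ 2) := by
    have e : formB ρ q₀ τ τ = (formB ρ q₀ τ (φd 0) - (starRingEnd ℂ) (redn g n₀ 0)⁻¹)
        + (starRingEnd ℂ) (redn g n₀ 0)⁻¹ - formB ρ q₀ τ n := by
      rw [eφ, map_add]; ring
    refine (Complex.re_le_norm _).trans ?_
    rw [e]
    refine (norm_sub_le _ _).trans (add_le_add ((norm_add_le _ _).trans ?_) h3)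
    rw [RCLike.norm_conj, norm_inv]
    linarith
  have h5 : 3 * C ^ 3 * ‖τ‖ * d ^ (1 + α) + C * ‖τ‖ * (50 * C ^ 7 * d ^ 2) ≤
      53 * (C ^ 8 * d ^ α) * (‖τ‖ * d) := by
    have hC3 : C ^ 3 ≤ C ^ 8 := pow_le_pow_right₀ hC (by norm_num)
    rw [Real.rpow_add hd, Real.rpow_one]
    calc _ = 3 * C ^ 3 * d ^ α * (‖τ‖ * d) + 50 * C ^ 8 * d * (‖τ‖ * d) := by ring
      _ ≤ 3 * C ^ 8 * d ^ α * (‖τ‖ * d) + 50 * C ^ 8 * d ^ α * (‖τ‖ * d) := by gcongr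
      _ = _ := by ring
  have h6 : C * (53 * (C ^ 8 * d ^ α) * (‖τ‖ * d)) ≤ 1 / 8 * (‖τ‖ * d) := by
    have := S.pow_mul_le hB (k := 9) (by norm_num)
    calc _ = 53 * (C ^ 9 * d ^ α) * (‖τ‖ * d) := by ring
      _ ≤ 1 / 8 * (‖τ‖ * d) := by gcongr; linarith
  have h7 : ‖τ‖ ^ 2 ≤ C * ‖redn g n₀ 0‖⁻¹ + 1 / 8 * (‖τ‖ * d) := by
    refine h2.trans ((mul_le_mul_of_nonneg_left h4 (by linarith)).trans ?_)
    have := mul_le_mul_of_nonneg_left h5 (show 0 ≤ C by linarith)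
    linarith
  nlinarith

theorem nice (h0 : g 0 n₀ = 0) : Nice ρ φ φd (192 * C ^ 6) d := by
  have hC := S.P.one_le
  have hC6 := one_le_pow₀ hC (n := 6)
  have hC1 : C ≤ C ^ 6 := le_self_pow₀ hC (by norm_num)
  have hd := S.D.pos
  refine ⟨hd, S.D.dist_le, fun ζ hζ => ?_, fun ζ hζ => ?_, fun ζ hζ => ?_, fun ζ hζ => ?_⟩
  · refine (S.deriv_le hB h0 hζ).trans ?_
    gcongr
    linarith
  · refine (S.le_deriv hB h0 hζ).trans ?_
    gcongr
    linarith
  · refine (S.nu_deriv_le hB h0 hζ).trans ?_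
    gcongr
    norm_num
  · have h1 := (S.ratio_le h0 (fun _ h => S.deriv_le hB h0 h) (S.log_bound hB) hζ).2
    have h2 : Real.exp 1 ≤ 3 := by have := Real.exp_one_lt_d9; linarith
    calc _ ≤ 32 * C * ‖redn g n₀ 0‖⁻¹ := S.le_inv_redn hB h0
      _ ≤ 32 * C ^ 6 * (2 * 3 * ‖nu ρ (φ ζ) (φd ζ)‖) := by
          gcongr
          exact h1.trans (by gcongr)
      _ = _ := by ring

end Small
end SmallNice

section SmallFinal
variable {Ω : Set (E N)} {α C : ℝ} {ρ : E N → ℝ} {φ φd : ℂ → E N}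

theorem Dom.exists_nice_of_small (P : Dom Ω α ρ C) (G : Geo Ω φ φd) {d : ℝ} (D : IsDiam φ d)
    (hB : 50000 * C ^ 12 / α * d ^ α ≤ 1) : ∃ a ∈ ball (0 : ℂ) 1,
      Nice ρ (fun ζ => φ (mob a ζ)) (fun ζ => mobd a ζ • φd (mob a ζ)) (192 * C ^ 6) d := by
  have hC := P.one_le
  have hd := D.pos
  have one : (1 : ℂ) ∈ sphere (0 : ℂ) 1 := by simp
  have onec := sphere_subset_closedBall one
  have hq := G.mem_frontier P.isOpen one
  have hκ : 0 < ‖nu ρ (φ 1)‖ := by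
    have := P.one_le_nu _ hq
    by_contra! h
    nlinarith
  have hd1 : 2 * C ^ 2 * d ≤ 1 := by
    have hα := P.α_pos
    have hα1 := P.α_le
    have e3 : 1 ≤ 1 / α := by rw [le_div_iff₀ hα]; linarith
    have hda := Real.rpow_pos_of_pos hd α
    have h1 : 50000 * C ^ 12 * d ^ α ≤ 1 := by
      calc 50000 * C ^ 12 * d ^ α = 50000 * C ^ 12 * d ^ α * 1 := by ring
        _ ≤ 50000 * C ^ 12 * d ^ α * (1 / α) := by gcongr
        _ = _ := by ring
        _ ≤ 1 := hB
    have hda1 : d ^ α ≤ 1 := by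
      have : 1 * d ^ α ≤ 50000 * C ^ 12 * d ^ α := by
        gcongr
        linarith [one_le_pow₀ hC (n := 12)]
      linarith
    have hdle : d ≤ 1 := by
      by_contra! h
      exact absurd hda1 (not_le.2 (Real.one_lt_rpow h hα))
    have hdα : d ≤ d ^ α := by
      simpa using Real.rpow_le_rpow_of_exponent_ge hd hdle hα1
    have h2 : C ^ 2 ≤ C ^ 12 := pow_le_pow_right₀ hC (by norm_num)
    calc 2 * C ^ 2 * d ≤ 50000 * C ^ 12 * d ^ α := by gcongr; norm_num
      _ ≤ 1 := h1
  set n₀ : E N := (((‖nu ρ (φ 1)‖ ^ 2)⁻¹ : ℝ) : ℂ) • nrm ρ (φ 1) with hn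
  have hn1 : nu ρ (φ 1) n₀ = 1 := by
    rw [hn, map_smul, nu_nrm, smul_eq_mul]
    have : (‖nu ρ (φ 1)‖ : ℂ) ≠ 0 := by exact_mod_cast hκ.ne'
    push_cast
    field_simp
  have hn2 : ‖n₀‖ ≤ C := by
    rw [hn, norm_smul, norm_nrm, Complex.norm_real, Real.norm_of_nonneg (by positivity)]
    have := P.one_le_nu _ hq
    rw [inv_mul_le_iff₀ (by positivity)]
    nlinarith
  obtain ⟨g, H⟩ := G.exists_dualMap P
  have S : Small Ω α ρ C φ φd g (φ 1) n₀ d :=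
    ⟨P, G, H, D, hq, fun ζ hζ => D.dist_le _ hζ _ onec, hd1, hn2, hn1⟩
  obtain ⟨a, ha, h0⟩ := S.exists_zero
  refine ⟨a, ha, Small.nice (q₀ := φ 1) (n₀ := n₀) (α := α) (Ω := Ω)
    (g := fun ζ => (mobd a ζ)⁻¹ • g (mob a ζ))
    ⟨P, G.comp_mob ha, H.comp_mob ha, D.comp_mob ha, hq,
      fun ζ hζ => S.near _ (mob_mem_closedBall ha hζ), hd1, hn2, hn1⟩ hB ?_⟩
  rw [mob_zero, smul_apply, h0, smul_zero]

lemma Geo.exists_max_bdist (G : Geo Ω φ φd) (P : Pkg Ω α ρ C) : ∃ a ∈ ball (0 : ℂ) 1,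
    ∀ ζ ∈ closedBall (0 : ℂ) 1, bdist Ω (φ ζ) ≤ bdist Ω (φ a) := by
  have hc : ContinuousOn (fun ζ => bdist Ω (φ ζ)) (closedBall 0 1) :=
    (continuous_infDist_pt _).comp_continuousOn G.cont
  obtain ⟨a, ha, hmax⟩ := (isCompact_closedBall (0 : ℂ) 1).exists_isMaxOn ⟨0, by simp⟩ hc
  refine ⟨a, ?_, fun ζ hζ => hmax hζ⟩
  rcases (mem_closedBall.1 ha).lt_or_eq with h | h
  · exact h
  · have h1 : bdist Ω (φ a) = 0 := infDist_zero_of_mem (G.mem_frontier P.isOpen h)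
    have h2 : bdist Ω (φ 0) ≤ bdist Ω (φ a) := hmax (by simp : (0 : ℂ) ∈ closedBall (0 : ℂ) 1)
    have h3 := P.bdist_pos (G.mapsTo (ζ := 0) (by simp))
    linarith

lemma Geo.bdist_mul_le (G : Geo Ω φ φd) (P : Dom Ω α ρ C) {ζ : ℂ} (hζ : ζ ∈ ball (0 : ℂ) 1) :
    bdist Ω (φ 0) * bdist Ω (φ ζ) ≤ Real.exp (2 * C) * (1 - ‖ζ‖) := by
  have h0 : (0 : ℂ) ∈ ball (0 : ℂ) 1 := by simp
  have h1 := P.bdist_pos (G.mapsTo h0)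
  have h2 := P.bdist_pos (G.mapsTo hζ)
  have h3 := P.chain _ (G.mapsTo h0) _ (G.mapsTo hζ)
  have hζ1 := mem_ball_zero_iff.1 hζ
  rw [G.geod.2.2 0 h0 ζ hζ, poincare_eq, psd_zero_left] at h3
  have h4 := half_log_le_artanh (norm_nonneg ζ) hζ1
  have hr : 0 < 1 - ‖ζ‖ := by linarith
  rw [← Real.log_le_log_iff (by positivity) (by positivity), Real.log_mul h1.ne' h2.ne',
    Real.log_mul (Real.exp_pos _).ne' hr.ne', Real.log_exp]
  rw [one_div, Real.log_inv] at h3 h4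
  rw [one_div, Real.log_inv] at h3
  linarith

lemma Geo.norm_deriv_sq_le (G : Geo Ω φ φd) (P : Dom Ω α ρ C) {ζ : ℂ} (hζ : ζ ∈ ball (0 : ℂ) 1) :
    (1 - ‖ζ‖) ^ 2 * ‖φd ζ‖ ^ 2 ≤ C * bdist Ω (φ ζ) := by
  have h := P.kob φ G.geod.1 (fun _ h => G.mapsTo h) ζ hζ
  rwa [← G.eq ζ hζ] at h

lemma le_mul_rpow_of_pow_le {x s K : ℝ} {n : ℕ} (hn : n ≠ 0) (hs : 0 < s) (hK : 0 ≤ K)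
    (h : (s * x) ^ n ≤ K ^ n * s) : x ≤ K * s ^ (1 / n - 1 : ℝ) := by
  have h1 : s * x ≤ K * s ^ (1 / n : ℝ) := by
    refine le_of_pow_le_pow_left₀ hn (by positivity) (h.trans (le_of_eq ?_))
    rw [mul_pow, ← Real.rpow_natCast (s ^ _), ← Real.rpow_mul hs.le,
      one_div_mul_cancel (Nat.cast_ne_zero.2 hn), Real.rpow_one]
  rw [Real.rpow_sub_one hs.ne', mul_div_assoc', le_div_iff₀ hs]
  linarith

lemma IsDiam.pow_le {d : ℝ} (D : IsDiam φ d) (G : Geo Ω φ φd) (P : Dom Ω α ρ C)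
    (hmax : ∀ ζ ∈ closedBall (0 : ℂ) 1, bdist Ω (φ ζ) ≤ bdist Ω (φ 0)) :
    d ^ 8 ≤ 16 ^ 8 * (C ^ 4 * Real.exp (2 * C) * bdist Ω (φ 0) ^ 2) := by
  have hC := P.one_le
  have h0 : (0 : ℂ) ∈ ball (0 : ℂ) 1 := by simp
  have hm := P.bdist_pos (G.mapsTo h0)
  set m := bdist Ω (φ 0)
  set A := Real.exp (2 * C)
  have hA : 0 < A := Real.exp_pos _
  set K := (C ^ 4 * A * m ^ 2) ^ (1 / 8 : ℝ) with hK
  have hK0 : 0 ≤ K := by positivity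
  have hK8 : K ^ 8 = C ^ 4 * A * m ^ 2 := by
    rw [hK, ← Real.rpow_natCast, ← Real.rpow_mul (by positivity)]
    norm_num
  have hd : ∀ ζ ∈ sphere (0 : ℂ) 1, ∀ r : ℝ, 0 ≤ r → r < 1 →
      ‖deriv φ (r * ζ)‖ ≤ K * (1 - r) ^ (1 / 8 - 1 : ℝ) := fun ζ hζ r hr0 hr1 => by
    have hz := smul_mem_ball_of hζ hr0 hr1
    have hn : ‖(r : ℂ) * ζ‖ = r := by
      rw [norm_mul, mem_sphere_zero_iff_norm.1 hζ, Complex.norm_real, Real.norm_of_nonneg hr0,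
        mul_one]
    have h1 := G.norm_deriv_sq_le P hz
    have h2 := G.bdist_mul_le P hz
    have h3 := hmax _ (ball_subset_closedBall hz)
    have h4 := P.bdist_pos (G.mapsTo hz)
    rw [hn] at h1 h2
    rw [← G.eq _ hz]
    set b := bdist Ω (φ (r * ζ))
    refine le_mul_rpow_of_pow_le (n := 8) (by norm_num) (by linarith) hK0 ?_
    rw [hK8]
    calc ((1 - r) * ‖φd (r * ζ)‖) ^ 8 = ((1 - r) ^ 2 * ‖φd (r * ζ)‖ ^ 2) ^ 4 := by ring
      _ ≤ (C * b) ^ 4 := by gcongr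
      _ = C ^ 4 * b ^ 3 * b := by ring
      _ ≤ C ^ 4 * m ^ 3 * b := by gcongr
      _ = C ^ 4 * m ^ 2 * (m * b) := by ring
      _ ≤ C ^ 4 * m ^ 2 * (A * (1 - r)) := by gcongr
      _ = _ := by ring
  have key : ∀ ζ ∈ closedBall (0 : ℂ) 1, ‖φ ζ - φ 0‖ ≤ 8 * K := fun ζ hζ => by
    refine DiskAlg.norm_le (f := fun ζ => φ ζ - φ 0) (G.diskAlg.sub (diskAlg_const _))
      (fun ξ hξ => ?_) hζ
    have := norm_sub_radial_le G.diskAlg (γ := 1 / 8) (by norm_num) hd hξ le_rfl zero_le_one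
    simp only [Complex.ofReal_zero, zero_mul, sub_zero, Real.one_rpow] at this
    linarith
  have hdK : d ≤ 16 * K := D.le _ fun ζ hζ ξ hξ => by
    have e : φ ζ - φ ξ = (φ ζ - φ 0) - (φ ξ - φ 0) := by abel
    rw [e]
    linarith [norm_sub_le (φ ζ - φ 0) (φ ξ - φ 0), key ζ hζ, key ξ hξ]
  calc d ^ 8 ≤ (16 * K) ^ 8 := by have := D.pos; gcongr
    _ = _ := by rw [mul_pow, hK8]

/-- A centered geodesic with uniform control on the normal derivative. -/
structure Large (Ω : Set (E N)) (α : ℝ) (ρ : E N → ℝ) (B : ℝ) (φ φd : ℂ → E N) : Prop where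
  P : Pkg Ω α ρ B
  G : Geo Ω φ φd
  pos : ∀ ζ ∈ sphere (0 : ℂ) 1, 0 < ‖nu ρ (φ ζ) (φd ζ)‖
  nu_le : ∀ ζ ∈ sphere (0 : ℂ) 1, ‖nu ρ (φ ζ) (φd ζ)‖ ≤ B
  le_nu : ∀ ζ ∈ sphere (0 : ℂ) 1, ‖nu ρ (φ ζ) (φd ζ)‖⁻¹ ≤ B
  holder : ∀ ζ ∈ sphere (0 : ℂ) 1, ∀ ξ ∈ sphere (0 : ℂ) 1, ‖φ ζ - φ ξ‖ ≤ B * ‖ζ - ξ‖ ^ (1 / 2 : ℝ)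

theorem Dom.exists_large (P : Dom Ω α ρ C) {d₀ : ℝ} (hd₀ : 0 < d₀) : ∃ B, C ≤ B ∧
    ∀ φ φd, Geo Ω φ φd → ∀ d, d₀ ≤ d → IsDiam φ d →
      (∀ ζ ∈ closedBall (0 : ℂ) 1, bdist Ω (φ ζ) ≤ bdist Ω (φ 0)) → Large Ω α ρ B φ φd := by
  have hC := P.one_le
  set A := Real.exp (2 * C)
  have hA : 0 < A := Real.exp_pos _
  set m₀ := Real.sqrt (d₀ ^ 8 / (16 ^ 8 * (C ^ 4 * A))) with hm₀
  have hm0 : 0 < m₀ := Real.sqrt_pos.2 (by positivity)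
  obtain ⟨c, hc, hopf⟩ := P.hopf m₀ hm0
  set K := Real.sqrt (C * (A / m₀)) with hK
  have hK0 : 0 ≤ K := Real.sqrt_nonneg _
  set B := C + C * (A / m₀) + C / c + 5 * K with hBdef
  have hB1 : 0 ≤ C * (A / m₀) := by positivity
  have hB2 : 0 ≤ C / c := by positivity
  have hCB : C ≤ B := by rw [hBdef]; linarith
  refine ⟨B, hCB, fun φ φd G d hdd D hmax => ?_⟩
  have hb0 := P.bdist_pos (G.mapsTo (ζ := 0) (by simp))
  have hm : m₀ ≤ bdist Ω (φ 0) := by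
    rw [hm₀]
    refine Real.sqrt_le_iff.2 ⟨hb0.le, ?_⟩
    rw [div_le_iff₀ (by positivity)]
    calc d₀ ^ 8 ≤ d ^ 8 := by gcongr
      _ ≤ _ := D.pow_le G P hmax
      _ = _ := by ring
  have hup : ∀ ζ ∈ ball (0 : ℂ) 1, bdist Ω (φ ζ) ≤ A / m₀ * (1 - ‖ζ‖) := fun ζ hζ => by
    have h1 := G.bdist_mul_le P hζ
    have h2 := P.bdist_pos (G.mapsTo hζ)
    rw [div_mul_eq_mul_div, le_div_iff₀ hm0]
    nlinarith
  have hlow := hopf φ G.geod.1 (fun _ h => G.mapsTo h) hm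
  refine ⟨P.toPkg.mono hCB, G, fun ζ hζ => ?_, fun ζ hζ => ?_, fun ζ hζ => ?_,
    fun ζ hζ ξ hξ => ?_⟩
  · rw [G.norm_nu_eq P hζ]
    exact G.nu_pos P hζ
  · rw [G.norm_nu_eq P hζ]
    refine (G.nu_le_of P.toPkg hup hζ).trans ?_
    rw [hBdef]; linarith
  · rw [G.norm_nu_eq P hζ]
    have := G.le_nu_of P.toPkg hlow hζ
    refine (inv_anti₀ (by positivity) this).trans ?_
    rw [inv_div, hBdef]; linarith
  · have hd : ∀ ζ ∈ sphere (0 : ℂ) 1, ∀ r : ℝ, 0 ≤ r → r < 1 →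
        ‖deriv φ (r * ζ)‖ ≤ K * (1 - r) ^ (1 / 2 - 1 : ℝ) := fun ζ hζ r hr0 hr1 => by
      have hz := smul_mem_ball_of hζ hr0 hr1
      have hn : ‖(r : ℂ) * ζ‖ = r := by
        rw [norm_mul, mem_sphere_zero_iff_norm.1 hζ, Complex.norm_real, Real.norm_of_nonneg hr0,
          mul_one]
      have h1 := G.norm_deriv_sq_le P hz
      have h2 := hup _ hz
      rw [hn] at h1 h2
      rw [← G.eq _ hz]
      refine le_mul_rpow_of_pow_le (n := 2) (by norm_num) (by linarith) hK0 ?_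
      rw [hK, Real.sq_sqrt hB1, mul_pow]
      refine h1.trans ?_
      rw [mul_assoc]
      gcongr
    refine (norm_sub_le_of_deriv_growth G.diskAlg (by norm_num) (by norm_num) hd hζ hξ).trans ?_
    gcongr
    rw [hBdef]
    norm_num
    linarith

end SmallFinal

section LargeEst
variable {Ω : Set (E N)} {α B C : ℝ} {ρ : E N → ℝ} {φ φd : ℂ → E N}
variable {g : ℂ → E N →L[ℂ] ℂ}

lemma DualMap.eq_smul (H : DualMap ρ φ φd g) (G : Geo Ω φ φd) (P : Dom Ω α ρ C) {ζ : ℂ}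
    (hζ : ζ ∈ sphere (0 : ℂ) 1) :
    g ζ = (ζ * (‖nu ρ (φ ζ) (φd ζ)‖⁻¹ : ℝ)) • nu ρ (φ ζ) := by
  rw [H.eq ζ hζ, G.nu_eq_ofReal P.toPkg hζ, ← G.norm_nu_eq P hζ]
  congr 1
  push_cast
  rfl

lemma norm_sub_le_two {ζ ξ : ℂ} (hζ : ζ ∈ sphere (0 : ℂ) 1) (hξ : ξ ∈ sphere (0 : ℂ) 1) :
    ‖ζ - ξ‖ ≤ 2 := by
  have h1 := mem_sphere_zero_iff_norm.1 hζ
  have h2 := mem_sphere_zero_iff_norm.1 hξ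
  linarith [norm_sub_le ζ ξ]

lemma rpow_le_two_mul_rpow {t a b : ℝ} (ht0 : 0 ≤ t) (ht : t ≤ 2) (hb : 0 < b) (hab : b ≤ a)
    (ha : a ≤ b + 1) : t ^ a ≤ 2 * t ^ b := by
  rcases ht0.eq_or_lt with rfl | ht0
  · rw [Real.zero_rpow (by linarith), Real.zero_rpow hb.ne']; simp
  have e : t ^ a = t ^ (a - b) * t ^ b := by rw [← Real.rpow_add ht0]; ring_nf
  rw [e]
  gcongr
  calc t ^ (a - b) ≤ 2 ^ (a - b) := by gcongr
    _ ≤ 2 ^ (1 : ℝ) := Real.rpow_le_rpow_of_exponent_le (by norm_num) (by linarith)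
    _ = 2 := by norm_num

namespace Large

lemma one_le (L : Large Ω α ρ B φ φd) : 1 ≤ B := L.P.one_le

lemma mem_closure (L : Large Ω α ρ B φ φd) {ζ : ℂ} (hζ : ζ ∈ sphere (0 : ℂ) 1) :
    φ ζ ∈ closure Ω := L.G.mem_closure (sphere_subset_closedBall hζ)

lemma norm_dual_le (L : Large Ω α ρ B φ φd) (H : DualMap ρ φ φd g) (P : Dom Ω α ρ C) {ζ : ℂ}
    (hζ : ζ ∈ closedBall (0 : ℂ) 1) : ‖g ζ‖ ≤ B ^ 2 := by
  refine H.diskAlg.norm_le (fun ξ hξ => ?_) hζ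
  have hB := L.one_le
  rw [H.eq_smul L.G P hξ, norm_smul, norm_mul, mem_sphere_zero_iff_norm.1 hξ, one_mul,
    Complex.norm_real, norm_inv, norm_norm, sq]
  exact mul_le_mul (L.le_nu ξ hξ) (L.P.nu_le _ (L.mem_closure hξ)) (norm_nonneg _) (by linarith)

lemma norm_dual_apply_le (L : Large Ω α ρ B φ φd) (H : DualMap ρ φ φd g) (P : Dom Ω α ρ C) {ζ : ℂ}
    (hζ : ζ ∈ closedBall (0 : ℂ) 1) (v : E N) : ‖g ζ v‖ ≤ B ^ 2 * ‖v‖ :=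
  ((g ζ).le_opNorm v).trans (by gcongr; exact L.norm_dual_le H P hζ)

lemma norm_deriv_dual_le_of_real (L : Large Ω α ρ B φ φd) (H : DualMap ρ φ φd g)
    (P : Dom Ω α ρ C) {ζ₀ : ℂ} (hζ₀ : ζ₀ ∈ sphere (0 : ℂ) 1) {v : E N}
    (hv : (starRingEnd ℂ) (nu ρ (φ ζ₀) v) = nu ρ (φ ζ₀) v) {r : ℝ} (hr0 : 0 ≤ r) (hr1 : r < 1) :
    ‖deriv (fun ζ => g ζ v) (r * ζ₀)‖ ≤ 35 * B ^ 3 * (1 - r) ^ (1 / 4 - 1 : ℝ) * ‖v‖ := by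
  have hB := L.one_le
  have hz := smul_mem_ball_of hζ₀ hr0 hr1
  set z : ℂ := r * ζ₀
  set u : ℂ → ℂ := fun ζ => g ζ v with hu
  have hud : DiskAlg u := H.diskAlg_apply (diskAlg_const v)
  have h00 : (0 : ℂ) ∈ ball (0 : ℂ) 1 := by simp
  have hT : DiskAlg (dslope u 0) := hud.dslope h00
  have hub : ∀ ζ ∈ closedBall (0 : ℂ) 1, ‖u ζ‖ ≤ B ^ 2 * ‖v‖ := fun ζ hζ =>
    L.norm_dual_apply_le H P hζ v
  have hu0 := hub 0 (by simp)
  have hTs : ∀ ζ ∈ sphere (0 : ℂ) 1, dslope u 0 ζ = ζ⁻¹ * (u ζ - u 0) := fun ζ hζ => by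
    rw [dslope_of_ne _ (ne_zero_of_sphere hζ), slope_def_module, sub_zero, smul_eq_mul]
  have hTb : ‖dslope u 0 z‖ ≤ 2 * (B ^ 2 * ‖v‖) := by
    refine hT.norm_le (fun ζ hζ => ?_) (ball_subset_closedBall hz)
    rw [hTs ζ hζ, norm_mul, norm_inv, mem_sphere_zero_iff_norm.1 hζ, inv_one, one_mul]
    linarith [norm_sub_le (u ζ) (u 0), hub ζ (sphere_subset_closedBall hζ)]
  have hS : DiskAlg fun ζ => u ζ - (starRingEnd ℂ) (u 0) * (ζ * ζ) :=
    hud.sub ((diskAlg_const _).mul (diskAlg_id.mul diskAlg_id))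
  have h := norm_deriv_sub_conj_le_sqrt hS hT hζ₀ (a := 2 * B ^ 3 * ‖v‖) (by positivity)
    (fun ζ hζ => by
      have hne := ne_zero_of_sphere hζ
      have e : (u ζ - (starRingEnd ℂ) (u 0) * (ζ * ζ)) / ζ - (starRingEnd ℂ) (dslope u 0 ζ) =
          (‖nu ρ (φ ζ) (φd ζ)‖⁻¹ : ℝ) * ((nu ρ (φ ζ) v - nu ρ (φ ζ₀) v) -
            (starRingEnd ℂ) (nu ρ (φ ζ) v - nu ρ (φ ζ₀) v)) := by
        rw [hTs ζ hζ, map_sub _ (nu ρ (φ ζ) v), hv]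
        simp only [hu]
        rw [H.eq_smul L.G P hζ]
        simp only [smul_apply, smul_eq_mul, map_mul, map_sub, Complex.conj_ofReal,
          map_inv₀, conj_eq_inv_of_sphere hζ]
        field_simp
        ring
      have h1 := L.P.norm_nu_apply_sub_le (L.mem_closure hζ) (L.mem_closure hζ₀) v
      have h2 := L.holder ζ hζ ζ₀ hζ₀
      rw [e, norm_mul, Complex.norm_real, norm_inv, norm_norm]
      calc _ ≤ B * (‖nu ρ (φ ζ) v - nu ρ (φ ζ₀) v‖ + ‖nu ρ (φ ζ) v - nu ρ (φ ζ₀) v‖) := by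
            gcongr
            · exact L.le_nu ζ hζ
            · refine (norm_sub_le _ _).trans ?_
              rw [Complex.norm_conj]
        _ ≤ B * (B * (B * ‖ζ - ζ₀‖ ^ (1 / 2 : ℝ)) * ‖v‖ + B * (B * ‖ζ - ζ₀‖ ^ (1 / 2 : ℝ)) * ‖v‖) := by
            have : B * ‖φ ζ - φ ζ₀‖ * ‖v‖ ≤ B * (B * ‖ζ - ζ₀‖ ^ (1 / 2 : ℝ)) * ‖v‖ := by gcongr
            gcongr <;> exact h1.trans this
        _ = _ := by ring) hr0 hr1
  simp only [mul_zero, sub_zero] at h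
  set w := (1 - r) ^ (1 / 4 - 1 : ℝ) with hw
  have hw1 : 1 ≤ w := Real.one_le_rpow_of_pos_of_le_one_of_nonpos (by linarith) (by linarith)
    (by norm_num)
  have hT' : ‖deriv (dslope u 0) z‖ ≤ 32 * B ^ 3 * ‖v‖ * w + B ^ 2 * ‖v‖ := by
    have h5 := norm_sub_norm_le (deriv (dslope u 0) z) ((starRingEnd ℂ) (u 0))
    rw [Complex.norm_conj] at h5
    linarith
  have hud' : u = fun ζ => u 0 + ζ * dslope u 0 ζ := by
    funext ζ
    have := sub_smul_dslope u 0 ζ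
    rw [sub_zero, smul_eq_mul] at this
    rw [this]; ring
  have hder : HasDerivAt u (dslope u 0 z + z * deriv (dslope u 0) z) z := by
    have h6 := ((hasDerivAt_id z).mul (hT.diffAt hz).hasDerivAt).const_add (u 0)
    simpa using h6.congr_of_eventuallyEq (f₁ := u) (.of_forall fun x => congrFun hud' x)
  rw [hder.deriv]
  have hzn : ‖z‖ ≤ 1 := mem_closedBall_zero_iff.1 (ball_subset_closedBall hz)
  have hB23 : B ^ 2 ≤ B ^ 3 := pow_le_pow_right₀ hB (by norm_num)
  calc _ ≤ ‖dslope u 0 z‖ + 1 * ‖deriv (dslope u 0) z‖ := by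
        refine (norm_add_le _ _).trans ?_
        rw [norm_mul]
        gcongr
    _ ≤ 2 * (B ^ 2 * ‖v‖) + 1 * (32 * B ^ 3 * ‖v‖ * w + B ^ 2 * ‖v‖) := by gcongr
    _ = 3 * B ^ 2 * ‖v‖ * 1 + 32 * B ^ 3 * ‖v‖ * w := by ring
    _ ≤ 3 * B ^ 3 * ‖v‖ * w + 32 * B ^ 3 * ‖v‖ * w := by gcongr
    _ = _ := by ring

lemma norm_deriv_dual_le (L : Large Ω α ρ B φ φd) (H : DualMap ρ φ φd g)
    (P : Dom Ω α ρ C) {ζ₀ : ℂ} (hζ₀ : ζ₀ ∈ sphere (0 : ℂ) 1) {r : ℝ} (hr0 : 0 ≤ r) (hr1 : r < 1) :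
    ‖deriv g (r * ζ₀)‖ ≤ 35 * B ^ 3 * (1 - r) ^ (1 / 4 - 1 : ℝ) := by
  have hB := L.one_le
  have hz := smul_mem_ball_of hζ₀ hr0 hr1
  have hr : 0 < 1 - r := by linarith
  refine ContinuousLinearMap.opNorm_le_bound _ (by positivity) fun v => ?_
  obtain ⟨c, hc, hcv⟩ : ∃ c : ℂ, ‖c‖ = 1 ∧
      (starRingEnd ℂ) (nu ρ (φ ζ₀) (c • v)) = nu ρ (φ ζ₀) (c • v) := by
    obtain ⟨c, hc, h⟩ := RCLike.exists_norm_eq_mul_self (nu ρ (φ ζ₀) v)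
    refine ⟨c, hc, ?_⟩
    have h' : (‖nu ρ (φ ζ₀) v‖ : ℂ) = c * nu ρ (φ ζ₀) v := h
    rw [map_smul, smul_eq_mul, ← h', Complex.conj_ofReal]
  have h := L.norm_deriv_dual_le_of_real H P hζ₀ hcv hr0 hr1
  have hd : HasDerivAt (fun ζ => g ζ (c • v)) (deriv g (r * ζ₀) (c • v)) (r * ζ₀) := by
    simpa using (H.diskAlg.diffAt hz).hasDerivAt.clm_apply (hasDerivAt_const _ (c • v))
  rw [hd.deriv, map_smul, norm_smul, norm_smul, hc, one_mul, one_mul] at h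
  exact h

lemma norm_dual_sub_le (L : Large Ω α ρ B φ φd) (H : DualMap ρ φ φd g)
    (P : Dom Ω α ρ C) {ζ ξ : ℂ} (hζ : ζ ∈ sphere (0 : ℂ) 1) (hξ : ξ ∈ sphere (0 : ℂ) 1) :
    ‖g ζ - g ξ‖ ≤ 315 * B ^ 3 * ‖ζ - ξ‖ ^ (1 / 4 : ℝ) := by
  refine (norm_sub_le_of_deriv_growth H.diskAlg (by norm_num) (by norm_num)
    (fun ζ hζ r hr0 hr1 => L.norm_deriv_dual_le H P hζ hr0 hr1) hζ hξ).trans (le_of_eq ?_)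
  ring

lemma abs_inv_sub_le (L : Large Ω α ρ B φ φd) (H : DualMap ρ φ φd g)
    (P : Dom Ω α ρ C) {ζ ξ : ℂ} (hζ : ζ ∈ sphere (0 : ℂ) 1) (hξ : ξ ∈ sphere (0 : ℂ) 1) :
    |‖nu ρ (φ ζ) (φd ζ)‖⁻¹ - ‖nu ρ (φ ξ) (φd ξ)‖⁻¹| ≤ 317 * B ^ 4 * ‖ζ - ξ‖ ^ (1 / 4 : ℝ) := by
  have hB := L.one_le
  have hn : ∀ ζ ∈ sphere (0 : ℂ) 1, ‖g ζ‖ = ‖nu ρ (φ ζ) (φd ζ)‖⁻¹ * ‖nu ρ (φ ζ)‖ := fun ζ hζ => by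
    rw [H.eq_smul L.G P hζ, norm_smul, norm_mul, mem_sphere_zero_iff_norm.1 hζ, one_mul,
      Complex.norm_real, norm_inv, norm_norm]
  have h1 := (abs_norm_sub_norm_le (g ζ) (g ξ)).trans (L.norm_dual_sub_le H P hζ hξ)
  have h2 := (abs_norm_sub_norm_le (nu ρ (φ ξ)) (nu ρ (φ ζ))).trans
    (L.P.nu_lip _ (L.mem_closure hξ) _ (L.mem_closure hζ))
  have h3 := L.holder ξ hξ ζ hζ
  have h4 := rpow_le_two_mul_rpow (norm_nonneg (ξ - ζ)) (norm_sub_le_two hξ hζ)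
    (a := 1 / 2) (b := 1 / 4) (by norm_num) (by norm_num) (by norm_num)
  rw [norm_sub_rev ξ ζ] at h3 h4
  rw [hn ζ hζ, hn ξ hξ] at h1
  have hp := L.le_nu ζ hζ
  have hp0 : 0 ≤ ‖nu ρ (φ ζ) (φd ζ)‖⁻¹ := by positivity
  set p := ‖nu ρ (φ ζ) (φd ζ)‖⁻¹
  set p₀ := ‖nu ρ (φ ξ) (φd ξ)‖⁻¹
  set t := ‖ζ - ξ‖ ^ (1 / 4 : ℝ)
  have ht : 0 ≤ t := by positivity
  have h5 : |p - p₀| * ‖nu ρ (φ ξ)‖ ≤ 317 * B ^ 3 * t := by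
    calc |p - p₀| * ‖nu ρ (φ ξ)‖ = |p * (‖nu ρ (φ ξ)‖ - ‖nu ρ (φ ζ)‖) +
          (p * ‖nu ρ (φ ζ)‖ - p₀ * ‖nu ρ (φ ξ)‖)| := by
          rw [← abs_of_nonneg (norm_nonneg (nu ρ (φ ξ))), ← abs_mul,
            abs_of_nonneg (norm_nonneg (nu ρ (φ ξ)))]
          congr 1; ring
      _ ≤ p * |‖nu ρ (φ ξ)‖ - ‖nu ρ (φ ζ)‖| + |p * ‖nu ρ (φ ζ)‖ - p₀ * ‖nu ρ (φ ξ)‖| := by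
          refine (abs_add_le _ _).trans ?_
          rw [abs_mul, abs_of_nonneg hp0]
      _ ≤ B * (B * (B * (2 * t))) + 315 * B ^ 3 * t := by
          have h6 : ‖φ ξ - φ ζ‖ ≤ B * (2 * t) := h3.trans (by gcongr)
          have h7 := h2.trans (by gcongr : B * ‖φ ξ - φ ζ‖ ≤ B * (B * (2 * t)))
          gcongr
      _ = _ := by ring
  have h6 := L.P.one_le_nu _ (L.G.mem_frontier L.P.isOpen hξ)
  calc |p - p₀| ≤ |p - p₀| * (B * ‖nu ρ (φ ξ)‖) := le_mul_of_one_le_right (abs_nonneg _) h6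
    _ = B * (|p - p₀| * ‖nu ρ (φ ξ)‖) := by ring
    _ ≤ B * (317 * B ^ 3 * t) := by gcongr
    _ = _ := by ring

end Large
end LargeEst

section LargeFinal
variable {Ω : Set (E N)} {α B C : ℝ} {ρ : E N → ℝ} {φ φd : ℂ → E N}
variable {g : ℂ → E N →L[ℂ] ℂ}

namespace Large

lemma norm_formB_le (L : Large Ω α ρ B φ φd) (H : DualMap ρ φ φd g) (P : Dom Ω α ρ C) {M : ℝ}
    (hM : ∀ ζ ∈ closedBall (0 : ℂ) 1, ‖φd ζ‖ ≤ M) {s : ℝ} (hs0 : 0 < s) (hs2 : s ≤ 2) {ζ₀ : ℂ}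
    (hζ₀ : ζ₀ ∈ sphere (0 : ℂ) 1) {τ : E N} (hτ : nu ρ (φ ζ₀) τ = 0) :
    ‖formB ρ (φ ζ₀) τ (φd ζ₀)‖ ≤
      B * (B ^ 2 + 4 * (640 * B ^ 5 * M * s ^ (α / 4) / (α / 4) + 6 * B ^ 4 / s)) * ‖τ‖ := by
  have hB := L.one_le
  have hα := L.P.α_pos
  have hα1 := L.P.α_le
  have hM0 : 0 ≤ M := (norm_nonneg _).trans (hM 0 (by simp))
  have hc0 := sphere_subset_closedBall hζ₀
  set q := φ ζ₀ with hq
  have hqc : q ∈ closure Ω := L.mem_closure hζ₀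
  have hx0 := L.pos ζ₀ hζ₀
  have hp0B := L.le_nu ζ₀ hζ₀
  set p₀ := ‖nu ρ q (φd ζ₀)‖⁻¹ with hp₀
  have hp0 : 0 < p₀ := inv_pos.2 hx0
  have hS : DiskAlg fun ζ => g ζ τ - ζ * (p₀ * formA ρ q τ (φ ζ - q)) :=
    (H.diskAlg_apply (diskAlg_const τ)).sub (diskAlg_id.mul ((diskAlg_const (p₀ : ℂ)).mul
      ((formA ρ q τ).differentiable.comp_diffContOnCl (L.G.diskAlg.sub (diskAlg_const q)))))
  have hG : DiskAlg fun ζ => (p₀ : ℂ) * formB ρ q τ (φ ζ - q) :=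
    (diskAlg_const (p₀ : ℂ)).mul
      ((formB ρ q τ).differentiable.comp_diffContOnCl (L.G.diskAlg.sub (diskAlg_const q)))
  have herr : ∀ ζ ∈ sphere (0 : ℂ) 1, ‖(g ζ τ - ζ * (p₀ * formA ρ q τ (φ ζ - q))) / ζ -
      (starRingEnd ℂ) ((p₀ : ℂ) * formB ρ q τ (φ ζ - q))‖ ≤
      B * (B * ‖τ‖ * ‖φ ζ - q‖ ^ (1 + α)) +
        |‖nu ρ (φ ζ) (φd ζ)‖⁻¹ - p₀| * (B * ‖φ ζ - q‖ * ‖τ‖) := fun ζ hζ => by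
    have hne := ne_zero_of_sphere hζ
    have e : (g ζ τ - ζ * (p₀ * formA ρ q τ (φ ζ - q))) / ζ -
        (starRingEnd ℂ) ((p₀ : ℂ) * formB ρ q τ (φ ζ - q)) =
        p₀ * (nu ρ (φ ζ) τ - nu ρ q τ -
          (formA ρ q τ (φ ζ - q) + (starRingEnd ℂ) (formB ρ q τ (φ ζ - q)))) +
        ((‖nu ρ (φ ζ) (φd ζ)‖⁻¹ - p₀ : ℝ) : ℂ) * (nu ρ (φ ζ) τ - nu ρ q τ) := by
      rw [H.eq_smul L.G P hζ, hτ]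
      simp only [smul_apply, smul_eq_mul, map_mul, Complex.conj_ofReal]
      rw [Complex.ofReal_sub]
      field_simp
      ring
    rw [e]
    refine (norm_add_le _ _).trans ?_
    rw [norm_mul, norm_mul, Complex.norm_real, Complex.norm_real, Real.norm_of_nonneg hp0.le,
      Real.norm_eq_abs]
    gcongr
    · exact L.P.dnu _ (L.mem_closure hζ) _ hqc τ
    · exact L.P.norm_nu_apply_sub_le (L.mem_closure hζ) hqc τ
  have h1 : ∀ ζ ∈ sphere (0 : ℂ) 1, ‖(g ζ τ - ζ * (p₀ * formA ρ q τ (φ ζ - q))) / ζ -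
      (starRingEnd ℂ) ((p₀ : ℂ) * formB ρ q τ (φ ζ - q))‖ ≤
      640 * B ^ 5 * M * ‖τ‖ * ‖ζ - ζ₀‖ ^ (1 + α / 4) := fun ζ hζ => by
    have hD1 := L.G.norm_sub_le hM (sphere_subset_closedBall hζ) hc0
    have hD2 := L.holder ζ hζ ζ₀ hζ₀
    have hp := L.abs_inv_sub_le H P hζ hζ₀
    have ht2 := norm_sub_le_two hζ hζ₀
    refine (herr ζ hζ).trans ?_
    rw [← hq] at hD1 hD2 hp
    rw [← hp₀] at hp
    set t := ‖ζ - ζ₀‖ with ht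
    have ht0 : 0 ≤ t := norm_nonneg _
    have r1 := rpow_le_two_mul_rpow ht0 ht2 (a := α / 2) (b := α / 4) (by positivity) (by linarith)
      (by linarith)
    have r2 := rpow_le_two_mul_rpow ht0 ht2 (a := 1 / 4) (b := α / 4) (by positivity) (by linarith)
      (by linarith)
    have hD0 := norm_nonneg (φ ζ - q)
    set D := ‖φ ζ - q‖
    have et : t ^ (1 + α / 4) = t * t ^ (α / 4) := by
      rw [Real.rpow_add' ht0 (by positivity), Real.rpow_one]
    have eD : D ^ (1 + α) = D * D ^ α := by
      rw [Real.rpow_add' hD0 (by positivity), Real.rpow_one]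
    have hDα : D ^ α ≤ B * (2 * t ^ (α / 4)) := by
      calc D ^ α ≤ (B * t ^ (1 / 2 : ℝ)) ^ α := by gcongr
        _ = B ^ α * t ^ (α / 2) := by
            rw [Real.mul_rpow (by positivity) (by positivity), ← Real.rpow_mul ht0]
            congr 2; ring
        _ ≤ B ^ (1 : ℝ) * (2 * t ^ (α / 4)) := by gcongr
        _ = _ := by rw [Real.rpow_one]
    rw [et, eD]
    have hw : 0 ≤ t ^ (α / 4) := by positivity
    have hB35 : B ^ 3 ≤ B ^ 5 := pow_le_pow_right₀ hB (by norm_num)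
    calc _ ≤ B * (B * ‖τ‖ * ((M * t) * (B * (2 * t ^ (α / 4))))) +
          317 * B ^ 4 * (2 * t ^ (α / 4)) * (B * (M * t) * ‖τ‖) := by
          have h6 : 317 * B ^ 4 * t ^ (1 / 4 : ℝ) ≤ 317 * B ^ 4 * (2 * t ^ (α / 4)) := by gcongr
          have h7 := hp.trans h6
          gcongr
      _ = (2 * B ^ 3 + 634 * B ^ 5) * (M * ‖τ‖ * (t * t ^ (α / 4))) := by ring
      _ ≤ (2 * B ^ 5 + 638 * B ^ 5) * (M * ‖τ‖ * (t * t ^ (α / 4))) := by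
          gcongr; norm_num
      _ = _ := by ring
  have h2 : ∀ ζ ∈ sphere (0 : ℂ) 1, ‖(g ζ τ - ζ * (p₀ * formA ρ q τ (φ ζ - q))) / ζ -
      (starRingEnd ℂ) ((p₀ : ℂ) * formB ρ q τ (φ ζ - q))‖ ≤ 6 * B ^ 4 * ‖τ‖ := fun ζ hζ => by
    refine (herr ζ hζ).trans ?_
    have hD2 : ‖φ ζ - q‖ ≤ 2 * B := by
      linarith [norm_sub_le (φ ζ) q, L.P.norm_le _ (L.mem_closure hζ), L.P.norm_le _ hqc]
    have hp : |‖nu ρ (φ ζ) (φd ζ)‖⁻¹ - p₀| ≤ B := by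
      have := L.le_nu ζ hζ
      have : 0 < ‖nu ρ (φ ζ) (φd ζ)‖⁻¹ := inv_pos.2 (L.pos ζ hζ)
      rw [abs_le]; constructor <;> linarith
    have h3 : ‖φ ζ - q‖ ^ (1 + α) ≤ (2 * B) ^ 2 := by
      calc _ ≤ (2 * B) ^ (1 + α) := by gcongr
        _ ≤ (2 * B) ^ (2 : ℝ) :=
            Real.rpow_le_rpow_of_exponent_le (by linarith) (by linarith)
        _ = _ := Real.rpow_two _
    have hB34 : B ^ 3 ≤ B ^ 4 := pow_le_pow_right₀ hB (by norm_num)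
    calc _ ≤ B * (B * ‖τ‖ * (2 * B) ^ 2) + B * (B * (2 * B) * ‖τ‖) := by gcongr
      _ = 4 * B ^ 4 * ‖τ‖ + 2 * B ^ 3 * ‖τ‖ := by ring
      _ ≤ 4 * B ^ 4 * ‖τ‖ + 2 * B ^ 4 * ‖τ‖ := by gcongr
      _ = _ := by ring
  have hK : ‖(p₀ : ℂ) * formB ρ q τ (φd ζ₀)‖ ≤ B ^ 2 * ‖τ‖ +
      4 * (640 * B ^ 5 * M * ‖τ‖ * s ^ (α / 4) / (α / 4) + 6 * B ^ 4 * ‖τ‖ / s) := by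
    refine norm_le_of_radial (f := fun ζ => (p₀ : ℂ) * formB ρ q τ (φd ζ))
      (continuousOn_const.mul ((formB ρ q τ).continuous.comp_continuousOn L.G.contd))
      hζ₀ fun r hr0 hr1 => ?_
    have hz := smul_mem_ball_of hζ₀ hr0 hr1
    have h := norm_deriv_sub_conj_le_split hS hG hζ₀ (by positivity) (by positivity) hs0 hs2
      (by positivity : 0 < α / 4) (by linarith) h1 h2 hr0 hr1
    have hd : HasDerivAt (fun ζ => (p₀ : ℂ) * formB ρ q τ (φ ζ - q))
        ((p₀ : ℂ) * formB ρ q τ (φd (r * ζ₀))) (r * ζ₀) :=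
      ((formB ρ q τ).hasFDerivAt.comp_hasDerivAt _ ((L.G.hasDerivAt hz).sub_const q)).const_mul _
    rw [hd.deriv, zero_mul, sub_zero] at h
    have h5 := norm_sub_norm_le ((p₀ : ℂ) * formB ρ q τ (φd (r * ζ₀))) ((starRingEnd ℂ) (g 0 τ))
    rw [Complex.norm_conj] at h5
    have h6 := L.norm_dual_apply_le H P (ζ := 0) (by simp) τ
    linarith
  rw [norm_mul, Complex.norm_real, Real.norm_of_nonneg hp0.le] at hK
  have e : ‖formB ρ q τ (φd ζ₀)‖ = ‖nu ρ q (φd ζ₀)‖ * (p₀ * ‖formB ρ q τ (φd ζ₀)‖) := by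
    rw [hp₀, mul_inv_cancel_left₀ hx0.ne']
  rw [e]
  calc _ ≤ B * (B ^ 2 * ‖τ‖ +
      4 * (640 * B ^ 5 * M * ‖τ‖ * s ^ (α / 4) / (α / 4) + 6 * B ^ 4 * ‖τ‖ / s)) := by
        gcongr; exact L.nu_le ζ₀ hζ₀
    _ = _ := by ring

/-- The scale at which the boundary estimate is split. -/
def scale (α B : ℝ) : ℝ := (α / 4 / (10240 * B ^ 9)) ^ (α / 4)⁻¹

/-- A bound for the derivative of a centered geodesic. -/
def bound (α B : ℝ) : ℝ := 4 * B ^ 3 * (B * (B ^ 2 + 24 * B ^ 4 / scale α B) + B)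

lemma norm_deriv_le (L : Large Ω α ρ B φ φd) (H : DualMap ρ φ φd g) (P : Dom Ω α ρ C) {ζ : ℂ}
    (hζ : ζ ∈ closedBall (0 : ℂ) 1) : ‖φd ζ‖ ≤ bound α B := by
  have hB := L.one_le
  have hα := L.P.α_pos
  have hα1 := L.P.α_le
  set s := scale α B with hs
  have hB9 : 1 ≤ B ^ 9 := one_le_pow₀ hB
  have hbase : 0 < α / 4 / (10240 * B ^ 9) := by positivity
  have hs0 : 0 < s := Real.rpow_pos_of_pos hbase _
  have hs1 : s ≤ 1 := Real.rpow_le_one hbase.le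
    (by rw [div_le_one (by positivity)]; linarith) (by positivity)
  have hsγ : s ^ (α / 4) = α / 4 / (10240 * B ^ 9) :=
    Real.rpow_inv_rpow hbase.le (by positivity)
  obtain ⟨ξ, hξ, hmax⟩ := (isCompact_closedBall (0 : ℂ) 1).exists_isMaxOn ⟨0, by simp⟩
    L.G.contd.norm
  have hM : ∀ ζ ∈ closedBall (0 : ℂ) 1, ‖φd ζ‖ ≤ ‖φd ξ‖ := fun ζ hζ => hmax hζ
  set M := ‖φd ξ‖ with hMdef
  have hM0 : 0 ≤ M := norm_nonneg _
  have hstep : M ≤ M / 2 + bound α B / 2 := by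
    refine L.G.diskAlgd.norm_le (fun ζ₀ hζ₀ => ?_) hξ
    have h := L.P.norm_le_of_formB (L.G.mem_frontier L.P.isOpen hζ₀) (by positivity)
      fun τ hτ => L.norm_formB_le H P hM hs0 (by linarith) hζ₀ hτ
    refine h.trans ?_
    have h5 := L.nu_le ζ₀ hζ₀
    rw [hsγ, bound, ← hs]
    calc _ ≤ 2 * B ^ 3 * (B * (B ^ 2 + 4 * (640 * B ^ 5 * M * (α / 4 / (10240 * B ^ 9)) / (α / 4) +
          6 * B ^ 4 / s)) + B) := by gcongr
      _ = _ := by field_simp; ring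
  linarith [hM ζ hζ]

end Large

theorem Dom.exists_nice_of_large (P : Dom Ω α ρ C) {d₀ : ℝ} (hd₀ : 0 < d₀) : ∃ K,
    ∀ φ φd, Geo Ω φ φd → ∀ d, d₀ ≤ d → IsDiam φ d → ∃ a ∈ ball (0 : ℂ) 1,
      Nice ρ (fun ζ => φ (mob a ζ)) (fun ζ => mobd a ζ • φd (mob a ζ)) K d := by
  obtain ⟨B, -, hL⟩ := P.exists_large hd₀
  refine ⟨|Large.bound α B| / d₀ + |B| / d₀ ^ 2 + 4 * |B| ^ 3, fun φ φd G d hd D => ?_⟩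
  obtain ⟨a, ha, hmax⟩ := G.exists_max_bdist P.toPkg
  refine ⟨a, ha, ?_⟩
  have G' := G.comp_mob ha
  have D' := D.comp_mob ha
  obtain ⟨g, H⟩ := G'.exists_dualMap P
  have L := hL _ _ G' d hd D' fun ζ hζ => by
    rw [mob_zero]
    exact hmax _ (mob_mem_closedBall ha hζ)
  generalize (fun ζ => φ (mob a ζ)) = ψ at *
  generalize (fun ζ => mobd a ζ • φd (mob a ζ)) = ψd at *
  have hB := L.one_le
  rw [abs_of_nonneg (by linarith : 0 ≤ B)]
  set R := Large.bound α B
  have hR := fun ζ hζ => L.norm_deriv_le H P (ζ := ζ) hζ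
  have hR0 : 0 ≤ R := (norm_nonneg _).trans (hR 0 (by simp))
  rw [abs_of_nonneg hR0]
  have hd2 : d ≤ 2 * B := D'.le _ fun ζ hζ ξ hξ => by
    linarith [norm_sub_le (ψ ζ) (ψ ξ), L.P.norm_le _ (L.G.mem_closure hζ),
      L.P.norm_le _ (L.G.mem_closure hξ)]
  have hdpos : 0 < d := D'.pos
  have hK1 : R / d₀ ≤ R / d₀ + B / d₀ ^ 2 + 4 * B ^ 3 := by
    have : 0 ≤ B / d₀ ^ 2 + 4 * B ^ 3 := by positivity
    linarith
  have hK2 : B / d₀ ^ 2 ≤ R / d₀ + B / d₀ ^ 2 + 4 * B ^ 3 := by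
    have : 0 ≤ R / d₀ + 4 * B ^ 3 := by positivity
    linarith
  have hK3 : 4 * B ^ 3 ≤ R / d₀ + B / d₀ ^ 2 + 4 * B ^ 3 := by
    have : 0 ≤ R / d₀ + B / d₀ ^ 2 := by positivity
    linarith
  refine ⟨hdpos, D'.dist_le, fun ζ hζ => ?_, fun ζ hζ => ?_, fun ζ hζ => ?_, fun ζ hζ => ?_⟩
  · calc ‖ψd ζ‖ ≤ R := hR ζ hζ
      _ = R / d₀ * d₀ := by field_simp
      _ ≤ _ := by gcongr
  · have h1 : 1 ≤ B ^ 2 * ‖ψd ζ‖ := by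
      calc (1 : ℝ) = ‖g ζ (ψd ζ)‖ := by rw [H.apply ζ hζ, norm_one]
        _ ≤ _ := L.norm_dual_apply_le H P hζ _
    calc d ≤ 2 * B * 1 := by linarith
      _ ≤ 2 * B * (B ^ 2 * ‖ψd ζ‖) := by gcongr
      _ = 2 * B ^ 3 * ‖ψd ζ‖ := by ring
      _ ≤ 4 * B ^ 3 * ‖ψd ζ‖ := by gcongr; norm_num
      _ ≤ _ := by gcongr
  · calc ‖nu ρ (ψ ζ) (ψd ζ)‖ ≤ B := L.nu_le ζ hζ
      _ = B / d₀ ^ 2 * d₀ ^ 2 := by field_simp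
      _ ≤ _ := by gcongr
  · have hx := L.pos ζ hζ
    have h1 : 1 ≤ B * ‖nu ρ (ψ ζ) (ψd ζ)‖ := by
      have := L.le_nu ζ hζ
      rwa [inv_le_iff_one_le_mul₀ hx] at this
    calc d ^ 2 ≤ (2 * B) ^ 2 * 1 := by rw [mul_one]; gcongr
      _ ≤ (2 * B) ^ 2 * (B * ‖nu ρ (ψ ζ) (ψd ζ)‖) := by gcongr
      _ = 4 * B ^ 3 * ‖nu ρ (ψ ζ) (ψd ζ)‖ := by ring
      _ ≤ _ := by gcongr

lemma Dom.mono {C' : ℝ} (P : Dom Ω α ρ C) (h : C ≤ C') : Dom Ω α ρ C' where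
  toPkg := P.toPkg.mono h
  kob ψ h1 h2 a ha := (P.kob ψ h1 h2 a ha).trans <| by
    have : 0 ≤ bdist Ω (ψ a) := infDist_nonneg
    gcongr
  hopf := P.hopf
  chain z hz w hw := (P.chain z hz w hw).trans (by gcongr)

/-- Every complex geodesic can be reparametrized so that its derivative is comparable to the
diameter of its image, with constants depending on the domain only. -/
theorem Dom.exists_nice (P : Dom Ω α ρ C) : ∃ K, C ≤ K ∧
    ∀ φ φd, Geo Ω φ φd → ∀ d, IsDiam φ d → ∃ a ∈ ball (0 : ℂ) 1,
      Nice ρ (fun ζ => φ (mob a ζ)) (fun ζ => mobd a ζ • φd (mob a ζ)) K d := by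
  have hC := P.one_le
  have hα := P.α_pos
  set d₀ : ℝ := (α / (50000 * C ^ 12)) ^ α⁻¹ with hd₀
  have hbase : 0 < α / (50000 * C ^ 12) := by positivity
  have hd0 : 0 < d₀ := Real.rpow_pos_of_pos hbase _
  obtain ⟨K, hK⟩ := P.exists_nice_of_large hd0
  refine ⟨max C (max (192 * C ^ 6) K), le_max_left _ _, fun φ φd G d D => ?_⟩
  rcases le_total d₀ d with h | h
  · obtain ⟨a, ha, hn⟩ := hK φ φd G d h D
    exact ⟨a, ha, hn.mono ((le_max_right _ _).trans (le_max_right _ _))⟩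
  · obtain ⟨a, ha, hn⟩ := P.exists_nice_of_small G D <| by
      have h1 : d ^ α ≤ α / (50000 * C ^ 12) := by
        calc d ^ α ≤ d₀ ^ α := by have := D.pos; gcongr
          _ = _ := Real.rpow_inv_rpow hbase.le hα.ne'
      calc 50000 * C ^ 12 / α * d ^ α ≤ 50000 * C ^ 12 / α * (α / (50000 * C ^ 12)) := by gcongr
        _ = 1 := by field_simp
    exact ⟨a, ha, hn.mono ((le_max_left _ _).trans (le_max_right _ _))⟩

end LargeFinal

section Final
variable {Ω : Set (E N)} {α C d : ℝ} {ρ : E N → ℝ} {φ φd : ℂ → E N}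

lemma IsComplexGeodesic.apply_zero_ne (h : IsComplexGeodesic Ω φ) : φ 0 ≠ φ (1 / 2) := fun he => by
  have h0 : (0 : ℂ) ∈ ball (0 : ℂ) 1 := by simp
  have h2 : (1 / 2 : ℂ) ∈ ball (0 : ℂ) 1 := by norm_num
  have h3 := h.2.2 0 h0 _ h2
  rw [← he, h.2.2 0 h0 0 h0] at h3
  have h4 : 0 < Real.log 3 := Real.log_pos (by norm_num)
  norm_num [poincare, artanh] at h3
  linarith

lemma Geo.isDiam (G : Geo Ω φ φd) : IsDiam φ (Metric.diam (φ '' ball 0 1)) := by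
  have hb : Bornology.IsBounded (φ '' closedBall 0 1) :=
    ((isCompact_closedBall (0 : ℂ) 1).image_of_continuousOn G.cont).isBounded
  have hb' := hb.subset (image_mono ball_subset_closedBall)
  have h0 : (0 : ℂ) ∈ ball (0 : ℂ) 1 := by simp
  have h2 : (1 / 2 : ℂ) ∈ ball (0 : ℂ) 1 := by norm_num
  have hcl : φ '' closedBall 0 1 ⊆ closure (φ '' ball 0 1) := by
    rw [← closure_ball (0 : ℂ) one_ne_zero]
    refine ContinuousOn.image_closure ?_
    rw [closure_ball (0 : ℂ) one_ne_zero]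
    exact G.cont
  refine ⟨?_, fun ζ hζ ξ hξ => ?_, fun b hb => ?_⟩
  · exact (dist_pos.2 G.geod.apply_zero_ne).trans_le
      (dist_le_diam_of_mem hb' (mem_image_of_mem φ h0) (mem_image_of_mem φ h2))
  · rw [← dist_eq_norm, ← Metric.diam_closure]
    exact dist_le_diam_of_mem hb'.closure (hcl (mem_image_of_mem φ hζ)) (hcl (mem_image_of_mem φ hξ))
  · refine diam_le_of_forall_dist_le ((norm_nonneg _).trans (hb 0 (by simp) 0 (by simp))) ?_
    rintro _ ⟨ζ, hζ, rfl⟩ _ ⟨ξ, hξ, rfl⟩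
    rw [dist_eq_norm]
    exact hb _ (ball_subset_closedBall hζ) _ (ball_subset_closedBall hξ)

lemma Pkg.nu_norm_pos (P : Pkg Ω α ρ C) {q : E N} (hq : q ∈ frontier Ω) : 0 < ‖nu ρ q‖ := by
  have := P.one_le_nu q hq
  have := P.one_le
  by_contra! h
  nlinarith

lemma Pkg.ncomp_eq (P : Pkg Ω α ρ C) {π : E N → E N} (hπ : IsClosestPointSelection Ω π) {z : E N}
    (hz : z ∈ Ω) (v : E N) : ncomp Ω π z v = ‖nu ρ (π z) v‖ / ‖nu ρ (π z)‖ := by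
  obtain ⟨h1, h2⟩ := hπ z hz
  rw [ncomp, div_eq_div_iff (P.bdist_pos hz).ne' (P.nu_norm_pos h1).ne']
  exact P.normal z hz _ h1 h2 v

lemma herm_real_smul (v η : E N) (t : ℝ) : herm v (t • η) = t * herm v η := by
  simp only [herm, Finset.mul_sum]
  refine Finset.sum_congr rfl fun j _ => ?_
  simp
  ring

lemma Pkg.norm_herm_eq (P : Pkg Ω α ρ C) {p η : E N} (h : IsOuterUnitNormalAt Ω p η) (v : E N) :
    ‖herm v η‖ = ‖nu ρ p v‖ / ‖nu ρ p‖ := by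
  obtain ⟨h1, hp, ε, hε, h2⟩ := h
  have ht : 0 < ε / 2 := by positivity
  obtain ⟨hz, hb⟩ := h2 (ε / 2) ht (by linarith)
  have hd : dist (p - (ε / 2) • η) p = bdist Ω (p - (ε / 2) • η) := by
    rw [hb, dist_eq_norm, sub_sub_cancel_left, norm_neg, norm_smul, h1, mul_one,
      Real.norm_of_nonneg ht.le]
  have h3 := P.normal _ hz p hp hd v
  rw [hb, sub_sub_cancel, herm_real_smul, norm_mul, Complex.norm_real,
    Real.norm_of_nonneg ht.le] at h3
  rw [eq_div_iff (P.nu_norm_pos hp).ne']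
  have : ε / 2 * (‖herm v η‖ * ‖nu ρ p‖) = ε / 2 * ‖nu ρ p v‖ := by linarith
  exact mul_left_cancel₀ ht.ne' this

/-- Uniform comparison of the diameter of a geodesic with the direction of its derivative. -/
lemma Dom.exists_comparison (P : Dom Ω α ρ C) {π : E N → E N}
    (hπ : IsClosestPointSelection Ω π) : ∃ K, 1 ≤ K ∧ ∀ φ φd, Geo Ω φ φd → ∀ d, IsDiam φ d →
      (∀ ζ ∈ ball (0 : ℂ) 1,
        d ≤ 8 * K ^ 8 * (ncomp Ω π (φ ζ) (φd ζ) / ‖φd ζ‖ + Real.sqrt (bdist Ω (φ ζ))) ∧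
        ncomp Ω π (φ ζ) (φd ζ) / ‖φd ζ‖ + Real.sqrt (bdist Ω (φ ζ)) ≤ 6 * K ^ 4 * d) ∧
      (∀ ζ ∈ sphere (0 : ℂ) 1, ∀ η, IsOuterUnitNormalAt Ω (φ ζ) η →
        d ≤ 8 * K ^ 8 * (‖herm (φd ζ) η‖ / ‖φd ζ‖) ∧ ‖herm (φd ζ) η‖ / ‖φd ζ‖ ≤ 6 * K ^ 4 * d) := by
  obtain ⟨K, hCK, hK⟩ := P.exists_nice
  have hK1 : 1 ≤ K := P.one_le.trans hCK
  have PK := P.mono hCK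
  refine ⟨K, hK1, fun φ φd G d D => ?_⟩
  obtain ⟨a, ha, hn⟩ := hK φ φd G d D
  have ha' : -a ∈ ball (0 : ℂ) 1 := by simpa using ha
  have G' := G.comp_mob ha
  have hscale : ∀ ζ ∈ closedBall (0 : ℂ) 1, ∀ q : E N,
      ‖nu ρ q (mobd a (mob (-a) ζ) • φd ζ)‖ / ‖mobd a (mob (-a) ζ) • φd ζ‖ =
        ‖nu ρ q (φd ζ)‖ / ‖φd ζ‖ := fun ζ hζ q => by
    have hne := norm_ne_zero_iff.2 (mobd_ne_zero ha (mob_mem_closedBall ha' hζ))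
    rw [map_smul, norm_smul, norm_smul, mul_div_mul_left _ _ hne]
  constructor
  · intro ζ hζ
    have hζ' := mob_mem_ball ha' hζ
    have hc := ball_subset_closedBall hζ
    obtain ⟨h1, h2⟩ := hπ _ (G.mapsTo hζ)
    have hu := hn.interior_le G' PK hζ' (q := π (φ ζ)) h1
    have hl := hn.le_interior G' PK hζ' (q := π (φ ζ)) h1
    simp only [mob_mob_neg ha hc] at hu hl
    rw [div_right_comm, hscale ζ hc, div_right_comm] at hu hl
    rw [P.ncomp_eq hπ (G.mapsTo hζ)]
    exact ⟨hl h2, hu h2⟩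
  · intro ζ hζ η hη
    have hc := sphere_subset_closedBall hζ
    have h := hn.boundary hK1 (mob_mem_sphere ha' hζ)
    simp only [mob_mob_neg ha hc] at h
    rw [hscale ζ hc] at h
    obtain ⟨hl, hu⟩ := h
    have hq := hη.2.1
    have hpos := P.nu_norm_pos hq
    have h1 := PK.one_le_nu _ hq
    have h2 := PK.nu_le _ (frontier_subset_closure hq)
    have hd := D.pos
    rw [P.norm_herm_eq hη, div_right_comm]
    set x := ‖nu ρ (φ ζ) (φd ζ)‖ / ‖φd ζ‖
    have hx : 0 ≤ x := by positivity
    constructor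
    · calc d ≤ K ^ 2 * x := hl
        _ = K ^ 2 * (‖nu ρ (φ ζ)‖ * (x / ‖nu ρ (φ ζ)‖)) := by field_simp
        _ ≤ K ^ 2 * (K * (x / ‖nu ρ (φ ζ)‖)) := by gcongr
        _ = 1 * K ^ 3 * (x / ‖nu ρ (φ ζ)‖) := by ring
        _ ≤ 8 * K ^ 8 * (x / ‖nu ρ (φ ζ)‖) := by gcongr <;> norm_num
    · rw [div_le_iff₀ hpos]
      calc x ≤ K ^ 2 * d * 1 := by linarith
        _ ≤ K ^ 2 * d * (K * ‖nu ρ (φ ζ)‖) := by gcongr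
        _ = 1 * K ^ 3 * d * ‖nu ρ (φ ζ)‖ := by ring
        _ ≤ 6 * K ^ 4 * d * ‖nu ρ (φ ζ)‖ := by gcongr <;> norm_num

end Final

/-- Infinitesimal version: for a complex geodesic `φ`, with `φd`
its `C^{1,α}`-smooth extension of the derivative to the closed disc,
`‖(φ'(ζ))_{φ(ζ)}‖/‖φ'(ζ)‖ + δ_Ω(φ(ζ))^{1/2} ∼ d_e(φ(Δ))` for `ζ ∈ Δ`, and
`‖(φ'(ζ))_{φ(ζ)}‖/‖φ'(ζ)‖ ∼ d_e(φ(Δ))` for `ζ ∈ ∂Δ`. -/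
theorem stmt6 {N : ℕ} {α : ℝ} (hα : α ∈ Set.Ioc (0:ℝ) 1)
    (Ω : Set (E N)) (hΩ : IsStronglyPseudoconvexDomain 2 α Ω)
    (π : E N → E N) (hπ : IsClosestPointSelection Ω π) :
    ∃ c C : ℝ, 0 < c ∧ c < C ∧ ∀ φ φd : ℂ → E N, IsComplexGeodesic Ω φ →
      ContinuousOn φ (closedBall (0:ℂ) 1) →
      ContinuousOn φd (closedBall (0:ℂ) 1) →
      (∀ ζ ∈ ball (0:ℂ) 1, φd ζ = deriv φ ζ) →
      (∃ M : ℝ, ∀ ζ ∈ closedBall (0:ℂ) 1, ∀ ξ ∈ closedBall (0:ℂ) 1,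
        ‖φd ζ - φd ξ‖ ≤ M * ‖ζ - ξ‖ ^ α) →
      ((∀ ζ ∈ ball (0:ℂ) 1,
          c * Metric.diam (φ '' ball (0:ℂ) 1) ≤
            ncomp Ω π (φ ζ) (φd ζ) / ‖φd ζ‖ + Real.sqrt (bdist Ω (φ ζ)) ∧
          ncomp Ω π (φ ζ) (φd ζ) / ‖φd ζ‖ + Real.sqrt (bdist Ω (φ ζ)) ≤
            C * Metric.diam (φ '' ball (0:ℂ) 1)) ∧
       (∀ ζ ∈ sphere (0:ℂ) 1, ∀ η : E N, IsOuterUnitNormalAt Ω (φ ζ) η →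
          c * Metric.diam (φ '' ball (0:ℂ) 1) ≤ ‖herm (φd ζ) η‖ / ‖φd ζ‖ ∧
          ‖herm (φd ζ) η‖ / ‖φd ζ‖ ≤ C * Metric.diam (φ '' ball (0:ℂ) 1))) := by
  obtain ⟨ρ, η, C₀, D⟩ := exists_defFn hα hΩ
  by_cases hne : (frontier Ω).Nonempty
  · obtain ⟨C, P⟩ := D.exists_dom hne
    obtain ⟨K, hK1, hK⟩ := P.exists_comparison hπ
    have hc : (8 * K ^ 8)⁻¹ < 6 * K ^ 4 := by
      have h8 : 1 ≤ K ^ 8 := one_le_pow₀ hK1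
      have h4 : 1 ≤ K ^ 4 := one_le_pow₀ hK1
      have : (8 * K ^ 8)⁻¹ ≤ 1 := inv_le_one_of_one_le₀ (by linarith)
      linarith
    refine ⟨(8 * K ^ 8)⁻¹, 6 * K ^ 4, by positivity, hc, fun φ φd h1 h2 h3 h4 _ => ?_⟩
    have G : Geo Ω φ φd := ⟨h1, h2, h3, h4⟩
    obtain ⟨hin, hbd⟩ := hK φ φd G _ G.isDiam
    refine ⟨fun ζ hζ => ⟨?_, (hin ζ hζ).2⟩, fun ζ hζ η hη => ⟨?_, (hbd ζ hζ η hη).2⟩⟩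
    · exact (inv_mul_le_iff₀ (by positivity)).2 (hin ζ hζ).1
    · exact (inv_mul_le_iff₀ (by positivity)).2 (hbd ζ hζ η hη).1
  · refine ⟨1, 2, one_pos, one_lt_two, fun φ φd h _ _ _ _ => ?_⟩
    have hN : Nontrivial (E N) := ⟨_, _, h.apply_zero_ne⟩
    exact absurd (D.frontier_nonempty (h.2.1 (mem_ball_self one_pos)) hN) hne

end InvDist
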